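/- The normalized gaps between consecutive primes satisfy liminf_{n → ∞} (p_{n+1} − p_n) / log p_n = 0. -/

import Mathlib

open Filter

namespace PrimeGaps

open Finset ArithmeticFunction
open scoped ComplexConjugate

/-- Large sieve inequality, by duality, for a family of nearly orthogonal sequences. -/
theorem large_sieve {ι : Type*} [Fintype ι] [DecidableEq ι] (χ : ι → ℕ → ℂ) (S : Finset ℕ)
    (a : ℕ → ℂ) (P : ℝ) (hP : 0 ≤ P) (h1 : ∀ i n, ‖χ i n‖ ≤ 1)
    (h2 : ∀ i j, i ≠ j → ‖∑ n ∈ S, χ i n * conj (χ j n)‖ ≤ P) :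
    ∑ i, ‖∑ n ∈ S, a n * χ i n‖ ^ 2 ≤
      (#S + Fintype.card ι * P) * ∑ n ∈ S, ‖a n‖ ^ 2 := by
  set A : ι → ℂ := fun i => ∑ n ∈ S, a n * χ i n with hA
  set T : ℝ := ∑ i, ‖A i‖ ^ 2 with hT
  set D : ℝ := #S + Fintype.card ι * P with hD
  have hD0 : 0 ≤ D := by positivity
  have hT0 : 0 ≤ T := by positivity
  -- the dual form
  have dual : ∑ n ∈ S, ‖∑ i, conj (A i) * χ i n‖ ^ 2 ≤ D * T := by
    have e1 : ((∑ n ∈ S, ‖∑ i, conj (A i) * χ i n‖ ^ 2 : ℝ) : ℂ) =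
        ∑ i, ∑ j, conj (A i) * A j * ∑ n ∈ S, χ i n * conj (χ j n) := by
      push_cast
      simp_rw [← Complex.mul_conj']
      simp_rw [map_sum, map_mul, Complex.conj_conj, sum_mul_sum, mul_sum]
      rw [sum_comm]
      refine sum_congr rfl fun i _ => ?_
      rw [sum_comm]
      refine sum_congr rfl fun j _ => ?_
      refine sum_congr rfl fun n _ => ?_
      ring
    have e2 : ∑ n ∈ S, ‖∑ i, conj (A i) * χ i n‖ ^ 2 ≤
        ‖∑ i, ∑ j, conj (A i) * A j * ∑ n ∈ S, χ i n * conj (χ j n)‖ := by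
      rw [← e1, Complex.norm_real]; exact le_abs_self _
    refine e2.trans ?_
    have e3 : ∀ i j, ‖conj (A i) * A j * ∑ n ∈ S, χ i n * conj (χ j n)‖ ≤
        (if i = j then ‖A i‖ ^ 2 * #S else 0) + (‖A i‖ ^ 2 + ‖A j‖ ^ 2) / 2 * P := by
      intro i j
      rw [norm_mul, norm_mul, RCLike.norm_conj]
      by_cases hij : i = j
      · subst hij
        simp only [if_true]
        have : ‖∑ n ∈ S, χ i n * conj (χ i n)‖ ≤ #S := by
          refine (norm_sum_le _ _).trans ?_
          calc _ ≤ ∑ n ∈ S, (1:ℝ) := sum_le_sum fun n _ => by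
                rw [norm_mul, RCLike.norm_conj]
                nlinarith [h1 i n, norm_nonneg (χ i n)]
            _ = #S := by simp
        have h3 : 0 ≤ (‖A i‖ ^ 2 + ‖A i‖ ^ 2) / 2 * P := by positivity
        nlinarith [norm_nonneg (A i), mul_le_mul_of_nonneg_left this (sq_nonneg ‖A i‖)]
      · simp only [hij, if_false, zero_add]
        have h4 : ‖A i‖ * ‖A j‖ ≤ (‖A i‖ ^ 2 + ‖A j‖ ^ 2) / 2 := by
          nlinarith [sq_nonneg (‖A i‖ - ‖A j‖)]
        exact mul_le_mul h4 (h2 i j hij) (norm_nonneg _) (by positivity)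
    calc _ ≤ ∑ i, ∑ j, ((if i = j then ‖A i‖ ^ 2 * #S else 0) +
          (‖A i‖ ^ 2 + ‖A j‖ ^ 2) / 2 * P) := by
            refine (norm_sum_le _ _).trans (sum_le_sum fun i _ => ?_)
            exact (norm_sum_le _ _).trans (sum_le_sum fun j _ => e3 i j)
      _ = D * T := by
            simp only [sum_add_distrib, ← sum_mul, ← sum_div, sum_ite_eq, mem_univ, if_true,
              sum_const, card_univ, nsmul_eq_mul]
            rw [← mul_sum, ← hT, hD]; ring
  have key : T ^ 2 ≤ (∑ n ∈ S, ‖a n‖ ^ 2) * (D * T) := by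
    have e1 : (T : ℂ) = ∑ n ∈ S, a n * ∑ i, conj (A i) * χ i n := by
      rw [hT]; push_cast
      simp_rw [← Complex.mul_conj', mul_sum]
      rw [sum_comm]
      refine sum_congr rfl fun i _ => ?_
      conv_lhs => rw [hA]
      simp only [sum_mul]
      refine sum_congr rfl fun n _ => ?_
      ring
    have e2 : T ≤ ∑ n ∈ S, ‖a n‖ * ‖∑ i, conj (A i) * χ i n‖ := by
      calc T ≤ ‖(T : ℂ)‖ := by rw [Complex.norm_real]; exact le_abs_self _
        _ ≤ _ := by
          rw [e1]
          refine (norm_sum_le _ _).trans (sum_le_sum fun n _ => ?_)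
          rw [norm_mul]
    calc T ^ 2 ≤ (∑ n ∈ S, ‖a n‖ * ‖∑ i, conj (A i) * χ i n‖) ^ 2 := by gcongr
      _ ≤ (∑ n ∈ S, ‖a n‖ ^ 2) * ∑ n ∈ S, ‖∑ i, conj (A i) * χ i n‖ ^ 2 :=
          sum_mul_sq_le_sq_mul_sq _ _ _
      _ ≤ _ := by gcongr
  rcases hT0.eq_or_lt with h | h
  · rw [← h]; positivity
  · have : T * T ≤ D * (∑ n ∈ S, ‖a n‖ ^ 2) * T := by nlinarith
    exact le_of_mul_le_mul_right this h

/-- Abel summation bound: bounded partial sums against a function of bounded variation. -/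
theorem norm_sum_range_mul_le (χ : ℕ → ℂ) (h : ℕ → ℝ) (P : ℝ)
    (hP : ∀ N, ‖∑ n ∈ range N, χ n‖ ≤ P) (N : ℕ) (hN : h N = 0) :
    ‖∑ n ∈ range N, (h n : ℂ) * χ n‖ ≤ P * ∑ n ∈ range N, |h (n + 1) - h n| := by
  have key : ∀ M, ∑ n ∈ range M, (h n : ℂ) * χ n =
      (h M : ℂ) * ∑ n ∈ range M, χ n -
        ∑ n ∈ range M, ((h (n + 1) - h n : ℝ) : ℂ) * ∑ m ∈ range (n + 1), χ m := by
    intro M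
    induction M with
    | zero => simp
    | succ M ih =>
      rw [sum_range_succ, ih]
      conv_rhs => rw [sum_range_succ (fun n => ((h (n + 1) - h n : ℝ) : ℂ) * _)]
      rw [sum_range_succ]; push_cast; ring
  rw [key, hN]
  simp only [Complex.ofReal_zero, zero_mul, zero_sub, norm_neg]
  rw [mul_sum]
  refine (norm_sum_le _ _).trans (sum_le_sum fun n _ => ?_)
  rw [norm_mul, Complex.norm_real, Real.norm_eq_abs, mul_comm]
  exact mul_le_mul_of_nonneg_right (hP _) (abs_nonneg _)

/-- The triangle kernel. -/
noncomputable def tri (u : ℝ) : ℝ := max 0 (1 - |u|)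

theorem tri_nonneg (u : ℝ) : 0 ≤ tri u := le_max_left _ _

theorem tri_le_one (u : ℝ) : tri u ≤ 1 := by
  unfold tri; exact max_le zero_le_one (by linarith [abs_nonneg u])

theorem tri_eq_zero {u : ℝ} (h : 1 ≤ |u|) : tri u = 0 := by
  unfold tri; exact max_eq_left (by linarith)

theorem abs_tri_sub_le (a b : ℝ) : |tri a - tri b| ≤ |a - b| := by
  unfold tri
  refine (abs_max_sub_max_le_max _ _ _ _).trans ?_
  rw [sub_self, abs_zero]
  refine max_le (abs_nonneg _) ?_
  rw [show 1 - |a| - (1 - |b|) = |b| - |a| by ring, abs_sub_comm a b]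
  exact abs_abs_sub_abs_le _ _

theorem continuous_tri : Continuous tri := by unfold tri; fun_prop

/-- The weight `tri (log x - v) / x`, localised at `x ≍ exp v`. -/
noncomputable def logTri (v x : ℝ) : ℝ := tri (Real.log x - v) / x

theorem logTri_nonneg (v : ℝ) {x : ℝ} (hx : 0 ≤ x) : 0 ≤ logTri v x :=
  div_nonneg (tri_nonneg _) hx

theorem logTri_eq_zero_of_le {v x : ℝ} (hx : 0 ≤ x) (h : x ≤ Real.exp (v - 1)) :
    logTri v x = 0 := by
  rcases hx.eq_or_lt with rfl | hx
  · simp [logTri]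
  · have : Real.log x ≤ v - 1 := by rwa [Real.log_le_iff_le_exp hx]
    rw [logTri, tri_eq_zero, zero_div]
    rw [abs_of_nonpos (by linarith)]; linarith

theorem logTri_eq_zero_of_ge {v x : ℝ} (h : Real.exp (v + 1) ≤ x) : logTri v x = 0 := by
  have hx : 0 < x := (Real.exp_pos _).trans_le h
  have : v + 1 ≤ Real.log x := by rwa [Real.le_log_iff_exp_le hx]
  rw [logTri, tri_eq_zero, zero_div]
  rw [abs_of_nonneg (by linarith)]; linarith

theorem logTri_le (v : ℝ) {x : ℝ} (hx : 0 ≤ x) : logTri v x ≤ 1 / x :=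
  div_le_div_of_nonneg_right (tri_le_one _) hx

theorem log_succ_sub_log_le {b : ℕ} (hb : 1 ≤ b) :
    Real.log ((b + 1 : ℕ) : ℝ) - Real.log b ≤ 1 / b := by
  have hb' : (0 : ℝ) < b := by exact_mod_cast hb
  rw [← Real.log_div (by positivity) (by positivity)]
  refine (Real.log_le_sub_one_of_pos (by positivity)).trans (le_of_eq ?_)
  push_cast; field_simp; ring

theorem abs_logTri_succ_sub_le (v : ℝ) {d : ℝ} (hd : 0 < d) {b : ℕ} (hb : 1 ≤ b) :
    |logTri v (d * (b + 1 : ℕ)) - logTri v (d * b)| ≤ 2 / (d * b ^ 2) := by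
  have hb' : (0 : ℝ) < b := by exact_mod_cast hb
  have hb1 : (0 : ℝ) < (b + 1 : ℕ) := by positivity
  have e : logTri v (d * (b + 1 : ℕ)) - logTri v (d * b) =
      (tri (Real.log (d * (b + 1 : ℕ)) - v) - tri (Real.log (d * b) - v)) * (1 / (d * b)) -
      tri (Real.log (d * (b + 1 : ℕ)) - v) * (1 / (d * b) - 1 / (d * (b + 1 : ℕ))) := by
    unfold logTri; field_simp; ring
  rw [e]
  refine (abs_sub _ _).trans ?_
  rw [abs_mul, abs_mul]
  have h1 : |tri (Real.log (d * (b + 1 : ℕ)) - v) - tri (Real.log (d * b) - v)| ≤ 1 / b := by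
    refine (abs_tri_sub_le _ _).trans ?_
    rw [Real.log_mul hd.ne' hb1.ne', Real.log_mul hd.ne' hb'.ne']
    rw [abs_of_nonneg]
    · linarith [log_succ_sub_log_le hb]
    · have : Real.log b ≤ Real.log (b + 1 : ℕ) := Real.log_le_log hb' (by push_cast; linarith)
      linarith
  have h2 : |1 / (d * b) - 1 / (d * (b + 1 : ℕ))| ≤ 1 / (d * b ^ 2) := by
    have : 1 / (d * b) - 1 / (d * (b + 1 : ℕ)) = 1 / (d * (b * (b + 1))) := by
      push_cast; field_simp; ring
    rw [this, abs_of_nonneg (by positivity)]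
    apply one_div_le_one_div_of_le (by positivity)
    gcongr
    nlinarith
  have h3 : |tri (Real.log (d * (b + 1 : ℕ)) - v)| ≤ 1 := by
    rw [abs_of_nonneg (tri_nonneg _)]; exact tri_le_one _
  calc _ ≤ 1 / b * (1 / (d * b)) + 1 * (1 / (d * b ^ 2)) := by
        rw [abs_of_nonneg (show 0 ≤ 1 / (d * (b : ℝ)) by positivity)]
        gcongr
    _ = 2 / (d * b ^ 2) := by field_simp; ring

/-- Total variation of a function living on `exp (v - 1) < d b < exp (v + 1)`. -/
theorem sum_variation_le (h : ℕ → ℝ) {d v K : ℝ} (hd : 1 ≤ d) (hK : 0 ≤ K)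
    (hv : 2 * d ≤ Real.exp (v - 1))
    (h1 : ∀ b : ℕ, 1 ≤ b → d * b < Real.exp (v + 1) → |h (b + 1) - h b| ≤ K / (d * b ^ 2))
    (h0 : ∀ b : ℕ, d * (b + 1 : ℕ) ≤ Real.exp (v - 1) ∨ Real.exp (v + 1) ≤ d * b →
      h (b + 1) - h b = 0) (N : ℕ) :
    ∑ b ∈ range N, |h (b + 1) - h b| ≤ 8 * K * Real.exp (3 - v) := by
  have hd0 : 0 < d := by linarith
  have e0 := Real.exp_pos (v - 1)
  have e1 := Real.exp_pos (v + 1)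
  set S := (range N).filter fun b : ℕ => Real.exp (v - 1) < d * (b + 1 : ℕ) ∧
    d * b < Real.exp (v + 1) with hS
  have hsum : ∑ b ∈ range N, |h (b + 1) - h b| = ∑ b ∈ S, |h (b + 1) - h b| := by
    rw [hS, sum_filter]
    refine sum_congr rfl fun b _ => ?_
    split_ifs with hb
    · rfl
    · rw [h0 b, abs_zero]
      by_contra hc; push Not at hc; exact hb hc
  rw [hsum]
  have hterm : ∀ b ∈ S, |h (b + 1) - h b| ≤ K * (4 * d * Real.exp (-(2 * (v - 1)))) := by
    intro b hb
    rw [hS, mem_filter] at hb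
    obtain ⟨-, hb1, hb2⟩ := hb
    push_cast at hb1
    have hdb : Real.exp (v - 1) / 2 ≤ d * b := by nlinarith
    have hb0 : (0 : ℝ) < b := by
      by_contra hc
      have : (b : ℝ) = 0 := le_antisymm (not_lt.mp hc) (Nat.cast_nonneg _)
      rw [this] at hdb; linarith
    have hb1' : 1 ≤ b := by exact_mod_cast hb0
    refine (h1 b hb1' hb2).trans ?_
    rw [div_eq_mul_inv]
    gcongr
    rw [Real.exp_neg, ← div_eq_mul_inv, inv_eq_one_div, div_le_div_iff₀ (by positivity)
      (Real.exp_pos _)]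
    have : Real.exp (2 * (v - 1)) = Real.exp (v - 1) ^ 2 := by
      rw [← Real.exp_nat_mul]; norm_num
    rw [this]
    have hsq : (Real.exp (v - 1) / 2) ^ 2 ≤ (d * b) ^ 2 := by gcongr
    nlinarith
  have hcard : (#S : ℝ) ≤ 2 * Real.exp (v + 1) / d := by
    have hsub : S ⊆ range (⌈Real.exp (v + 1) / d⌉₊) := by
      intro b hb
      rw [hS, mem_filter] at hb
      rw [mem_range, Nat.lt_ceil, lt_div_iff₀ hd0]
      linarith [hb.2.2, mul_comm d (b : ℝ)]
    have h2 := card_le_card hsub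
    rw [card_range] at h2
    have h3 : (#S : ℝ) ≤ ⌈Real.exp (v + 1) / d⌉₊ := by exact_mod_cast h2
    have h4 := (Nat.ceil_lt_add_one (show 0 ≤ Real.exp (v + 1) / d by positivity)).le
    have h5 : 1 ≤ Real.exp (v + 1) / d := by
      rw [le_div_iff₀ hd0]
      have : Real.exp (v - 1) ≤ Real.exp (v + 1) := Real.exp_le_exp.2 (by linarith)
      linarith
    rw [mul_div_assoc]; linarith
  calc _ ≤ #S • (K * (4 * d * Real.exp (-(2 * (v - 1))))) := sum_le_card_nsmul _ _ _ hterm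
    _ ≤ (2 * Real.exp (v + 1) / d) * (K * (4 * d * Real.exp (-(2 * (v - 1))))) := by
        rw [nsmul_eq_mul]; gcongr
    _ = 8 * K * (Real.exp (v + 1) * Real.exp (-(2 * (v - 1)))) := by field_simp; ring
    _ = _ := by rw [← Real.exp_add]; ring_nf

theorem sum_logTri_variation_le {d v : ℝ} (hd : 1 ≤ d) (hv : 2 * d ≤ Real.exp (v - 1)) (N : ℕ) :
    ∑ b ∈ range N, |logTri v (d * (b + 1 : ℕ)) - logTri v (d * b)| ≤
      16 * Real.exp (3 - v) := by
  have := sum_variation_le (fun b : ℕ => logTri v (d * b)) hd (zero_le_two) hv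
    (fun b hb _ => abs_logTri_succ_sub_le v (by linarith) hb) (fun b hb => ?_) N
  · simpa [show (8 : ℝ) * 2 = 16 by norm_num] using this
  · have hd0 : 0 < d := by linarith
    have hm : d * b ≤ d * (b + 1 : ℕ) := by push_cast; gcongr; linarith
    rcases hb with hb | hb
    · rw [logTri_eq_zero_of_le (by positivity) hb,
        logTri_eq_zero_of_le (by positivity) (hm.trans hb), sub_zero]
    · rw [logTri_eq_zero_of_ge hb, logTri_eq_zero_of_ge (hb.trans hm), sub_zero]

theorem sum_log_mul_logTri_variation_le {d v : ℝ} (hd : 1 ≤ d) (hv0 : 0 ≤ v)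
    (hv : 2 * d ≤ Real.exp (v - 1)) (N : ℕ) :
    ∑ b ∈ range N, |Real.log (b + 1 : ℕ) * logTri v (d * (b + 1 : ℕ)) -
      Real.log b * logTri v (d * b)| ≤ 8 * (2 * v + 3) * Real.exp (3 - v) := by
  have hd0 : 0 < d := by linarith
  refine sum_variation_le (fun b : ℕ => Real.log b * logTri v (d * b)) hd (by linarith) hv
    (fun b hb hb2 => ?_) (fun b hb => ?_) N
  · have hb' : (0 : ℝ) < b := by exact_mod_cast hb
    have e : Real.log (b + 1 : ℕ) * logTri v (d * (b + 1 : ℕ)) - Real.log b * logTri v (d * b) =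
        (Real.log (b + 1 : ℕ) - Real.log b) * logTri v (d * (b + 1 : ℕ)) +
        Real.log b * (logTri v (d * (b + 1 : ℕ)) - logTri v (d * b)) := by ring
    have hlog : Real.log b ≤ v + 1 := by
      rw [Real.log_le_iff_le_exp hb']; nlinarith
    have hlog0 : 0 ≤ Real.log b := Real.log_natCast_nonneg b
    have hmono : Real.log b ≤ Real.log (b + 1 : ℕ) :=
      Real.log_le_log hb' (by push_cast; linarith)
    rw [e]
    refine (abs_add_le _ _).trans ?_
    rw [abs_mul, abs_mul, abs_of_nonneg hlog0, abs_of_nonneg (sub_nonneg.2 hmono)]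
    have h1 : |logTri v (d * (b + 1 : ℕ))| ≤ 1 / (d * b) := by
      rw [abs_of_nonneg (logTri_nonneg _ (by positivity))]
      refine (logTri_le v (by positivity)).trans ?_
      apply one_div_le_one_div_of_le (by positivity)
      push_cast; gcongr; linarith
    calc _ ≤ 1 / b * (1 / (d * b)) + (v + 1) * (2 / (d * b ^ 2)) := by
          gcongr
          · exact log_succ_sub_log_le hb
          · exact abs_logTri_succ_sub_le v hd0 hb
      _ = _ := by field_simp; ring
  · have hm : d * b ≤ d * (b + 1 : ℕ) := by push_cast; gcongr; linarith
    rcases hb with hb | hb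
    · rw [logTri_eq_zero_of_le (by positivity) hb,
        logTri_eq_zero_of_le (by positivity) (hm.trans hb)]; simp
    · rw [logTri_eq_zero_of_ge hb, logTri_eq_zero_of_ge (hb.trans hm)]; simp

/-- Opening a Dirichlet convolution against a function supported below `N`. -/
theorem sum_range_convolution (g h : ArithmeticFunction ℝ) (F : ℕ → ℂ) (N : ℕ)
    (hF : ∀ n, N ≤ n → F n = 0) :
    ∑ n ∈ range N, ((g * h) n : ℂ) * F n =
      ∑ a ∈ range N, (g a : ℂ) * ∑ b ∈ range N, (h b : ℂ) * F (a * b) := by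
  have e1 : ∑ a ∈ range N, (g a : ℂ) * ∑ b ∈ range N, (h b : ℂ) * F (a * b) =
      ∑ x ∈ (range N ×ˢ range N) with x.1 * x.2 ∈ Ico 1 N, (g x.1 : ℂ) * (h x.2) *
        F (x.1 * x.2) := by
    rw [sum_filter, sum_product]
    refine sum_congr rfl fun a _ => ?_
    rw [mul_sum]
    refine sum_congr rfl fun b _ => ?_
    split_ifs with hab
    · ring
    · rw [mem_Ico, not_and_or, not_le, not_lt] at hab
      rcases hab with hab | hab
      · have : a * b = 0 := Nat.lt_one_iff.1 hab
        rcases Nat.mul_eq_zero.1 this with rfl | rfl <;> simp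
      · rw [hF _ hab]; simp
  rw [e1, ← sum_fiberwise_of_maps_to (g := fun x : ℕ × ℕ => x.1 * x.2) (t := Ico 1 N)
    (fun x hx => (mem_filter.1 hx).2)]
  have e2 : ∑ n ∈ range N, ((g * h) n : ℂ) * F n = ∑ n ∈ Ico 1 N, ((g * h) n : ℂ) * F n := by
    rcases Nat.eq_zero_or_pos N with rfl | hN
    · simp
    · rw [range_eq_Ico, sum_eq_sum_Ico_succ_bot hN]; simp
  rw [e2]
  refine sum_congr rfl fun n hn => ?_
  rw [mem_Ico] at hn
  rw [mul_apply]; push_cast; rw [sum_mul]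
  refine sum_congr ?_ ?_
  · ext ⟨a, b⟩
    simp only [Nat.mem_divisorsAntidiagonal, mem_filter, mem_product, mem_range, mem_Ico]
    constructor
    · rintro ⟨rfl, h0⟩
      have ha : a ≤ a * b := Nat.le_mul_of_pos_right _ (Nat.pos_of_ne_zero fun h => h0
          (by simp [h]))
      have hb : b ≤ a * b := Nat.le_mul_of_pos_left _ (Nat.pos_of_ne_zero fun h => h0 (by simp [h]))
      exact ⟨⟨⟨by omega, by omega⟩, hn⟩, rfl⟩
    · rintro ⟨_, rfl⟩; exact ⟨rfl, by omega⟩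
  · rintro ⟨a, b⟩ hab
    rw [mem_filter] at hab
    rw [show a * b = n from hab.2]

/-- Restriction of an arithmetic function to `n ≤ Y`. -/
noncomputable def lowPart (f : ArithmeticFunction ℝ) (Y : ℝ) : ArithmeticFunction ℝ :=
  ⟨fun n => if (n : ℝ) ≤ Y then f n else 0, by simp⟩

/-- Restriction of an arithmetic function to `n > Y`. -/
noncomputable def highPart (f : ArithmeticFunction ℝ) (Y : ℝ) : ArithmeticFunction ℝ :=
  ⟨fun n => if (n : ℝ) ≤ Y then 0 else f n, by simp⟩

theorem lowPart_apply (f : ArithmeticFunction ℝ) (Y : ℝ) (n : ℕ) :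
    lowPart f Y n = if (n : ℝ) ≤ Y then f n else 0 := rfl

theorem highPart_apply (f : ArithmeticFunction ℝ) (Y : ℝ) (n : ℕ) :
    highPart f Y n = if (n : ℝ) ≤ Y then 0 else f n := rfl

theorem lowPart_add_highPart (f : ArithmeticFunction ℝ) (Y : ℝ) :
    lowPart f Y + highPart f Y = f := by
  ext n
  rw [ArithmeticFunction.add_apply, lowPart_apply, highPart_apply]
  split_ifs <;> simp

/-- Vaughan's identity. -/
theorem vaughan_identity (Y : ℝ) :
    highPart vonMangoldt Y = lowPart (moebius : ArithmeticFunction ℝ) Y * log -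
      lowPart (moebius : ArithmeticFunction ℝ) Y * (lowPart vonMangoldt Y * zeta) +
      highPart (moebius : ArithmeticFunction ℝ) Y * (highPart vonMangoldt Y * zeta) := by
  have h1 := lowPart_add_highPart (moebius : ArithmeticFunction ℝ) Y
  have h2 := lowPart_add_highPart vonMangoldt Y
  have h3 : (zeta : ArithmeticFunction ℝ) * (moebius : ArithmeticFunction ℝ) = 1 :=
    coe_zeta_mul_coe_moebius
  have h4 := vonMangoldt_mul_zeta
  set m1 := lowPart (moebius : ArithmeticFunction ℝ) Y
  set m2 := highPart (moebius : ArithmeticFunction ℝ) Y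
  set l1 := lowPart vonMangoldt Y
  set l2 := highPart vonMangoldt Y
  rw [← h4, ← h2]
  calc l2 = l2 * (zeta * (moebius : ArithmeticFunction ℝ)) := by rw [h3, mul_one]
    _ = _ := by rw [← h1]; ring

theorem abs_moebius_real_le (n : ℕ) : |(moebius : ArithmeticFunction ℝ) n| ≤ 1 := by
  rw [intCoe_apply, ← Int.cast_abs]
  exact_mod_cast abs_moebius_le_one

theorem sum_lowPart_le (f : ArithmeticFunction ℝ) {Y K : ℝ} (hY : 0 ≤ Y) (hK : 0 ≤ K)
    (hf : ∀ n : ℕ, (n : ℝ) ≤ Y → |f n| ≤ K) (N : ℕ) (T : ℕ → ℂ) (E : ℝ) (hE : 0 ≤ E)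
    (hT : ∀ n : ℕ, 1 ≤ n → (n : ℝ) ≤ Y → ‖T n‖ ≤ E) :
    ‖∑ n ∈ range N, ((lowPart f Y n : ℝ) : ℂ) * T n‖ ≤ Y * (K * E) := by
  calc _ ≤ ∑ n ∈ range N, if n ∈ Ioc 0 ⌊Y⌋₊ then K * E else 0 := by
        refine (norm_sum_le _ _).trans (sum_le_sum fun n _ => ?_)
        rw [norm_mul, Complex.norm_real, Real.norm_eq_abs, lowPart_apply]
        simp only [mem_Ioc]
        rcases Nat.eq_zero_or_pos n with rfl | hn
        · simp
        · by_cases h : (n : ℝ) ≤ Y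
          · rw [if_pos h, if_pos ⟨hn, Nat.le_floor h⟩]
            exact mul_le_mul (hf n h) (hT n hn h) (norm_nonneg _) hK
          · rw [if_neg h, abs_zero, zero_mul]
            split_ifs <;> positivity
    _ ≤ ∑ n ∈ Ioc 0 ⌊Y⌋₊, K * E := by
        rw [← sum_filter]
        refine sum_le_sum_of_subset_of_nonneg (fun n hn => (mem_filter.1 hn).2) ?_
        intros; positivity
    _ ≤ Y * (K * E) := by
        rw [sum_const, nsmul_eq_mul, Nat.card_Ioc, Nat.sub_zero]
        gcongr
        exact Nat.floor_le hY

section typeI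

variable {χ : ℕ → ℂ} {P v : ℝ}

/-- The type I contribution with a logarithmic smooth variable. -/
theorem norm_typeI_log_le (h1 : ∀ n, ‖χ n‖ ≤ 1) (hmul : ∀ a b, χ (a * b) = χ a * χ b)
    (hP : ∀ N, ‖∑ n ∈ range N, χ n‖ ≤ P) (hv : 4 ≤ v) (N : ℕ) (hN : Real.exp (v + 1) ≤ N) :
    ‖∑ n ∈ range N, (((lowPart (moebius : ArithmeticFunction ℝ) (Real.exp (v / 4)) * log) n : ℝ) :
      ℂ) * (χ n * (logTri v n : ℂ))‖ ≤
      Real.exp (v / 4) * (1 * (P * (8 * (2 * v + 3) * Real.exp (3 - v)))) := by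
  have hP0 : 0 ≤ P := (norm_nonneg _).trans (hP 0)
  have hN0 : ∀ n : ℕ, N ≤ n → logTri v n = 0 := fun n hn =>
    logTri_eq_zero_of_ge (hN.trans (by exact_mod_cast hn))
  rw [sum_range_convolution _ _ _ _ (fun n hn => by rw [hN0 n hn]; simp)]
  refine sum_lowPart_le _ (Real.exp_pos _).le zero_le_one (fun n _ => abs_moebius_real_le n) N _ _
    (by positivity) fun a ha haY => ?_
  have e : ∑ b ∈ range N, ((log b : ℝ) : ℂ) * (χ (a * b) * (logTri v ((a * b : ℕ) : ℝ) : ℂ)) =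
      χ a * ∑ b ∈ range N, ((Real.log b * logTri v (a * b) : ℝ) : ℂ) * χ b := by
    rw [mul_sum]
    refine sum_congr rfl fun b _ => ?_
    rw [hmul, log_apply]; push_cast; ring
  rw [e, norm_mul]
  have ha1 : (1 : ℝ) ≤ a := by exact_mod_cast ha
  have hcond : 2 * (a : ℝ) ≤ Real.exp (v - 1) := by
    have h2 : (2 : ℝ) ≤ Real.exp 1 := by linarith [Real.add_one_le_exp 1]
    calc 2 * (a : ℝ) ≤ Real.exp 1 * Real.exp (v / 4) := by gcongr
      _ = Real.exp (1 + v / 4) := (Real.exp_add _ _).symm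
      _ ≤ _ := Real.exp_le_exp.2 (by linarith)
  have hz : Real.log N * logTri v (a * N) = 0 := by
    rw [logTri_eq_zero_of_ge, mul_zero]
    refine hN.trans ?_
    nlinarith [(Nat.cast_nonneg N : (0:ℝ) ≤ N)]
  have := norm_sum_range_mul_le χ (fun b => Real.log b * logTri v (a * b)) P hP N hz
  calc _ ≤ 1 * (P * ∑ b ∈ range N, |Real.log (b + 1 : ℕ) * logTri v (a * (b + 1 : ℕ)) -
      Real.log b * logTri v (a * b)|) := by
        gcongr
        exact h1 a
    _ ≤ _ := by
        rw [one_mul]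
        gcongr
        exact sum_log_mul_logTri_variation_le ha1 (by linarith) hcond N

/-- The type I contribution with two short variables. -/
theorem norm_typeI_zeta_le (h1 : ∀ n, ‖χ n‖ ≤ 1) (hmul : ∀ a b, χ (a * b) = χ a * χ b)
    (hP : ∀ N, ‖∑ n ∈ range N, χ n‖ ≤ P) (hv : 4 ≤ v) (N : ℕ) (hN : Real.exp (v + 1) ≤ N) :
    ‖∑ n ∈ range N, (((lowPart (moebius : ArithmeticFunction ℝ) (Real.exp (v / 4)) *
      (lowPart vonMangoldt (Real.exp (v / 4)) * zeta)) n : ℝ) : ℂ) *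
        (χ n * (logTri v n : ℂ))‖ ≤
      Real.exp (v / 4) * (1 * (Real.exp (v / 4) * (v / 4 * (P * (16 * Real.exp (3 - v)))))) := by
  have hP0 : 0 ≤ P := (norm_nonneg _).trans (hP 0)
  have hN0 : ∀ n : ℕ, N ≤ n → logTri v n = 0 := fun n hn =>
    logTri_eq_zero_of_ge (hN.trans (by exact_mod_cast hn))
  rw [sum_range_convolution _ _ _ _ (fun n hn => by rw [hN0 n hn]; simp)]
  refine sum_lowPart_le _ (Real.exp_pos _).le zero_le_one (fun n _ => abs_moebius_real_le n) N _ _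
    (by positivity) fun a ha haY => ?_
  rw [sum_range_convolution _ _ (fun n => χ (a * n) * (logTri v ((a * n : ℕ) : ℝ) : ℂ)) _
    (fun n hn => by rw [hN0 (a * n) (hn.trans (Nat.le_mul_of_pos_left _ ha))]; simp)]
  refine sum_lowPart_le _ (Real.exp_pos _).le (by linarith) (fun n hn => ?_) N _ _
    (by positivity) fun d hd hdY => ?_
  · rw [abs_of_nonneg vonMangoldt_nonneg]
    refine vonMangoldt_le_log.trans ?_
    rcases Nat.eq_zero_or_pos n with rfl | hn0
    · simp; linarith
    · rwa [Real.log_le_iff_le_exp (by exact_mod_cast hn0)]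
  have e : ∑ b ∈ range N, ((((zeta : ArithmeticFunction ℝ) b : ℝ)) : ℂ) *
      (χ (a * (d * b)) * (logTri v ((a * (d * b) : ℕ) : ℝ) : ℂ)) =
      χ (a * d) * ∑ b ∈ range N, ((logTri v ((a * d : ℕ) * b) : ℝ) : ℂ) * χ b := by
    rw [mul_sum]
    refine sum_congr rfl fun b _ => ?_
    rcases Nat.eq_zero_or_pos b with rfl | hb
    · simp [logTri]
    · rw [← mul_assoc a d b, hmul (a * d) b, natCoe_apply, zeta_apply_ne hb.ne']; push_cast; ring
  rw [e, norm_mul]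
  have hm1 : 1 ≤ a * d := Nat.one_le_iff_ne_zero.2 (Nat.mul_ne_zero (by omega) (by omega))
  have ha1 : (1 : ℝ) ≤ (a * d : ℕ) := by exact_mod_cast hm1
  have hcond : 2 * ((a * d : ℕ) : ℝ) ≤ Real.exp (v - 1) := by
    have h2 : (2 : ℝ) ≤ Real.exp 1 := by linarith [Real.add_one_le_exp 1]
    push_cast
    calc 2 * ((a : ℝ) * d) ≤ Real.exp 1 * (Real.exp (v / 4) * Real.exp (v / 4)) := by gcongr
      _ = Real.exp (1 + (v / 4 + v / 4)) := by rw [← Real.exp_add, ← Real.exp_add]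
      _ ≤ _ := Real.exp_le_exp.2 (by linarith)
  have hz : logTri v ((a * d : ℕ) * N) = 0 := by
    rw [logTri_eq_zero_of_ge]
    refine hN.trans ?_
    nlinarith [(Nat.cast_nonneg N : (0:ℝ) ≤ N)]
  have := norm_sum_range_mul_le χ (fun b => logTri v ((a * d : ℕ) * b)) P hP N hz
  calc _ ≤ 1 * (P * ∑ b ∈ range N, |logTri v ((a * d : ℕ) * (b + 1 : ℕ)) -
      logTri v ((a * d : ℕ) * b)|) := by
        gcongr
        exact h1 _
    _ ≤ _ := by
        rw [one_mul]
        gcongr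
        exact sum_logTri_variation_le ha1 hcond N

end typeI

/-- Integers up to `N` within a factor `exp (1/2)` of `exp w`. -/
noncomputable def logBlock (N : ℕ) (w : ℝ) : Finset ℕ :=
  (range N).filter fun n : ℕ => Real.exp (w - 1 / 2) ≤ n ∧ (n : ℝ) ≤ Real.exp (w + 1 / 2)

theorem logBlock_eq_Ico (N : ℕ) (w : ℝ) :
    logBlock N w = Ico ⌈Real.exp (w - 1 / 2)⌉₊ (min N (⌊Real.exp (w + 1 / 2)⌋₊ + 1)) := by
  ext n
  simp only [logBlock, mem_filter, mem_range, mem_Ico, lt_min_iff, Nat.ceil_le,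
    Nat.lt_add_one_iff, Nat.le_floor_iff (Real.exp_pos _).le]
  tauto

theorem card_logBlock_le (N : ℕ) (w : ℝ) : (#(logBlock N w) : ℝ) ≤ Real.exp (w + 1 / 2) := by
  have hsub : logBlock N w ⊆ Ioc 0 ⌊Real.exp (w + 1 / 2)⌋₊ := by
    intro n hn
    rw [logBlock, mem_filter] at hn
    rw [mem_Ioc]
    refine ⟨?_, Nat.le_floor hn.2.2⟩
    have := (Real.exp_pos _).trans_le hn.2.1
    exact_mod_cast this
  have := card_le_card hsub
  rw [Nat.card_Ioc, Nat.sub_zero] at this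
  exact (Nat.cast_le.2 this).trans (Nat.floor_le (Real.exp_pos _).le)

theorem norm_sum_Ico_le {f : ℕ → ℂ} {P : ℝ} (h : ∀ N, ‖∑ n ∈ range N, f n‖ ≤ P) (a b : ℕ) :
    ‖∑ n ∈ Ico a b, f n‖ ≤ 2 * P := by
  rcases le_total a b with hab | hab
  · rw [sum_Ico_eq_sub _ hab]
    exact (norm_sub_le _ _).trans (by linarith [h a, h b])
  · rw [Ico_eq_empty_of_le hab, sum_empty, norm_zero]
    linarith [(norm_nonneg _).trans (h 0)]

section typeII

variable {ι : Type*} [Fintype ι] [DecidableEq ι] {χ : ι → ℕ → ℂ} {P : ℝ}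

theorem sum_norm_sq_logBlock_le (h1 : ∀ i n, ‖χ i n‖ ≤ 1) (hP : 0 ≤ P)
    (hcorr : ∀ i j, i ≠ j → ∀ N, ‖∑ n ∈ range N, χ i n * conj (χ j n)‖ ≤ P)
    (N : ℕ) {w K : ℝ} (hw : 2 * (Fintype.card ι * P) ≤ Real.exp w) (α : ℕ → ℂ)
    (hα : ∀ n ∈ logBlock N w, ‖α n‖ ≤ K / n) :
    ∑ i, ‖∑ n ∈ logBlock N w, α n * χ i n‖ ^ 2 ≤ 20 * K ^ 2 := by
  have hls := large_sieve χ (logBlock N w) α (2 * P) (by positivity) h1 (fun i j hij => by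
    rw [logBlock_eq_Ico]; exact norm_sum_Ico_le (hcorr i j hij) _ _)
  refine hls.trans ?_
  have hc := card_logBlock_le N w
  have e0 := Real.exp_pos w
  have hsum : ∑ n ∈ logBlock N w, ‖α n‖ ^ 2 ≤
      Real.exp (w + 1 / 2) * (K ^ 2 * Real.exp (-(2 * (w - 1 / 2)))) := by
    calc _ ≤ ∑ n ∈ logBlock N w, K ^ 2 * Real.exp (-(2 * (w - 1 / 2))) := by
          refine sum_le_sum fun n hn => ?_
          have h2 := hα n hn
          rw [logBlock, mem_filter] at hn
          have hn0 : (0 : ℝ) < n := (Real.exp_pos _).trans_le hn.2.1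
          have h3 : ‖α n‖ ^ 2 ≤ (K / n) ^ 2 := by gcongr
          refine h3.trans ?_
          rw [div_pow, div_eq_mul_inv, Real.exp_neg]
          gcongr
          calc Real.exp (2 * (w - 1 / 2)) = Real.exp (w - 1 / 2) ^ 2 := by
                rw [← Real.exp_nat_mul]; norm_num
            _ ≤ (n : ℝ) ^ 2 := by gcongr; exact hn.2.1
      _ ≤ _ := by
          rw [sum_const, nsmul_eq_mul]
          gcongr
  calc _ ≤ (Real.exp (w + 1 / 2) + Real.exp w) *
        (Real.exp (w + 1 / 2) * (K ^ 2 * Real.exp (-(2 * (w - 1 / 2))))) := by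
        gcongr
        linarith
    _ = (Real.exp 2 + Real.exp (3 / 2)) * K ^ 2 := by
        have a1 : Real.exp (w + 1 / 2) * Real.exp (w + 1 / 2) * Real.exp (-(2 * (w - 1 / 2))) =
          Real.exp 2 := by rw [← Real.exp_add, ← Real.exp_add]; ring_nf
        have a2 : Real.exp w * Real.exp (w + 1 / 2) * Real.exp (-(2 * (w - 1 / 2))) =
          Real.exp (3 / 2) := by rw [← Real.exp_add, ← Real.exp_add]; ring_nf
        rw [← a1, ← a2]; ring
    _ ≤ 20 * K ^ 2 := by
        gcongr
        have b1 : Real.exp 2 = Real.exp 1 ^ 2 := by rw [← Real.exp_nat_mul]; norm_num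
        have b2 : Real.exp (3 / 2) ≤ Real.exp 2 := Real.exp_le_exp.2 (by norm_num)
        have b3 := Real.exp_one_lt_d9
        nlinarith [Real.exp_pos 1]

/-- The set of `w` with `w` near `x` and `v - w` near `y`. -/
def pairSet (v x y : ℝ) : Set ℝ :=
  Set.Icc (max (x - 1 / 2) (v - y - 1 / 2)) (min (x + 1 / 2) (v - y + 1 / 2))

theorem integral_indicator_pairSet (v x y : ℝ) :
    ∫ w, (pairSet v x y).indicator (1 : ℝ → ℂ) w = (tri (x + y - v) : ℂ) := by
  have h0 : ∫ w, (pairSet v x y).indicator (1 : ℝ → ℂ) w =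
      ((MeasureTheory.volume.real (pairSet v x y) : ℝ) : ℂ) := by
    rw [Pi.one_def, MeasureTheory.integral_indicator_const _
      (by unfold pairSet; exact measurableSet_Icc)]
    simp
  rw [h0, pairSet, MeasureTheory.measureReal_def, Real.volume_Icc]
  rw [ENNReal.toReal_ofReal']
  congr 1
  rw [tri, max_comm]
  congr 1
  rcases le_total x (v - y) with h | h
  · rw [min_eq_left (by linarith), max_eq_right (by linarith), abs_of_nonpos (by linarith)]
    ring
  · rw [min_eq_right (by linarith), max_eq_left (by linarith), abs_of_nonneg (by linarith)]
    ring

theorem mem_pairSet_iff {N : ℕ} {v w : ℝ} {a b : ℕ} (ha : 1 ≤ a) (hb : 1 ≤ b) (haN : a < N)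
    (hbN : b < N) :
    w ∈ pairSet v (Real.log a) (Real.log b) ↔ a ∈ logBlock N w ∧ b ∈ logBlock N (v - w) := by
  have ha' : (0 : ℝ) < a := by exact_mod_cast ha
  have hb' : (0 : ℝ) < b := by exact_mod_cast hb
  simp only [logBlock, mem_filter, mem_range, ← Real.le_log_iff_exp_le ha',
    ← Real.log_le_iff_le_exp ha', ← Real.le_log_iff_exp_le hb', ← Real.log_le_iff_le_exp hb',
    pairSet, Set.mem_Icc, max_le_iff, le_min_iff]
  constructor
  · rintro ⟨⟨h1, h2⟩, h3, h4⟩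
    exact ⟨⟨haN, by linarith, by linarith⟩, hbN, by linarith, by linarith⟩
  · rintro ⟨⟨-, h1, h2⟩, -, h3, h4⟩
    exact ⟨⟨by linarith, by linarith⟩, by linarith, by linarith⟩

/-- Exact separation of variables for the triangle weight. -/
theorem sum_sum_logTri_eq_integral (N : ℕ) (v : ℝ) (α β : ℕ → ℂ) (hα : α 0 = 0)
    (hβ : β 0 = 0) :
    MeasureTheory.Integrable (fun w => (∑ a ∈ logBlock N w, α a) * ∑ b ∈ logBlock N (v - w), β b) ∧
    ∑ a ∈ range N, ∑ b ∈ range N, α a * β b * (tri (Real.log a + Real.log b - v) : ℂ) =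
      ∫ w, (∑ a ∈ logBlock N w, α a) * ∑ b ∈ logBlock N (v - w), β b := by
  have e : (fun w => (∑ a ∈ logBlock N w, α a) * ∑ b ∈ logBlock N (v - w), β b) =
      fun w => ∑ a ∈ range N, ∑ b ∈ range N, α a * β b *
        (pairSet v (Real.log a) (Real.log b)).indicator (1 : ℝ → ℂ) w := by
    ext w
    have hs : ∀ (γ : ℕ → ℂ) (u : ℝ), ∑ a ∈ logBlock N u, γ a =
        ∑ a ∈ range N, if a ∈ logBlock N u then γ a else 0 := by
      intro γ u
      rw [← sum_filter]
      refine sum_congr ?_ fun _ _ => rfl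
      ext n; simp only [logBlock, mem_filter]; tauto
    rw [hs α, hs β, sum_mul_sum]
    refine sum_congr rfl fun a ha => sum_congr rfl fun b hb => ?_
    rcases Nat.eq_zero_or_pos a with rfl | ha0
    · simp [hα]
    rcases Nat.eq_zero_or_pos b with rfl | hb0
    · simp [hβ]
    classical
    rw [Set.indicator_apply]
    simp only [mem_pairSet_iff ha0 hb0 (mem_range.1 ha) (mem_range.1 hb), Pi.one_apply]
    by_cases h1 : a ∈ logBlock N w <;> by_cases h2 : b ∈ logBlock N (v - w) <;> simp [h1, h2]
  have hintegrable : ∀ x y : ℝ, MeasureTheory.Integrable ((pairSet v x y).indicator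
      (1 : ℝ → ℂ)) := by
    intro x y
    refine (MeasureTheory.integrable_indicator_iff
        (by unfold pairSet; exact measurableSet_Icc)).2 ?_
    exact MeasureTheory.integrableOn_const (by simp [pairSet]) (by simp)
  rw [e]
  refine ⟨MeasureTheory.integrable_finsetSum _ fun a _ => MeasureTheory.integrable_finsetSum _
      fun b _ =>
    (hintegrable _ _).const_mul _, ?_⟩
  rw [MeasureTheory.integral_finsetSum _ fun a _ => MeasureTheory.integrable_finsetSum _ fun b _ =>
    (hintegrable _ _).const_mul _]
  refine sum_congr rfl fun a _ => ?_
  rw [MeasureTheory.integral_finsetSum _ fun b _ => (hintegrable _ _).const_mul _]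
  refine sum_congr rfl fun b _ => ?_
  rw [MeasureTheory.integral_const_mul, integral_indicator_pairSet]

end typeII

section meanValue

variable {ι : Type*} [Fintype ι] [DecidableEq ι] {χ : ι → ℕ → ℂ} {P : ℝ}

theorem abs_highPart_vonMangoldt_mul_zeta_le (Y : ℝ) (n : ℕ) :
    |(highPart vonMangoldt Y * zeta : ArithmeticFunction ℝ) n| ≤ Real.log n := by
  rw [coe_mul_zeta_apply]
  have h0 : ∀ i, 0 ≤ highPart vonMangoldt Y i := fun i => by
    rw [highPart_apply]; split_ifs
    · rfl
    · exact vonMangoldt_nonneg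
  rw [abs_of_nonneg (sum_nonneg fun i _ => h0 i), ← vonMangoldt_sum]
  refine sum_le_sum fun i _ => ?_
  rw [highPart_apply]; split_ifs
  · exact vonMangoldt_nonneg
  · rfl

theorem highPart_vonMangoldt_mul_zeta_eq_zero {Y : ℝ} {n : ℕ} (hn : (n : ℝ) ≤ Y) :
    (highPart vonMangoldt Y * zeta : ArithmeticFunction ℝ) n = 0 := by
  rw [coe_mul_zeta_apply]
  refine sum_eq_zero fun i hi => ?_
  rw [highPart_apply, if_pos]
  have : (i : ℝ) ≤ n := by exact_mod_cast Nat.divisor_le hi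
  linarith

/-- The bilinear contribution on average over the family. -/
theorem sum_norm_typeII_le (h1 : ∀ i n, ‖χ i n‖ ≤ 1)
    (hmul : ∀ i a b, χ i (a * b) = χ i a * χ i b) (hP0 : 0 ≤ P)
    (hcorr : ∀ i j, i ≠ j → ∀ N, ‖∑ n ∈ range N, χ i n * conj (χ j n)‖ ≤ P)
    {v : ℝ} (hv : 16 ≤ v) (hcard : Fintype.card ι * P ≤ Real.exp (v / 8)) (N : ℕ)
    (hN : Real.exp (v + 1) ≤ N) :
    ∑ i, ‖∑ n ∈ range N, (((highPart (moebius : ArithmeticFunction ℝ) (Real.exp (v / 4)) *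
      (highPart vonMangoldt (Real.exp (v / 4)) * zeta)) n : ℝ) : ℂ) *
        (χ i n * (logTri v n : ℂ))‖ ≤ 20 * v * v := by
  set Y := Real.exp (v / 4) with hY
  set g := highPart (moebius : ArithmeticFunction ℝ) Y with hg
  set h : ArithmeticFunction ℝ := highPart vonMangoldt Y * zeta with hh
  have hN0 : ∀ n : ℕ, N ≤ n → logTri v n = 0 := fun n hn =>
    logTri_eq_zero_of_ge (hN.trans (by exact_mod_cast hn))
  set α : ℕ → ℂ := fun n => (g n : ℂ) / n with hα
  set β : ℕ → ℂ := fun n => (h n : ℂ) / n with hβ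
  set A : ι → ℝ → ℂ := fun i w => ∑ a ∈ logBlock N w, α a * χ i a with hA
  set B : ι → ℝ → ℂ := fun i w => ∑ b ∈ logBlock N w, β b * χ i b with hB
  have hsep := fun i => sum_sum_logTri_eq_integral N v (fun a => α a * χ i a)
    (fun b => β b * χ i b) (by simp [hα]) (by simp [hβ])
  have hT : ∀ i, ∑ n ∈ range N, (((g * h) n : ℝ) : ℂ) * (χ i n * (logTri v n : ℂ)) =
      ∫ w, A i w * B i (v - w) := by
    intro i
    rw [← (hsep i).2, sum_range_convolution _ _ (fun n => χ i n * (logTri v n : ℂ)) _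
      (fun n hn => by rw [hN0 n hn]; simp)]
    refine sum_congr rfl fun a _ => ?_
    rw [mul_sum]
    refine sum_congr rfl fun b _ => ?_
    rw [hmul, logTri]
    rcases Nat.eq_zero_or_pos a with rfl | ha0
    · simp [hα]
    rcases Nat.eq_zero_or_pos b with rfl | hb0
    · simp [hβ]
    have ha' : (a : ℝ) ≠ 0 := by positivity
    have hb' : (b : ℝ) ≠ 0 := by positivity
    simp only [hα, hβ]
    rw [Nat.cast_mul, Real.log_mul ha' hb']
    push_cast
    have ha'' : (a : ℂ) ≠ 0 := by exact_mod_cast ha'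
    have hb'' : (b : ℂ) ≠ 0 := by exact_mod_cast hb'
    field_simp
  have hA0 : ∀ i w, w < v / 4 - 1 / 2 → A i w = 0 := by
    intro i w hw
    refine sum_eq_zero fun a ha => ?_
    rw [logBlock, mem_filter] at ha
    have : (a : ℝ) ≤ Y := ha.2.2.trans (Real.exp_le_exp.2 (by linarith))
    simp [hα, hg, highPart_apply, this]
  have hB0 : ∀ i w, w < v / 4 - 1 / 2 → B i w = 0 := by
    intro i w hw
    refine sum_eq_zero fun a ha => ?_
    rw [logBlock, mem_filter] at ha
    have : (a : ℝ) ≤ Y := ha.2.2.trans (Real.exp_le_exp.2 (by linarith))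
    simp only [hβ, hh]
    rw [highPart_vonMangoldt_mul_zeta_eq_zero this]; simp
  have hexp : 2 * Real.exp (v / 8) ≤ Real.exp (v / 4 - 1 / 2) := by
    have h2 : (2 : ℝ) ≤ Real.exp (v / 8 - 1 / 2) := by
      linarith [Real.add_one_le_exp (v / 8 - 1 / 2)]
    calc 2 * Real.exp (v / 8) ≤ Real.exp (v / 8 - 1 / 2) * Real.exp (v / 8) := by gcongr
      _ = _ := by rw [← Real.exp_add]; ring_nf
  have hbound : ∀ w, ∑ i, ‖A i w * B i (v - w)‖ ≤
      (Set.Icc (v / 4 - 1 / 2) (3 * v / 4 + 1 / 2)).indicator (fun _ => 20 * v) w := by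
    intro w
    by_cases hw : w ∈ Set.Icc (v / 4 - 1 / 2) (3 * v / 4 + 1 / 2)
    · rw [Set.indicator_of_mem hw]
      have hAs := sum_norm_sq_logBlock_le h1 hP0 hcorr N (w := w) (K := 1)
        (by have := Real.exp_le_exp.2 hw.1; linarith) α (fun n hn => by
          simp only [hα, norm_div, Complex.norm_real, Complex.norm_natCast, Real.norm_eq_abs]
          gcongr
          rw [hg, highPart_apply]
          split_ifs
          · simp
          · exact abs_moebius_real_le n)
      have hBs := sum_norm_sq_logBlock_le h1 hP0 hcorr N (w := v - w) (K := v)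
        (by have := Real.exp_le_exp.2 (show v / 4 - 1 / 2 ≤ v - w by linarith [hw.2]); linarith)
        β (fun n hn => by
          rw [logBlock, mem_filter] at hn
          have hn0 : (0 : ℝ) < n := (Real.exp_pos _).trans_le hn.2.1
          simp only [hβ, norm_div, Complex.norm_real, Complex.norm_natCast, Real.norm_eq_abs]
          gcongr
          refine (abs_highPart_vonMangoldt_mul_zeta_le _ _).trans ?_
          rw [Real.log_le_iff_le_exp hn0]
          exact hn.2.2.trans (Real.exp_le_exp.2 (by linarith [hw.1])))
      have hcs := sum_mul_sq_le_sq_mul_sq univ (fun i => ‖A i w‖) (fun i => ‖B i (v - w)‖)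
      have hfin : (∑ i, ‖A i w * B i (v - w)‖) ^ 2 ≤ (20 * v) ^ 2 := by
        simp_rw [norm_mul]
        refine hcs.trans ?_
        calc _ ≤ (20 * 1 ^ 2) * (20 * v ^ 2) := by gcongr
          _ = _ := by ring
      exact le_of_sq_le_sq hfin (by linarith)
    · rw [Set.indicator_of_notMem hw]
      refine le_of_eq (sum_eq_zero fun i _ => ?_)
      rw [Set.mem_Icc, not_and_or, not_le, not_le] at hw
      rcases hw with hw | hw
      · rw [hA0 i w hw]; simp
      · rw [hB0 i (v - w) (by linarith)]; simp
  calc _ = ∑ i, ‖∫ w, A i w * B i (v - w)‖ := sum_congr rfl fun i _ => by rw [hT i]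
    _ ≤ ∑ i, ∫ w, ‖A i w * B i (v - w)‖ :=
        sum_le_sum fun i _ => MeasureTheory.norm_integral_le_integral_norm _
    _ = ∫ w, ∑ i, ‖A i w * B i (v - w)‖ :=
        (MeasureTheory.integral_finsetSum _ fun i _ => (hsep i).1.norm).symm
    _ ≤ ∫ w, (Set.Icc (v / 4 - 1 / 2) (3 * v / 4 + 1 / 2)).indicator (fun _ => 20 * v) w := by
        refine MeasureTheory.integral_mono
          (MeasureTheory.integrable_finsetSum _ fun i _ => (hsep i).1.norm) ?_ hbound
        refine (MeasureTheory.integrable_indicator_iff measurableSet_Icc).2 ?_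
        exact MeasureTheory.integrableOn_const (by simp) enorm_ne_top
    _ ≤ 20 * v * v := by
        rw [MeasureTheory.integral_indicator_const _ measurableSet_Icc]
        rw [MeasureTheory.measureReal_def, Real.volume_Icc, ENNReal.toReal_ofReal (by linarith),
          smul_eq_mul]
        nlinarith

/-- Mean value theorem for von Mangoldt sums twisted by a nearly orthogonal family of
completely multiplicative functions with small partial sums. -/
theorem sum_norm_vonMangoldt_logTri_le (h1 : ∀ i n, ‖χ i n‖ ≤ 1)
    (hmul : ∀ i a b, χ i (a * b) = χ i a * χ i b)
    (hP : ∀ i N, ‖∑ n ∈ range N, χ i n‖ ≤ P) (hP0 : 0 ≤ P)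
    (hcorr : ∀ i j, i ≠ j → ∀ N, ‖∑ n ∈ range N, χ i n * conj (χ j n)‖ ≤ P)
    {v : ℝ} (hv : 16 ≤ v) (hcard : Fintype.card ι * P ≤ Real.exp (v / 8)) (N : ℕ)
    (hN : Real.exp (v + 1) ≤ N) :
    ∑ i, ‖∑ n ∈ range N, (vonMangoldt n : ℂ) * (χ i n * (logTri v n : ℂ))‖ ≤ 30 * v ^ 2 := by
  set Y := Real.exp (v / 4) with hY
  have hsplit : ∀ i, ‖∑ n ∈ range N, (vonMangoldt n : ℂ) * (χ i n * (logTri v n : ℂ))‖ ≤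
      Real.exp (v / 4) * (1 * (P * (8 * (2 * v + 3) * Real.exp (3 - v)))) +
      Real.exp (v / 4) * (1 * (Real.exp (v / 4) * (v / 4 * (P * (16 * Real.exp (3 - v)))))) +
      ‖∑ n ∈ range N, (((highPart (moebius : ArithmeticFunction ℝ) Y *
      (highPart vonMangoldt Y * zeta)) n : ℝ) : ℂ) * (χ i n * (logTri v n : ℂ))‖ := by
    intro i
    have e : ∑ n ∈ range N, (vonMangoldt n : ℂ) * (χ i n * (logTri v n : ℂ)) =
        ∑ n ∈ range N, (((lowPart (moebius : ArithmeticFunction ℝ) Y * log) n : ℝ) : ℂ) *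
          (χ i n * (logTri v n : ℂ)) -
        ∑ n ∈ range N, (((lowPart (moebius : ArithmeticFunction ℝ) Y *
          (lowPart vonMangoldt Y * zeta)) n : ℝ) : ℂ) * (χ i n * (logTri v n : ℂ)) +
        ∑ n ∈ range N, (((highPart (moebius : ArithmeticFunction ℝ) Y *
          (highPart vonMangoldt Y * zeta)) n : ℝ) : ℂ) * (χ i n * (logTri v n : ℂ)) := by
      rw [← sum_sub_distrib, ← sum_add_distrib]
      refine sum_congr rfl fun n _ => ?_
      rw [← sub_mul, ← add_mul]
      have hvau : highPart vonMangoldt Y n = (lowPart (moebius : ArithmeticFunction ℝ) Y * log) n -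
          (lowPart (moebius : ArithmeticFunction ℝ) Y * (lowPart vonMangoldt Y * zeta)) n +
          (highPart (moebius : ArithmeticFunction ℝ) Y * (highPart vonMangoldt Y * zeta)) n := by
        conv_lhs => rw [vaughan_identity Y]
        rw [ArithmeticFunction.add_apply, sub_eq_add_neg, ArithmeticFunction.add_apply,
          ArithmeticFunction.neg_apply, ← sub_eq_add_neg]
      have hvau' := congrArg (fun x : ℝ => (x : ℂ)) hvau
      push_cast at hvau'
      rw [← hvau', highPart_apply]
      split_ifs with hn
      · rw [logTri_eq_zero_of_le (by positivity)
          (hn.trans (Real.exp_le_exp.2 (by linarith)))]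
        simp
      · rfl
    rw [e]
    refine (norm_add_le _ _).trans (add_le_add_left ((norm_sub_le _ _).trans ?_) _)
    exact add_le_add (norm_typeI_log_le (h1 i) (hmul i) (hP i) (by linarith) N hN)
      (norm_typeI_zeta_le (h1 i) (hmul i) (hP i) (by linarith) N hN)
  refine (sum_le_sum fun i _ => hsplit i).trans ?_
  rw [sum_add_distrib, sum_const, card_univ, nsmul_eq_mul]
  have h3 := sum_norm_typeII_le h1 hmul hP0 hcorr hv hcard N hN
  have e1 : Real.exp (v / 4) ≤ Real.exp (v / 2) := Real.exp_le_exp.2 (by linarith)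
  have e2 : Real.exp (v / 8) * (Real.exp (v / 2) * Real.exp (3 - v)) ≤ 1 := by
    rw [← Real.exp_add, ← Real.exp_add]
    exact Real.exp_le_one_iff.2 (by linarith)
  have e3 : Real.exp (v / 4) * Real.exp (v / 4) = Real.exp (v / 2) := by
    rw [← Real.exp_add]; ring_nf
  have h4 : Fintype.card ι * (Real.exp (v / 4) *
      (1 * (P * (8 * (2 * v + 3) * Real.exp (3 - v)))) +
      Real.exp (v / 4) * (1 * (Real.exp (v / 4) * (v / 4 * (P * (16 * Real.exp (3 - v))))))) ≤
      8 * (2 * v + 3) + 4 * v := by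
    calc _ = Real.exp (v / 4) * ((Fintype.card ι * P) * (8 * (2 * v + 3) * Real.exp (3 - v))) +
          (Real.exp (v / 4) * Real.exp (v / 4)) *
            ((Fintype.card ι * P) * (4 * v * Real.exp (3 - v))) := by ring
      _ ≤ Real.exp (v / 2) * (Real.exp (v / 8) * (8 * (2 * v + 3) * Real.exp (3 - v))) +
          Real.exp (v / 2) * (Real.exp (v / 8) * (4 * v * Real.exp (3 - v))) := by
          rw [e3]
          gcongr
      _ = (Real.exp (v / 8) * (Real.exp (v / 2) * Real.exp (3 - v))) *
          (8 * (2 * v + 3) + 4 * v) := by ring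
      _ ≤ 1 * (8 * (2 * v + 3) + 4 * v) := by gcongr
      _ = _ := one_mul _
  nlinarith

end meanValue

/-- A nonprincipal character modulo `q` has partial sums bounded by `q`. -/
theorem norm_sum_range_le_of_ne_one {q : ℕ} [NeZero q] {χ : DirichletCharacter ℂ q} (hχ : χ ≠ 1)
    (N : ℕ) : ‖∑ n ∈ range N, χ (n : ZMod q)‖ ≤ q := by
  induction N using Nat.strong_induction_on with
  | _ N ih =>
    rcases lt_or_ge N q with h | h
    · calc ‖∑ n ∈ range N, χ (n : ZMod q)‖ ≤ ∑ n ∈ range N, (1 : ℝ) :=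
            norm_sum_le_of_le _ fun n _ => DirichletCharacter.norm_le_one χ _
        _ ≤ q := by simpa using h.le
    · obtain ⟨M, rfl⟩ := Nat.exists_eq_add_of_le h
      have hper : ∑ n ∈ range q, χ (n : ZMod q) = 0 := by
        rw [← MulChar.sum_eq_zero_of_ne_one hχ]
        refine Finset.sum_bij' (fun n _ => (n : ZMod q)) (fun a _ => a.val) (by simp) ?_ ?_ ?_ ?_
        · intro a _; simpa using ZMod.val_lt a
        · intro a ha; exact ZMod.val_cast_of_lt (by simpa using ha)
        · intro a _; simp
        · intro a _; rfl
      rw [Finset.sum_range_add, hper, zero_add]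
      simp only [Nat.cast_add, CharP.cast_eq_zero, zero_add]
      exact ih M (by have := NeZero.pos q; omega)

/-- Primitive characters of conductor `f` with `1 < f ≤ Q`. -/
def primitiveSet (Q : ℕ) : Set (Σ f : ℕ, DirichletCharacter ℂ f) :=
  {x | 1 < x.1 ∧ x.1 ≤ Q ∧ x.2.IsPrimitive}

theorem finite_primitiveSet (Q : ℕ) : (primitiveSet Q).Finite := by
  refine Set.Finite.subset (s := ⋃ f ∈ Set.Icc 0 Q, Set.range (Sigma.mk f)) ?_ ?_
  · refine (Set.finite_Icc 0 Q).biUnion fun f _ => ?_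
    have : Finite (DirichletCharacter ℂ f) := by
      rcases eq_or_ne f 0 with rfl | hf
      · have : Finite (ZMod 0)ˣ := inferInstanceAs (Finite ℤˣ)
        infer_instance
      · have : NeZero f := ⟨hf⟩
        infer_instance
    exact Set.finite_range _
  · rintro x ⟨_, h, _⟩
    exact Set.mem_biUnion (Set.mem_Icc.2 ⟨Nat.zero_le _, h⟩) ⟨x.2, rfl⟩

theorem card_le_of_subset_primitiveSet {Q : ℕ} {s : Finset (Σ f : ℕ, DirichletCharacter ℂ f)}
    (hs : ↑s ⊆ primitiveSet Q) : s.card ≤ Q * Q := by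
  classical
  calc s.card ≤ Q * (s.image Sigma.fst).card := by
        refine Finset.card_le_mul_card_image s Q fun f hf => ?_
        obtain ⟨x, hx, rfl⟩ := Finset.mem_image.1 hf
        have hxq := hs hx
        have : NeZero x.1 := ⟨by have := hxq.1; omega⟩
        calc (s.filter fun y => y.1 = x.1).card
            ≤ ((univ : Finset (DirichletCharacter ℂ x.1)).image (Sigma.mk x.1)).card := by
              refine card_le_card fun y hy => ?_
              obtain ⟨f, χ⟩ := y
              obtain ⟨_, h⟩ := Finset.mem_filter.1 hy
              obtain rfl : f = x.1 := h
              exact Finset.mem_image.2 ⟨χ, mem_univ _, rfl⟩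
          _ ≤ (univ : Finset (DirichletCharacter ℂ x.1)).card := card_image_le
          _ = x.1.totient := by
              rw [card_univ, ← Nat.card_eq_fintype_card,
                DirichletCharacter.card_eq_totient_of_hasEnoughRootsOfUnity]
          _ ≤ x.1 := Nat.totient_le _
          _ ≤ Q := hxq.2.1
    _ ≤ Q * (Finset.Icc 1 Q).card := by
        refine Nat.mul_le_mul_left _ (card_le_card fun f hf => ?_)
        obtain ⟨x, hx, rfl⟩ := Finset.mem_image.1 hf
        have := hs hx
        exact Finset.mem_Icc.2 ⟨this.1.le, this.2.1⟩
    _ = Q * Q := by simp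

theorem changeLevel_natCast_apply {f m : ℕ} (χ : DirichletCharacter ℂ f) (hm : f ∣ m) {n : ℕ}
    (hn : n.Coprime m) :
    DirichletCharacter.changeLevel hm χ (n : ZMod m) = χ (n : ZMod f) := by
  have h := DirichletCharacter.changeLevel_eq_cast_of_dvd' χ hm (a := (n : ℤ))
    (Nat.isCoprime_iff_coprime.2 hn)
  simpa using h

/-- The product of a primitive character and the conjugate of another one is induced by
a nonprincipal character modulo the product of the moduli. -/
theorem exists_ne_one_mul_conj {x y : Σ f : ℕ, DirichletCharacter ℂ f} (hx : x.2.IsPrimitive)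
    (hy : y.2.IsPrimitive) (hx0 : x.1 ≠ 0) (hy0 : y.1 ≠ 0) (hxy : x ≠ y) :
    ∃ ψ : DirichletCharacter ℂ (x.1 * y.1), ψ ≠ 1 ∧
      ∀ n : ℕ, ψ (n : ZMod (x.1 * y.1)) = x.2 (n : ZMod x.1) * conj (y.2 (n : ZMod y.1)) := by
  obtain ⟨f, χ⟩ := x
  obtain ⟨g, ψ⟩ := y
  simp only at hx hy hx0 hy0 ⊢
  have : NeZero (f * g) := ⟨mul_ne_zero hx0 hy0⟩
  have : NeZero f := ⟨hx0⟩
  have : NeZero g := ⟨hy0⟩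
  refine ⟨DirichletCharacter.changeLevel (dvd_mul_right f g) χ *
    (DirichletCharacter.changeLevel (dvd_mul_left g f) ψ)⁻¹, fun h => hxy ?_, fun n => ?_⟩
  · have h' := mul_inv_eq_one.1 h
    have hc := congrArg DirichletCharacter.conductor h'
    rw [DirichletCharacter.conductor_changeLevel, DirichletCharacter.conductor_changeLevel,
      hx, hy] at hc
    subst hc
    have := DirichletCharacter.changeLevel_injective (dvd_mul_right f f) h'
    rw [this]
  · rw [MulChar.mul_apply, ← MulChar.star_apply']
    by_cases hn : n.Coprime (f * g)
    · rw [changeLevel_natCast_apply _ _ hn, changeLevel_natCast_apply _ _ hn]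
      rfl
    · have h1 : DirichletCharacter.changeLevel (dvd_mul_right f g) χ (n : ZMod (f * g)) = 0 :=
        MulChar.map_nonunit _ (by rwa [ZMod.isUnit_iff_coprime])
      rw [h1, zero_mul]
      rw [Nat.coprime_mul_iff_right, not_and_or] at hn
      rcases hn with hn | hn
      · rw [MulChar.map_nonunit χ (by rwa [ZMod.isUnit_iff_coprime]), zero_mul]
      · rw [MulChar.map_nonunit ψ (by rwa [ZMod.isUnit_iff_coprime]), _root_.map_zero, mul_zero]

theorem ne_one_of_isPrimitive {f : ℕ} (hf : 1 < f) {χ : DirichletCharacter ℂ f}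
    (h : χ.IsPrimitive) : χ ≠ 1 := by
  have : NeZero f := ⟨by omega⟩
  rw [Ne, DirichletCharacter.eq_one_iff_conductor_eq_one, h]
  omega

/-- Mean value of `Λ` twisted by primitive characters of conductor at most `Q`. -/
theorem sum_primitive_norm_vonMangoldt_logTri_le {Q : ℕ}
    {s : Finset (Σ f : ℕ, DirichletCharacter ℂ f)} (hs : ↑s ⊆ primitiveSet Q) {v : ℝ}
    (hv : 16 ≤ v) (hQ : (Q : ℝ) ^ 4 ≤ Real.exp (v / 8)) {N : ℕ} (hN : Real.exp (v + 1) ≤ N) :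
    ∑ x ∈ s, ‖∑ n ∈ range N, (Λ n : ℂ) * (x.2 (n : ZMod x.1) * (logTri v n : ℂ))‖
      ≤ 30 * v ^ 2 := by
  classical
  rw [← Finset.sum_coe_sort s fun x =>
    ‖∑ n ∈ range N, (Λ n : ℂ) * (x.2 (n : ZMod x.1) * (logTri v n : ℂ))‖]
  rcases isEmpty_or_nonempty s with h | ⟨⟨x₀, hx₀⟩⟩
  · rw [Finset.univ_eq_empty, Finset.sum_empty]; positivity
  have hQ1 : 1 ≤ Q := by have := hs hx₀; have h1 := this.1; have h2 := this.2.1; omega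
  refine sum_norm_vonMangoldt_logTri_le (ι := s)
    (χ := fun x n => x.1.2 (n : ZMod x.1.1)) (P := (Q : ℝ) * Q)
    (fun x n => DirichletCharacter.norm_le_one _ _) (fun x a b => by simp) ?_ (by positivity)
    ?_ hv ?_ N hN
  · intro x N
    obtain ⟨h1, h2, h3⟩ := hs x.2
    have : NeZero x.1.1 := ⟨by omega⟩
    calc _ ≤ (x.1.1 : ℝ) := norm_sum_range_le_of_ne_one (ne_one_of_isPrimitive h1 h3) N
      _ ≤ 1 * Q := by rw [one_mul]; exact_mod_cast h2
      _ ≤ Q * Q := by gcongr; exact_mod_cast hQ1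
  · intro x y hxy N
    obtain ⟨h1, h2, h3⟩ := hs x.2
    obtain ⟨h1', h2', h3'⟩ := hs y.2
    obtain ⟨ψ, hψ, h⟩ := exists_ne_one_mul_conj h3 h3' (by omega) (by omega)
      (fun h => hxy (Subtype.ext h))
    have : NeZero (x.1.1 * y.1.1) := ⟨mul_ne_zero (by omega) (by omega)⟩
    simp only [← h]
    refine (norm_sum_range_le_of_ne_one hψ N).trans ?_
    push_cast
    gcongr
  · rw [Fintype.card_coe]
    calc (s.card : ℝ) * (Q * Q) ≤ (Q * Q) * (Q * Q) := by
          gcongr; exact_mod_cast card_le_of_subset_primitiveSet hs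
      _ = (Q : ℝ) ^ 4 := by ring
      _ ≤ _ := hQ

theorem norm_cpow_neg_sub_cpow_neg_le {n : ℕ} (hn : 1 ≤ n) {z : ℂ} (hz : 0 ≤ z.re) :
    ‖(n : ℂ) ^ (-z) - ((n + 1 : ℕ) : ℂ) ^ (-z)‖ ≤ ‖z‖ * (n : ℝ) ^ (-z.re - 1) := by
  have hn0 : (0 : ℝ) < n := by exact_mod_cast hn
  have hd : ∀ t ∈ Set.Icc (n : ℝ) ((n : ℝ) + 1),
      HasDerivWithinAt (fun t : ℝ => (t : ℂ) ^ (-z)) (-z * (t : ℂ) ^ (-z - 1))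
        (Set.Icc (n : ℝ) ((n : ℝ) + 1)) t := by
    intro t ht
    have ht0 : 0 < t := hn0.trans_le ht.1
    have := (hasDerivAt_id (t : ℂ)).cpow_const (c := -z) (Complex.ofReal_mem_slitPlane.2 ht0)
    simpa using this.comp_ofReal.hasDerivWithinAt
  have := (convex_Icc (n : ℝ) (n + 1)).norm_image_sub_le_of_norm_hasDerivWithin_le
    (C := ‖z‖ * (n : ℝ) ^ (-z.re - 1)) hd (fun t ht => ?_)
    (Set.right_mem_Icc.2 (by linarith)) (Set.left_mem_Icc.2 (by linarith))
  · simpa using this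
  · have ht0 : 0 < t := hn0.trans_le ht.1
    rw [norm_mul, norm_neg, Complex.norm_cpow_eq_rpow_re_of_pos ht0]
    refine mul_le_mul_of_nonneg_left ?_ (norm_nonneg _)
    simp only [Complex.sub_re, Complex.neg_re, Complex.one_re]
    exact Real.rpow_le_rpow_of_nonpos hn0 ht.1 (by linarith)

/-- The constant in the bound for `L(z, χ)` near `1`. -/
noncomputable def lConst (η : ℝ) : ℝ := 4 * ∑' i : ℕ, ((i + 1 : ℕ) : ℝ) ^ (-1 - η / 2)

theorem summable_lConst {η : ℝ} (hη : 0 < η) :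
    Summable fun i : ℕ => ((i + 1 : ℕ) : ℝ) ^ (-1 - η / 2) := by
  have := (summable_nat_add_iff 1).2 (Real.summable_nat_rpow (p := -1 - η / 2) |>.2 (by linarith))
  exact this

theorem four_le_lConst {η : ℝ} (hη : 0 < η) : 4 ≤ lConst η := by
  have := (summable_lConst hη).le_tsum 0 (fun i _ => by positivity)
  rw [lConst]
  simp only [zero_add, Nat.cast_one, Real.one_rpow] at this
  linarith

section lBound

variable {q : ℕ} [NeZero q] {χ : DirichletCharacter ℂ q}

theorem norm_sum_range_le_rpow (hχ : χ ≠ 1) {η : ℝ} (hη0 : 0 ≤ η) (hη1 : η ≤ 1) (N : ℕ) :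
    ‖∑ n ∈ range N, χ (n : ZMod q)‖ ≤ (q : ℝ) ^ η * (N : ℝ) ^ (1 - η) := by
  set a := ‖∑ n ∈ range N, χ (n : ZMod q)‖
  have h1 : a ≤ q := norm_sum_range_le_of_ne_one hχ N
  have h2 : a ≤ N := by
    calc a ≤ ∑ n ∈ range N, (1 : ℝ) :=
          norm_sum_le_of_le _ fun n _ => DirichletCharacter.norm_le_one χ _
      _ = N := by simp
  calc a = a ^ η * a ^ (1 - η) := by
        have ha : 0 ≤ a := norm_nonneg _
        rcases ha.eq_or_lt with h | h
        · rw [← h]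
          rcases eq_or_ne η 0 with rfl | hη
          · simp
          · simp [Real.zero_rpow hη]
        · rw [← Real.rpow_add h]; simp
    _ ≤ _ := by
        gcongr

/-- Terms of the series for `L(z, χ)` obtained by partial summation. -/
noncomputable def abelTerm (χ : DirichletCharacter ℂ q) (i : ℕ) (z : ℂ) : ℂ :=
  (∑ n ∈ range (i + 2), χ (n : ZMod q)) *
    (((i + 1 : ℕ) : ℂ) ^ (-z) - ((i + 1 + 1 : ℕ) : ℂ) ^ (-z))

theorem norm_abelTerm_le (hχ : χ ≠ 1) {η : ℝ} (hη0 : 0 < η) (hη1 : η ≤ 1) {z : ℂ}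
    (hz : z ∈ Metric.ball (1 : ℂ) (η / 2)) (i : ℕ) :
    ‖abelTerm χ i z‖ ≤ 4 * (q : ℝ) ^ η * ((i + 1 : ℕ) : ℝ) ^ (-1 - η / 2) := by
  rw [mem_ball_iff_norm] at hz
  have hre : 1 - η / 2 ≤ z.re := by
    have := (Complex.abs_re_le_norm (z - 1)).trans hz.le
    simp only [Complex.sub_re, Complex.one_re, abs_le] at this
    linarith
  have hz2 : ‖z‖ ≤ 2 := by
    calc ‖z‖ = ‖(z - 1) + 1‖ := by ring_nf
      _ ≤ ‖z - 1‖ + ‖(1 : ℂ)‖ := norm_add_le _ _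
      _ ≤ 2 := by rw [norm_one]; linarith
  have hi : (1 : ℝ) ≤ ((i + 1 : ℕ) : ℝ) := by exact_mod_cast Nat.le_add_left 1 i
  rw [abelTerm, norm_mul]
  calc _ ≤ ((q : ℝ) ^ η * ((i + 2 : ℕ) : ℝ) ^ (1 - η)) *
        (‖z‖ * ((i + 1 : ℕ) : ℝ) ^ (-z.re - 1)) := by
        gcongr
        · exact norm_sum_range_le_rpow hχ hη0.le hη1 _
        · exact norm_cpow_neg_sub_cpow_neg_le (by omega) (by linarith)
    _ ≤ ((q : ℝ) ^ η * (2 * ((i + 1 : ℕ) : ℝ) ^ (1 - η))) *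
        (2 * ((i + 1 : ℕ) : ℝ) ^ (-2 + η / 2)) := by
        gcongr
        · calc ((i + 2 : ℕ) : ℝ) ^ (1 - η) ≤ (2 * ((i + 1 : ℕ) : ℝ)) ^ (1 - η) := by
                gcongr
                push_cast
                linarith [(Nat.cast_nonneg i : (0 : ℝ) ≤ i)]
            _ = 2 ^ (1 - η) * ((i + 1 : ℕ) : ℝ) ^ (1 - η) := by
                rw [Real.mul_rpow] <;> positivity
            _ ≤ _ := by
                gcongr
                calc (2 : ℝ) ^ (1 - η) ≤ 2 ^ (1 : ℝ) :=
                      Real.rpow_le_rpow_of_exponent_le (by norm_num) (by linarith)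
                  _ = 2 := by simp
        · linarith
    _ = 4 * (q : ℝ) ^ η * (((i + 1 : ℕ) : ℝ) ^ (1 - η) * ((i + 1 : ℕ) : ℝ) ^ (-2 + η / 2)) := by
        ring
    _ = _ := by
        rw [← Real.rpow_add (by linarith)]
        ring_nf

omit [NeZero q] in
theorem sum_range_abelTerm (hq : q ≠ 1) (z : ℂ) (N : ℕ) :
    ∑ i ∈ range N, abelTerm χ i z =
      ∑ i ∈ range N, χ ((i + 1 : ℕ) : ZMod q) * ((i + 1 : ℕ) : ℂ) ^ (-z) -
        (∑ n ∈ range (N + 1), χ (n : ZMod q)) * ((N + 1 : ℕ) : ℂ) ^ (-z) := by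
  induction N with
  | zero =>
    have : Nontrivial (ZMod q) := ZMod.nontrivial_iff.2 hq
    simp [MulChar.map_zero]
  | succ N ih =>
    rw [sum_range_succ, ih, abelTerm, sum_range_succ (fun n : ℕ => χ (n : ZMod q)) (N + 1),
      sum_range_succ (fun i : ℕ => χ ((i + 1 : ℕ) : ZMod q) * ((i + 1 : ℕ) : ℂ) ^ (-z)) N]
    ring

theorem LSeries_eq_tsum_abelTerm (hχ : χ ≠ 1) {z : ℂ} (hz : 1 < z.re)
    (hs : Summable fun i => abelTerm χ i z) :
    LSeries (fun n => χ n) z = ∑' i, abelTerm χ i z := by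
  have hq : q ≠ 1 := by
    rintro rfl
    exact hχ (Subsingleton.elim _ _)
  have h1 := hs.hasSum.tendsto_sum_nat
  have h2 := ((DirichletCharacter.LSeriesSummable_of_one_lt_re χ hz).hasSum.tendsto_sum_nat).comp
    (tendsto_add_atTop_nat 1)
  have h3 : Tendsto (fun N : ℕ => (∑ n ∈ range (N + 1), χ (n : ZMod q)) *
      ((N + 1 : ℕ) : ℂ) ^ (-z)) atTop (nhds 0) := by
    rw [tendsto_zero_iff_norm_tendsto_zero]
    have h4 : Tendsto (fun N : ℕ => (q : ℝ) * ((N + 1 : ℕ) : ℝ) ^ (-1 : ℝ)) atTop (nhds 0) := by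
      have := (tendsto_rpow_neg_atTop (y := 1) one_pos).comp
        ((tendsto_natCast_atTop_atTop (R := ℝ)).comp (tendsto_add_atTop_nat 1))
      simpa using this.const_mul (q : ℝ)
    refine squeeze_zero (fun _ => norm_nonneg _) (fun N => ?_) h4
    rw [norm_mul, Complex.norm_natCast_cpow_of_pos (Nat.succ_pos _)]
    gcongr
    · exact norm_sum_range_le_of_ne_one hχ _
    · push_cast; linarith [(Nat.cast_nonneg N : (0 : ℝ) ≤ N)]
    · simpa using hz.le
  have h5 := h2.sub h3
  rw [sub_zero] at h5
  refine tendsto_nhds_unique h5 (h1.congr fun N => ?_)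
  rw [sum_range_abelTerm hq]
  simp only [Function.comp_apply]
  congr 1
  rw [sum_range_succ', LSeries.term_zero, add_zero]
  refine sum_congr rfl fun i _ => ?_
  rw [LSeries.term_of_ne_zero (Nat.succ_ne_zero i), Complex.cpow_neg, div_eq_mul_inv]

/-- Convexity-type bound for `L(z, χ)` close to `1`. -/
theorem norm_LFunction_le (hχ : χ ≠ 1) {η : ℝ} (hη0 : 0 < η) (hη1 : η ≤ 1) {z : ℂ}
    (hz : z ∈ Metric.ball (1 : ℂ) (η / 2)) :
    ‖DirichletCharacter.LFunction χ z‖ ≤ lConst η * (q : ℝ) ^ η := by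
  have hsum : Summable fun i : ℕ => 4 * (q : ℝ) ^ η * ((i + 1 : ℕ) : ℝ) ^ (-1 - η / 2) :=
    (summable_lConst hη0).mul_left _
  have hsumm : ∀ z ∈ Metric.ball (1 : ℂ) (η / 2), Summable fun i => abelTerm χ i z :=
    fun z hz => Summable.of_norm_bounded hsum fun i => norm_abelTerm_le hχ hη0 hη1 hz i
  have hdiff : DifferentiableOn ℂ (fun z => ∑' i, abelTerm χ i z) (Metric.ball 1 (η / 2)) := by
    refine Complex.differentiableOn_tsum_of_summable_norm hsum (fun i => ?_) Metric.isOpen_ball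
      (fun i w hw => norm_abelTerm_le hχ hη0 hη1 hw i)
    have h1 : ((i + 1 : ℕ) : ℂ) ≠ 0 := Nat.cast_ne_zero.2 (Nat.succ_ne_zero _)
    have h2 : ((i + 1 + 1 : ℕ) : ℂ) ≠ 0 := Nat.cast_ne_zero.2 (Nat.succ_ne_zero _)
    refine Differentiable.differentiableOn ?_
    refine Differentiable.const_mul (Differentiable.sub ?_ ?_) _
    · exact differentiable_id.neg.const_cpow (Or.inl h1)
    · exact differentiable_id.neg.const_cpow (Or.inl h2)
  have heq : Set.EqOn (DirichletCharacter.LFunction χ) (fun z => ∑' i, abelTerm χ i z)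
      (Metric.ball 1 (η / 2)) := by
    have hmem : (1 + (η / 4 : ℝ) : ℂ) ∈ Metric.ball (1 : ℂ) (η / 2) := by
      rw [mem_ball_iff_norm, add_sub_cancel_left, Complex.norm_real, Real.norm_eq_abs,
        abs_of_pos (by positivity)]
      linarith
    refine AnalyticOnNhd.eqOn_of_preconnected_of_eventuallyEq (z₀ := 1 + (η / 4 : ℝ))
      ((DirichletCharacter.differentiable_LFunction hχ).differentiableOn.analyticOnNhd
        Metric.isOpen_ball) (hdiff.analyticOnNhd Metric.isOpen_ball)
      (convex_ball _ _).isPreconnected hmem ?_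
    have hopen : IsOpen {z : ℂ | 1 < z.re} := isOpen_lt continuous_const Complex.continuous_re
    filter_upwards [hopen.mem_nhds (show (1 + (η / 4 : ℝ) : ℂ) ∈ {z : ℂ | 1 < z.re} by
      simp [hη0]), Metric.isOpen_ball.mem_nhds hmem] with z hz1 hz2
    rw [DirichletCharacter.LFunction_eq_LSeries χ hz1]
    exact LSeries_eq_tsum_abelTerm hχ hz1 (hsumm z hz2)
  rw [heq hz]
  calc ‖∑' i, abelTerm χ i z‖ ≤ ∑' i : ℕ, 4 * (q : ℝ) ^ η * ((i + 1 : ℕ) : ℝ) ^ (-1 - η / 2) :=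
        tsum_of_norm_bounded hsum.hasSum fun i => norm_abelTerm_le hχ hη0 hη1 hz i
    _ = _ := by rw [tsum_mul_left, lConst]; ring

theorem norm_deriv_LFunction_le (hχ : χ ≠ 1) {η : ℝ} (hη0 : 0 < η) (hη1 : η ≤ 1) {z : ℂ}
    (hz : z ∈ Metric.ball (1 : ℂ) (η / 4)) :
    ‖deriv (DirichletCharacter.LFunction χ) z‖ ≤ 8 / η * lConst η * (q : ℝ) ^ η := by
  have h := Complex.norm_deriv_le_of_forall_mem_sphere_norm_le (c := z) (R := η / 8)
    (f := DirichletCharacter.LFunction χ) (C := lConst η * (q : ℝ) ^ η) (by positivity)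
    (DirichletCharacter.differentiable_LFunction hχ).diffContOnCl (fun w hw => ?_)
  · refine h.trans (le_of_eq ?_)
    field_simp
  · refine norm_LFunction_le hχ hη0 hη1 ?_
    rw [mem_sphere_iff_norm] at hw
    rw [mem_ball_iff_norm] at hz ⊢
    calc ‖w - 1‖ = ‖(w - z) + (z - 1)‖ := by ring_nf
      _ ≤ _ := norm_add_le _ _
      _ < η / 2 := by rw [hw]; linarith

end lBound

theorem LSeriesSummable_mul_vonMangoldt_div_log {a : ℕ → ℂ} (ha : ∀ n, ‖a n‖ ≤ 1) {s : ℂ}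
    (hs : 1 < s.re) : LSeriesSummable (fun n => a n * Λ n / Real.log n) s := by
  refine LSeriesSummable_of_bounded_of_one_lt_re (m := 1) (fun n _ => ?_) hs
  have h0 : 0 ≤ Real.log n := Real.log_natCast_nonneg n
  rw [mul_div_assoc, norm_mul, norm_div, Complex.norm_real, Complex.norm_real, Real.norm_eq_abs,
    Real.norm_eq_abs, abs_of_nonneg vonMangoldt_nonneg, abs_of_nonneg h0]
  exact mul_le_one₀ (ha n) (div_nonneg vonMangoldt_nonneg h0)
    (div_le_one_of_le₀ vonMangoldt_le_log h0)

theorem re_term_mul_vonMangoldt_div_log (a : ℕ → ℂ) (s : ℝ) (n : ℕ) :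
    (LSeries.term (fun n => a n * Λ n / Real.log n) s n).re =
      (a n).re * (Λ n / Real.log n * (n : ℝ) ^ (-s)) := by
  rcases eq_or_ne n 0 with rfl | hn
  · simp
  rw [LSeries.term_of_ne_zero hn, div_eq_mul_inv, ← Complex.cpow_neg]
  have h : a n * Λ n / Real.log n * (n : ℂ) ^ (-(s : ℂ)) =
      ((Λ n / Real.log n * (n : ℝ) ^ (-s) : ℝ) : ℂ) * a n := by
    push_cast
    rw [Complex.ofReal_cpow (by positivity)]
    push_cast
    ring
  rw [h, Complex.re_ofReal_mul, mul_comm]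

/-- The `3 + 2 + 2 + 2` inequality for two characters. -/
theorem one_le_norm_LSeries_product {q₁ q₂ q₃ : ℕ} (χ₁ : DirichletCharacter ℂ q₁)
    (χ₂ : DirichletCharacter ℂ q₂) (ψ : DirichletCharacter ℂ q₃)
    (hψ : ∀ n : ℕ, ψ (n : ZMod q₃) = χ₁ (n : ZMod q₁) * conj (χ₂ (n : ZMod q₂))) {s : ℝ}
    (hs : 1 < s) :
    1 ≤ ‖riemannZeta s‖ ^ 3 * ‖LSeries (fun n => χ₁ n) s‖ ^ 2 * ‖LSeries (fun n => χ₂ n) s‖ ^ 2 *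
      ‖LSeries (fun n => ψ n) s‖ ^ 2 := by
  have hs' : 1 < (s : ℂ).re := by simpa using hs
  have e0 := riemannZeta_eq_exp_LSeries hs'
  have e1 := DirichletCharacter.LSeries_eq_exp_LSeries χ₁ hs'
  have e2 := DirichletCharacter.LSeries_eq_exp_LSeries χ₂ hs'
  have e3 := DirichletCharacter.LSeries_eq_exp_LSeries ψ hs'
  have h0 := (LSeriesSummable_mul_vonMangoldt_div_log (a := fun _ => 1) (by simp) hs').hasSum
  have h1 := (LSeriesSummable_mul_vonMangoldt_div_log (a := fun n => χ₁ n)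
    (fun n => DirichletCharacter.norm_le_one _ _) hs').hasSum
  have h2 := (LSeriesSummable_mul_vonMangoldt_div_log (a := fun n => χ₂ n)
    (fun n => DirichletCharacter.norm_le_one _ _) hs').hasSum
  have h3 := (LSeriesSummable_mul_vonMangoldt_div_log (a := fun n => ψ n)
    (fun n => DirichletCharacter.norm_le_one _ _) hs').hasSum
  simp only [one_mul] at h0
  rw [← e0, ← e1, ← e2, ← e3]
  simp only [Complex.norm_exp, ← Real.exp_nat_mul, ← Real.exp_add]
  refine Real.one_le_exp ?_
  have := ((((Complex.hasSum_re h0).mul_left 3).add ((Complex.hasSum_re h1).mul_left 2)).add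
    ((Complex.hasSum_re h2).mul_left 2)).add ((Complex.hasSum_re h3).mul_left 2)
  refine (this.nonneg ?_ : (0 : ℝ) ≤ _).trans (le_of_eq ?_)
  swap
  · simp only [LSeries, Nat.cast_ofNat]
  intro n
  have t0 := re_term_mul_vonMangoldt_div_log (fun _ => 1) s n
  simp only [one_mul, Complex.one_re] at t0
  rw [t0, re_term_mul_vonMangoldt_div_log (fun n => χ₁ n), 
    re_term_mul_vonMangoldt_div_log (fun n => χ₂ n), re_term_mul_vonMangoldt_div_log (fun n => ψ n),
    hψ]
  have hw : 0 ≤ Λ n / Real.log n * (n : ℝ) ^ (-s) :=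
    mul_nonneg (div_nonneg vonMangoldt_nonneg (Real.log_natCast_nonneg n)) (by positivity)
  set a := χ₁ (n : ZMod q₁)
  set b := χ₂ (n : ZMod q₂)
  have ha : ‖a‖ ≤ 1 := DirichletCharacter.norm_le_one _ _
  have hb : ‖b‖ ≤ 1 := DirichletCharacter.norm_le_one _ _
  have ha2 : a.re ^ 2 + a.im ^ 2 ≤ 1 := by
    have : ‖a‖ ^ 2 ≤ 1 := pow_le_one₀ (norm_nonneg _) ha
    rw [Complex.sq_norm, Complex.normSq_apply] at this
    linarith
  have hb2 : b.re ^ 2 + b.im ^ 2 ≤ 1 := by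
    have : ‖b‖ ^ 2 ≤ 1 := pow_le_one₀ (norm_nonneg _) hb
    rw [Complex.sq_norm, Complex.normSq_apply] at this
    linarith
  have key : 0 ≤ 3 + 2 * a.re + 2 * b.re + 2 * (a * conj b).re := by
    simp only [Complex.mul_re, Complex.conj_re, Complex.conj_im]
    nlinarith [sq_nonneg (1 + a.re + b.re), sq_nonneg (a.im + b.im)]
  nlinarith [mul_nonneg key hw]

theorem logMul_iterate_apply (f : ℕ → ℂ) (m n : ℕ) :
    (LSeries.logMul^[m] f) n = Complex.log n ^ m * f n := by
  induction m with
  | zero => simp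
  | succ m ih => rw [Function.iterate_succ_apply', LSeries.logMul, ih]; ring

theorem term_logMul_iterate {q : ℕ} (χ : DirichletCharacter ℂ q) (m : ℕ) (s : ℝ) (n : ℕ) :
    LSeries.term (LSeries.logMul^[m] fun n => χ n * (Λ n : ℂ)) s n =
      (χ n * (Λ n : ℂ)) * (((n : ℝ) ^ (-s) * Real.log n ^ m : ℝ) : ℂ) := by
  rcases eq_or_ne n 0 with rfl | hn
  · simp
  rw [LSeries.term_of_ne_zero hn, logMul_iterate_apply, div_eq_mul_inv, ← Complex.cpow_neg]
  push_cast
  rw [Complex.ofReal_cpow (by positivity)]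
  push_cast
  ring

theorem abscissaOfAbsConv_twist_vonMangoldt_lt {q : ℕ} (χ : DirichletCharacter ℂ q) {s : ℝ}
    (hs : 1 < s) : LSeries.abscissaOfAbsConv (fun n => χ n * (Λ n : ℂ)) < (s : ℂ).re := by
  have h : LSeries.abscissaOfAbsConv (fun n => χ n * (Λ n : ℂ)) ≤ (1 : ℝ) :=
    LSeries.abscissaOfAbsConv_le_of_forall_lt_LSeriesSummable fun y hy =>
      DirichletCharacter.LSeriesSummable_twist_vonMangoldt χ (by simpa using hy)
  refine h.trans_lt ?_
  rw [Complex.ofReal_re]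
  exact EReal.coe_lt_coe_iff.2 hs

section logDeriv

variable {q : ℕ} [NeZero q] {χ : DirichletCharacter ℂ q} {δ M σ : ℝ}

theorem norm_LFunction_ge (hδ : 0 < δ)
    (hd : ∀ z ∈ Metric.closedBall (1 + δ : ℂ) (3 / 2 * δ),
      ‖deriv (DirichletCharacter.LFunction χ) z‖ ≤ M) (hχ : χ ≠ 1)
    (hnb : 2 * δ * M ≤ ‖DirichletCharacter.LFunction χ (1 + δ)‖) {z : ℂ}
    (hz : z ∈ Metric.closedBall (1 + δ : ℂ) (3 / 2 * δ)) :
    δ * M / 2 ≤ ‖DirichletCharacter.LFunction χ z‖ := by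
  have h := (convex_closedBall (1 + δ : ℂ) (3 / 2 * δ)).norm_image_sub_le_of_norm_deriv_le
    (fun z _ => (DirichletCharacter.differentiable_LFunction hχ).differentiableAt) hd
    hz (Metric.mem_closedBall_self (by positivity))
  have hM : 0 ≤ M := (norm_nonneg _).trans (hd _ hz)
  rw [mem_closedBall_iff_norm'] at hz
  have h2 : M * ‖(1 + δ : ℂ) - z‖ ≤ M * (3 / 2 * δ) := by gcongr
  have h3 := norm_sub_norm_le (DirichletCharacter.LFunction χ (1 + δ))
    (DirichletCharacter.LFunction χ z)
  linarith

theorem norm_LSeries_logMul_le (hδ : 0 < δ) (hM : 0 < M)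
    (hd : ∀ z ∈ Metric.closedBall (1 + δ : ℂ) (3 / 2 * δ),
      ‖deriv (DirichletCharacter.LFunction χ) z‖ ≤ M) (hχ : χ ≠ 1)
    (hnb : 2 * δ * M ≤ ‖DirichletCharacter.LFunction χ (1 + δ)‖) (hσ0 : 0 < σ) (hσ : σ ≤ δ)
    (m : ℕ) :
    ‖LSeries (LSeries.logMul^[m] fun n => χ n * (Λ n : ℂ)) ((1 + σ : ℝ) : ℂ)‖
      ≤ m.factorial * (2 / δ) / (δ / 4) ^ m := by
  set c : ℂ := ((1 + σ : ℝ) : ℂ)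
  have hsub : Metric.closedBall c (δ / 4) ⊆ Metric.closedBall (1 + δ : ℂ) (3 / 2 * δ) := by
    refine Metric.closedBall_subset_closedBall' ?_
    have : dist c (1 + δ : ℂ) = δ - σ := by
      rw [dist_comm, Complex.dist_eq,
        show (1 + δ : ℂ) - c = ((δ - σ : ℝ) : ℂ) by simp only [c]; push_cast; ring,
        Complex.norm_real, Real.norm_eq_abs, abs_of_nonneg (by linarith)]
    rw [this]; linarith
  set F : ℂ → ℂ := fun z => -deriv (DirichletCharacter.LFunction χ) z /
    DirichletCharacter.LFunction χ z
  have hL := DirichletCharacter.differentiable_LFunction hχ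
  have hne : ∀ z ∈ Metric.closedBall c (δ / 4), DirichletCharacter.LFunction χ z ≠ 0 := by
    intro z hz h0
    have := norm_LFunction_ge hδ hd hχ hnb (hsub hz)
    rw [h0, norm_zero] at this
    have : 0 < δ * M / 2 := by positivity
    linarith
  have hdc : DiffContOnCl ℂ F (Metric.ball c (δ / 4)) := by
    refine DifferentiableOn.diffContOnCl fun z hz => ?_
    rw [closure_ball c (by positivity)] at hz
    have hd1 : DifferentiableAt ℂ (deriv (DirichletCharacter.LFunction χ)) z :=
      (hL.analyticAt z).deriv.differentiableAt
    exact (hd1.neg.div (hL z) (hne z hz)).differentiableWithinAt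
  have hF : ∀ z ∈ Metric.sphere c (δ / 4), ‖F z‖ ≤ 2 / δ := by
    intro z hz
    have hz' := hsub (Metric.sphere_subset_closedBall hz)
    rw [norm_div, norm_neg]
    calc _ ≤ M / (δ * M / 2) := by
          gcongr
          · exact hd z hz'
          · exact norm_LFunction_ge hδ hd hχ hnb hz'
      _ = 2 / δ := by field_simp
  have hit := Complex.norm_iteratedDeriv_le_of_forall_mem_sphere_norm_le m (by positivity) hdc hF
  have hc : (1 : ℝ) < 1 + σ := by linarith
  have h1 := LSeries_iteratedDeriv m (abscissaOfAbsConv_twist_vonMangoldt_lt χ hc)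
  have heq : LSeries (fun n => χ n * (Λ n : ℂ)) =ᶠ[nhds c] F := by
    have hopen : IsOpen {z : ℂ | 1 < z.re} := isOpen_lt continuous_const Complex.continuous_re
    filter_upwards [hopen.mem_nhds (show c ∈ {z : ℂ | 1 < z.re} by simpa [c] using hσ0)] with z hz
    have := DirichletCharacter.LSeries_twist_vonMangoldt_eq χ hz
    simp only [F]
    rw [DirichletCharacter.deriv_LFunction_eq_deriv_LSeries χ hz,
      DirichletCharacter.LFunction_eq_LSeries χ hz]
    exact this
  rw [heq.iteratedDeriv_eq m] at h1
  rw [h1, norm_mul, norm_pow, norm_neg, norm_one, one_pow, one_mul] at hit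
  exact hit

theorem norm_tsum_vonMangoldt_log_sub_pow_le (hδ : 0 < δ) (hM : 0 < M)
    (hd : ∀ z ∈ Metric.closedBall (1 + δ : ℂ) (3 / 2 * δ),
      ‖deriv (DirichletCharacter.LFunction χ) z‖ ≤ M) (hχ : χ ≠ 1)
    (hnb : 2 * δ * M ≤ ‖DirichletCharacter.LFunction χ (1 + δ)‖) (hσ0 : 0 < σ) (hσ : σ ≤ δ)
    (j : ℕ) {w : ℝ} (hw : |w| ≤ 1) :
    Summable (fun n : ℕ => (χ n * (Λ n : ℂ)) *
      (((n : ℝ) ^ (-(1 + σ)) * (Real.log n - w) ^ j : ℝ) : ℂ)) ∧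
    ‖∑' n : ℕ, (χ n * (Λ n : ℂ)) * (((n : ℝ) ^ (-(1 + σ)) * (Real.log n - w) ^ j : ℝ) : ℂ)‖
      ≤ j.factorial * (4 / δ) ^ j * Real.exp (δ / 4) * (2 / δ) := by
  have hc : (1 : ℝ) < 1 + σ := by linarith
  have hs : ∀ m, HasSum (fun n : ℕ =>
      (χ n * (Λ n : ℂ)) * (((n : ℝ) ^ (-(1 + σ)) * Real.log n ^ m : ℝ) : ℂ))
      (LSeries (LSeries.logMul^[m] fun n => χ n * (Λ n : ℂ)) ((1 + σ : ℝ) : ℂ)) := by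
    intro m
    have h := (LSeriesSummable_of_abscissaOfAbsConv_lt_re
      (LSeries.absicssaOfAbsConv_logPowMul (m := m).symm ▸
        abscissaOfAbsConv_twist_vonMangoldt_lt χ hc)).LSeriesHasSum
    rw [LSeriesHasSum] at h
    exact h.congr_fun fun n => (term_logMul_iterate χ m (1 + σ) n).symm
  have hsum := hasSum_sum (s := range (j + 1)) fun m _ =>
    (hs m).mul_right (((-w) ^ (j - m) * (j.choose m : ℝ) : ℝ) : ℂ)
  have hfun : (fun n : ℕ => ∑ m ∈ range (j + 1),
      (χ n * (Λ n : ℂ)) * (((n : ℝ) ^ (-(1 + σ)) * Real.log n ^ m : ℝ) : ℂ) *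
        (((-w) ^ (j - m) * (j.choose m : ℝ) : ℝ) : ℂ)) = fun n : ℕ => (χ n * (Λ n : ℂ)) *
      (((n : ℝ) ^ (-(1 + σ)) * (Real.log n - w) ^ j : ℝ) : ℂ) := by
    funext n
    rw [sub_eq_add_neg, add_pow, mul_sum]
    push_cast
    rw [mul_sum]
    refine sum_congr rfl fun m _ => ?_
    ring
  rw [hfun] at hsum
  refine ⟨hsum.summable, ?_⟩
  rw [hsum.tsum_eq]
  have hr : 0 < δ / 4 := by positivity
  calc _ ≤ ∑ m ∈ range (j + 1), m.factorial * (2 / δ) / (δ / 4) ^ m * (j.choose m : ℝ) := by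
        refine norm_sum_le_of_le _ fun m _ => ?_
        rw [norm_mul, Complex.norm_real, Real.norm_eq_abs, abs_mul, abs_pow, abs_neg,
          Nat.abs_cast]
        gcongr
        · exact norm_LSeries_logMul_le hδ hM hd hχ hnb hσ0 hσ m
        · exact mul_le_of_le_one_left (Nat.cast_nonneg _) (pow_le_one₀ (abs_nonneg _) hw)
    _ = j.factorial * (4 / δ) ^ j * (2 / δ) *
          ∑ m ∈ range (j + 1), (δ / 4) ^ (j - m) / (j - m).factorial := by
        rw [mul_sum]
        refine sum_congr rfl fun m hm => ?_
        have hm' : m ≤ j := by rw [mem_range] at hm; omega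
        have h4 : (4 / δ) ^ j = 1 / ((δ / 4) ^ m * (δ / 4) ^ (j - m)) := by
          rw [← pow_add, Nat.add_sub_cancel' hm', ← one_div_pow]
          congr 1
          field_simp
        rw [h4, Nat.cast_choose ℝ hm']
        have h5 : (m.factorial : ℝ) ≠ 0 := by positivity
        field_simp
    _ ≤ j.factorial * (4 / δ) ^ j * (2 / δ) * Real.exp (δ / 4) := by
        gcongr
        rw [← Finset.sum_range_reflect]
        refine le_trans (le_of_eq ?_) (Real.sum_le_exp_of_nonneg hr.le (j + 1))
        refine sum_congr rfl fun m hm => ?_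
        have hm' : m ≤ j := by rw [mem_range] at hm; omega
        rw [show j - (j + 1 - 1 - m) = m by omega]
    _ = _ := by ring

end logDeriv

/-- A bound for `L(s, χ)` and its derivative near `s = 1`, uniform over moduli `q ≤ L ^ (2 * B)`. -/
noncomputable def derivBound (B : ℕ) (L : ℝ) : ℝ :=
  8 / (1 / (48 * B)) * lConst (1 / (48 * B)) * L ^ (1 / 24 : ℝ)

theorem derivBound_pos {B : ℕ} (hB : 0 < B) {L : ℝ} (hL : 0 < L) : 0 < derivBound B L := by
  have hη : (0 : ℝ) < 1 / (48 * B) := by positivity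
  have := four_le_lConst hη
  unfold derivBound
  positivity

theorem rpow_le_of_le_pow {B q : ℕ} (hB : 0 < B) {L : ℝ} (hL : 1 ≤ L) (hq : (q : ℝ) ≤ L ^ (2 * B)) :
    (q : ℝ) ^ (1 / (48 * B) : ℝ) ≤ L ^ (1 / 24 : ℝ) := by
  have hB' : (B : ℝ) ≠ 0 := by positivity
  calc (q : ℝ) ^ (1 / (48 * B) : ℝ) ≤ (L ^ (2 * B)) ^ (1 / (48 * B) : ℝ) := by gcongr
    _ = L ^ (1 / 24 : ℝ) := by
      rw [← Real.rpow_natCast, ← Real.rpow_mul (by linarith)]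
      congr 1
      push_cast
      field_simp
      norm_num

theorem norm_deriv_LFunction_le_derivBound {B q : ℕ} [NeZero q] (hB : 0 < B) {L : ℝ} (hL : 1 ≤ L)
    (hq : (q : ℝ) ≤ L ^ (2 * B)) {χ : DirichletCharacter ℂ q} (hχ : χ ≠ 1) {z : ℂ}
    (hz : z ∈ Metric.ball (1 : ℂ) (1 / (48 * B) / 4)) :
    ‖deriv (DirichletCharacter.LFunction χ) z‖ ≤ derivBound B L := by
  have hη : (0 : ℝ) < 1 / (48 * B) := by positivity
  have hη1 : (1 : ℝ) / (48 * B) ≤ 1 := by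
    rw [div_le_one (by positivity)]
    have : (1 : ℝ) ≤ B := by exact_mod_cast hB
    linarith
  have := four_le_lConst hη
  refine (norm_deriv_LFunction_le hχ hη hη1 hz).trans ?_
  unfold derivBound
  gcongr
  exact rpow_le_of_le_pow hB hL hq

theorem norm_LFunction_le_derivBound {B q : ℕ} [NeZero q] (hB : 0 < B) {L : ℝ} (hL : 1 ≤ L)
    (hq : (q : ℝ) ≤ L ^ (2 * B)) {χ : DirichletCharacter ℂ q} (hχ : χ ≠ 1) {z : ℂ}
    (hz : z ∈ Metric.ball (1 : ℂ) (1 / (48 * B) / 2)) :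
    ‖DirichletCharacter.LFunction χ z‖ ≤ derivBound B L := by
  have hη : (0 : ℝ) < 1 / (48 * B) := by positivity
  have hη1 : (1 : ℝ) / (48 * B) ≤ 1 := by
    rw [div_le_one (by positivity)]
    have : (1 : ℝ) ≤ B := by exact_mod_cast hB
    linarith
  have h4 := four_le_lConst hη
  refine (norm_LFunction_le hχ hη hη1 hz).trans ?_
  unfold derivBound
  have h8 : (1 : ℝ) ≤ 8 / (1 / (48 * B)) := by
    rw [le_div_iff₀ hη]
    linarith
  gcongr
  · nlinarith
  · exact rpow_le_of_le_pow hB hL hq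

theorem tendsto_inv_sqrt : Tendsto (fun L : ℝ => 1 / √L) atTop (nhds 0) := by
  simp_rw [one_div]
  exact Real.tendsto_sqrt_atTop.inv_tendsto_atTop

theorem tendsto_derivBound_pow_mul (B : ℕ) :
    Tendsto (fun L : ℝ => 1 / √L * derivBound B L ^ 6) atTop (nhds 0) := by
  have h : Tendsto (fun L : ℝ => (8 / (1 / (48 * B)) * lConst (1 / (48 * B))) ^ 6
      * L ^ (-(1 / 4) : ℝ)) atTop (nhds 0) := by
    simpa using (tendsto_rpow_neg_atTop (show (0 : ℝ) < 1 / 4 by norm_num)).const_mul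
      ((8 / (1 / (48 * (B : ℝ))) * lConst (1 / (48 * B))) ^ 6)
  refine h.congr' ?_
  filter_upwards [eventually_gt_atTop 0] with L hL
  have h1 : 1 / √L = L ^ (-(1 / 2) : ℝ) := by
    rw [Real.rpow_neg hL.le, Real.sqrt_eq_rpow, one_div]
  have h2 : (L ^ (1 / 24 : ℝ)) ^ 6 = L ^ (1 / 4 : ℝ) := by
    rw [← Real.rpow_natCast, ← Real.rpow_mul hL.le]
    norm_num
  have h3 : L ^ (-(1 / 4) : ℝ) = L ^ (-(1 / 2) : ℝ) * L ^ (1 / 4 : ℝ) := by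
    rw [← Real.rpow_add hL]
    norm_num
  rw [derivBound, mul_pow _ (L ^ _), h2, h1, h3]
  ring

theorem tendsto_derivBound_mul (B : ℕ) :
    Tendsto (fun L : ℝ => 2 * (1 / √L) * derivBound B L) atTop (nhds 0) := by
  have h : Tendsto (fun L : ℝ => 2 * ((8 / (1 / (48 * B)) * lConst (1 / (48 * B)))
      * L ^ (-(11 / 24) : ℝ))) atTop (nhds 0) := by
    simpa using ((tendsto_rpow_neg_atTop (show (0 : ℝ) < 11 / 24 by norm_num)).const_mul
      (8 / (1 / (48 * (B : ℝ))) * lConst (1 / (48 * B)))).const_mul 2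
  refine h.congr' ?_
  filter_upwards [eventually_gt_atTop 0] with L hL
  have h1 : 1 / √L = L ^ (-(1 / 2) : ℝ) := by
    rw [Real.rpow_neg hL.le, Real.sqrt_eq_rpow, one_div]
  have h3 : L ^ (-(11 / 24) : ℝ) = L ^ (-(1 / 2) : ℝ) * L ^ (1 / 24 : ℝ) := by
    rw [← Real.rpow_add hL]
    norm_num
  rw [derivBound, h1, h3]
  ring

theorem eventually_norm_zeta_le :
    ∀ᶠ L : ℝ in atTop, ‖riemannZeta (((1 + 1 / √L : ℝ)) : ℂ)‖ ≤ 2 * √L := by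
  have hd : Tendsto (fun L : ℝ => ((1 + 1 / √L : ℝ) : ℂ)) atTop (nhdsWithin 1 {1}ᶜ) := by
    refine tendsto_nhdsWithin_iff.2 ⟨?_, ?_⟩
    · have h := (tendsto_inv_sqrt.const_add 1)
      rw [add_zero] at h
      have h2 := (Complex.continuous_ofReal.tendsto (1 : ℝ)).comp h
      rwa [Complex.ofReal_one] at h2
    · filter_upwards [eventually_gt_atTop 0] with L hL
      have : 0 < 1 / √L := by positivity
      simp only [Set.mem_compl_iff, Set.mem_singleton_iff]
      intro h
      have : (1 + 1 / √L : ℝ) = 1 := by exact_mod_cast h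
      linarith
  have h := (riemannZeta_residue_one.comp hd).norm
  rw [norm_one] at h
  filter_upwards [h.eventually (gt_mem_nhds (show (1 : ℝ) < 2 by norm_num)),
    eventually_gt_atTop 0] with L h1 hL
  have hs : 0 < √L := Real.sqrt_pos.2 hL
  simp only [Function.comp, norm_mul] at h1
  have h2 : ‖((1 + 1 / √L : ℝ) : ℂ) - 1‖ = 1 / √L := by
    push_cast
    rw [add_sub_cancel_left, ← Complex.ofReal_one, ← Complex.ofReal_div, Complex.norm_real,
      Real.norm_of_nonneg (by positivity)]
  rw [h2, one_div_mul_eq_div, div_lt_iff₀ hs] at h1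
  linarith

/-- At most one primitive character of small conductor has a small value `L(1 + δ, χ)`. -/
theorem eventually_exceptional_unique {B : ℕ} (hB : 0 < B) :
    ∀ᶠ L : ℝ in atTop, ∀ x y : Σ f : ℕ, DirichletCharacter ℂ f,
      1 < x.1 → 1 < y.1 → (x.1 : ℝ) ≤ L ^ B → (y.1 : ℝ) ≤ L ^ B → x.2.IsPrimitive →
      y.2.IsPrimitive →
      ‖LSeries (fun n => x.2 n) (1 + 1 / √L : ℝ)‖ ≤ 2 * (1 / √L) * derivBound B L →
      ‖LSeries (fun n => y.2 n) (1 + 1 / √L : ℝ)‖ ≤ 2 * (1 / √L) * derivBound B L → x = y := by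
  have hη : (0 : ℝ) < 1 / (48 * B) / 2 := by positivity
  filter_upwards [eventually_ge_atTop 1, eventually_norm_zeta_le,
    tendsto_inv_sqrt.eventually (gt_mem_nhds hη),
    (tendsto_derivBound_pow_mul B).eventually
      (gt_mem_nhds (show (0 : ℝ) < 1 / 128 by norm_num))]
    with L hL hz hδ hM x y hx hy hxB hyB hxp hyp hxe hye
  by_contra hne
  have : NeZero x.1 := ⟨by omega⟩
  have : NeZero y.1 := ⟨by omega⟩
  have hs : 0 < √L := Real.sqrt_pos.2 (by linarith)
  have hδ0 : 0 < 1 / √L := by positivity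
  obtain ⟨ψ, hψ1, hψ⟩ := exists_ne_one_mul_conj hxp hyp (by omega) (by omega) hne
  have hp := one_le_norm_LSeries_product x.2 y.2 ψ hψ (s := 1 + 1 / √L) (by linarith)
  have hMp := derivBound_pos hB (show 0 < L by linarith)
  have hψM : ‖LSeries (fun n => ψ n) (1 + 1 / √L : ℝ)‖ ≤ derivBound B L := by
    have hre : 1 < (((1 + 1 / √L : ℝ)) : ℂ).re := by
      rw [Complex.ofReal_re]
      linarith
    rw [← DirichletCharacter.LFunction_eq_LSeries ψ hre]
    refine norm_LFunction_le_derivBound hB hL ?_ hψ1 ?_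
    · push_cast
      calc (x.1 : ℝ) * y.1 ≤ L ^ B * L ^ B := by gcongr
        _ = L ^ (2 * B) := by ring
    · rw [mem_ball_iff_norm, ← Complex.ofReal_one, ← Complex.ofReal_sub, Complex.norm_real,
        Real.norm_of_nonneg (by linarith)]
      linarith
  have hfin : (1 : ℝ) ≤ (2 * √L) ^ 3 * (2 * (1 / √L) * derivBound B L) ^ 2
      * (2 * (1 / √L) * derivBound B L) ^ 2 * derivBound B L ^ 2 :=
    hp.trans (by gcongr)
  have heq : (2 * √L) ^ 3 * (2 * (1 / √L) * derivBound B L) ^ 2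
      * (2 * (1 / √L) * derivBound B L) ^ 2 * derivBound B L ^ 2
      = 128 * (1 / √L * derivBound B L ^ 6) := by
    field_simp
    ring
  linarith

theorem eventually_not_exceptional {q : ℕ} [NeZero q] (B : ℕ) {χ : DirichletCharacter ℂ q}
    (hχ : χ ≠ 1) : ∀ᶠ L : ℝ in atTop,
    2 * (1 / √L) * derivBound B L < ‖LSeries (fun n => χ n) (1 + 1 / √L : ℝ)‖ := by
  have h := (tendsto_inv_sqrt.const_add 1)
  rw [add_zero] at h
  have h2 : Tendsto (fun L : ℝ => ‖DirichletCharacter.LFunction χ ((1 + 1 / √L : ℝ) : ℂ)‖) atTop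
      (nhds ‖DirichletCharacter.LFunction χ ((1 : ℝ) : ℂ)‖) :=
    ((((DirichletCharacter.differentiable_LFunction hχ).continuous.comp
      Complex.continuous_ofReal).tendsto 1).comp h).norm
  have h3 : 0 < ‖DirichletCharacter.LFunction χ ((1 : ℝ) : ℂ)‖ := by
    rw [Complex.ofReal_one]
    exact norm_pos_iff.2 (DirichletCharacter.LFunction_apply_one_ne_zero hχ)
  filter_upwards [(tendsto_derivBound_mul B).eventually_lt h2 h3, eventually_gt_atTop 0]
      with L hL h0
  have hre : 1 < (((1 + 1 / √L : ℝ)) : ℂ).re := by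
    have : 0 < 1 / √L := by positivity
    rw [Complex.ofReal_re]
    linarith
  rwa [DirichletCharacter.LFunction_eq_LSeries _ hre] at hL

theorem exists_prime_dvd_of_squarefree {f W : ℕ} (hf : Squarefree f) (h : ¬f ∣ W) :
    ∃ ℓ, ℓ.Prime ∧ ℓ ∣ f ∧ ¬ℓ ∣ W := by
  by_contra! hc
  refine h ?_
  rw [← Nat.prod_primeFactors_of_squarefree hf]
  exact Finset.prod_primes_dvd _ (fun p hp => (Nat.prime_of_mem_primeFactors hp).prime)
    fun p hp => hc p (Nat.prime_of_mem_primeFactors hp) (Nat.dvd_of_mem_primeFactors hp)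

/-- Discarding the multiples of one prime, all primitive characters of small squarefree conductor
satisfy strong bounds for the high derivatives of their logarithmic derivatives. -/
theorem eventually_exists_prime_norm_tsum_le {B W : ℕ} (hB : 0 < B) (hW : 0 < W) :
    ∀ᶠ L : ℝ in atTop, ∃ ℓ : ℕ, ℓ.Prime ∧ ¬ℓ ∣ W ∧ ∀ x : Σ f : ℕ, DirichletCharacter ℂ f,
      1 < x.1 → (x.1 : ℝ) ≤ L ^ B → x.2.IsPrimitive → Squarefree x.1 → ¬ℓ ∣ x.1 →
      ∀ (σ w : ℝ) (j : ℕ), 0 < σ → σ ≤ 1 / √L → |w| ≤ 1 →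
      Summable (fun n : ℕ => (x.2 n * (Λ n : ℂ)) *
        (((n : ℝ) ^ (-(1 + σ)) * (Real.log n - w) ^ j : ℝ) : ℂ)) ∧
      ‖∑' n : ℕ, (x.2 n * (Λ n : ℂ)) *
        (((n : ℝ) ^ (-(1 + σ)) * (Real.log n - w) ^ j : ℝ) : ℂ)‖
        ≤ j.factorial * (4 * √L) ^ j * (4 * √L) := by
  have hη : (0 : ℝ) < 1 / (48 * B) / 4 / 3 := by positivity
  have hsmall : ∀ᶠ L : ℝ in atTop, ∀ x ∈ primitiveSet W, 2 * (1 / √L) * derivBound B L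
      < ‖LSeries (fun n => x.2 n) (1 + 1 / √L : ℝ)‖ := by
    refine (eventually_all_finite (finite_primitiveSet W)).2 fun x hx => ?_
    have : NeZero x.1 := ⟨by have := hx.1; omega⟩
    exact eventually_not_exceptional B (ne_one_of_isPrimitive hx.1 hx.2.2)
  filter_upwards [eventually_ge_atTop 1, hsmall, eventually_exceptional_unique hB,
    tendsto_inv_sqrt.eventually (gt_mem_nhds hη)] with L hL hWs huniq hδ
  have hs : 0 < √L := Real.sqrt_pos.2 (by linarith)
  have hδ0 : 0 < 1 / √L := by positivity
  have hs1 : 1 ≤ √L := Real.one_le_sqrt.2 hL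
  have hMp := derivBound_pos hB (show 0 < L by linarith)
  have key : ∀ x : Σ f : ℕ, DirichletCharacter ℂ f, 1 < x.1 → (x.1 : ℝ) ≤ L ^ B →
      x.2.IsPrimitive → 2 * (1 / √L) * derivBound B L
      ≤ ‖LSeries (fun n => x.2 n) (1 + 1 / √L : ℝ)‖ →
      ∀ (σ w : ℝ) (j : ℕ), 0 < σ → σ ≤ 1 / √L → |w| ≤ 1 →
      Summable (fun n : ℕ => (x.2 n * (Λ n : ℂ)) *
        (((n : ℝ) ^ (-(1 + σ)) * (Real.log n - w) ^ j : ℝ) : ℂ)) ∧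
      ‖∑' n : ℕ, (x.2 n * (Λ n : ℂ)) *
        (((n : ℝ) ^ (-(1 + σ)) * (Real.log n - w) ^ j : ℝ) : ℂ)‖
        ≤ j.factorial * (4 * √L) ^ j * (4 * √L) := by
    intro x hx hxB hp hnb σ w j hσ0 hσ hw
    have : NeZero x.1 := ⟨by omega⟩
    have hχ := ne_one_of_isPrimitive hx hp
    have hre : 1 < (((1 + 1 / √L : ℝ)) : ℂ).re := by
      rw [Complex.ofReal_re]
      linarith
    rw [← DirichletCharacter.LFunction_eq_LSeries _ hre] at hnb
    push_cast at hnb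
    obtain ⟨h1, h2⟩ := norm_tsum_vonMangoldt_log_sub_pow_le hδ0 hMp (χ := x.2) (fun z hz => by
      refine norm_deriv_LFunction_le_derivBound hB hL (hxB.trans ?_) hχ ?_
      · exact pow_le_pow_right₀ hL (by omega)
      · rw [mem_ball_iff_norm]
        rw [mem_closedBall_iff_norm] at hz
        have h3 : z - 1 = (z - (1 + ((1 / √L : ℝ) : ℂ))) + ((1 / √L : ℝ) : ℂ) := by ring
        rw [h3]
        refine (norm_add_le _ _).trans_lt ?_
        rw [Complex.norm_real, Real.norm_of_nonneg hδ0.le]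
        linarith) hχ (by push_cast; exact hnb) hσ0 hσ j hw
    refine ⟨h1, h2.trans ?_⟩
    have he : Real.exp (1 / √L / 4) ≤ 2 := by
      have h4 : 1 / √L ≤ 1 := by rw [div_le_one hs]; exact hs1
      calc Real.exp (1 / √L / 4) ≤ Real.exp (Real.log 2) := by
            gcongr
            have := Real.log_two_gt_d9
            linarith
        _ = 2 := Real.exp_log (by norm_num)
    have h5 : (4 : ℝ) / (1 / √L) = 4 * √L := by field_simp
    have h6 : (2 : ℝ) / (1 / √L) = 2 * √L := by field_simp
    rw [h5, h6]
    calc j.factorial * (4 * √L) ^ j * Real.exp (1 / √L / 4) * (2 * √L)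
        ≤ j.factorial * (4 * √L) ^ j * 2 * (2 * √L) := by gcongr
      _ = _ := by ring
  by_cases hex : ∃ x : Σ f : ℕ, DirichletCharacter ℂ f, 1 < x.1 ∧ (x.1 : ℝ) ≤ L ^ B ∧
      x.2.IsPrimitive ∧ Squarefree x.1 ∧
      ‖LSeries (fun n => x.2 n) (1 + 1 / √L : ℝ)‖
        < 2 * (1 / √L) * derivBound B L
  · obtain ⟨x, hx1, hxB, hxp, hxs, hxe⟩ := hex
    have hnd : ¬x.1 ∣ W := fun hd =>
      absurd (hWs x ⟨hx1, Nat.le_of_dvd hW hd, hxp⟩) (not_lt.2 hxe.le)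
    obtain ⟨ℓ, hℓ, hℓx, hℓW⟩ := exists_prime_dvd_of_squarefree hxs hnd
    refine ⟨ℓ, hℓ, hℓW, fun y hy1 hyB hyp hys hyℓ => key y hy1 hyB hyp ?_⟩
    by_contra! hye
    exact hyℓ (huniq x y hx1 hy1 hxB hyB hxp hyp hxe.le hye.le ▸ hℓx)
  · push Not at hex
    obtain ⟨ℓ, hℓ1, hℓ⟩ := Nat.exists_infinite_primes (W + 1)
    refine ⟨ℓ, hℓ, fun h => absurd (Nat.le_of_dvd hW h) (by omega),
      fun y hy1 hyB hyp hys _ => key y hy1 hyB hyp (hex y hy1 hyB hyp hys)⟩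

theorem card_filter_lt_le (N : ℕ) {x : ℝ} (hx : 0 ≤ x) :
    (#((range N).filter fun n : ℕ => 1 ≤ n ∧ (n : ℝ) < x) : ℝ) ≤ x := by
  have h : ((range N).filter fun n : ℕ => 1 ≤ n ∧ (n : ℝ) < x) ⊆ Ioc 0 ⌊x⌋₊ := by
    intro n hn
    obtain ⟨_, h1, h2⟩ := mem_filter.1 hn
    exact mem_Ioc.2 ⟨h1, Nat.le_floor h2.le⟩
  calc (#((range N).filter fun n : ℕ => 1 ≤ n ∧ (n : ℝ) < x) : ℝ) ≤ (#(Ioc 0 ⌊x⌋₊) : ℝ) := by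
        exact_mod_cast card_le_card h
    _ ≤ x := by simpa using Nat.floor_le hx

theorem logTri_le_exp (v : ℝ) (n : ℕ) : logTri v n ≤ Real.exp (1 - v) := by
  rcases le_or_gt (n : ℝ) (Real.exp (v - 1)) with h | h
  · rw [logTri_eq_zero_of_le n.cast_nonneg h]
    positivity
  · refine (logTri_le v n.cast_nonneg).trans ?_
    rw [show 1 - v = -(v - 1) by ring, Real.exp_neg, ← one_div]
    gcongr

theorem sum_mul_logTri_le {c : ℕ → ℝ} (hc : ∀ n, 0 ≤ c n) (v : ℝ) (N : ℕ) :
    ∑ n ∈ range N, c n * logTri v n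
      ≤ Real.exp (1 - v) * ∑ n ∈ (range N).filter fun n : ℕ => 1 ≤ n ∧ (n : ℝ) < Real.exp
          (v + 1), c n := by
  rw [mul_sum, sum_filter]
  refine sum_le_sum fun n _ => ?_
  split_ifs with h
  · rw [mul_comm]
    exact mul_le_mul_of_nonneg_right (logTri_le_exp v n) (hc n)
  · rw [not_and_or, not_lt] at h
    rcases h with h | h
    · rw [show n = 0 by omega]
      simp [logTri]
    · rw [logTri_eq_zero_of_ge h, mul_zero]

theorem sum_logTri_le (v : ℝ) (N : ℕ) : ∑ n ∈ range N, logTri v n ≤ 8 := by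
  have h := sum_mul_logTri_le (c := fun _ => 1) (fun _ => zero_le_one) v N
  simp only [one_mul, sum_const, nsmul_eq_mul, mul_one] at h
  refine h.trans ?_
  calc _ ≤ Real.exp (1 - v) * Real.exp (v + 1) := by
        gcongr
        exact card_filter_lt_le N (Real.exp_pos _).le
    _ = Real.exp 1 ^ 2 := by
        rw [← Real.exp_add, ← Real.exp_nat_mul]
        congr 1
        push_cast
        ring
    _ ≤ 8 := by
        have := Real.exp_one_lt_d9
        have := Real.exp_one_gt_d9
        nlinarith

theorem eventually_theta_ge : ∀ᶠ x : ℝ in atTop, 69 / 100 * x ≤ Chebyshev.theta x := by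
  have h := (isLittleO_log_rpow_atTop (show (0 : ℝ) < 1 / 2 by norm_num)).def
    (show (0 : ℝ) < 1 / 4000 by norm_num)
  filter_upwards [h, eventually_ge_atTop 10000] with x hx h1
  have hx0 : 0 ≤ x := by linarith
  rw [← Real.sqrt_eq_rpow, Real.norm_of_nonneg (Real.log_nonneg (by linarith)),
    Real.norm_of_nonneg (Real.sqrt_nonneg x)] at hx
  have h2 := Chebyshev.theta_ge' (x := x) (by linarith)
  have h3 : Real.log (x + 2) ≤ 2 * Real.log x := by
    rw [← Real.log_rpow (by linarith)]
    gcongr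
    norm_num
    nlinarith
  have h4 := Real.mul_self_sqrt hx0
  have h5 : √x ≤ x := by
    rw [Real.sqrt_le_left hx0]
    nlinarith
  have h6 : √x * Real.log x ≤ 1 / 4000 * x := by
    calc √x * Real.log x ≤ √x * (1 / 4000 * √x) := by gcongr
      _ = 1 / 4000 * x := by rw [← h4]; ring_nf; rw [Real.sqrt_sq (by positivity)]
  have := Real.log_two_gt_d9
  have := Real.log_two_lt_d9
  nlinarith

theorem sum_log_prime_Ioc (N : ℕ) {a b : ℝ} (ha : 0 ≤ a) (hab : a ≤ b) (hN : b < N) :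
    ∑ p ∈ N.primesBelow.filter fun p : ℕ => a < (p : ℝ) ∧ (p : ℝ) ≤ b, Real.log p
      = Chebyshev.theta b - Chebyshev.theta a := by
  have h : ∀ x : ℝ, 0 ≤ x → x < N → Chebyshev.theta x
      = ∑ p ∈ N.primesBelow.filter fun p : ℕ => (p : ℝ) ≤ x, Real.log p := by
    intro x hx hxN
    rw [Chebyshev.theta_eq_sum_Icc]
    refine sum_congr ?_ fun _ _ => rfl
    ext p
    simp only [mem_filter, mem_Icc, Nat.mem_primesBelow, zero_le, true_and]
    rw [Nat.le_floor_iff hx]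
    refine ⟨fun h => ⟨⟨?_, h.2⟩, h.1⟩, fun h => ⟨h.2, h.1.2⟩⟩
    exact_mod_cast h.1.trans_lt hxN
  rw [h a ha (hab.trans_lt hN), h b (ha.trans hab) hN, eq_sub_iff_add_eq, add_comm,
    ← sum_filter_add_sum_filter_not (N.primesBelow.filter fun p : ℕ => (p : ℝ) ≤ b)
      (fun p : ℕ => (p : ℝ) ≤ a), filter_filter, filter_filter]
  congr 1
  · refine sum_congr (filter_congr fun p _ => ?_) fun _ _ => rfl
    exact ⟨fun h => ⟨h.trans hab, h⟩, fun h => h.2⟩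
  · refine sum_congr (filter_congr fun p _ => ?_) fun _ _ => rfl
    rw [not_le, and_comm]

theorem eventually_sum_log_mul_logTri_ge : ∀ᶠ v : ℝ in atTop, ∀ N : ℕ, Real.exp (v + 1) ≤ N →
    1 / 20 ≤ ∑ p ∈ N.primesBelow, Real.log p * logTri v p := by
  have ht : Tendsto (fun v : ℝ => Real.exp (v + 1 / 2)) atTop atTop :=
    Real.tendsto_exp_atTop.comp (tendsto_atTop_add_const_right _ _ tendsto_id)
  filter_upwards [ht.eventually eventually_theta_ge, eventually_ge_atTop 1] with v hv hv1 N hN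
  have h1 := sum_log_prime_Ioc N (a := Real.exp (v - 1 / 2)) (b := Real.exp (v + 1 / 2))
    (Real.exp_pos _).le (Real.exp_le_exp.2 (by linarith))
    ((Real.exp_lt_exp.2 (by linarith)).trans_le hN)
  have h2 : 1 / 2 * Real.exp (-(v + 1 / 2))
      * ∑ p ∈ N.primesBelow.filter fun p : ℕ => Real.exp (v - 1 / 2) < (p : ℝ) ∧ (p : ℝ) ≤ Real.exp
          (v + 1 / 2),
        Real.log p ≤ ∑ p ∈ N.primesBelow, Real.log p * logTri v p := by
    rw [mul_sum]
    refine (sum_le_sum fun p hp => ?_).trans (sum_le_sum_of_subset_of_nonneg (filter_subset _ _)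
      fun p _ _ => mul_nonneg (Real.log_natCast_nonneg p) (logTri_nonneg v p.cast_nonneg))
    obtain ⟨hpN, hp1, hp2⟩ := mem_filter.1 hp
    have hp0 : (0 : ℝ) < p := (Real.exp_pos _).trans hp1
    have hl1 : v - 1 / 2 ≤ Real.log p := (Real.le_log_iff_exp_le hp0).2 hp1.le
    have hl2 : Real.log p ≤ v + 1 / 2 := (Real.log_le_iff_le_exp hp0).2 hp2
    rw [mul_comm]
    refine mul_le_mul_of_nonneg_left ?_ (by linarith)
    rw [logTri, Real.exp_neg, ← div_eq_mul_inv]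
    refine div_le_div₀ (tri_nonneg _) ?_ hp0 hp2
    refine le_max_of_le_right ?_
    have : |Real.log p - v| ≤ 1 / 2 := abs_le.2 ⟨by linarith, by linarith⟩
    linarith
  refine le_trans ?_ h2
  rw [h1]
  have h3 := Chebyshev.theta_le_log4_mul_x (Real.exp_pos (v - 1 / 2)).le
  have h4 : Real.exp (v + 1 / 2) = Real.exp 1 * Real.exp (v - 1 / 2) := by
    rw [← Real.exp_add]
    ring_nf
  have h5 : Real.log 4 = 2 * Real.log 2 := by
    rw [show (4 : ℝ) = 2 ^ 2 by norm_num, Real.log_pow]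
    norm_num
  have h6 := Real.log_two_lt_d9
  have he := Real.exp_one_gt_d9
  have he2 := Real.exp_one_lt_d9
  have hz := Real.exp_pos (v - 1 / 2)
  have h7 : 45 / 100 * Real.exp (v - 1 / 2) ≤ Chebyshev.theta (Real.exp (v + 1 / 2))
      - Chebyshev.theta (Real.exp (v - 1 / 2)) := by
    rw [h4] at hv
    rw [h4]
    nlinarith
  calc (1 : ℝ) / 20 ≤ 1 / 2 * (45 / 100) * Real.exp (-1) := by
        rw [Real.exp_neg, ← div_eq_mul_inv, le_div_iff₀ (by positivity)]
        linarith
    _ = 1 / 2 * Real.exp (-(v + 1 / 2)) * (45 / 100 * Real.exp (v - 1 / 2)) := by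
        have : Real.exp (-1) = Real.exp (-(v + 1 / 2)) * Real.exp (v - 1 / 2) := by
          rw [← Real.exp_add]
          ring_nf
        rw [this]
        ring
    _ ≤ _ := by gcongr

theorem sum_primesBelow_mul_eq (N : ℕ) (f : ℕ → ℂ) :
    ∑ p ∈ N.primesBelow, (Real.log p : ℂ) * f p
      = ∑ n ∈ range N, (Λ n : ℂ) * f n
        - ∑ n ∈ range N, ((Λ n - if n.Prime then Real.log n else 0 : ℝ) : ℂ) * f n := by
  rw [← sum_sub_distrib, Nat.primesBelow, sum_filter]
  refine sum_congr rfl fun n _ => ?_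
  split_ifs
  · push_cast
    ring
  · push_cast
    ring

theorem vonMangoldt_sub_log_nonneg (n : ℕ) :
    0 ≤ Λ n - if n.Prime then Real.log n else 0 := by
  split_ifs with h
  · rw [vonMangoldt_apply_prime h, sub_self]
  · simp

/-- The contribution of proper prime powers. -/
theorem sum_vonMangoldt_sub_log_mul_logTri_le {v : ℝ} (hv : 0 ≤ v) (N : ℕ) :
    ∑ n ∈ range N, (Λ n - if n.Prime then Real.log n else 0) * logTri v n
      ≤ 16 * (v + 1) * Real.exp (-v / 2) := by
  refine (sum_mul_logTri_le vonMangoldt_sub_log_nonneg v N).trans ?_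
  have h1 : ∑ n ∈ (range N).filter fun n : ℕ => 1 ≤ n ∧ (n : ℝ) < Real.exp (v + 1),
      (Λ n - if n.Prime then Real.log n else 0)
      ≤ Chebyshev.psi (Real.exp (v + 1)) - Chebyshev.theta (Real.exp (v + 1)) := by
    rw [Chebyshev.psi_eq_sum_Icc, Chebyshev.theta_eq_sum_Icc, sum_filter
        (s := Icc _ _), ← sum_sub_distrib]
    refine sum_le_sum_of_subset_of_nonneg (fun n hn => ?_)
      fun n _ _ => vonMangoldt_sub_log_nonneg n
    exact mem_Icc.2 ⟨Nat.zero_le _, Nat.le_floor (mem_filter.1 hn).2.2.le⟩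
  have h2 := Chebyshev.psi_sub_theta_le (x := Real.exp (v + 1))
    (Real.one_le_exp (by linarith))
  rw [Real.log_exp, Real.sqrt_eq_rpow, ← Real.exp_mul] at h2
  calc _ ≤ Real.exp (1 - v) * (2 * Real.exp ((v + 1) * (1 / 2)) * (v + 1)) := by
        gcongr
        exact h1.trans h2
    _ = 2 * (v + 1) * (Real.exp (3 / 2) * Real.exp (-v / 2)) := by
        rw [← Real.exp_add, show 3 / 2 + -v / 2 = (1 - v) + (v + 1) * (1 / 2) by ring, Real.exp_add]
        ring
    _ ≤ 2 * (v + 1) * (8 * Real.exp (-v / 2)) := by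
        have h8 : Real.exp (3 / 2) ≤ 8 := by
          calc Real.exp (3 / 2) ≤ Real.exp (2 * 1) := by gcongr; norm_num
            _ = Real.exp 1 ^ 2 := by rw [← Real.exp_nat_mul]; norm_num
            _ ≤ 8 := by
              have := Real.exp_one_lt_d9
              have := Real.exp_one_gt_d9
              nlinarith
        gcongr
    _ = _ := by ring

/-- The average `∫ γ(v) logTri v n dv` over `[a, b]`. -/
noncomputable def avgWeight (γ : ℝ → ℝ) (a b : ℝ) (n : ℕ) : ℝ :=
  ∫ v in a..b, γ v * logTri v n

theorem continuous_logTri (x : ℝ) : Continuous fun v => logTri v x := by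
  unfold logTri
  have := continuous_tri
  fun_prop

section avgWeight
variable {γ : ℝ → ℝ} {a b : ℝ}

theorem avgWeight_nonneg (hγ0 : ∀ v ∈ Set.Icc a b, 0 ≤ γ v) (hab : a ≤ b) (n : ℕ) :
    0 ≤ avgWeight γ a b n :=
  intervalIntegral.integral_nonneg hab fun v hv =>
    mul_nonneg (hγ0 v hv) (logTri_nonneg v n.cast_nonneg)

theorem avgWeight_eq_zero_of_le (hab : a ≤ b) {n : ℕ} (hn : (n : ℝ) ≤ Real.exp (a - 1)) :
    avgWeight γ a b n = 0 := by
  rw [avgWeight, intervalIntegral.integral_congr (g := fun _ => 0), intervalIntegral.integral_zero]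
  intro v hv
  rw [Set.uIcc_of_le hab] at hv
  simp only
  rw [logTri_eq_zero_of_le n.cast_nonneg
    (hn.trans (Real.exp_le_exp.2 (by linarith [hv.1]))), mul_zero]

theorem avgWeight_eq_zero_of_ge (hab : a ≤ b) {n : ℕ} (hn : Real.exp (b + 1) ≤ n) :
    avgWeight γ a b n = 0 := by
  rw [avgWeight, intervalIntegral.integral_congr (g := fun _ => 0), intervalIntegral.integral_zero]
  intro v hv
  rw [Set.uIcc_of_le hab] at hv
  simp only
  rw [logTri_eq_zero_of_ge ((Real.exp_le_exp.2 (by linarith [hv.2])).trans hn), mul_zero]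

theorem sum_mul_avgWeight (hγ : Continuous γ) (s : Finset ℕ) (c : ℕ → ℝ) :
    ∑ n ∈ s, c n * avgWeight γ a b n = ∫ v in a..b, γ v * ∑ n ∈ s, c n * logTri v n := by
  simp_rw [avgWeight, ← intervalIntegral.integral_const_mul]
  rw [← intervalIntegral.integral_finsetSum]
  · congr 1
    ext v
    rw [mul_sum]
    exact sum_congr rfl fun n _ => by ring
  · intro n _
    have := continuous_logTri n
    exact Continuous.intervalIntegrable (by fun_prop) _ _

theorem sum_mul_avgWeight_le (hγ : Continuous γ) (hγ0 : ∀ v ∈ Set.Icc a b, 0 ≤ γ v) (hab : a ≤ b)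
    (s : Finset ℕ) (c : ℕ → ℝ) {K : ℝ} (h : ∀ v ∈ Set.Icc a b, ∑ n ∈ s, c n * logTri v n ≤ K) :
    ∑ n ∈ s, c n * avgWeight γ a b n ≤ K * ∫ v in a..b, γ v := by
  rw [sum_mul_avgWeight hγ, ← intervalIntegral.integral_const_mul]
  have hc : ∀ n : ℕ, Continuous fun v => logTri v n := fun n => continuous_logTri n
  refine intervalIntegral.integral_mono_on hab (Continuous.intervalIntegrable (by fun_prop) _ _)
    (Continuous.intervalIntegrable (by fun_prop) _ _) fun v hv => ?_
  rw [mul_comm K]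
  exact mul_le_mul_of_nonneg_left (h v hv) (hγ0 v hv)

theorem le_sum_mul_avgWeight (hγ : Continuous γ) (hγ0 : ∀ v ∈ Set.Icc a b, 0 ≤ γ v) (hab : a ≤ b)
    (s : Finset ℕ) (c : ℕ → ℝ) {K : ℝ} (h : ∀ v ∈ Set.Icc a b, K ≤ ∑ n ∈ s, c n * logTri v n) :
    K * ∫ v in a..b, γ v ≤ ∑ n ∈ s, c n * avgWeight γ a b n := by
  have := sum_mul_avgWeight_le hγ hγ0 hab s (fun n => -c n) (K := -K) fun v hv => by
    simpa [neg_mul, sum_neg_distrib] using h v hv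
  simp only [neg_mul, sum_neg_distrib] at this
  linarith

theorem norm_sum_mul_avgWeight_le (hγ : Continuous γ) (hγ0 : ∀ v ∈ Set.Icc a b, 0 ≤ γ v)
    (hab : a ≤ b) (s : Finset ℕ) (c : ℕ → ℂ) :
    ‖∑ n ∈ s, c n * (avgWeight γ a b n : ℂ)‖
      ≤ ∫ v in a..b, γ v * ‖∑ n ∈ s, c n * (logTri v n : ℂ)‖ := by
  have hc : ∀ n : ℕ, Continuous fun v => logTri v n := fun n => continuous_logTri n
  have heq : ∑ n ∈ s, c n * (avgWeight γ a b n : ℂ)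
      = ∫ v in a..b, (γ v : ℂ) * ∑ n ∈ s, c n * (logTri v n : ℂ) := by
    simp_rw [avgWeight, ← intervalIntegral.integral_ofReal, ← intervalIntegral.integral_const_mul]
    rw [← intervalIntegral.integral_finsetSum]
    · congr 1
      ext v
      rw [mul_sum]
      refine sum_congr rfl fun n _ => ?_
      push_cast
      ring
    · intro n _
      exact Continuous.intervalIntegrable (by fun_prop) _ _
  rw [heq]
  refine (intervalIntegral.norm_integral_le_integral_norm hab).trans (le_of_eq ?_)
  refine intervalIntegral.integral_congr fun v hv => ?_
  rw [Set.uIcc_of_le hab] at hv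
  simp only [norm_mul, Complex.norm_real]
  rw [Real.norm_of_nonneg (hγ0 v hv)]

theorem sum_norm_sum_mul_avgWeight_le (hγ : Continuous γ) (hγ0 : ∀ v ∈ Set.Icc a b, 0 ≤ γ v)
    (hab : a ≤ b) {ι : Type*} (t : Finset ι) (s : Finset ℕ) (c : ι → ℕ → ℂ) {K : ℝ}
    (h : ∀ v ∈ Set.Icc a b, ∑ x ∈ t, ‖∑ n ∈ s, c x n * (logTri v n : ℂ)‖ ≤ K) :
    ∑ x ∈ t, ‖∑ n ∈ s, c x n * (avgWeight γ a b n : ℂ)‖ ≤ K * ∫ v in a..b, γ v := by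
  have hc : ∀ n : ℕ, Continuous fun v => logTri v n := fun n => continuous_logTri n
  refine (sum_le_sum fun x _ => norm_sum_mul_avgWeight_le hγ hγ0 hab s (c x)).trans ?_
  rw [← intervalIntegral.integral_finsetSum
    (fun x _ => Continuous.intervalIntegrable (by fun_prop) _ _),
    ← intervalIntegral.integral_const_mul]
  refine intervalIntegral.integral_mono_on hab (Continuous.intervalIntegrable (by fun_prop) _ _)
    (Continuous.intervalIntegrable (by fun_prop) _ _) fun v hv => ?_
  rw [← mul_sum, mul_comm K]
  exact mul_le_mul_of_nonneg_left (h v hv) (hγ0 v hv)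

theorem sum_abs_avgWeight_sub_le (hγ : Continuous γ) (hγ0 : ∀ v ∈ Set.Icc a b, 0 ≤ γ v)
    (hab : a ≤ b) (ha : 2 ≤ a) (N : ℕ) :
    ∑ n ∈ range N, |avgWeight γ a b (n + 1) - avgWeight γ a b n|
      ≤ 16 * Real.exp (3 - a) * ∫ v in a..b, γ v := by
  have hc : ∀ n : ℕ, Continuous fun v => logTri v n := fun n => continuous_logTri n
  have h : ∀ n : ℕ, |avgWeight γ a b (n + 1) - avgWeight γ a b n|
      ≤ ∫ v in a..b, γ v * |logTri v (n + 1 : ℕ) - logTri v n| := by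
    intro n
    rw [avgWeight, avgWeight, ← intervalIntegral.integral_sub]
    · refine (intervalIntegral.abs_integral_le_integral_abs hab).trans (le_of_eq ?_)
      refine intervalIntegral.integral_congr fun v hv => ?_
      rw [Set.uIcc_of_le hab] at hv
      rw [← mul_sub, abs_mul, abs_of_nonneg (hγ0 v hv)]
    · exact Continuous.intervalIntegrable (hγ.mul (hc _)) _ _
    · exact Continuous.intervalIntegrable (hγ.mul (hc _)) _ _
  have hi : ∀ n : ℕ, IntervalIntegrable (fun v => γ v * |logTri v (n + 1 : ℕ) - logTri v n|)
      MeasureTheory.volume a b := fun n =>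
    Continuous.intervalIntegrable (hγ.mul ((hc _).sub (hc _)).abs) _ _
  refine (sum_le_sum fun n _ => h n).trans ?_
  rw [← intervalIntegral.integral_finsetSum
    (fun x _ => hi x),
    ← intervalIntegral.integral_const_mul]
  refine intervalIntegral.integral_mono_on hab (Continuous.intervalIntegrable
    (continuous_finsetSum _ fun n _ => hγ.mul ((hc _).sub (hc _)).abs) _ _)
    (Continuous.intervalIntegrable (by fun_prop) _ _) fun v hv => ?_
  rw [← mul_sum, mul_comm _ (γ v)]
  refine mul_le_mul_of_nonneg_left ?_ (hγ0 v hv)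
  have h1 := sum_logTri_variation_le (d := 1) (v := v) le_rfl (by
    have := Real.add_one_le_exp (v - 1)
    have := hv.1
    linarith) N
  simp only [one_mul] at h1
  refine h1.trans ?_
  gcongr
  exact hv.1

end avgWeight

theorem summable_rpow_neg_one_add {s : ℝ} (hs : 0 < s) :
    Summable fun n : ℕ => (n : ℝ) ^ (-(1 + s)) :=
  Real.summable_nat_rpow.2 (by linarith)

theorem tsum_rpow_neg_one_add_le {s : ℝ} (hs : 0 < s) :
    ∑' n : ℕ, (n : ℝ) ^ (-(1 + s)) ≤ 1 + 1 / s := by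
  rw [(summable_rpow_neg_one_add hs).tsum_eq_zero_add]
  have h := ZetaAsymptotics.zeta_limit_aux1 (s := 1 + s) (by linarith)
  have h0 : 0 ≤ ZetaAsymptotics.termTSum (1 + s) :=
    tsum_nonneg fun n => ZetaAsymptotics.term_nonneg _ _
  have h1 : ∑' n : ℕ, ((n + 1 : ℕ) : ℝ) ^ (-(1 + s)) = ∑' n : ℕ, 1 / (n + 1 : ℝ) ^ (1 + s) := by
    refine tsum_congr fun n => ?_
    rw [Real.rpow_neg (by positivity), one_div]
    push_cast
    rfl
  rw [h1, Nat.cast_zero, Real.zero_rpow (by linarith)]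
  rw [add_sub_cancel_left] at h
  have : 0 ≤ (1 + s) * ZetaAsymptotics.termTSum (1 + s) := by positivity
  linarith

/-- The density `u ^ j * exp (-j u / L)`, which is maximal at `u = L`. -/
noncomputable def bump (L : ℝ) (j : ℕ) (u : ℝ) : ℝ := u ^ j * Real.exp (-(j / L * u))

theorem continuous_bump (L : ℝ) (j : ℕ) : Continuous (bump L j) := by
  unfold bump
  fun_prop

theorem bump_nonneg {L : ℝ} {j : ℕ} {u : ℝ} (hu : 0 ≤ u) : 0 ≤ bump L j u := by
  unfold bump
  positivity

theorem abs_bump_le_of_lt {L : ℝ} {j : ℕ} {u : ℝ} (hL : 10 ≤ L) (hj : (j : ℝ) ≤ L) (hu : -1 ≤ u)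
    (hu2 : u ≤ L / 10) : |bump L j u| ≤ (L / 10) ^ j * Real.exp 1 := by
  rw [bump, abs_mul, abs_pow, abs_of_nonneg (Real.exp_pos _).le]
  have h : |u| ≤ L / 10 := abs_le.2 ⟨by linarith, hu2⟩
  have h0 : 0 ≤ (j : ℝ) / L := by positivity
  have h1 : (j : ℝ) / L ≤ 1 := by
    rw [div_le_one (by linarith)]
    exact hj
  gcongr
  nlinarith

theorem bump_le_of_gt {L : ℝ} {j : ℕ} {u : ℝ} (hL : 0 < L) (hu : 10 * L ≤ u) :
    bump L j u ≤ (10 * L) ^ j * Real.exp (-(5 * j)) * Real.exp (-(j / L / 2 * u)) := by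
  have h1 : u * Real.exp (-(u / (2 * L))) ≤ 10 * L * Real.exp (-5) := by
    have h := Real.add_one_le_exp (u / (2 * L) - 5)
    have h2 : u / (10 * L) ≤ Real.exp (u / (2 * L) - 5) := by
      refine le_trans ?_ h
      have h3 : 5 * (u / (10 * L)) = u / (2 * L) := by
        field_simp
        ring
      have h4 : 1 ≤ u / (10 * L) := by rwa [one_le_div (by positivity)]
      linarith
    rw [div_le_iff₀ (by positivity)] at h2
    calc u * Real.exp (-(u / (2 * L)))
        ≤ Real.exp (u / (2 * L) - 5) * (10 * L) * Real.exp (-(u / (2 * L))) := by gcongr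
      _ = 10 * L * (Real.exp (u / (2 * L) - 5) * Real.exp (-(u / (2 * L)))) := by ring
      _ = _ := by
        rw [← Real.exp_add]
        ring_nf
  have hu0 : 0 ≤ u := by linarith
  have h2 := pow_le_pow_left₀ (by positivity) h1 j
  rw [mul_pow, mul_pow, ← Real.exp_nat_mul, ← Real.exp_nat_mul] at h2
  have h3 : Real.exp (-(j / L * u))
      = Real.exp (j * -(u / (2 * L))) * Real.exp (-(j / L / 2 * u)) := by
    rw [← Real.exp_add]
    congr 1
    field_simp
    ring
  rw [bump, h3, ← mul_assoc]
  refine mul_le_mul_of_nonneg_right (h2.trans (le_of_eq ?_)) (Real.exp_pos _).le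
  rw [mul_pow]
  ring_nf

theorem bump_log_sub_div {L : ℝ} {j n : ℕ} (hn : 1 ≤ n) (w : ℝ) :
    bump L j (Real.log n - w) / n
      = Real.exp (j / L * w) * ((n : ℝ) ^ (-(1 + j / L)) * (Real.log n - w) ^ j) := by
  have hn' : (0 : ℝ) < n := by exact_mod_cast hn
  have h : Real.exp (-(j / L * (Real.log n - w)))
      = Real.exp (j / L * w) * (n : ℝ) ^ (-(j / L)) := by
    rw [Real.rpow_def_of_pos hn', ← Real.exp_add]
    ring_nf
  rw [bump, h, neg_add, Real.rpow_add hn', Real.rpow_neg_one]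
  field_simp

theorem sum_inv_Icc_exp_le {t : ℝ} (ht : 0 ≤ t) :
    ∑ n ∈ Icc 1 ⌊Real.exp t⌋₊, ((n : ℝ))⁻¹ ≤ t + 1 := by
  have h := harmonic_floor_le_one_add_log (Real.exp t) (Real.one_le_exp ht)
  rw [Real.log_exp, harmonic_eq_sum_Icc] at h
  push_cast at h
  linarith

section
variable {L T : ℝ} {j : ℕ} {c : ℕ → ℂ}

theorem norm_sum_mul_bump_le (hL : 10 ≤ L) (hj : 1 ≤ j) (hjL : (j : ℝ) ≤ L)
    (hc : ∀ n, ‖c n‖ ≤ Λ n) {w : ℝ} (hw : |w| ≤ 1)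
    (hs : Summable fun n : ℕ => c n *
      (((n : ℝ) ^ (-(1 + j / L)) * (Real.log n - w) ^ j : ℝ) : ℂ))
    (hT : ‖∑' n : ℕ, c n * (((n : ℝ) ^ (-(1 + j / L)) * (Real.log n - w) ^ j : ℝ) : ℂ)‖ ≤ T)
    {N : ℕ} (hN : Real.exp (11 * L) ≤ N) :
    ‖∑ n ∈ range N, c n * (((Set.Icc (L / 10) (10 * L)).indicator (bump L j) (Real.log n - w) / n
      : ℝ) : ℂ)‖ ≤ Real.exp 1 * T + (L / 10 + 1) * (L / 10 + 2) * ((L / 10) ^ j * Real.exp 1)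
        + (10 * L) ^ j * Real.exp (-(5 * j)) * Real.exp 1 * (4 * L) * (1 + 4 * L) := by
  have hL0 : 0 < L := by linarith
  have hj0 : (0 : ℝ) < j := by exact_mod_cast hj
  obtain ⟨hw1, hw2⟩ := abs_le.1 hw
  have hσ1 : (j : ℝ) / L ≤ 1 := (div_le_one hL0).2 hjL
  have hσ0 : 0 < (j : ℝ) / L := by positivity
  have hc0 : c 0 = 0 := by simpa using hc 0
  have hT0 : 0 ≤ T := (norm_nonneg _).trans hT
  have hfull := hs.hasSum.mul_left ((Real.exp (j / L * w) : ℝ) : ℂ)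
  have hfull' : HasSum (fun n : ℕ => c n * ((bump L j (Real.log n - w) / n : ℝ) : ℂ))
      (((Real.exp (j / L * w) : ℝ) : ℂ) * ∑' n : ℕ, c n *
        (((n : ℝ) ^ (-(1 + j / L)) * (Real.log n - w) ^ j : ℝ) : ℂ)) := by
    refine hfull.congr_fun fun n => ?_
    rcases Nat.eq_zero_or_pos n with rfl | hn
    · simp [hc0]
    · rw [bump_log_sub_div hn]
      push_cast
      ring
  have hmid : HasSum (fun n : ℕ => c n * (((Set.Icc (L / 10) (10 * L)).indicator (bump L j)
      (Real.log n - w) / n : ℝ) : ℂ)) (∑ n ∈ range N, c n *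
      (((Set.Icc (L / 10) (10 * L)).indicator (bump L j) (Real.log n - w) / n : ℝ) : ℂ)) := by
    refine hasSum_sum_of_ne_finset_zero fun n hn => ?_
    have hn' : Real.exp (11 * L) ≤ n := hN.trans (by simpa using hn)
    have hn0 : (0 : ℝ) < n := (Real.exp_pos _).trans_le hn'
    have hl := (Real.le_log_iff_exp_le hn0).2 hn'
    rw [Set.indicator_of_notMem]
    · simp
    · rintro ⟨_, h⟩
      linarith
  set Z := ⌊Real.exp (L / 10 + 1)⌋₊
  set D := (10 * L) ^ j * Real.exp (-(5 * j))
  have hlow : HasSum (fun n : ℕ => if n ∈ Icc 1 Z then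
      (L / 10 + 1) * ((L / 10) ^ j * Real.exp 1) * (n : ℝ)⁻¹ else 0)
      (∑ n ∈ Icc 1 Z, (L / 10 + 1) * ((L / 10) ^ j * Real.exp 1) * (n : ℝ)⁻¹) := by
    have h := hasSum_sum_of_ne_finset_zero (L := SummationFilter.unconditional ℕ) (s := Icc 1 Z)
        (f := fun n : ℕ => if n ∈ Icc 1 Z then
      (L / 10 + 1) * ((L / 10) ^ j * Real.exp 1) * (n : ℝ)⁻¹ else 0) fun n hn => if_neg hn
    rwa [sum_congr rfl fun n hn => if_pos hn] at h
  have hhigh := ((summable_rpow_neg_one_add (show 0 <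
      (j : ℝ) / L / 4 by positivity)).hasSum).mul_left
    (D * Real.exp 1 * (4 / (j / L)))
  have hb := tsum_of_norm_bounded (hlow.add hhigh) (f := fun n =>
    c n * ((bump L j (Real.log n - w) / n : ℝ) : ℂ) - c n * (((Set.Icc (L / 10) (10 * L)).indicator
      (bump L j) (Real.log n - w) / n : ℝ) : ℂ)) fun n => by
    have hl0 : 0 ≤ (if n ∈ Icc 1 Z then
      (L / 10 + 1) * ((L / 10) ^ j * Real.exp 1) * (n : ℝ)⁻¹ else 0) := by
      split_ifs <;> positivity
    have hh0 : 0 ≤ D * Real.exp 1 * (4 / (j / L)) * (n : ℝ) ^ (-(1 + j / L / 4)) := by positivity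
    rcases Nat.eq_zero_or_pos n with rfl | hn
    · simp only [hc0, zero_mul, sub_zero, norm_zero]
      exact add_nonneg hl0 hh0
    have hn' : (1 : ℝ) ≤ n := by exact_mod_cast hn
    have hn0 : (0 : ℝ) < n := by linarith
    have hlog := Real.log_nonneg hn'
    by_cases hm : Real.log n - w ∈ Set.Icc (L / 10) (10 * L)
    · rw [Set.indicator_of_mem hm, sub_self, norm_zero]
      exact add_nonneg hl0 hh0
    rw [Set.indicator_of_notMem hm, zero_div, Complex.ofReal_zero, mul_zero, sub_zero, norm_mul,
      Complex.norm_real, Real.norm_eq_abs, abs_div, abs_of_pos hn0]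
    have hcn : ‖c n‖ ≤ Real.log n := (hc n).trans vonMangoldt_le_log
    rcases lt_or_ge (Real.log n - w) (L / 10) with h | h
    · refine le_trans ?_ (le_add_of_nonneg_right hh0)
      have hlt : Real.log n ≤ L / 10 + 1 := by linarith
      have hmem : n ∈ Icc 1 Z := mem_Icc.2 ⟨hn, Nat.le_floor ((Real.log_le_iff_le_exp hn0).1 hlt)⟩
      rw [if_pos hmem]
      have hbd := abs_bump_le_of_lt (j := j) hL hjL (show -1 ≤ Real.log n - w by linarith) h.le
      calc ‖c n‖ * (|bump L j (Real.log n - w)| / n)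
          ≤ (L / 10 + 1) * (((L / 10) ^ j * Real.exp 1) / n) := by
            gcongr
            exact hcn.trans hlt
        _ = _ := by ring
    · have h' : 10 * L ≤ Real.log n - w := by
        by_contra! hlt
        exact hm ⟨h, hlt.le⟩
      refine le_trans ?_ (le_add_of_nonneg_left hl0)
      rw [abs_of_nonneg (bump_nonneg (by linarith))]
      have hbd := bump_le_of_gt (j := j) hL0 h'
      have hlr := Real.log_le_rpow_div hn0.le (show 0 < (j : ℝ) / L / 4 by positivity)
      have he : Real.exp (-(j / L / 2 * (Real.log n - w)))
          ≤ Real.exp 1 * (n : ℝ) ^ (-(j / L / 2)) := by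
        rw [Real.rpow_def_of_pos hn0, ← Real.exp_add, Real.exp_le_exp]
        nlinarith
      calc ‖c n‖ * (bump L j (Real.log n - w) / n)
          ≤ (n : ℝ) ^ ((j : ℝ) / L / 4) / ((j : ℝ) / L / 4)
            * (D * (Real.exp 1 * (n : ℝ) ^ (-((j : ℝ) / L / 2))) / n) := by
            have hbd' := hbd.trans (mul_le_mul_of_nonneg_left he (show 0 ≤ D by positivity))
            have hbp : 0 ≤ bump L j (Real.log n - w) := bump_nonneg (by linarith)
            gcongr
            exact hcn.trans hlr
        _ = D * Real.exp 1 * (4 / (j / L)) * ((n : ℝ) ^ ((j : ℝ) / L / 4)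
            * (n : ℝ) ^ (-((j : ℝ) / L / 2)) * (n : ℝ) ^ (-1 : ℝ)) := by
          rw [Real.rpow_neg_one]
          field_simp
        _ = _ := by
          rw [← Real.rpow_add hn0, ← Real.rpow_add hn0]
          congr 2
          ring
  rw [(hfull'.sub hmid).tsum_eq] at hb
  have h1 : ‖((Real.exp (j / L * w) : ℝ) : ℂ) * ∑' n : ℕ, c n *
        (((n : ℝ) ^ (-(1 + j / L)) * (Real.log n - w) ^ j : ℝ) : ℂ)‖ ≤ Real.exp 1 * T := by
    rw [norm_mul, Complex.norm_real, Real.norm_of_nonneg (Real.exp_pos _).le]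
    gcongr
    nlinarith
  have h2 : ∑ n ∈ Icc 1 Z, (L / 10 + 1) * ((L / 10) ^ j * Real.exp 1) * (n : ℝ)⁻¹
      ≤ (L / 10 + 1) * (L / 10 + 2) * ((L / 10) ^ j * Real.exp 1) := by
    rw [← mul_sum]
    calc _ ≤ (L / 10 + 1) * ((L / 10) ^ j * Real.exp 1) * (L / 10 + 1 + 1) := by
          gcongr
          exact sum_inv_Icc_exp_le (by positivity)
      _ = _ := by ring
  have h3 : D * Real.exp 1 * (4 / (j / L)) * ∑' n : ℕ, (n : ℝ) ^ (-(1 + j / L / 4))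
      ≤ D * Real.exp 1 * (4 * L) * (1 + 4 * L) := by
    have hj1 : (1 : ℝ) ≤ j := by exact_mod_cast hj
    have hq : 4 / ((j : ℝ) / L) ≤ 4 * L := by
      rw [div_div_eq_mul_div, div_le_iff₀ hj0]
      nlinarith
    have h4 := tsum_rpow_neg_one_add_le (show 0 < (j : ℝ) / L / 4 by positivity)
    have h5 : 1 / ((j : ℝ) / L / 4) = 4 / (j / L) := by field_simp
    rw [h5] at h4
    gcongr
    linarith
  have h4 := norm_sub_norm_le (∑ n ∈ range N, c n *
      (((Set.Icc (L / 10) (10 * L)).indicator (bump L j) (Real.log n - w) / n : ℝ) : ℂ))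
      (((Real.exp (j / L * w) : ℝ) : ℂ) * ∑' n : ℕ, c n *
        (((n : ℝ) ^ (-(1 + j / L)) * (Real.log n - w) ^ j : ℝ) : ℂ))
  rw [norm_sub_rev] at h4
  linarith

theorem norm_sum_mul_avgWeight_bump_le (hL : 10 ≤ L) (hj : 1 ≤ j) (hjL : (j : ℝ) ≤ L)
    (hc : ∀ n, ‖c n‖ ≤ Λ n)
    (hsT : ∀ w : ℝ, |w| ≤ 1 → (Summable fun n : ℕ => c n *
      (((n : ℝ) ^ (-(1 + j / L)) * (Real.log n - w) ^ j : ℝ) : ℂ)) ∧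
      ‖∑' n : ℕ, c n * (((n : ℝ) ^ (-(1 + j / L)) * (Real.log n - w) ^ j : ℝ) : ℂ)‖ ≤ T)
    {N : ℕ} (hN : Real.exp (11 * L) ≤ N) :
    ‖∑ n ∈ range N, c n * (avgWeight (bump L j) (L / 10) (10 * L) n : ℂ)‖
      ≤ 2 * (Real.exp 1 * T + (L / 10 + 1) * (L / 10 + 2) * ((L / 10) ^ j * Real.exp 1)
        + (10 * L) ^ j * Real.exp (-(5 * j)) * Real.exp 1 * (4 * L) * (1 + 4 * L)) := by
  set K := Real.exp 1 * T + (L / 10 + 1) * (L / 10 + 2) * ((L / 10) ^ j * Real.exp 1)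
        + (10 * L) ^ j * Real.exp (-(5 * j)) * Real.exp 1 * (4 * L) * (1 + 4 * L)
  set F : ℕ → ℝ → ℝ := fun n => (Set.Icc (L / 10) (10 * L)).indicator
    fun v => bump L j v * logTri v n with hF
  have hintegrable : ∀ n, MeasureTheory.Integrable (F n) := fun n => by
    rw [hF, MeasureTheory.integrable_indicator_iff measurableSet_Icc]
    exact ((continuous_bump L j).mul (continuous_logTri n)).continuousOn.integrableOn_Icc
  have havg : ∀ n : ℕ, avgWeight (bump L j) (L / 10) (10 * L) n
      = ∫ w : ℝ, F n (Real.log n - w) := fun n => by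
    rw [MeasureTheory.integral_sub_left_eq_self (F n), hF,
      MeasureTheory.integral_indicator measurableSet_Icc, avgWeight,
      intervalIntegral.integral_of_le (by linarith), MeasureTheory.integral_Icc_eq_integral_Ioc]
  have hsum : ∑ n ∈ range N, c n * (avgWeight (bump L j) (L / 10) (10 * L) n : ℂ)
      = ∫ w : ℝ, ∑ n ∈ range N, c n * (F n (Real.log n - w) : ℂ) := by
    rw [MeasureTheory.integral_finsetSum]
    · refine sum_congr rfl fun n _ => ?_
      rw [MeasureTheory.integral_const_mul, integral_complex_ofReal, havg]
    · intro n _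
      exact (((hintegrable n).comp_sub_left (Real.log n)).ofReal).const_mul _
  rw [hsum]
  have hbound : ∀ w : ℝ, ‖∑ n ∈ range N, c n * (F n (Real.log n - w) : ℂ)‖
      ≤ (Set.Icc (-1 : ℝ) 1).indicator (fun _ => K) w := by
    intro w
    have h1 : ∀ n : ℕ, F n (Real.log n - w) = tri w *
        ((Set.Icc (L / 10) (10 * L)).indicator (bump L j) (Real.log n - w) / n) := fun n => by
      simp only [hF, Set.indicator_apply, logTri, sub_sub_cancel]
      split_ifs <;> ring
    have h2 : ∑ n ∈ range N, c n * (F n (Real.log n - w) : ℂ) = (tri w : ℂ) * ∑ n ∈ range N,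
        c n * (((Set.Icc (L / 10) (10 * L)).indicator (bump L j)
            (Real.log n - w) / n : ℝ) : ℂ) := by
      rw [mul_sum]
      refine sum_congr rfl fun n _ => ?_
      rw [h1]
      push_cast
      ring
    rw [h2, norm_mul, Complex.norm_real, Real.norm_of_nonneg (tri_nonneg w)]
    by_cases hw : |w| ≤ 1
    · rw [Set.indicator_of_mem (Set.mem_Icc.2 (abs_le.1 hw))]
      have h3 := norm_sum_mul_bump_le hL hj hjL hc hw (hsT w hw).1 (hsT w hw).2 hN
      exact (mul_le_of_le_one_left (norm_nonneg _) (tri_le_one w)).trans h3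
    · rw [Set.indicator_of_notMem (s := Set.Icc (-1) 1) (fun h => hw (abs_le.2 h)),
        tri_eq_zero (not_le.1 hw).le, zero_mul]
  have hK : MeasureTheory.Integrable ((Set.Icc (-1 : ℝ) 1).indicator fun _ => K) := by
    rw [MeasureTheory.integrable_indicator_iff measurableSet_Icc]
    exact continuous_const.continuousOn.integrableOn_Icc
  refine (MeasureTheory.norm_integral_le_of_norm_le hK (Eventually.of_forall hbound)).trans
    (le_of_eq ?_)
  rw [MeasureTheory.integral_indicator measurableSet_Icc, MeasureTheory.setIntegral_const]
  simp [MeasureTheory.measureReal_def]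
  norm_num

end

theorem exp_two_le : Real.exp 2 ≤ 15 / 2 := by
  rw [show (2 : ℝ) = (2 : ℕ) * 1 by norm_num, Real.exp_nat_mul]
  have := Real.exp_one_lt_d9
  have := Real.exp_one_gt_d9
  nlinarith

theorem le_exp_three : 20 ≤ Real.exp 3 := by
  rw [show (3 : ℝ) = (3 : ℕ) * 1 by norm_num, Real.exp_nat_mul]
  have h := Real.exp_one_gt_d9
  calc (20 : ℝ) ≤ 2.7182818283 ^ 3 := by norm_num
    _ ≤ _ := by gcongr

theorem half_bump_le_integral {L : ℝ} {j : ℕ} (hL : 10 ≤ L) (hj : (j : ℝ) ≤ L) :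
    bump L j L / 2 ≤ ∫ v in (L / 10)..(10 * L), bump L j v := by
  have hL0 : 0 < L := by linarith
  have hc := continuous_bump L j
  have h1 : ∫ v in L..(L + 1), bump L j v ≤ ∫ v in (L / 10)..(10 * L), bump L j v := by
    refine intervalIntegral.integral_mono_interval (by linarith) (by linarith) (by linarith) ?_
      (hc.intervalIntegrable _ _)
    refine (MeasureTheory.ae_restrict_iff' measurableSet_Ioc).2 (Eventually.of_forall
        fun v hv => ?_)
    exact bump_nonneg (by linarith [hv.1])
  refine le_trans ?_ h1
  have h2 : ∫ v in L..(L + 1), bump L j L / 2 ≤ ∫ v in L..(L + 1), bump L j v := by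
    refine intervalIntegral.integral_mono_on (by linarith) (by simp) (hc.intervalIntegrable _ _)
      fun v hv => ?_
    obtain ⟨hv1, hv2⟩ := hv
    set t := v / L - 1 with ht
    have hv' : v = L * (1 + t) := by rw [ht]; field_simp; ring
    have ht0 : 0 ≤ t := by
      rw [ht, sub_nonneg, one_le_div hL0]
      exact hv1
    have ht1 : t ≤ 1 / L := by
      rw [ht, div_sub_one hL0.ne']
      gcongr
      linarith
    have hLi : 1 / L ≤ 1 / 10 := by gcongr
    have ht2 : j * t ^ 2 ≤ 1 / 2 := by
      calc j * t ^ 2 ≤ L * (1 / L) ^ 2 := by gcongr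
        _ = 1 / L := by field_simp
        _ ≤ 1 / 2 := by linarith
    have h3 : (1 : ℝ) / 2 ≤ ((1 + t) * Real.exp (-t)) ^ j := by
      calc (1 : ℝ) / 2 ≤ 1 + j * (-(t ^ 2)) := by linarith
        _ ≤ (1 + -(t ^ 2)) ^ j := one_add_mul_le_pow (by nlinarith) j
        _ ≤ ((1 + t) * Real.exp (-t)) ^ j := by
          have h4 := Real.add_one_le_exp (-t)
          have h5 : 1 + -(t ^ 2) ≤ (1 + t) * Real.exp (-t) := by nlinarith
          have : 0 ≤ 1 + -(t ^ 2) := by nlinarith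
          gcongr
    have h4 : bump L j v = bump L j L * ((1 + t) * Real.exp (-t)) ^ j := by
      have h5 : Real.exp (-(j / L * (L * (1 + t)))) = Real.exp (-(j / L * L)) * Real.exp
          (-t) ^ j := by
        rw [← Real.exp_nat_mul, ← Real.exp_add]
        congr 1
        field_simp
        ring
      rw [bump, bump, hv', h5, mul_pow, mul_pow]
      ring
    rw [h4, div_eq_mul_inv, ← one_div]
    exact mul_le_mul_of_nonneg_left h3 (bump_nonneg hL0.le)
  simpa using h2

theorem small_conductor_bound_le {L : ℝ} {j : ℕ} (hL : 10 ≤ L) (hj : 30 * j ≤ √L) :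
    2 * (Real.exp 1 * (j.factorial * (4 * √L) ^ j * (4 * √L))
      + (L / 10 + 1) * (L / 10 + 2) * ((L / 10) ^ j * Real.exp 1)
      + (10 * L) ^ j * Real.exp (-(5 * j)) * Real.exp 1 * (4 * L) * (1 + 4 * L))
      ≤ 150 * L ^ 2 * Real.exp (-j) * bump L j L := by
  have hL0 : 0 < L := by linarith
  have he := Real.exp_one_lt_d9
  have hss := Real.mul_self_sqrt hL0.le
  have hs1 : √L ≤ L := by
    rw [Real.sqrt_le_left hL0.le]
    nlinarith
  have he2 := exp_two_le
  have hbase : Real.exp (-j) * bump L j L = (L * Real.exp (-2)) ^ j := by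
    rw [bump, div_mul_cancel₀ _ hL0.ne', mul_pow, ← Real.exp_nat_mul,
      mul_left_comm, ← Real.exp_add]
    ring_nf
  have hx : ∀ x : ℝ, x * Real.exp 2 ≤ L → x ≤ L * Real.exp (-2) := fun x hx => by
    rwa [Real.exp_neg, ← div_eq_mul_inv, le_div_iff₀ (Real.exp_pos _)]
  have h1 : (j.factorial : ℝ) * (4 * √L) ^ j ≤ (L * Real.exp (-2)) ^ j := by
    calc (j.factorial : ℝ) * (4 * √L) ^ j ≤ (j : ℝ) ^ j * (4 * √L) ^ j := by
          gcongr
          exact_mod_cast Nat.factorial_le_pow j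
      _ = (4 * j * √L) ^ j := by rw [← mul_pow]; ring
      _ ≤ _ := by
        refine pow_le_pow_left₀ (by positivity) (hx _ ?_) j
        calc 4 * j * √L * Real.exp 2 ≤ 4 * j * √L * (15 / 2) := by gcongr
          _ = 30 * j * √L := by ring
          _ ≤ √L * √L := by gcongr
          _ = L := hss
  have h2 : (L / 10) ^ j ≤ (L * Real.exp (-2)) ^ j :=
    pow_le_pow_left₀ (by positivity) (hx _ (by nlinarith)) j
  have h3 : (10 * L) ^ j * Real.exp (-(5 * j)) ≤ (L * Real.exp (-2)) ^ j := by
    have : Real.exp (-(5 * j)) = Real.exp (-5) ^ j := by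
      rw [← Real.exp_nat_mul]
      ring_nf
    rw [this, ← mul_pow]
    refine pow_le_pow_left₀ (by positivity) ?_ j
    have h5 : Real.exp (-2) = Real.exp (-5) * Real.exp 3 := by
      rw [← Real.exp_add]
      norm_num
    rw [h5]
    have := le_exp_three
    have h6 : 0 < L * Real.exp (-5) := by positivity
    nlinarith
  rw [mul_assoc (150 * L ^ 2), hbase]
  set Y := (L * Real.exp (-2)) ^ j
  have hY : 0 ≤ Y := by positivity
  have e1 : Real.exp 1 * (j.factorial * (4 * √L) ^ j * (4 * √L)) ≤ 3 * (Y * (4 * L ^ 2)) := by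
    gcongr
    · linarith
    · nlinarith
  have e2 : (L / 10 + 1) * (L / 10 + 2) * ((L / 10) ^ j * Real.exp 1)
      ≤ L * L * (Y * 3) := by
    gcongr
    · linarith
    · linarith
    · linarith
  have e3 : (10 * L) ^ j * Real.exp (-(5 * j)) * Real.exp 1 * (4 * L) * (1 + 4 * L)
      ≤ Y * 3 * (4 * L) * (5 * L) := by
    gcongr
    · linarith
    · linarith
  nlinarith

theorem eventually_mul_pow_mul_exp_le (C : ℝ) (A : ℕ) {c ε : ℝ} (hc : 0 < c) (hε : 0 < ε) :
    ∀ᶠ L : ℝ in atTop, C * L ^ A * Real.exp (-(c * L)) ≤ ε := by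
  have h := (Real.tendsto_pow_mul_exp_neg_atTop_nhds_zero A).comp
    (tendsto_id.const_mul_atTop hc)
  have h2 := h.const_mul (C * (c ^ A)⁻¹)
  rw [mul_zero] at h2
  filter_upwards [h2.eventually (gt_mem_nhds hε)] with L hL
  refine le_trans (le_of_eq ?_) hL.le
  simp only [Function.comp, id, mul_pow]
  field_simp

theorem eventually_mul_log_add_le (K C : ℝ) : ∀ᶠ L : ℝ in atTop, C * (K * Real.log L + 1) ≤ √L := by
  have h := (isLittleO_log_rpow_atTop (show (0 : ℝ) < 1 / 2 by norm_num)).tendsto_div_nhds_zero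
  have h1 : Tendsto (fun L : ℝ => C * K * (Real.log L / L ^ (1 / 2 : ℝ)) + C * (1 / √L)) atTop
      (nhds 0) := by
    simpa using (h.const_mul (C * K)).add (tendsto_inv_sqrt.const_mul C)
  filter_upwards [h1.eventually (gt_mem_nhds zero_lt_one), eventually_gt_atTop 0] with L hL h0
  have hs : 0 < √L := Real.sqrt_pos.2 h0
  rw [← Real.sqrt_eq_rpow, mul_one_div, ← mul_div_assoc, ← add_div, div_lt_one hs] at hL
  linarith

/-- The three contributions are those of the proper prime powers, of the small conductors and of the
large conductors. -/
theorem sum_norm_sum_primesBelow_avgWeight_le {L : ℝ} {j K b Q N : ℕ} (hL : 10000 ≤ L) (hj1 : 1 ≤ j)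
    (hj : 30 * j ≤ √L) (hK : L ^ K ≤ Real.exp j) (hQ : (Q : ℝ) ^ 4 ≤ Real.exp (L / 80))
    (hN : Real.exp (11 * L) ≤ N) {s : Finset (Σ f : ℕ, DirichletCharacter ℂ f)}
    (hs : ↑s ⊆ primitiveSet Q)
    (hsT : ∀ x ∈ s, (x.1 : ℝ) ≤ L ^ (2 * b) → ∀ w : ℝ, |w| ≤ 1 →
      (Summable fun n : ℕ => (x.2 n * (Λ n : ℂ)) *
        (((n : ℝ) ^ (-(1 + j / L)) * (Real.log n - w) ^ j : ℝ) : ℂ)) ∧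
      ‖∑' n : ℕ, (x.2 n * (Λ n : ℂ)) *
        (((n : ℝ) ^ (-(1 + j / L)) * (Real.log n - w) ^ j : ℝ) : ℂ)‖
        ≤ j.factorial * (4 * √L) ^ j * (4 * √L)) :
    ∑ x ∈ s, ‖∑ p ∈ N.primesBelow,
        (Real.log p : ℂ) * (x.2 p * (avgWeight (bump L j) (L / 10) (10 * L) p : ℂ))‖ / √x.1
      ≤ ((Q : ℝ) * Q * (16 * (10 * L + 1) * Real.exp (-(L / 20)))
        + L ^ (2 * b) * L ^ (2 * b) * (300 * L ^ 2 / L ^ K) + 3000 * L ^ 2 / L ^ b)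
        * ∫ v in (L / 10)..(10 * L), bump L j v := by
  have hL0 : 0 < L := by linarith
  have hab : L / 10 ≤ 10 * L := by linarith
  have hγ := continuous_bump L j
  have hγ0 : ∀ v ∈ Set.Icc (L / 10) (10 * L), 0 ≤ bump L j v := fun v hv =>
    bump_nonneg (by linarith [hv.1])
  have hjL : (j : ℝ) ≤ L := by
    have : √L ≤ L := by
      rw [Real.sqrt_le_left hL0.le]
      nlinarith
    nlinarith [(Nat.cast_nonneg j : (0 : ℝ) ≤ j)]
  have hHI := half_bump_le_integral (by linarith) hjL
  set I := ∫ v in (L / 10)..(10 * L), bump L j v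
  have hH : 0 ≤ bump L j L := bump_nonneg hL0.le
  have hI : 0 ≤ I := by linarith
  set g := avgWeight (bump L j) (L / 10) (10 * L)
  have hg : ∀ n, 0 ≤ g n := avgWeight_nonneg hγ0 hab
  let T : (Σ f : ℕ, DirichletCharacter ℂ f) → ℝ := fun x =>
    ‖∑ n ∈ range N, (x.2 n * (Λ n : ℂ)) * (g n : ℂ)‖
  set E := 16 * (10 * L + 1) * Real.exp (-(L / 20)) * I
  have hE : 0 ≤ E := by positivity
  have hsqrt : ∀ x ∈ s, 1 ≤ √(x.1 : ℝ) := fun x hx => by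
    rw [Real.one_le_sqrt]
    exact_mod_cast (hs hx).1.le
  have hpp : ∑ n ∈ range N, (Λ n - if n.Prime then Real.log n else 0) * g n ≤ E := by
    refine sum_mul_avgWeight_le hγ hγ0 hab _ _ fun v hv => ?_
    obtain ⟨h1, h2⟩ := hv
    refine (sum_vonMangoldt_sub_log_mul_logTri_le (by linarith) N).trans ?_
    have : 0 ≤ v := by linarith
    gcongr
    linarith
  have hterm : ∀ x ∈ s, ‖∑ p ∈ N.primesBelow, (Real.log p : ℂ) * (x.2 p * (g p : ℂ))‖
      ≤ T x + E := by
    intro x _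
    rw [sum_primesBelow_mul_eq N fun p => x.2 p * (g p : ℂ)]
    refine (norm_sub_le _ _).trans (add_le_add (le_of_eq ?_) (le_trans ?_ hpp))
    · simp only [T]
      congr 1
      exact sum_congr rfl fun n _ => by ring
    · refine norm_sum_le_of_le _ fun n _ => ?_
      rw [norm_mul, norm_mul, Complex.norm_real, Complex.norm_real,
        Real.norm_of_nonneg (vonMangoldt_sub_log_nonneg n), Real.norm_of_nonneg (hg n)]
      refine mul_le_mul_of_nonneg_left ?_ (vonMangoldt_sub_log_nonneg n)
      exact mul_le_of_le_one_left (hg n) (x.2.norm_le_one _)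
  have hsum : ∑ x ∈ s, T x ≤ 30 * (10 * L) ^ 2 * I := by
    refine sum_norm_sum_mul_avgWeight_le hγ hγ0 hab s (range N) (fun x n => x.2 n * (Λ n : ℂ))
      fun v hv => ?_
    obtain ⟨h1, h2⟩ := hv
    have hv : 16 ≤ v := by linarith
    refine le_trans (le_of_eq ?_) ((sum_primitive_norm_vonMangoldt_logTri_le hs hv
      (hQ.trans ?_) (le_trans ?_ hN)).trans ?_)
    · refine sum_congr rfl fun x _ => ?_
      congr 1
      exact sum_congr rfl fun n _ => by ring
    · exact Real.exp_le_exp.2 (by linarith)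
    · exact Real.exp_le_exp.2 (by linarith)
    · gcongr
  have hbig : ∑ x ∈ s.filter (fun x => ¬ (x.1 : ℝ) ≤ L ^ (2 * b)), T x / √x.1
      ≤ 3000 * L ^ 2 / L ^ b * I := by
    calc _ ≤ ∑ x ∈ s.filter (fun x => ¬ (x.1 : ℝ) ≤ L ^ (2 * b)), T x / L ^ b := by
          refine sum_le_sum fun x hx => ?_
          have h := (mem_filter.1 hx).2
          have : L ^ b ≤ √x.1 := by
            refine Real.le_sqrt_of_sq_le ?_
            rw [← pow_mul, mul_comm b 2]
            exact (not_le.1 h).le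
          gcongr
      _ ≤ ∑ x ∈ s, T x / L ^ b := sum_le_sum_of_subset_of_nonneg (filter_subset _ _)
          fun x _ _ => div_nonneg (norm_nonneg _) (by positivity)
      _ = (∑ x ∈ s, T x) / L ^ b := by rw [sum_div]
      _ ≤ (30 * (10 * L) ^ 2 * I) / L ^ b := by gcongr
      _ = _ := by ring
  have hsmall : ∑ x ∈ s.filter (fun x => (x.1 : ℝ) ≤ L ^ (2 * b)), T x / √x.1
      ≤ L ^ (2 * b) * L ^ (2 * b) * (300 * L ^ 2 / L ^ K) * I := by
    have hcard : (#(s.filter (fun x => (x.1 : ℝ) ≤ L ^ (2 * b))) : ℝ)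
        ≤ L ^ (2 * b) * L ^ (2 * b) := by
      have hsub : ↑(s.filter (fun x => (x.1 : ℝ) ≤ L ^ (2 * b))) ⊆
          primitiveSet ⌊L ^ (2 * b)⌋₊ := fun x hx => by
        have hx' := mem_filter.1 (mem_coe.1 hx)
        exact ⟨(hs hx'.1).1, Nat.le_floor hx'.2, (hs hx'.1).2.2⟩
      have h := card_le_of_subset_primitiveSet hsub
      have hfl := Nat.floor_le (a := L ^ (2 * b)) (by positivity)
      calc _ ≤ ((⌊L ^ (2 * b)⌋₊ * ⌊L ^ (2 * b)⌋₊ : ℕ) : ℝ) := by exact_mod_cast h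
        _ ≤ _ := by
          push_cast
          gcongr
    have hone : ∀ x ∈ s.filter (fun x => (x.1 : ℝ) ≤ L ^ (2 * b)),
        T x / √x.1 ≤ 300 * L ^ 2 / L ^ K * I := by
      intro x hx
      obtain ⟨hx, hxL⟩ := mem_filter.1 hx
      refine (div_le_self (norm_nonneg _) (hsqrt x hx)).trans ?_
      have h := norm_sum_mul_avgWeight_bump_le (by linarith) hj1 hjL
        (c := fun n => x.2 n * (Λ n : ℂ)) (fun n => by
          rw [norm_mul, Complex.norm_real, Real.norm_of_nonneg vonMangoldt_nonneg]
          exact mul_le_of_le_one_left vonMangoldt_nonneg (x.2.norm_le_one _))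
        (hsT x hx hxL) hN
      refine h.trans ((small_conductor_bound_le (by linarith) hj).trans ?_)
      calc 150 * L ^ 2 * Real.exp (-j) * bump L j L
          ≤ 150 * L ^ 2 * (1 / L ^ K) * (2 * I) := by
            gcongr
            · rw [Real.exp_neg, ← one_div]
              gcongr
            · linarith
        _ = _ := by ring
    calc _ ≤ _ := sum_le_card_nsmul _ _ _ hone
      _ ≤ _ := by
        rw [nsmul_eq_mul, mul_assoc (L ^ (2 * b) * L ^ (2 * b))]
        gcongr
  have hcardQ : (#s : ℝ) ≤ (Q : ℝ) * Q := by exact_mod_cast card_le_of_subset_primitiveSet hs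
  calc _ ≤ ∑ x ∈ s, (T x / √x.1 + E) := by
        refine sum_le_sum fun x hx => ?_
        have h1 := hsqrt x hx
        calc _ ≤ (T x + E) / √x.1 := by
              gcongr
              exact hterm x hx
          _ ≤ _ := by
            rw [add_div]
            gcongr
            exact div_le_self hE h1
    _ = ∑ x ∈ s, T x / √x.1 + #s * E := by rw [sum_add_distrib, sum_const, nsmul_eq_mul]
    _ ≤ _ := by
      rw [← sum_filter_add_sum_filter_not s (fun x => (x.1 : ℝ) ≤ L ^ (2 * b))]
      have : #s * E ≤ Q * Q * (16 * (10 * L + 1) * Real.exp (-(L / 20))) * I := by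
        rw [mul_assoc ((Q : ℝ) * Q)]
        gcongr
      linarith

/-- A nonnegative weight living on a logarithmically long range, of small total variation, with
respect to which the primes have positive density and are well distributed in progressions to
squarefree moduli at most `W * exp (L / 500)` prime to `ℓ`. -/
structure IsAdmissibleWeight (W A ℓ : ℕ) (L : ℝ) (G : ℕ → ℝ) : Prop where
  nonneg : ∀ n, 0 ≤ G n
  support : ∀ n, G n ≠ 0 → Real.exp (L / 20) ≤ n ∧ (n : ℝ) ≤ Real.exp (11 * L)
  variation : ∀ N, ∑ n ∈ range N, |G (n + 1) - G n| ≤ Real.exp (-(L / 20))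
  sum_le : ∀ N, ∑ n ∈ range N, G n ≤ 8
  le_sum_primes : ∀ N : ℕ, Real.exp (11 * L) ≤ N → 1 / 20 ≤ ∑ p ∈ N.primesBelow, Real.log p * G p
  sum_characters : ∀ N : ℕ, Real.exp (11 * L) ≤ N →
    ∀ s : Finset (Σ f : ℕ, DirichletCharacter ℂ f),
      ↑s ⊆ primitiveSet ⌊W * Real.exp (L / 500)⌋₊ → (∀ x ∈ s, Squarefree x.1 ∧ ¬ ℓ ∣ x.1) →
      ∑ x ∈ s, ‖∑ p ∈ N.primesBelow, (Real.log p : ℂ) * (x.2 p * (G p : ℂ))‖ / √x.1 ≤ 1 / L ^ A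

theorem eventually_exists_isAdmissibleWeight {W : ℕ} (hW : 0 < W) (A : ℕ) :
    ∀ᶠ L : ℝ in atTop, ∃ ℓ : ℕ, ℓ.Prime ∧ ¬ ℓ ∣ W ∧
      ∃ G : ℕ → ℝ, IsAdmissibleWeight W A ℓ L G := by
  set b := A + 3 with hb
  set K := 4 * b + 3 + A with hK
  obtain ⟨v₀, hv₀⟩ := eventually_atTop.1 eventually_sum_log_mul_logTri_ge
  filter_upwards [eventually_ge_atTop 10000, eventually_ge_atTop (10 * v₀),
    eventually_mul_log_add_le K 30, eventually_exists_prime_norm_tsum_le (B := 2 * b) (by omega) hW,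
    eventually_mul_pow_mul_exp_le (1000 * (W : ℝ) ^ 2) (A + 1) (c := 1 / 50) (by norm_num)
      (show (0 : ℝ) < 1 by norm_num),
    eventually_mul_pow_mul_exp_le ((W : ℝ) ^ 4) 0 (c := 1 / 1000) (by norm_num)
      (show (0 : ℝ) < 1 by norm_num)]
    with L hL hLv hlog hprime hexp hWL
  have hL0 : 0 < L := by linarith
  obtain ⟨ℓ, hℓ, hℓW, hℓT⟩ := hprime
  have hlogL : 0 < Real.log L := Real.log_pos (by linarith)
  have hK0 : 0 < (K : ℝ) := by
    have : 0 < K := by omega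
    exact_mod_cast this
  set j := ⌈K * Real.log L⌉₊ with hjdef
  have hj1 : 1 ≤ j := Nat.ceil_pos.2 (by positivity)
  have hjle : K * Real.log L ≤ j := Nat.le_ceil _
  have hj : 30 * j ≤ √L := by
    refine le_trans ?_ hlog
    have := (Nat.ceil_lt_add_one (a := K * Real.log L) (by positivity)).le
    linarith
  have hss := Real.mul_self_sqrt hL0.le
  have hs0 : 0 < √L := Real.sqrt_pos.2 hL0
  have hj0 : (1 : ℝ) ≤ j := by exact_mod_cast hj1
  have hjK : L ^ K ≤ Real.exp j := by
    rw [← Real.exp_log (show 0 < L ^ K by positivity), Real.log_pow]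
    exact Real.exp_le_exp.2 hjle
  have hjL : (j : ℝ) ≤ L := by nlinarith
  have hab : L / 10 ≤ 10 * L := by linarith
  have hγ := continuous_bump L j
  have hγ0 : ∀ v ∈ Set.Icc (L / 10) (10 * L), 0 ≤ bump L j v := fun v hv =>
    bump_nonneg (by linarith [hv.1])
  have hHI := half_bump_le_integral (by linarith) hjL
  have hH : 0 < bump L j L := by
    rw [bump]
    positivity
  set I := ∫ v in (L / 10)..(10 * L), bump L j v with hI
  have hI0 : 0 < I := by linarith
  set g := avgWeight (bump L j) (L / 10) (10 * L) with hg
  have hg0 : ∀ n, 0 ≤ g n := avgWeight_nonneg hγ0 hab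
  refine ⟨ℓ, hℓ, hℓW, fun n => g n / I, ?_, ?_, ?_, ?_, ?_, ?_⟩
  · exact fun n => div_nonneg (hg0 n) hI0.le
  · intro n hn
    have hn' : g n ≠ 0 := fun h => hn (by rw [h, zero_div])
    constructor
    · by_contra! h
      exact hn' (avgWeight_eq_zero_of_le hab (h.le.trans (Real.exp_le_exp.2 (by linarith))))
    · by_contra! h
      exact hn' (avgWeight_eq_zero_of_ge hab (le_trans (Real.exp_le_exp.2 (by linarith)) h.le))
  · intro N
    have h := sum_abs_avgWeight_sub_le hγ hγ0 hab (by linarith) N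
    calc ∑ n ∈ range N, |g (n + 1) / I - g n / I|
        = (∑ n ∈ range N, |g (n + 1) - g n|) / I := by
          rw [sum_div]
          refine sum_congr rfl fun n _ => ?_
          rw [← sub_div, abs_div, abs_of_pos hI0]
      _ ≤ 16 * Real.exp (3 - L / 10) := by
          rw [div_le_iff₀ hI0]
          exact h
      _ ≤ Real.exp 3 * Real.exp (3 - L / 10) := by
          gcongr
          linarith [le_exp_three]
      _ ≤ _ := by
          rw [← Real.exp_add]
          exact Real.exp_le_exp.2 (by linarith)
  · intro N
    rw [← sum_div, div_le_iff₀ hI0]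
    simpa using sum_mul_avgWeight_le hγ hγ0 hab (range N) (fun _ => 1) (K := 8)
      fun v _ => by simpa using sum_logTri_le v N
  · intro N hN
    simp only [← mul_div_assoc]
    rw [← sum_div, le_div_iff₀ hI0]
    refine le_sum_mul_avgWeight hγ hγ0 hab _ _ fun v hv => ?_
    obtain ⟨h1, h2⟩ := hv
    exact hv₀ v (by linarith) N (le_trans (Real.exp_le_exp.2 (by linarith)) hN)
  · intro N hN s hs hsq
    set Q := ⌊W * Real.exp (L / 500)⌋₊ with hQdef
    have hQle : (Q : ℝ) ≤ W * Real.exp (L / 500) := Nat.floor_le (by positivity)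
    have hQ : (Q : ℝ) ^ 4 ≤ Real.exp (L / 80) := by
      calc (Q : ℝ) ^ 4 ≤ (W * Real.exp (L / 500)) ^ 4 := by gcongr
        _ = ((W : ℝ) ^ 4 * L ^ 0 * Real.exp (-(1 / 1000 * L))) * Real.exp (9 * L / 1000) := by
          rw [mul_pow, ← Real.exp_nat_mul, pow_zero, mul_one, mul_assoc, ← Real.exp_add]
          congr 2
          push_cast
          ring
        _ ≤ 1 * Real.exp (9 * L / 1000) := by gcongr
        _ ≤ _ := by
          rw [one_mul]
          exact Real.exp_le_exp.2 (by linarith)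
    have h := sum_norm_sum_primesBelow_avgWeight_le (K := K) (b := b) hL hj1 hj hjK hQ hN hs
      fun x hx hxL w hw => hℓT x (hs hx).1 hxL (hs hx).2.2 (hsq x hx).1 (hsq x hx).2 (j / L) w j
        (by positivity) (by
          rw [div_le_div_iff₀ hL0 hs0]
          nlinarith) hw
    rw [← hI, ← hg] at h
    have e1 : ((Q : ℝ) * Q * (16 * (10 * L + 1) * Real.exp (-(L / 20)))) ≤ 1 / (3 * L ^ A) := by
      rw [le_div_iff₀ (by positivity)]
      calc (Q : ℝ) * Q * (16 * (10 * L + 1) * Real.exp (-(L / 20))) * (3 * L ^ A)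
          ≤ (W * Real.exp (L / 500)) * (W * Real.exp (L / 500))
            * (16 * (11 * L) * Real.exp (-(L / 20))) * (3 * L ^ A) := by
            gcongr
            linarith
        _ = 528 * (W : ℝ) ^ 2 * L ^ (A + 1) *
            (Real.exp (L / 500) * Real.exp (L / 500) * Real.exp (-(L / 20))) := by ring
        _ ≤ 1000 * (W : ℝ) ^ 2 * L ^ (A + 1) * Real.exp (-(1 / 50 * L)) := by
            rw [← Real.exp_add, ← Real.exp_add]
            gcongr
            · norm_num
            · linarith
        _ ≤ 1 := hexp
    have e2 : L ^ (2 * b) * L ^ (2 * b) * (300 * L ^ 2 / L ^ K) ≤ 1 / (3 * L ^ A) := by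
      have : L ^ K = L ^ (2 * b) * L ^ (2 * b) * L ^ 3 * L ^ A := by
        rw [← pow_add, ← pow_add, ← pow_add]
        congr 1
        omega
      rw [this, ← mul_div_assoc, div_le_div_iff₀ (by positivity) (by positivity)]
      have hp : 0 < L ^ (2 * b) * L ^ (2 * b) * L ^ 2 * L ^ A := by positivity
      calc _ = 900 * (L ^ (2 * b) * L ^ (2 * b) * L ^ 2 * L ^ A) := by ring
        _ ≤ L * (L ^ (2 * b) * L ^ (2 * b) * L ^ 2 * L ^ A) := by
          gcongr
          linarith
        _ = _ := by ring
    have e3 : 3000 * L ^ 2 / L ^ b ≤ 1 / (3 * L ^ A) := by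
      rw [div_le_div_iff₀ (by positivity) (by positivity), hb]
      calc _ = 9000 * (L ^ 2 * L ^ A) := by ring
        _ ≤ L * (L ^ 2 * L ^ A) := by
          gcongr
          linarith
        _ = _ := by ring
    have hdiv : ∀ x : Σ f : ℕ, DirichletCharacter ℂ f,
        ‖∑ p ∈ N.primesBelow, (Real.log p : ℂ) * (x.2 p * ((g p / I : ℝ) : ℂ))‖ / √x.1
          = ‖∑ p ∈ N.primesBelow, (Real.log p : ℂ) * (x.2 p * (g p : ℂ))‖ / √x.1 / I := by
      intro x
      have : ∑ p ∈ N.primesBelow, (Real.log p : ℂ) * (x.2 p * ((g p / I : ℝ) : ℂ))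
          = (∑ p ∈ N.primesBelow, (Real.log p : ℂ) * (x.2 p * (g p : ℂ))) / (I : ℂ) := by
        rw [sum_div]
        refine sum_congr rfl fun p _ => ?_
        push_cast
        ring
      rw [this, norm_div, Complex.norm_real, Real.norm_of_nonneg hI0.le, div_right_comm]
    rw [sum_congr rfl fun x _ => hdiv x, ← sum_div, div_le_iff₀ hI0]
    refine h.trans ?_
    gcongr
    have : 1 / L ^ A = 1 / (3 * L ^ A) + 1 / (3 * L ^ A) + 1 / (3 * L ^ A) := by
      field_simp
      norm_num
    linarith

section tensor
variable {α β : Type*} [Fintype α] [DecidableEq α] [Fintype β]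

theorem posSemidef_of_form {n : Type*} [Fintype n] {M : Matrix n n ℝ} (hM : ∀ s t, M s t = M t s)
    (h : ∀ x : n → ℝ, 0 ≤ ∑ s, ∑ t, x s * x t * M s t) : M.PosSemidef := by
  refine Matrix.PosSemidef.of_dotProduct_mulVec_nonneg ?_ fun x => ?_
  · ext s t
    simp [hM s t]
  · refine (h x).trans (le_of_eq ?_)
    simp only [dotProduct, Matrix.mulVec, mul_sum, star_trivial]
    exact sum_congr rfl fun s _ => sum_congr rfl fun t _ => by ring

theorem form_nonneg_of_posSemidef {n : Type*} [Fintype n] {M : Matrix n n ℝ} (h : M.PosSemidef)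
    (x : n → ℝ) : 0 ≤ ∑ s, ∑ t, x s * x t * M s t := by
  refine (h.dotProduct_mulVec_nonneg x).trans (le_of_eq ?_)
  simp only [dotProduct, Matrix.mulVec, mul_sum, star_trivial]
  exact sum_congr rfl fun s _ => sum_congr rfl fun t _ => by ring

/-- The matrix indexed by functions whose entries are products of the entries of the factors. -/
def tensor (M : α → Matrix β β ℝ) (s : Finset α) : Matrix (α → β) (α → β) ℝ :=
  Matrix.of fun σ τ => ∏ a ∈ s, M a (σ a) (τ a)

omit [Fintype α] [Fintype β] in
theorem tensor_insert (M : α → Matrix β β ℝ) {s : Finset α} {a : α} (ha : a ∉ s) :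
    tensor M (insert a s)
      = Matrix.hadamard ((M a).submatrix (fun σ : α → β => σ a) fun σ => σ a) (tensor M s) := by
  ext σ τ
  simp [tensor, prod_insert ha]

theorem posSemidef_tensor {M : α → Matrix β β ℝ} (hM : ∀ a, (M a).PosSemidef) (s : Finset α) :
    (tensor M s).PosSemidef := by
  induction s using Finset.induction_on with
  | empty =>
    refine posSemidef_of_form (fun _ _ => by simp [tensor]) fun x => ?_
    simp only [tensor, prod_empty, Matrix.of_apply, mul_one]
    rw [← sum_mul_sum]
    exact mul_self_nonneg _
  | insert a s ha ih =>
    rw [tensor_insert M ha]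
    exact ((hM a).submatrix _).hadamard ih

theorem posSemidef_tensor_sub {M N : α → Matrix β β ℝ} (hM : ∀ a, (M a).PosSemidef)
    (hMN : ∀ a, (N a - M a).PosSemidef) (s : Finset α) :
    (tensor N s - tensor M s).PosSemidef := by
  have hN : ∀ a, (N a).PosSemidef := fun a => by
    simpa using (hM a).add (hMN a)
  induction s using Finset.induction_on with
  | empty => simpa [tensor] using Matrix.PosSemidef.zero
  | insert a s ha ih =>
    rw [tensor_insert M ha, tensor_insert N ha]
    have h : Matrix.hadamard ((N a).submatrix (fun σ : α → β => σ a) fun σ => σ a) (tensor N s)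
        - Matrix.hadamard ((M a).submatrix (fun σ : α → β => σ a) fun σ => σ a) (tensor M s)
        = Matrix.hadamard ((N a - M a).submatrix (fun σ : α → β => σ a) fun σ => σ a) (tensor N s)
          + Matrix.hadamard ((M a).submatrix (fun σ : α → β => σ a) fun σ => σ a)
            (tensor N s - tensor M s) := by
      ext σ τ
      simp
      ring
    rw [h]
    exact (((hMN a).submatrix fun σ : α → β => σ a).hadamard (posSemidef_tensor hN s)).add
      (((hM a).submatrix fun σ : α → β => σ a).hadamard ih)

theorem tensor_form_le {M N : α → Matrix β β ℝ} (hM : ∀ a, (M a).PosSemidef)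
    (hMN : ∀ a, (N a - M a).PosSemidef) (x : (α → β) → ℝ) :
    ∑ σ, ∑ τ, x σ * x τ * ∏ a, M a (σ a) (τ a) ≤ ∑ σ, ∑ τ, x σ * x τ * ∏ a, N a (σ a) (τ a) := by
  have h := form_nonneg_of_posSemidef (posSemidef_tensor_sub hM hMN univ) x
  simp only [tensor, Matrix.sub_apply, Matrix.of_apply, mul_sub, sum_sub_distrib] at h
  linarith

theorem tensor_form_eq_sum_sq {γ : Type*} [Fintype γ] [DecidableEq γ] (B : α → γ → β → ℝ)
    (x : (α → β) → ℝ) :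
    ∑ σ, ∑ τ, x σ * x τ * ∏ a, ∑ c, B a c (σ a) * B a c (τ a)
      = ∑ c : α → γ, (∑ σ, x σ * ∏ a, B a (c a) (σ a)) ^ 2 := by
  have h : ∀ σ τ : α → β, ∏ a, ∑ c, B a c (σ a) * B a c (τ a)
      = ∑ c : α → γ, (∏ a, B a (c a) (σ a)) * ∏ a, B a (c a) (τ a) := by
    intro σ τ
    rw [prod_univ_sum, Fintype.piFinset_univ]
    exact sum_congr rfl fun c _ => prod_mul_distrib
  simp only [h, mul_sum, sq, sum_mul]
  rw [sum_congr rfl fun σ _ => sum_comm, sum_comm]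
  refine sum_congr rfl fun c _ => ?_
  rw [sum_comm]
  exact sum_congr rfl fun σ _ => sum_congr rfl fun τ _ => by ring

end tensor

section localForm
variable {ι : Type*} [DecidableEq ι]

/-- The factor at a prime `x` of the sieve weight: `s` is the choice made by the weight and `w`
records which of the linear forms is divisible by the prime. -/
def localFactor (x : ℝ) (s w : Option ι) : ℝ := s.elim 1 fun i => if w = some i then x - 1 else -1

/-- Coefficients expressing a product of two local factors through the indicators `w = r`. -/
def localCoeff (x : ℝ) (s t r : Option ι) : ℝ :=
  r.elim (localFactor x s none * localFactor x t none) fun i =>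
    localFactor x s (some i) * localFactor x t (some i) - localFactor x s none
        * localFactor x t none

theorem sum_localCoeff_mul_ite [Fintype ι] (x : ℝ) (s t w : Option ι) :
    ∑ r, localCoeff x s t r * (if r = none ∨ r = w then 1 else 0)
      = localFactor x s w * localFactor x t w := by
  rw [Fintype.sum_option]
  cases w with
  | none => simp [localCoeff]
  | some i => simp [localCoeff]

/-- The local quadratic form of the sieve for the densities `g`. -/
def localForm [Fintype ι] (x : ℝ) (g : ι → ℝ) : Matrix (Option ι) (Option ι) ℝ :=
  Matrix.of fun s t => ∑ r, localCoeff x s t r * r.elim 1 g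

theorem localForm_symm [Fintype ι] (x : ℝ) (g : ι → ℝ) (s t : Option ι) :
    localForm x g s t = localForm x g t s := by
  have : ∀ r, localCoeff x s t r = localCoeff x t s r := fun r => by
    cases r <;> simp [localCoeff, mul_comm]
  simp [localForm, this]

theorem sum_mul_localFactor_none [Fintype ι] (x : ℝ) (v : Option ι → ℝ) :
    ∑ s, v s * localFactor x s none = v none - ∑ i, v (some i) := by
  simp [Fintype.sum_option, localFactor, sub_eq_add_neg]

theorem sum_mul_localFactor_some [Fintype ι] (x : ℝ) (v : Option ι → ℝ) (i : ι) :
    ∑ s, v s * localFactor x s (some i) = v none - ∑ i, v (some i) + x * v (some i) := by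
  have : ∀ j, v (some j) * localFactor x (some j) (some i)
      = -v (some j) + if i = j then x * v (some i) else 0 := by
    intro j
    by_cases h : i = j
    · subst h
      simp [localFactor]
      ring
    · simp [localFactor, h]
  rw [Fintype.sum_option]
  simp only [this, sum_add_distrib, sum_ite_eq, mem_univ, if_true, sum_neg_distrib]
  simp [localFactor]
  ring

theorem localForm_form [Fintype ι] (x : ℝ) (g : ι → ℝ) (v : Option ι → ℝ) :
    ∑ s, ∑ t, v s * v t * localForm x g s t
      = (1 - ∑ i, g i) * (v none - ∑ i, v (some i)) ^ 2
        + ∑ i, g i * (v none - ∑ i, v (some i) + x * v (some i)) ^ 2 := by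
  have h1 : ∀ s t, localForm x g s t
      = (1 - ∑ i, g i) * (localFactor x s none * localFactor x t none)
        + ∑ i, g i * (localFactor x s (some i) * localFactor x t (some i)) := by
    intro s t
    simp only [localForm, Matrix.of_apply, Fintype.sum_option, localCoeff, Option.elim_none,
      Option.elim_some, sub_mul, sum_sub_distrib, mul_one]
    rw [← mul_sum]
    simp only [mul_comm]
    ring
  have h2 : ∀ w : Option ι, ∑ s, ∑ t, v s * v t * (localFactor x s w * localFactor x t w)
      = (∑ s, v s * localFactor x s w) ^ 2 := by
    intro w
    rw [sq, sum_mul_sum]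
    exact sum_congr rfl fun s _ => sum_congr rfl fun t _ => by ring
  rw [← sum_mul_localFactor_none x, ← h2]
  simp_rw [sum_mul_localFactor_none x, ← sum_mul_localFactor_some x, ← h2, h1, mul_add,
    sum_add_distrib, mul_sum]
  congr 1
  · exact sum_congr rfl fun s _ => sum_congr rfl fun t _ => by ring
  · rw [sum_congr rfl fun s _ => sum_comm, sum_comm]
    exact sum_congr rfl fun i _ => sum_congr rfl fun s _ => sum_congr rfl fun t _ => by ring

theorem posSemidef_localForm [Fintype ι] (x : ℝ) {g : ι → ℝ} (hg : ∀ i, 0 ≤ g i)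
    (hg1 : ∑ i, g i ≤ 1) : (localForm x g).PosSemidef := by
  refine posSemidef_of_form (localForm_symm x g) fun v => ?_
  rw [localForm_form]
  have : 0 ≤ ∑ i, g i * (v none - ∑ i, v (some i) + x * v (some i)) ^ 2 :=
    sum_nonneg fun i _ => mul_nonneg (hg i) (sq_nonneg _)
  have h1 : 0 ≤ 1 - ∑ i, g i := by linarith
  positivity

theorem posSemidef_diagonal_sub_localForm [Fintype ι] {x : ℝ} (hx : 0 < x) :
    (Matrix.diagonal (fun s : Option ι => s.elim 1 fun _ => x)
      - localForm x fun _ : ι => 1 / x).PosSemidef := by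
  refine posSemidef_of_form (fun s t => ?_) fun v => ?_
  · rw [Matrix.sub_apply, Matrix.sub_apply, localForm_symm]
    congr 1
    by_cases h : s = t
    · rw [h]
    · rw [Matrix.diagonal_apply_ne _ h, Matrix.diagonal_apply_ne _ (Ne.symm h)]
  · simp only [Matrix.sub_apply, mul_sub, sum_sub_distrib, localForm_form, Matrix.diagonal_apply,
      mul_ite, mul_zero, sum_ite_eq, mem_univ, if_true]
    rw [Fintype.sum_option]
    set X := ∑ i, v (some i) with hX
    have h1 : ∑ i : ι, 1 / x * (v none - X + x * v (some i)) ^ 2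
        = (∑ _i : ι, 1 / x) * (v none - X) ^ 2 + 2 * (v none - X) * X
          + x * ∑ i, v (some i) * v (some i) := by
      rw [hX, sum_mul, mul_sum, mul_sum, ← sum_add_distrib, ← sum_add_distrib]
      refine sum_congr rfl fun i _ => ?_
      field_simp
      ring
    rw [h1]
    simp only [Option.elim_none, Option.elim_some, mul_one]
    rw [← sum_mul]
    nlinarith [sq_nonneg X]

/-- Rows of the square root of a lower bound for the local form of the primes. -/
noncomputable def lowerRow (x κ : ℝ) (m : ι) (c s : Option ι) : ℝ :=
  c.elim (s.elim 1 fun i => if i = m then -1 else 0)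
    fun j => if j ≠ m ∧ s = some j then √(x - κ) else 0

theorem sum_mul_lowerRow_none [Fintype ι] (x κ : ℝ) (m : ι) (v : Option ι → ℝ) :
    ∑ s, v s * lowerRow x κ m none s = v none - v (some m) := by
  simp [Fintype.sum_option, lowerRow, sub_eq_add_neg]

theorem sum_mul_lowerRow_some [Fintype ι] (x κ : ℝ) (m : ι) (v : Option ι → ℝ) (j : ι) :
    ∑ s, v s * lowerRow x κ m (some j) s = if j = m then 0 else √(x - κ) * v (some j) := by
  by_cases h : j = m
  · simp [lowerRow, h]
  · simp [lowerRow, h, mul_comm]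

theorem lowerRow_form [Fintype ι] {x κ : ℝ} (hx : κ ≤ x) (m : ι) (v : Option ι → ℝ) :
    ∑ s, ∑ t, v s * v t * ∑ c, lowerRow x κ m c s * lowerRow x κ m c t
      = (v none - v (some m)) ^ 2 + (x - κ) * ∑ j ∈ univ.erase m, v (some j) ^ 2 := by
  have h2 : ∀ c : Option ι, ∑ s, ∑ t, v s * v t * (lowerRow x κ m c s * lowerRow x κ m c t)
      = (∑ s, v s * lowerRow x κ m c s) ^ 2 := by
    intro w
    rw [sq, sum_mul_sum]
    exact sum_congr rfl fun s _ => sum_congr rfl fun t _ => by ring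
  simp_rw [mul_sum (s := (univ : Finset (Option ι)))]
  rw [sum_congr rfl fun s _ => sum_comm, sum_comm, sum_congr rfl fun c _ => h2 c,
    Fintype.sum_option, sum_mul_lowerRow_none]
  simp only [sum_mul_lowerRow_some]
  congr 1
  rw [← add_sum_erase _ _ (mem_univ m), if_pos rfl, mul_sum]
  rw [zero_pow two_ne_zero, zero_add]
  refine sum_congr rfl fun j hj => ?_
  rw [if_neg (ne_of_mem_erase hj), mul_pow, Real.sq_sqrt (by linarith)]

theorem posSemidef_localForm_sub_lower [Fintype ι] {x : ℝ} (hx : 4 * (Fintype.card ι + 1) ≤ x)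
    (m : ι) :
    ((localForm x fun i => if i = m then 0 else 1 / (x - 1))
      - (1 - 1 / x ^ 2) • Matrix.of fun s t => ∑ c, lowerRow x (4 * Fintype.card ι) m c s
          * lowerRow x (4 * Fintype.card ι) m c t).PosSemidef := by
  set k : ℝ := (Fintype.card ι : ℝ) with hk
  have hk0 : 1 ≤ k := by
    have := Fintype.card_pos_iff.2 ⟨m⟩
    rw [hk]
    exact_mod_cast this
  refine posSemidef_of_form (fun s t => ?_) fun v => ?_
  · simp only [Matrix.sub_apply, Matrix.smul_apply, Matrix.of_apply]
    rw [localForm_symm]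
    simp only [mul_comm]
  · simp only [Matrix.sub_apply, mul_sub, sum_sub_distrib, localForm_form, Matrix.smul_apply,
      Matrix.of_apply, smul_eq_mul]
    have e : ∑ s, ∑ t, v s * v t * ((1 - 1 / x ^ 2) * ∑ c, lowerRow x (4 * k) m c s
          * lowerRow x (4 * k) m c t)
        = (1 - 1 / x ^ 2) * ((v none - v (some m)) ^ 2
          + (x - 4 * k) * ∑ j ∈ univ.erase m, v (some j) ^ 2) := by
      rw [← lowerRow_form (by linarith) m v, mul_sum]
      simp only [mul_sum]
      refine sum_congr rfl fun s _ => sum_congr rfl fun t _ => sum_congr rfl fun c _ => by ring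
    rw [e]
    have e2 : ∀ f : ι → ℝ, ∑ i, f i = f m + ∑ i ∈ univ.erase m, f i := fun f =>
      (add_sum_erase univ f (mem_univ m)).symm
    simp only [e2]
    set S := ∑ i ∈ univ.erase m, v (some i) with hS
    set q := ∑ j ∈ univ.erase m, v (some j) ^ 2 with hq
    set u := v none - v (some m) with hu
    have hcard : (#(univ.erase m) : ℝ) ≤ k := by
      rw [hk]
      exact_mod_cast card_le_univ _
    have hSq : S ^ 2 ≤ k * q := by
      refine (sq_sum_le_card_mul_sum_sq).trans ?_
      have : 0 ≤ q := sum_nonneg fun _ _ => sq_nonneg _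
      gcongr
    have hx1 : 0 < x - 1 := by linarith
    have hx0 : 0 < x := by linarith
    rw [sum_congr rfl fun i hi => if_neg (ne_of_mem_erase hi)]
    have e3 : ∑ i ∈ univ.erase m, (if i = m then 0 else 1 / (x - 1))
          * (v none - (v (some m) + S) + x * v (some i)) ^ 2
        = (∑ i ∈ univ.erase m, 1 / (x - 1)) * (u - S) ^ 2
          + (2 * x * (u - S) * S + x ^ 2 * q) / (x - 1) := by
      rw [hS, hq, sum_mul, mul_sum, mul_sum, ← sum_add_distrib, sum_div, ← sum_add_distrib]
      refine sum_congr rfl fun i hi => ?_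
      rw [if_neg (ne_of_mem_erase hi)]
      field_simp
      rw [hu]
      ring
    rw [e3]
    simp only [if_true]
    have e4 : v none - (v (some m) + S) = u - S := by rw [hu]; ring
    rw [e4]
    have hmain : 0 ≤ (u - S) ^ 2 + (2 * x * (u - S) * S + x ^ 2 * q) / (x - 1)
        - (1 - 1 / x ^ 2) * (u ^ 2 + (x - 4 * k) * q) := by
      have hq0 : 0 ≤ q := sum_nonneg fun _ _ => sq_nonneg _
      have e5 : (u - S) ^ 2 + (2 * x * (u - S) * S + x ^ 2 * q) / (x - 1)
          - (1 - 1 / x ^ 2) * (u ^ 2 + (x - 4 * k) * q)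
          = (u / x + x / (x - 1) * S) ^ 2
            + (x ^ 2 / (x - 1) - (1 - 1 / x ^ 2) * (x - 4 * k)) * q
            - ((x + 1) / (x - 1) + (x / (x - 1)) ^ 2) * S ^ 2 := by
        field_simp
        ring
      rw [e5]
      have hr : x / (x - 1) ≤ 8 / 7 := by
        rw [div_le_div_iff₀ hx1 (by norm_num)]
        linarith
      have hr0 : 0 ≤ x / (x - 1) := by positivity
      have hr2 : (x + 1) / (x - 1) ≤ 9 / 7 := by
        rw [div_le_div_iff₀ hx1 (by norm_num)]
        linarith
      have hr3 : x ≤ x ^ 2 / (x - 1) := by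
        rw [le_div_iff₀ hx1]
        nlinarith
      have hr4 : (1 - 1 / x ^ 2) * (x - 4 * k) ≤ x - 4 * k := by
        have : 0 ≤ 1 / x ^ 2 := by positivity
        have : 0 ≤ x - 4 * k := by linarith
        nlinarith
      have h6 : ((x + 1) / (x - 1) + (x / (x - 1)) ^ 2) * S ^ 2 ≤ 4 * (k * q) := by
        have : (x + 1) / (x - 1) + (x / (x - 1)) ^ 2 ≤ 4 := by nlinarith
        calc _ ≤ 4 * S ^ 2 := by gcongr
          _ ≤ _ := by linarith
      have h7 : 4 * k * q ≤ (x ^ 2 / (x - 1) - (1 - 1 / x ^ 2) * (x - 4 * k)) * q := by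
        gcongr
        linarith
      have h8 := sq_nonneg (u / x + x / (x - 1) * S)
      linarith
    linarith

end localForm

section sieveForm
variable {P ι : Type*} [Fintype P] [DecidableEq P] [DecidableEq ι]

/-- The product of the elements of a set of primes. -/
def vol (u : P → ℝ) (T : Finset P) : ℝ := ∏ a ∈ T, u a

/-- The primes to which a configuration assigns the index `i`. -/
def fiber (σ : P → Option ι) (i : ι) : Finset P := univ.filter fun a => σ a = some i

omit [DecidableEq P] in
theorem mem_fiber {σ : P → Option ι} {i : ι} {a : P} : a ∈ fiber σ i ↔ σ a = some i := by
  simp [fiber]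

omit [DecidableEq P] in
theorem prod_fiber [Fintype ι] (σ : P → Option ι) (h : P → ℝ) :
    ∏ i, ∏ a ∈ fiber σ i, h a = ∏ a, (σ a).elim 1 fun _ => h a := by
  simp only [fiber, prod_filter]
  rw [Finset.prod_comm]
  refine prod_congr rfl fun a _ => ?_
  cases h' : σ a with
  | none => simp
  | some i => simp

omit [DecidableEq P] in
theorem sum_fiber [Fintype ι] (σ : P → Option ι) (h : P → ℝ) :
    ∑ i, ∑ a ∈ fiber σ i, h a = ∑ a, (σ a).elim 0 fun _ => h a := by
  simp only [fiber, sum_filter]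
  rw [Finset.sum_comm]
  refine sum_congr rfl fun a _ => ?_
  cases h' : σ a with
  | none => simp
  | some i => simp

omit [DecidableEq P] in
theorem fiber_injective : Function.Injective (fiber : (P → Option ι) → ι → Finset P) := by
  intro σ τ h
  funext a
  ext i
  have := congrArg (fun F => a ∈ F) (congrFun h i)
  simpa [mem_fiber] using this

omit [DecidableEq P] in
theorem exists_fiber_eq {T : ι → Finset P} (hT : ∀ i j, i ≠ j → Disjoint (T i) (T j)) :
    ∃ σ : P → Option ι, fiber σ = T := by
  classical
  refine ⟨fun a => if h : ∃ i, a ∈ T i then some h.choose else none, ?_⟩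
  funext i
  ext a
  rw [mem_fiber]
  constructor
  · intro h
    split_ifs at h with h'
    obtain rfl := Option.some.inj h
    exact h'.choose_spec
  · intro h
    have h' : ∃ i, a ∈ T i := ⟨i, h⟩
    rw [dif_pos h', Option.some_inj]
    by_contra hne
    exact disjoint_left.1 (hT _ _ hne) h'.choose_spec h

theorem sum_fiber_le [Fintype ι] {h : (ι → Finset P) → ℝ} (h0 : ∀ T, 0 ≤ h T) :
    ∑ σ : P → Option ι, h (fiber σ) ≤ ∑ T, h T := by
  rw [← sum_image (f := h) fun σ _ τ _ e => fiber_injective e]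
  exact sum_le_sum_of_subset_of_nonneg (subset_univ _) fun T _ _ => h0 T

theorem le_sum_fiber [Fintype ι] {g : (ι → Finset P) → ℝ} {h : (P → Option ι) → ℝ}
    (hg : ∀ σ, g (fiber σ) ≤ h σ)
    (hg0 : ∀ T : ι → Finset P, (∃ i j, i ≠ j ∧ ¬ Disjoint (T i) (T j)) → g T ≤ 0) :
    ∑ T, g T ≤ ∑ σ, h σ := by
  refine le_trans ?_ (sum_le_sum fun σ _ => hg σ)
  rw [← sum_image (f := g) fun σ _ τ _ e => fiber_injective e,
    ← sum_add_sum_compl (univ.image (fiber : (P → Option ι) → ι → Finset P)) g]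
  refine add_le_of_nonpos_right (sum_nonpos fun T hT => hg0 T ?_)
  by_contra! hd
  obtain ⟨σ, rfl⟩ := exists_fiber_eq hd
  exact mem_compl.1 hT (mem_image_of_mem _ (mem_univ _))

/-- The sieve coefficients: a product weight truncated at `R`. -/
noncomputable def sieveCoeff [Fintype ι] (u : P → ℝ) (f : ℝ → ℝ) (R : ℝ) (σ : P → Option ι) : ℝ :=
  (∏ a, (σ a).elim 1 fun _ => -1 / u a) *
    ((∏ i, f (vol u (fiber σ i))) * if ∏ a, (σ a).elim 1 (fun _ => u a) ≤ R then 1 else 0)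

/-- The sum `∑ f(r)² / r` over products `r` of distinct primes. -/
noncomputable def sqSum (u : P → ℝ) (f : ℝ → ℝ) : ℝ := ∑ T, f (vol u T) ^ 2 / vol u T

/-- The sum `∑ f(r) / r` over products `r` of distinct primes. -/
noncomputable def linSum (u : P → ℝ) (f : ℝ → ℝ) : ℝ := ∑ T, f (vol u T) / vol u T

omit [Fintype P] [DecidableEq P] in
theorem vol_pos {u : P → ℝ} (hu : ∀ a, 0 < u a) (T : Finset P) : 0 < vol u T :=
  prod_pos fun a _ => hu a

omit [DecidableEq P] in
theorem sq_sieveCoeff_mul_le [Fintype ι] {u : P → ℝ} (hu : ∀ a, 0 < u a) (f : ℝ → ℝ) (R : ℝ)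
    (σ : P → Option ι) :
    sieveCoeff u f R σ ^ 2 * ∏ a, (σ a).elim 1 (fun _ => u a)
      ≤ ∏ i, f (vol u (fiber σ i)) ^ 2 / vol u (fiber σ i) := by
  have h2 : (∏ a, (σ a).elim 1 fun _ => -1 / u a) ^ 2 * ∏ a, (σ a).elim 1 (fun _ => u a)
      = (∏ i, vol u (fiber σ i))⁻¹ := by
    simp only [vol]
    rw [prod_fiber, ← prod_pow, ← prod_mul_distrib, ← prod_inv_distrib]
    refine prod_congr rfl fun a _ => ?_
    have := (hu a).ne'
    cases σ a with
    | none => simp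
    | some i =>
      simp only [Option.elim_some]
      field_simp
  have h3 : 0 ≤ (∏ i, vol u (fiber σ i))⁻¹ :=
    inv_nonneg.2 (prod_nonneg fun i _ => (vol_pos hu _).le)
  rw [prod_div_distrib, prod_pow, div_eq_mul_inv, sieveCoeff, mul_pow, mul_right_comm,
    h2, mul_comm]
  refine mul_le_mul_of_nonneg_right ?_ h3
  split_ifs
  · rw [mul_one]
  · rw [mul_zero, zero_pow two_ne_zero]
    positivity

omit [DecidableEq P] in
theorem sum_prod_eq_sqSum_pow [Fintype ι] (u : P → ℝ) (f : ℝ → ℝ) :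
    ∑ T : ι → Finset P, ∏ i, f (vol u (T i)) ^ 2 / vol u (T i) = sqSum u f ^ Fintype.card ι := by
  rw [sqSum, ← card_univ, ← prod_const, prod_univ_sum, Fintype.piFinset_univ]

/-- Upper bound for the main term of the unrestricted sum. -/
theorem diagonal_form_sieveCoeff_le [Fintype ι] {u : P → ℝ} (hu : ∀ a, 0 < u a)
    (hk : ∀ a, (Fintype.card ι : ℝ) ≤ u a) (f : ℝ → ℝ) (R : ℝ) :
    ∑ σ : P → Option ι, ∑ τ : P → Option ι, sieveCoeff u f R σ * sieveCoeff u f R τ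
      * ∏ a, localForm (u a) (fun _ => 1 / u a) (σ a) (τ a) ≤ sqSum u f ^ Fintype.card ι := by
  have h1 : _ ≤ ∑ σ : P → Option ι, ∑ τ : P → Option ι, sieveCoeff u f R σ * sieveCoeff u f R τ
      * ∏ a, Matrix.diagonal (fun s : Option ι => s.elim 1 fun _ => u a) (σ a)
          (τ a) := tensor_form_le (M := fun a => localForm (u a) fun _ : ι => 1 / u a)
    (N := fun a => Matrix.diagonal fun s : Option ι => s.elim 1 fun _ => u a)
    (fun a => posSemidef_localForm _ (fun _ => (one_div_pos.2 (hu a)).le) (by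
      rw [sum_const, card_univ, nsmul_eq_mul, mul_one_div, div_le_one (hu a)]
      exact hk a))
    (fun a => posSemidef_diagonal_sub_localForm (hu a)) (sieveCoeff (ι := ι) u f R)
  refine h1.trans ?_
  calc _ = ∑ σ : P → Option ι, sieveCoeff u f R σ ^ 2 * ∏ a, (σ a).elim 1 fun _ => u a := by
        refine sum_congr rfl fun σ _ => ?_
        rw [sum_eq_single σ]
        · simp [sq]
        · intro τ _ hτ
          obtain ⟨a, ha⟩ := Function.ne_iff.1 hτ
          rw [prod_eq_zero (mem_univ a), mul_zero]
          exact Matrix.diagonal_apply_ne _ ha.symm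
        · simp
    _ ≤ ∑ σ : P → Option ι, ∏ i, f (vol u (fiber σ i)) ^ 2 / vol u (fiber σ i) :=
        sum_le_sum fun σ _ => sq_sieveCoeff_mul_le hu f R σ
    _ ≤ ∑ T : ι → Finset P, ∏ i, f (vol u (T i)) ^ 2 / vol u (T i) :=
        sum_fiber_le (h := fun T => ∏ i, f (vol u (T i)) ^ 2 / vol u (T i))
          fun T => prod_nonneg fun i _ => div_nonneg (sq_nonneg _) (vol_pos hu _).le
    _ = _ := sum_prod_eq_sqSum_pow u f

end sieveForm

section sieveLower
variable {P ι : Type*} [Fintype P] [DecidableEq P] [DecidableEq ι]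

theorem sum_filter_mem_le {u : P → ℝ} (hu : ∀ a, 1 ≤ u a) {g : ℝ → ℝ} (hg : Antitone g)
    (hg0 : ∀ x, 0 ≤ g x) (a : P) :
    ∑ T ∈ univ.filter (fun T : Finset P => a ∈ T), g (vol u T) / vol u T
      ≤ (∑ T, g (vol u T) / vol u T) * (1 / u a) := by
  have hu0 : ∀ a, 0 < u a := fun a => by linarith [hu a]
  have h1 : ∀ T ∈ univ.filter (fun T : Finset P => a ∈ T),
      g (vol u T) / vol u T ≤ g (vol u (T.erase a)) / vol u (T.erase a) * (1 / u a) := by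
    intro T hT
    have hv : vol u T = u a * vol u (T.erase a) := (mul_prod_erase T u (mem_filter.1 hT).2).symm
    have hv0 := vol_pos hu0 (T.erase a)
    rw [hv, ← mul_div_mul_comm, mul_one, mul_comm (vol u (T.erase a))]
    have := hu0 a
    gcongr
    exact hg (le_mul_of_one_le_left hv0.le (hu a))
  refine (sum_le_sum h1).trans ?_
  rw [← sum_mul]
  refine mul_le_mul_of_nonneg_right ?_ (one_div_pos.2 (hu0 a)).le
  rw [← sum_image (f := fun T => g (vol u T) / vol u T) (g := fun T : Finset P => T.erase a)]
  · exact sum_le_sum_of_subset_of_nonneg (subset_univ _) fun T _ _ =>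
      div_nonneg (hg0 _) (vol_pos hu0 _).le
  · intro S hS T hT h
    rw [← insert_erase (mem_filter.1 (mem_coe.1 hS)).2, ← insert_erase (mem_filter.1
        (mem_coe.1 hT)).2]
    exact congrArg (insert a) h

theorem le_sum_filter_disjoint {u : P → ℝ} (hu : ∀ a, 1 ≤ u a) {f : ℝ → ℝ} (hf : Antitone f)
    (hf0 : ∀ x, 0 ≤ f x) (Z : Finset P) :
    linSum u f * (1 - ∑ a ∈ Z, 1 / u a)
      ≤ ∑ T ∈ univ.filter (fun T : Finset P => Disjoint T Z), f (vol u T) / vol u T := by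
  have hu0 : ∀ a, 0 < u a := fun a => by linarith [hu a]
  have h0 : ∀ T : Finset P, 0 ≤ f (vol u T) / vol u T := fun T => div_nonneg (hf0 _)
      (vol_pos hu0 _).le
  have h1 : ∑ T ∈ univ.filter (fun T : Finset P => ¬ Disjoint T Z), f (vol u T) / vol u T
      ≤ ∑ a ∈ Z, linSum u f * (1 / u a) := by
    calc _ ≤ ∑ T : Finset P, ∑ a ∈ Z, if a ∈ T then f (vol u T) / vol u T else 0 := by
          rw [sum_filter]
          refine sum_le_sum fun T _ => ?_
          have hn : ∀ a ∈ Z, 0 ≤ if a ∈ T then f (vol u T) / vol u T else 0 := fun a _ => by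
            split_ifs
            exacts [h0 T, le_rfl]
          split_ifs with hT
          · exact sum_nonneg hn
          · obtain ⟨a, haT, haZ⟩ := not_disjoint_iff.1 hT
            refine le_trans (le_of_eq ?_) (single_le_sum hn haZ)
            rw [if_pos haT]
      _ = ∑ a ∈ Z, ∑ T ∈ univ.filter (fun T : Finset P => a ∈ T), f (vol u T) / vol u T := by
          rw [Finset.sum_comm]
          exact sum_congr rfl fun a _ => (sum_filter _ _).symm
      _ ≤ _ := sum_le_sum fun a _ => sum_filter_mem_le hu hf hf0 a
  have h2 := sum_filter_add_sum_filter_not univ (fun T : Finset P => Disjoint T Z)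
    fun T => f (vol u T) / vol u T
  rw [← mul_sum] at h1
  rw [linSum] at h1 ⊢
  linarith

/-- Add to a configuration avoiding `m` a set of primes assigned to `m`. -/
def extendConfig {m : ι} (σ : P → Option {i // i ≠ m}) (T : Finset P) (a : P) : Option ι :=
  (σ a).elim (if a ∈ T then some m else none) fun i => some i

theorem fiber_extendConfig_self {m : ι} (σ : P → Option {i // i ≠ m}) {T : Finset P}
    (hT : ∀ a ∈ T, σ a = none) : fiber (extendConfig σ T) m = T := by
  ext a
  rw [mem_fiber, extendConfig]
  cases h : σ a with
  | none => simp
  | some i =>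
    have h1 : a ∉ T := fun ha => by simp [hT a ha] at h
    simp [h1, i.2]

theorem fiber_extendConfig {m : ι} (σ : P → Option {i // i ≠ m}) (T : Finset P)
    (i : {i // i ≠ m}) : fiber (extendConfig σ T) i = fiber σ i := by
  ext a
  rw [mem_fiber, mem_fiber, extendConfig]
  cases h : σ a with
  | none =>
    by_cases ha : a ∈ T
    · simp [ha, i.2.symm]
    · simp [ha]
  | some j => simp [Subtype.ext_iff]

/-- The primes used by a configuration. -/
def support (σ : P → Option ι) : Finset P := univ.filter fun a => σ a ≠ none

omit [DecidableEq P] [DecidableEq ι] in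
theorem sum_support (σ : P → Option ι) (h : P → ℝ) :
    ∑ a ∈ support σ, h a = ∑ a, (σ a).elim 0 fun _ => h a := by
  rw [support, sum_filter]
  refine sum_congr rfl fun a _ => ?_
  cases σ a <;> simp

/-- The form of the sieve coefficients against a row of the lower bound is a signed sum of
nonnegative terms. -/
theorem abs_sum_sieveCoeff_lowerRow_ge [Fintype ι] {u : P → ℝ} (hu : ∀ a, 1 ≤ u a) {f : ℝ → ℝ}
    (hf : Antitone f) (hf0 : ∀ x, 0 ≤ f x) {R : ℝ} (hR : ∀ x, f x ≠ 0 → x ≤ √R) (κ : ℝ) (m : ι)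
    (σ : P → Option {i // i ≠ m}) (hσ : ∏ a, (σ a).elim 1 (fun _ => u a) ≤ √R) :
    (∏ i, f (vol u (fiber σ i))) * (∏ a, (σ a).elim 1 fun _ => √(u a - κ) / u a) *
      (linSum u f * (1 - ∑ a, (σ a).elim 0 fun _ => 1 / u a))
      ≤ |∑ τ : P → Option ι, sieveCoeff u f R τ *
          ∏ a, lowerRow (u a) κ m ((σ a).map Subtype.val) (τ a)| := by
  have hu0 : ∀ a, 0 < u a := fun a => by linarith [hu a]
  set ε : ℝ := ∏ a, (σ a).elim 1 fun _ => -1 with hε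
  have hε1 : |ε| = 1 := by
    rw [hε, abs_prod]
    refine prod_eq_one fun a _ => ?_
    cases σ a <;> simp
  set y : (P → Option ι) → ℝ := fun τ =>
    (∏ i, f (vol u (fiber τ i))) * if ∏ a, (τ a).elim 1 (fun _ => u a) ≤ R then 1 else 0 with hy
  have hy0 : ∀ τ, 0 ≤ y τ := fun τ => mul_nonneg (prod_nonneg fun i _ => hf0 _) (by
    split_ifs <;> norm_num)
  set K : (P → Option ι) → P → ℝ := fun τ a => (σ a).elim 1 (fun _ => -1) *
    (τ a).elim 1 (fun _ => -1 / u a) * lowerRow (u a) κ m ((σ a).map Subtype.val) (τ a) with hK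
  have hK0 : ∀ τ a, 0 ≤ K τ a := by
    intro τ a
    have := hu0 a
    simp only [hK]
    cases σ a with
    | none =>
      cases τ a with
      | none => simp [lowerRow]
      | some i =>
        by_cases hi : i = m
        · have h : -1 / u a ≤ 0 := div_nonpos_of_nonpos_of_nonneg (by norm_num) this.le
          simp [lowerRow, hi, h]
        · simp [lowerRow, hi]
    | some j =>
      by_cases hj : τ a = some (j : ι)
      · have h : -1 / u a * √(u a - κ) ≤ 0 := mul_nonpos_of_nonpos_of_nonneg
          (div_nonpos_of_nonpos_of_nonneg (by norm_num) this.le) (Real.sqrt_nonneg _)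
        simpa [lowerRow, hj, j.2] using h
      · simp [lowerRow, hj]
  have h1 : ε * ∑ τ : P → Option ι, sieveCoeff u f R τ *
      ∏ a, lowerRow (u a) κ m ((σ a).map Subtype.val) (τ a) = ∑ τ, y τ * ∏ a, K τ a := by
    rw [mul_sum]
    refine sum_congr rfl fun τ _ => ?_
    simp only [hK, prod_mul_distrib, sieveCoeff, hy, hε]
    ring
  have h2 : |∑ τ : P → Option ι, sieveCoeff u f R τ *
      ∏ a, lowerRow (u a) κ m ((σ a).map Subtype.val) (τ a)| = ∑ τ, y τ * ∏ a, K τ a := by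
    rw [← one_mul |_|, ← hε1, ← abs_mul, h1, abs_of_nonneg]
    exact sum_nonneg fun τ _ => mul_nonneg (hy0 τ) (prod_nonneg fun a _ => hK0 τ a)
  rw [h2]
  set D := univ.filter fun T : Finset P => Disjoint T (support σ) with hD
  have hDσ : ∀ T ∈ D, ∀ a ∈ T, σ a = none := by
    intro T hT a ha
    by_contra h
    exact disjoint_left.1 (mem_filter.1 hT).2 ha (mem_filter.2 ⟨mem_univ _, h⟩)
  have hinj : Set.InjOn (extendConfig σ : Finset P → P → Option ι) D := by
    intro S hS T hT h
    rw [← fiber_extendConfig_self σ (hDσ S hS), h, fiber_extendConfig_self σ (hDσ T hT)]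
  have h3 : ∑ T ∈ D, y (extendConfig σ T) * ∏ a, K (extendConfig σ T) a
      ≤ ∑ τ, y τ * ∏ a, K τ a := by
    rw [← sum_image (f := fun τ => y τ * ∏ a, K τ a) hinj]
    exact sum_le_sum_of_subset_of_nonneg (subset_univ _) fun τ _ _ =>
      mul_nonneg (hy0 τ) (prod_nonneg fun a _ => hK0 τ a)
  refine le_trans ?_ h3
  have h4 : ∀ T ∈ D, y (extendConfig σ T) * ∏ a, K (extendConfig σ T) a
      = (∏ i, f (vol u (fiber σ i))) * (∏ a, (σ a).elim 1 fun _ => √(u a - κ) / u a) *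
        (f (vol u T) / vol u T) := by
    intro T hT
    have e1 : ∏ i, f (vol u (fiber (extendConfig σ T) i))
        = f (vol u T) * ∏ i, f (vol u (fiber σ i)) := by
      rw [Fintype.prod_eq_mul_prod_subtype_ne _ m, fiber_extendConfig_self σ (hDσ T hT)]
      simp only [fiber_extendConfig]
    have e2 : ∏ a, (extendConfig σ T a).elim 1 (fun _ => u a)
        = (∏ a, (σ a).elim 1 (fun _ => u a)) * vol u T := by
      rw [vol, ← Fintype.prod_ite_mem T u, ← prod_mul_distrib]
      refine prod_congr rfl fun a _ => ?_
      by_cases ha : a ∈ T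
      · simp [extendConfig, ha, hDσ T hT a ha]
      · cases h : σ a <;> simp [extendConfig, ha, h]
    have e3 : ∏ a, K (extendConfig σ T) a
        = (∏ a, (σ a).elim 1 fun _ => √(u a - κ) / u a) * (vol u T)⁻¹ := by
      rw [vol, ← Fintype.prod_ite_mem T u, ← prod_inv_distrib, ← prod_mul_distrib]
      refine prod_congr rfl fun a _ => ?_
      have := hu0 a
      by_cases ha : a ∈ T
      · simp [hK, extendConfig, lowerRow, ha, hDσ T hT a ha, neg_div]
      · cases h : σ a with
        | none => simp [hK, extendConfig, lowerRow, ha, h]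
        | some j =>
          simp [hK, extendConfig, lowerRow, ha, h, j.2]
          ring
    have e4 : f (vol u T) * (if (∏ a, (σ a).elim 1 (fun _ => u a)) * vol u T ≤ R then 1 else 0)
        = f (vol u T) := by
      by_cases hfz : f (vol u T) = 0
      · rw [hfz, zero_mul]
      · rw [if_pos, mul_one]
        have hR0 : 0 ≤ R := by
          by_contra! h
          have := (vol_pos hu0 T).trans_le (hR _ hfz)
          rw [Real.sqrt_eq_zero_of_nonpos h.le] at this
          exact lt_irrefl _ this
        calc _ ≤ √R * √R := mul_le_mul hσ (hR _ hfz) (vol_pos hu0 T).le (Real.sqrt_nonneg R)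
          _ = R := Real.mul_self_sqrt hR0
    simp only [hy]
    rw [e1, e2, e3, mul_right_comm (f (vol u T)), e4]
    ring
  rw [sum_congr rfl h4, ← mul_sum]
  refine mul_le_mul_of_nonneg_left ?_ (mul_nonneg (prod_nonneg fun i _ => hf0 _)
    (prod_nonneg fun a _ => ?_))
  · rw [← sum_support]
    exact le_sum_filter_disjoint hu hf hf0 _
  · have := hu0 a
    cases σ a with
    | none => simp
    | some i =>
      simp only [Option.elim_some]
      positivity

end sieveLower

section sieveLowerB
variable {P ι : Type*} [Fintype P] [DecidableEq P] [Fintype ι] [DecidableEq ι]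

omit [Fintype P] [DecidableEq P] [Fintype ι] [DecidableEq ι] in
theorem one_sub_sum_le_prod_one_sub (s : Finset P) {x : P → ℝ} (h0 : ∀ a, 0 ≤ x a)
    (h1 : ∀ a, x a ≤ 1) : 1 - ∑ a ∈ s, x a ≤ ∏ a ∈ s, (1 - x a) := by
  classical
  induction s using Finset.induction_on with
  | empty => simp
  | insert a s ha ih =>
    rw [sum_insert ha, prod_insert ha]
    have hp0 : 0 ≤ ∏ a ∈ s, (1 - x a) := prod_nonneg fun a _ => by linarith [h1 a]
    have hp1 : ∏ a ∈ s, (1 - x a) ≤ 1 :=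
      prod_le_one (fun a _ => by linarith [h1 a]) fun a _ => by linarith [h0 a]
    nlinarith [h0 a]

omit [Fintype P] [DecidableEq P] in
theorem sum_prod_mul_prod_le {α : Type*} [Fintype α] {h : α → ℝ} (h0 : ∀ S, 0 ≤ h S)
    {χ : ι → α → ℝ} (hχ : ∀ i S, 0 ≤ χ i S) {θ : ι → ℝ}
    (hθ : ∀ i, ∑ S, h S * χ i S ≤ (∑ S, h S) * θ i) :
    ∑ T : ι → α, (∏ i, h (T i)) * ∏ i, χ i (T i) ≤ (∑ S, h S) ^ Fintype.card ι * ∏ i, θ i := by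
  have h1 := prod_univ_sum (fun _ : ι => (univ : Finset α)) fun i S => h S * χ i S
  rw [Fintype.piFinset_univ] at h1
  simp only [← prod_mul_distrib]
  rw [← h1, ← card_univ, ← prod_const, ← prod_mul_distrib]
  exact prod_le_prod (fun i _ => sum_nonneg fun S _ => mul_nonneg (h0 S) (hχ i S)) fun i _ => hθ i

omit [Fintype P] [DecidableEq P] in
theorem sum_prod_mul_single_le {α : Type*} [Fintype α] {h : α → ℝ} (h0 : ∀ S, 0 ≤ h S)
    {χ : α → ℝ} (hχ : ∀ S, 0 ≤ χ S) {θ : ℝ} (hθ : ∑ S, h S * χ S ≤ (∑ S, h S) * θ) (i : ι) :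
    ∑ T : ι → α, (∏ i, h (T i)) * χ (T i) ≤ (∑ S, h S) ^ Fintype.card ι * θ := by
  have := sum_prod_mul_prod_le h0 (χ := fun j S => if j = i then χ S else 1)
    (θ := fun j => if j = i then θ else 1) (fun j S => by split_ifs <;> simp [hχ]) fun j => by
      split_ifs <;> simp [hθ]
  simpa using this

omit [Fintype P] [DecidableEq P] in
theorem sum_prod_mul_pair_le {α : Type*} [Fintype α] {h : α → ℝ} (h0 : ∀ S, 0 ≤ h S)
    {χ : α → ℝ} (hχ : ∀ S, 0 ≤ χ S) {θ : ℝ} (hθ : ∑ S, h S * χ S ≤ (∑ S, h S) * θ) {i j : ι}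
    (hij : i ≠ j) :
    ∑ T : ι → α, (∏ i, h (T i)) * (χ (T i) * χ (T j))
      ≤ (∑ S, h S) ^ Fintype.card ι * (θ * θ) := by
  have := sum_prod_mul_prod_le h0
    (χ := fun l S => (if l = i then χ S else 1) * if l = j then χ S else 1)
    (θ := fun l => (if l = i then θ else 1) * if l = j then θ else 1)
    (fun l S => by split_ifs <;> simp [hχ, mul_nonneg]) fun l => by
      by_cases hi : l = i
      · have hj : l ≠ j := fun h => hij (hi.symm.trans h)
        simpa [hi, hij] using hθ
      · by_cases hj : l = j
        · simpa [hi, hj, hij.symm] using hθ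
        · simp [hi, hj]
  simp only [prod_mul_distrib, prod_ite_eq', mem_univ, if_true] at this
  exact this

/-- A bound for the proportion of a tuple of sets of primes lost when forcing disjointness, a
bounded total size and few small primes. -/
noncomputable def configLoss (u : P → ℝ) (κ R : ℝ) (T : ι → Finset P) : ℝ :=
  ∑ i, (κ + 2) * ∑ a ∈ T i, 1 / u a + ∑ i, 2 / Real.log R * Real.log (vol u (T i))
    + ∑ i, ∑ j ∈ univ.erase i, ∑ a, (if a ∈ T i then 1 else 0) * if a ∈ T j then 1 else 0

theorem sum_configLoss_le {u : P → ℝ} (hu : ∀ a, 1 ≤ u a) {f : ℝ → ℝ} (hf : Antitone f)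
    (hf0 : ∀ x, 0 ≤ f x) {κ R b : ℝ} (hκ : 0 ≤ κ) (hR : 1 < R)
    (hb : ∑ T, f (vol u T) ^ 2 / vol u T * Real.log (vol u T) ≤ sqSum u f * (b * Real.log R)) :
    ∑ T : ι → Finset P, (∏ i, f (vol u (T i)) ^ 2 / vol u (T i)) * configLoss u κ R T
      ≤ sqSum u f ^ Fintype.card ι * (Fintype.card ι * ((κ + 2) * ∑ a, 1 / u a ^ 2) +
        Fintype.card ι * (2 * b) + Fintype.card ι ^ 2 * ∑ a, 1 / u a ^ 2) := by
  have hu0 : ∀ a, 0 < u a := fun a => by linarith [hu a]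
  have hlR := Real.log_pos hR
  set h : Finset P → ℝ := fun S => f (vol u S) ^ 2 / vol u S with hh
  have h0 : ∀ S, 0 ≤ h S := fun S => div_nonneg (sq_nonneg _) (vol_pos hu0 S).le
  have hf2 : Antitone fun x => f x ^ 2 := fun x y hxy => pow_le_pow_left₀ (hf0 y) (hf hxy) 2
  have hmem : ∀ a, ∑ S, h S * (if a ∈ S then 1 else 0) ≤ (∑ S, h S) * (1 / u a) := by
    intro a
    refine le_trans (le_of_eq ?_) (sum_filter_mem_le hu hf2 (fun x => sq_nonneg (f x)) a)
    simp only [mul_ite, mul_one, mul_zero]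
    exact (sum_filter _ _).symm
  have hα : sqSum u f = ∑ S, h S := rfl
  have hδ0 : 0 ≤ ∑ a, 1 / u a ^ 2 := sum_nonneg fun a _ => by positivity
  have hα0 : 0 ≤ ∑ S, h S := sum_nonneg fun S _ => h0 S
  have h1 : ∀ i, ∑ T : ι → Finset P, (∏ i, h (T i)) * ((κ + 2) * ∑ a ∈ T i, 1 / u a)
      ≤ (∑ S, h S) ^ Fintype.card ι * ((κ + 2) * ∑ a, 1 / u a ^ 2) := by
    intro i
    refine sum_prod_mul_single_le h0 (χ := fun S => (κ + 2) * ∑ a ∈ S, 1 / u a) (fun S =>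
      mul_nonneg (by linarith) (sum_nonneg fun a _ => (one_div_pos.2 (hu0 a)).le)) ?_ i
    calc ∑ S, h S * ((κ + 2) * ∑ a ∈ S, 1 / u a)
        = (κ + 2) * ∑ a, 1 / u a * ∑ S, h S * (if a ∈ S then 1 else 0) := by
          simp only [mul_sum]
          rw [Finset.sum_comm]
          refine sum_congr rfl fun S _ => ?_
          rw [← sum_filter_add_sum_filter_not univ (fun a => a ∈ S), filter_univ_mem]
          rw [sum_eq_zero (s := univ.filter fun a => a ∉ S) fun a ha => by
            simp [(mem_filter.1 ha).2], add_zero]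
          refine sum_congr rfl fun a ha => ?_
          rw [if_pos ha]
          ring
      _ ≤ (κ + 2) * ∑ a, 1 / u a * ((∑ S, h S) * (1 / u a)) := by
          refine mul_le_mul_of_nonneg_left (sum_le_sum fun a _ => ?_) (by linarith)
          exact mul_le_mul_of_nonneg_left (hmem a) (one_div_pos.2 (hu0 a)).le
      _ = _ := by
          simp only [mul_sum]
          refine sum_congr rfl fun a _ => ?_
          field_simp
  have h2 : ∀ i, ∑ T : ι → Finset P, (∏ i, h (T i)) * (2 / Real.log R * Real.log (vol u (T i)))
      ≤ (∑ S, h S) ^ Fintype.card ι * (2 * b) := by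
    intro i
    refine sum_prod_mul_single_le h0 (χ := fun S => 2 / Real.log R * Real.log (vol u S)) (fun S =>
      mul_nonneg (by positivity) (Real.log_nonneg (one_le_prod fun a _ => hu a))) ?_ i
    calc ∑ S, h S * (2 / Real.log R * Real.log (vol u S))
        = 2 / Real.log R * ∑ S, h S * Real.log (vol u S) := by
          rw [mul_sum]
          exact sum_congr rfl fun S _ => by ring
      _ ≤ 2 / Real.log R * ((∑ S, h S) * (b * Real.log R)) :=
          mul_le_mul_of_nonneg_left hb (by positivity)
      _ = _ := by field_simp
  have h3 : ∀ i, ∀ j ∈ univ.erase i, ∀ a, ∑ T : ι → Finset P, (∏ i, h (T i)) *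
      ((if a ∈ T i then 1 else 0) * if a ∈ T j then 1 else 0)
      ≤ (∑ S, h S) ^ Fintype.card ι * (1 / u a ^ 2) := by
    intro i j hj a
    have := sum_prod_mul_pair_le h0 (χ := fun S => if a ∈ S then 1 else 0)
      (fun S => by split_ifs <;> norm_num) (hmem a) (ne_of_mem_erase hj).symm
    refine this.trans (le_of_eq ?_)
    rw [sq]
    field_simp
  calc _ = ∑ i : ι, ∑ T : ι → Finset P, (∏ i, h (T i)) * ((κ + 2) * ∑ a ∈ T i, 1 / u a)
        + ∑ i : ι, ∑ T : ι → Finset P, (∏ i, h (T i)) * (2 / Real.log R * Real.log (vol u (T i)))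
        + ∑ i : ι, ∑ j ∈ univ.erase i, ∑ a, ∑ T : ι → Finset P, (∏ i, h (T i)) *
          ((if a ∈ T i then 1 else 0) * if a ∈ T j then 1 else 0) := by
        have e1 : ∀ T : ι → Finset P, (∏ i, h (T i)) * configLoss u κ R T
            = ∑ i, (∏ i, h (T i)) * ((κ + 2) * ∑ a ∈ T i, 1 / u a)
            + ∑ i, (∏ i, h (T i)) * (2 / Real.log R * Real.log (vol u (T i)))
            + ∑ i, ∑ j ∈ univ.erase i, ∑ a, (∏ i, h (T i)) *
              ((if a ∈ T i then 1 else 0) * if a ∈ T j then 1 else 0) := by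
          intro T
          simp only [configLoss, mul_add, ← mul_sum]
        rw [sum_congr rfl fun T _ => e1 T, sum_add_distrib, sum_add_distrib]
        congr 1
        · congr 1 <;> exact Finset.sum_comm
        · rw [Finset.sum_comm]
          refine sum_congr rfl fun i _ => ?_
          rw [Finset.sum_comm]
          exact sum_congr rfl fun j _ => Finset.sum_comm
    _ ≤ ∑ i : ι, (∑ S, h S) ^ Fintype.card ι * ((κ + 2) * ∑ a, 1 / u a ^ 2)
        + ∑ i : ι, (∑ S, h S) ^ Fintype.card ι * (2 * b)
        + ∑ i : ι, ∑ j : ι, ∑ a, (∑ S, h S) ^ Fintype.card ι * (1 / u a ^ 2) := by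
        refine add_le_add (add_le_add (sum_le_sum fun i _ => h1 i) (sum_le_sum fun i _ => h2 i))
          (sum_le_sum fun i _ => ?_)
        refine (sum_le_sum fun j hj => sum_le_sum fun a _ => h3 i j hj a).trans ?_
        exact sum_le_sum_of_subset_of_nonneg (erase_subset _ _) fun j _ _ =>
          sum_nonneg fun a _ => by positivity
    _ = _ := by
        simp only [sum_const, card_univ, nsmul_eq_mul, ← mul_sum]
        rw [hα]
        ring

theorem sq_abs_sieveCoeff_lowerRow_ge {u : P → ℝ} (hu : ∀ a, 1 ≤ u a) {f : ℝ → ℝ}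
    (hf : Antitone f) (hf0 : ∀ x, 0 ≤ f x) {R : ℝ} (hR : ∀ x, f x ≠ 0 → x ≤ √R) (hR1 : 1 < R)
    {κ : ℝ} (hκ : 0 ≤ κ) (huκ : ∀ a, κ ≤ u a) (m : ι) (σ : P → Option {i // i ≠ m}) :
    linSum u f ^ 2 * ((∏ i, f (vol u (fiber σ i)) ^ 2 / vol u (fiber σ i)) *
        (1 - configLoss u κ R (fiber σ)))
      ≤ (∑ τ : P → Option ι, sieveCoeff u f R τ *
          ∏ a, lowerRow (u a) κ m ((σ a).map Subtype.val) (τ a)) ^ 2 := by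
  have hu0 : ∀ a, 0 < u a := fun a => by linarith [hu a]
  have hlR := Real.log_pos hR1
  set w := ∏ i, f (vol u (fiber σ i)) ^ 2 / vol u (fiber σ i) with hw
  have hw0 : 0 ≤ w := prod_nonneg fun i _ => div_nonneg (sq_nonneg _) (vol_pos hu0 _).le
  set s := ∑ a, (σ a).elim 0 fun _ => 1 / u a with hs
  have hs0 : 0 ≤ s := sum_nonneg fun a _ => by
    have := hu0 a
    cases σ a <;> simp [this.le]
  set V := ∏ a, (σ a).elim 1 fun _ => u a with hV
  have hVpos : 0 < V := prod_pos fun a _ => by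
    have := hu0 a
    cases σ a <;> simp [this]
  have hlog : ∑ i, Real.log (vol u (fiber σ i)) = Real.log V := by
    rw [← Real.log_prod fun i _ => (vol_pos hu0 _).ne', hV, ← prod_fiber]
    rfl
  have hlV : 0 ≤ Real.log V := by
    rw [← hlog]
    exact sum_nonneg fun i _ => Real.log_nonneg (one_le_prod fun a _ => hu a)
  have hloss : (κ + 2) * s + 2 / Real.log R * Real.log V ≤ configLoss u κ R (fiber σ) := by
    rw [configLoss, ← mul_sum, ← mul_sum, sum_fiber, hlog]
    refine le_add_of_nonneg_right (sum_nonneg fun i _ => sum_nonneg fun j _ => sum_nonneg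
        fun a _ => ?_)
    split_ifs <;> norm_num
  by_cases hl : 1 ≤ configLoss u κ R (fiber σ)
  · refine le_trans ?_ (sq_nonneg _)
    exact mul_nonpos_of_nonneg_of_nonpos (sq_nonneg _)
      (mul_nonpos_of_nonneg_of_nonpos hw0 (by linarith))
  push Not at hl
  have h2R : 0 ≤ 2 / Real.log R * Real.log V := by positivity
  have hks : 0 ≤ κ * s := by positivity
  have hsR : V ≤ √R := by
    have h1 : 2 / Real.log R * Real.log V < 1 := by nlinarith
    have h2 : Real.log V < Real.log R / 2 := by
      rw [div_mul_eq_mul_div, div_lt_one hlR] at h1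
      linarith
    rw [← Real.log_sqrt (by linarith)] at h2
    exact ((Real.log_lt_log_iff hVpos (Real.sqrt_pos.2 (by linarith))).1 h2).le
  have h1 := abs_sum_sieveCoeff_lowerRow_ge hu hf hf0 hR κ m σ hsR
  have hB0 : 0 ≤ linSum u f := sum_nonneg fun T _ => div_nonneg (hf0 _) (vol_pos hu0 _).le
  set q := ∏ a, (σ a).elim 1 fun _ => √(u a - κ) / u a with hq
  have hq0 : 0 ≤ q := prod_nonneg fun a _ => by
    have := hu0 a
    cases σ a <;> simp
    positivity
  have hf' : 0 ≤ ∏ i, f (vol u (fiber σ i)) := prod_nonneg fun i _ => hf0 _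
  have hs1 : s ≤ 1 := by nlinarith
  rw [← sq_abs (∑ τ : P → Option ι, _)]
  refine le_trans ?_ (pow_le_pow_left₀ (mul_nonneg (mul_nonneg hf' hq0)
    (mul_nonneg hB0 (by linarith))) h1 2)
  have hq2 : q ^ 2 ≥ V⁻¹ * (1 - κ * s) := by
    have e1 : q ^ 2 = V⁻¹ * ∏ a, (1 - (σ a).elim 0 fun _ => κ / u a) := by
      rw [hq, hV, ← prod_pow, ← prod_inv_distrib, ← prod_mul_distrib]
      refine prod_congr rfl fun a _ => ?_
      have := hu0 a
      cases σ a with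
      | none => simp
      | some i =>
        simp only [Option.elim_some]
        rw [div_pow, Real.sq_sqrt (by linarith [huκ a])]
        field_simp
    rw [e1]
    refine mul_le_mul_of_nonneg_left ?_ (inv_pos.2 hVpos).le
    have e2 : κ * s = ∑ a, (σ a).elim 0 fun _ => κ / u a := by
      rw [hs, mul_sum]
      refine sum_congr rfl fun a _ => ?_
      cases σ a <;> simp [div_eq_mul_inv]
    rw [e2]
    refine one_sub_sum_le_prod_one_sub _ (fun a => ?_) (fun a => ?_)
    · have := hu0 a
      cases σ a <;> simp
      positivity
    · have := hu0 a
      cases σ a <;> simp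
      exact div_le_one_of_le₀ (huκ a) this.le
  have hwV : w = (∏ i, f (vol u (fiber σ i))) ^ 2 * V⁻¹ := by
    rw [hw, hV, ← prod_fiber, prod_div_distrib, prod_pow, div_eq_mul_inv]
    rfl
  have h3 : 1 - configLoss u κ R (fiber σ) ≤ (1 - κ * s) * (1 - s) ^ 2 := by
    nlinarith [mul_nonneg hks hs0, mul_nonneg (mul_nonneg hks hs0) hs0, sq_nonneg s,
      mul_nonneg (mul_nonneg hks hs0) (by linarith : 0 ≤ 1 - s)]
  calc _ ≤ linSum u f ^ 2 * (w * ((1 - κ * s) * (1 - s) ^ 2)) := by gcongr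
    _ = (linSum u f ^ 2 * (∏ i, f (vol u (fiber σ i))) ^ 2 * (1 - s) ^ 2) *
        (V⁻¹ * (1 - κ * s)) := by
        rw [hwV]
        ring
    _ ≤ (linSum u f ^ 2 * (∏ i, f (vol u (fiber σ i))) ^ 2 * (1 - s) ^ 2) * q ^ 2 := by gcongr
    _ = _ := by ring

theorem sum_configLoss_form_le {u : P → ℝ} (hu : ∀ a, 1 ≤ u a) {f : ℝ → ℝ} (hf : Antitone f)
    (hf0 : ∀ x, 0 ≤ f x) {R : ℝ} (hR : ∀ x, f x ≠ 0 → x ≤ √R) (hR1 : 1 < R)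
    {κ : ℝ} (hκ : 0 ≤ κ) (huκ : ∀ a, κ ≤ u a) (m : ι) :
    linSum u f ^ 2 * ∑ T : {i // i ≠ m} → Finset P, (∏ i, f (vol u (T i)) ^ 2 / vol u (T i)) *
        (1 - configLoss u κ R T)
      ≤ ∑ c : P → Option ι, (∑ τ : P → Option ι, sieveCoeff u f R τ *
          ∏ a, lowerRow (u a) κ m (c a) (τ a)) ^ 2 := by
  have hu0 : ∀ a, 0 < u a := fun a => by linarith [hu a]
  have hinj : Function.Injective fun (σ : P → Option {i // i ≠ m}) a => (σ a).map Subtype.val := by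
    intro σ τ h
    funext a
    exact Option.map_injective Subtype.val_injective (congrFun h a)
  calc _ = ∑ T : {i // i ≠ m} → Finset P, linSum u f ^ 2 *
        ((∏ i, f (vol u (T i)) ^ 2 / vol u (T i)) * (1 - configLoss u κ R T)) := by rw [mul_sum]
    _ ≤ ∑ σ : P → Option {i // i ≠ m}, (∑ τ : P → Option ι, sieveCoeff u f R τ *
          ∏ a, lowerRow (u a) κ m ((σ a).map Subtype.val) (τ a)) ^ 2 := by
        refine le_sum_fiber (fun σ =>
          sq_abs_sieveCoeff_lowerRow_ge hu hf hf0 hR hR1 hκ huκ m σ) ?_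
        rintro T ⟨i, j, hij, hT⟩
        obtain ⟨a, hai, haj⟩ := not_disjoint_iff.1 hT
        refine mul_nonpos_of_nonneg_of_nonpos (sq_nonneg _) (mul_nonpos_of_nonneg_of_nonpos
          (prod_nonneg fun i _ => div_nonneg (sq_nonneg _) (vol_pos hu0 _).le) ?_)
        rw [sub_nonpos, configLoss]
        have hn : ∀ i j : {i // i ≠ m}, ∀ a : P, (0 : ℝ) ≤
            (if a ∈ T i then 1 else 0) * if a ∈ T j then 1 else 0 := fun i j a => by
          split_ifs <;> norm_num
        refine le_add_of_nonneg_of_le (add_nonneg (sum_nonneg fun i _ => ?_)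
          (sum_nonneg fun i _ => ?_)) ?_
        · exact mul_nonneg (by linarith) (sum_nonneg fun a _ => (one_div_pos.2 (hu0 a)).le)
        · have := Real.log_pos hR1
          have := Real.log_nonneg (one_le_prod (s := T i) fun a _ => hu a)
          rw [vol]
          positivity
        · calc (1 : ℝ) = (if a ∈ T i then 1 else 0) * if a ∈ T j then 1 else 0 := by
                rw [if_pos hai, if_pos haj, mul_one]
            _ ≤ _ := single_le_sum (fun a _ => hn i j a) (mem_univ a)
            _ ≤ _ := single_le_sum (f := fun j => ∑ a, (if a ∈ T i then (1 : ℝ) else 0) *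
                if a ∈ T j then 1 else 0) (fun j _ => sum_nonneg fun a _ => hn i j a)
                (mem_erase.2 ⟨hij.symm, mem_univ j⟩)
            _ ≤ _ := single_le_sum (f := fun i => ∑ j ∈ univ.erase i, ∑ a,
                (if a ∈ T i then (1 : ℝ) else 0) * if a ∈ T j then 1 else 0)
                (fun i _ => sum_nonneg fun j _ => sum_nonneg fun a _ => hn i j a) (mem_univ i)
    _ ≤ _ := by
        rw [← sum_image (f := fun c => (∑ τ : P → Option ι, sieveCoeff u f R τ *
          ∏ a, lowerRow (u a) κ m (c a) (τ a)) ^ 2) (hinj.injOn)]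
        exact sum_le_sum_of_subset_of_nonneg (subset_univ _) fun c _ _ => sq_nonneg _

/-- Lower bound for the form of the sieve coefficients detecting a prime at the place `m`. -/
theorem form_sieveCoeff_ge {u : P → ℝ} (hu : ∀ a, 4 * (Fintype.card ι + 1 : ℝ) ≤ u a) {f : ℝ → ℝ}
    (hf : Antitone f) (hf0 : ∀ x, 0 ≤ f x) {R : ℝ} (hR : ∀ x, f x ≠ 0 → x ≤ √R) (hR1 : 1 < R)
    (hδ : 20 * (Fintype.card ι + 1 : ℝ) ^ 2 * ∑ a, 1 / u a ^ 2 ≤ 1)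
    (hb : ∑ T, f (vol u T) ^ 2 / vol u T * Real.log (vol u T)
      ≤ sqSum u f * (1 / (8 * Fintype.card ι) * Real.log R)) (m : ι) :
    1 / 4 * linSum u f ^ 2 * sqSum u f ^ (Fintype.card ι - 1)
      ≤ ∑ σ : P → Option ι, ∑ τ : P → Option ι, sieveCoeff u f R σ * sieveCoeff u f R τ *
        ∏ a, localForm (u a) (fun i => if i = m then 0 else 1 / (u a - 1)) (σ a) (τ a) := by
  have hk0 : (1 : ℝ) ≤ Fintype.card ι := by exact_mod_cast Fintype.card_pos_iff.2 ⟨m⟩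
  have hu1 : ∀ a, 1 ≤ u a := fun a => by linarith [hu a]
  have hu0 : ∀ a, 0 < u a := fun a => by linarith [hu a]
  set δ := ∑ a, 1 / u a ^ 2 with hδ_def
  have hδ0 : 0 ≤ δ := sum_nonneg fun a _ => by have := hu0 a; positivity
  set κ : ℝ := 4 * Fintype.card ι with hκ
  have hc : Fintype.card {i // i ≠ m} = Fintype.card ι - 1 := by
    rw [Fintype.card_subtype_compl, Fintype.card_subtype_eq]
  have hα0 : 0 ≤ sqSum u f := sum_nonneg fun T _ => div_nonneg (sq_nonneg _) (vol_pos hu0 _).le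
  set M : P → Matrix (Option ι) (Option ι) ℝ := fun a => (1 - 1 / u a ^ 2) •
    Matrix.of fun s t => ∑ c, lowerRow (u a) κ m c s * lowerRow (u a) κ m c t with hM
  have hMp : ∀ a, (M a).PosSemidef := by
    intro a
    refine posSemidef_of_form (fun s t => ?_) fun v => ?_
    · simp [hM, mul_comm]
    · have hx : κ ≤ u a := by linarith [hu a]
      have h1 := lowerRow_form hx m v
      have h2 : 0 ≤ ∑ s, ∑ t, v s * v t * ∑ c, lowerRow (u a) κ m c s * lowerRow (u a) κ m c t := by
        rw [h1]
        exact add_nonneg (sq_nonneg _) (mul_nonneg (by linarith) (sum_nonneg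
            fun j _ => sq_nonneg _))
      have h3 : 0 ≤ 1 - 1 / u a ^ 2 := by
        rw [sub_nonneg]
        exact div_le_one_of_le₀ (by nlinarith [hu1 a]) (sq_nonneg _)
      have h4 := mul_nonneg h3 h2
      refine h4.trans (le_of_eq ?_)
      simp only [mul_sum, hM, Matrix.smul_apply, Matrix.of_apply, smul_eq_mul]
      refine sum_congr rfl fun s _ => sum_congr rfl fun t _ => sum_congr rfl fun c _ => ?_
      ring
  have h1 := tensor_form_le hMp (fun a => posSemidef_localForm_sub_lower (hu a) m)
      (sieveCoeff u f R)
  refine le_trans ?_ h1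
  set Q := ∏ a, (1 - 1 / u a ^ 2) with hQ
  have hQ1 : 1 / 2 ≤ Q := by
    have e1 : 1 - δ ≤ Q := one_sub_sum_le_prod_one_sub _ (fun a => by
      have := hu0 a
      positivity) fun a => div_le_one_of_le₀ (by nlinarith [hu1 a]) (sq_nonneg _)
    nlinarith
  have h2 : ∑ σ : P → Option ι, ∑ τ : P → Option ι, sieveCoeff u f R σ * sieveCoeff u f R τ *
        ∏ a, M a (σ a) (τ a)
      = Q * ∑ c : P → Option ι, (∑ τ : P → Option ι, sieveCoeff u f R τ *
          ∏ a, lowerRow (u a) κ m (c a) (τ a)) ^ 2 := by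
    rw [← tensor_form_eq_sum_sq, mul_sum]
    refine sum_congr rfl fun σ _ => ?_
    rw [mul_sum]
    refine sum_congr rfl fun τ _ => ?_
    simp only [hM, Matrix.smul_apply, Matrix.of_apply, smul_eq_mul, prod_mul_distrib]
    rw [← hQ]
    ring
  rw [h2]
  have h3 := sum_configLoss_form_le hu1 hf hf0 hR hR1 (by positivity : 0 ≤ κ)
    (fun a => by linarith [hu a]) m
  have h4 := sum_configLoss_le (ι := {i // i ≠ m}) hu1 hf hf0 (by positivity : 0 ≤ κ) hR1 hb
  have h5 : ∑ T : {i // i ≠ m} → Finset P, ∏ i, f (vol u (T i)) ^ 2 / vol u (T i)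
      = sqSum u f ^ (Fintype.card ι - 1) := by
    rw [sum_prod_eq_sqSum_pow, hc]
  have h6 : sqSum u f ^ (Fintype.card ι - 1) * (1 / 2) ≤
      ∑ T : {i // i ≠ m} → Finset P, (∏ i, f (vol u (T i)) ^ 2 / vol u (T i)) *
        (1 - configLoss u κ R T) := by
    simp only [mul_sub, mul_one, sum_sub_distrib]
    rw [h5]
    have h7 : ∑ T : {i // i ≠ m} → Finset P, (∏ i, f (vol u (T i)) ^ 2 / vol u (T i)) *
        configLoss u κ R T ≤ sqSum u f ^ (Fintype.card ι - 1) * (1 / 2) := by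
      refine h4.trans ?_
      rw [hc]
      refine mul_le_mul_of_nonneg_left ?_ (pow_nonneg hα0 _)
      have hc1 : ((Fintype.card ι - 1 : ℕ) : ℝ) ≤ (Fintype.card ι : ℝ) := by
        exact_mod_cast Nat.sub_le _ _
      set k : ℝ := (Fintype.card ι : ℝ)
      have hc0 : (0 : ℝ) ≤ ((Fintype.card ι - 1 : ℕ) : ℝ) := Nat.cast_nonneg _
      set c : ℝ := ((Fintype.card ι - 1 : ℕ) : ℝ)
      have hk0' : 0 < k := by linarith
      calc c * ((κ + 2) * δ) + c * (2 * (1 / (8 * k))) + c ^ 2 * δ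
          ≤ k * ((κ + 2) * δ) + k * (2 * (1 / (8 * k))) + k ^ 2 * δ := by gcongr
        _ = (5 * k ^ 2 + 2 * k) * δ + 1 / 4 := by
            rw [hκ]
            field_simp
            ring
        _ ≤ _ := by nlinarith
    linarith
  have hS0 : 0 ≤ ∑ c : P → Option ι, (∑ τ : P → Option ι, sieveCoeff u f R τ *
          ∏ a, lowerRow (u a) κ m (c a) (τ a)) ^ 2 := sum_nonneg fun c _ => sq_nonneg _
  have h8 := mul_le_mul_of_nonneg_left h6 (sq_nonneg (linSum u f))
  nlinarith

end sieveLowerB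

/-- The sum of the reciprocals of the integers below `N` coprime to `W`. -/
noncomputable def copSum (W N : ℕ) : ℝ := ∑ r ∈ (range N).filter fun r => W.Coprime r, 1 / (r : ℝ)

theorem copSum_mono (W : ℕ) {M N : ℕ} (h : M ≤ N) : copSum W M ≤ copSum W N :=
  sum_le_sum_of_subset_of_nonneg (filter_subset_filter _ (range_subset_range.2 h)) fun r _ _ => by
    positivity

theorem copSum_succ_mul (W J : ℕ) : copSum W ((J + 1) * W) = copSum W (J * W)
    + ∑ r ∈ (Ico (J * W) (J * W + W)).filter fun r => W.Coprime r, 1 / (r : ℝ) := by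
  simp only [copSum, sum_filter]
  rw [range_eq_Ico, range_eq_Ico, add_mul, one_mul, sum_Ico_consecutive _ (Nat.zero_le _)
    (Nat.le_add_right _ _)]

theorem card_coprime_Ico (W n : ℕ) :
    (#((Ico n (n + W)).filter fun r => W.Coprime r) : ℝ) = Nat.totient W := by
  exact_mod_cast Nat.filter_coprime_Ico_eq_totient W n

theorem le_copSum_mul {W : ℕ} (hW : 1 < W) (J : ℕ) :
    (Nat.totient W / W : ℝ) * harmonic J ≤ copSum W (J * W) := by
  have hW' : (0 : ℝ) < W := by exact_mod_cast (by omega : 0 < W)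
  induction J with
  | zero => simp [copSum]
  | succ J ih =>
    rw [copSum_succ_mul, harmonic_succ]
    push_cast
    rw [mul_add]
    refine add_le_add ih ?_
    rw [← card_coprime_Ico W (J * W), div_mul_eq_mul_div, mul_div_assoc, ← nsmul_eq_mul]
    refine card_nsmul_le_sum _ _ _ fun r hr => ?_
    obtain ⟨hr1, hr2⟩ := mem_filter.1 hr
    have hr0 : 0 < r := by
      rcases Nat.eq_zero_or_pos r with rfl | h
      · simp at hr2
        omega
      · exact h
    have hr3 : (r : ℝ) ≤ (J + 1) * W := by
      have := (mem_Ico.1 hr1).2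
      have : r ≤ (J + 1) * W := by linarith
      exact_mod_cast this
    have hr0' : (0 : ℝ) < r := by exact_mod_cast hr0
    rw [← one_div, div_div]
    gcongr

theorem copSum_succ_mul_le {W : ℕ} (hW : 0 < W) (J : ℕ) :
    copSum W ((J + 1) * W) ≤ W + (Nat.totient W / W : ℝ) * harmonic J := by
  have hW' : (0 : ℝ) < W := by exact_mod_cast hW
  induction J with
  | zero =>
    simp only [copSum, zero_add, one_mul, harmonic_zero, Rat.cast_zero, mul_zero, add_zero]
    calc _ ≤ ∑ r ∈ range W, (1 : ℝ) := by
          refine (sum_le_sum_of_subset_of_nonneg (filter_subset _ _) fun r _ _ => by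
            positivity).trans (sum_le_sum fun r _ => ?_)
          rcases Nat.eq_zero_or_pos r with rfl | h
          · simp
          · have : (1 : ℝ) ≤ r := by exact_mod_cast h
            exact div_le_one_of_le₀ this (by linarith)
      _ = W := by simp
  | succ J ih =>
    rw [copSum_succ_mul, harmonic_succ]
    push_cast
    rw [mul_add, ← add_assoc]
    refine add_le_add ih ?_
    rw [← card_coprime_Ico W ((J + 1) * W), div_mul_eq_mul_div, mul_div_assoc, ← nsmul_eq_mul]
    refine sum_le_card_nsmul _ _ _ fun r hr => ?_
    have hr3 : ((J + 1) * W : ℝ) ≤ r := by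
      exact_mod_cast (mem_Ico.1 (mem_filter.1 hr).1).1
    rw [← one_div, div_div]
    gcongr

/-- Lower bound for the logarithmic density of the integers coprime to `W`. -/
theorem le_copSum {W : ℕ} (hW : 1 < W) {y : ℝ} (hy : 1 ≤ y) :
    (Nat.totient W / W : ℝ) * (Real.log y - Real.log W) ≤ copSum W (⌊y⌋₊ + 1) := by
  have hW' : (0 : ℝ) < W := by exact_mod_cast (by omega : 0 < W)
  have h1 := le_copSum_mul hW (⌊y⌋₊ / W)
  refine le_trans ?_ (h1.trans (copSum_mono W ((Nat.div_mul_le_self _ _).trans (Nat.le_succ _))))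
  refine mul_le_mul_of_nonneg_left ?_ (by positivity)
  refine le_trans ?_ (log_add_one_le_harmonic _)
  rw [← Real.log_div (by linarith) hW'.ne']
  refine Real.log_le_log (by positivity) ?_
  rw [div_le_iff₀ hW']
  have h2 := Nat.lt_succ_floor y
  have h3 : ⌊y⌋₊.succ ≤ (⌊y⌋₊ / W + 1) * W := by
    have := Nat.lt_div_mul_add (a := ⌊y⌋₊) (by omega : 0 < W)
    rw [add_mul, one_mul]
    omega
  have h4 : ((⌊y⌋₊.succ : ℕ) : ℝ) ≤ ((⌊y⌋₊ / W : ℕ) + 1 : ℝ) * W := by exact_mod_cast h3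
  push_cast at h2 h4 ⊢
  linarith

/-- Upper bound for the logarithmic density of the integers coprime to `W`. -/
theorem copSum_le {W : ℕ} (hW : 0 < W) {y : ℝ} (hy : 1 ≤ y) :
    copSum W (⌊y⌋₊ + 1) ≤ W + 1 + (Nat.totient W / W : ℝ) * Real.log y := by
  have hW' : (0 : ℝ) < W := by exact_mod_cast hW
  have h3 : ⌊y⌋₊.succ ≤ (⌊y⌋₊ / W + 1) * W := by
    have := Nat.lt_div_mul_add (a := ⌊y⌋₊) hW
    rw [add_mul, one_mul]
    omega
  refine (copSum_mono W h3).trans ((copSum_succ_mul_le hW _).trans ?_)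
  have hφ : (Nat.totient W / W : ℝ) ≤ 1 :=
    div_le_one_of_le₀ (by exact_mod_cast Nat.totient_le W) hW'.le
  have hφ0 : (0 : ℝ) ≤ Nat.totient W / W := by positivity
  have h4 : (harmonic (⌊y⌋₊ / W) : ℝ) ≤ 1 + Real.log y := by
    refine (harmonic_le_one_add_log _).trans ?_
    rcases Nat.eq_zero_or_pos (⌊y⌋₊ / W) with h | h
    · rw [h]
      simp [Real.log_nonneg hy]
    · have : ((⌊y⌋₊ / W : ℕ) : ℝ) ≤ y :=
        le_trans (by exact_mod_cast Nat.div_le_self _ _) (Nat.floor_le (by linarith))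
      have h' : (0 : ℝ) < ((⌊y⌋₊ / W : ℕ) : ℝ) := by exact_mod_cast h
      linarith [Real.log_le_log h' this]
  nlinarith

theorem sum_filter_dvd_le (W N : ℕ) {d : ℕ} (hd : 0 < d) :
    ∑ r ∈ (range N).filter (fun r => W.Coprime r ∧ d ∣ r), 1 / (r : ℝ) ≤ copSum W N * (1 / d) := by
  have hd' : (0 : ℝ) < d := by exact_mod_cast hd
  calc _ = ∑ r ∈ (range N).filter (fun r => W.Coprime r ∧ d ∣ r), 1 / ((r / d : ℕ) : ℝ) *
      (1 / d) := by
        refine sum_congr rfl fun r hr => ?_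
        obtain ⟨s, rfl⟩ := (mem_filter.1 hr).2.2
        rw [Nat.mul_div_cancel_left _ hd]
        push_cast
        rw [div_mul_div_comm, mul_comm (s : ℝ), mul_one]
    _ ≤ _ := by
        rw [← sum_mul]
        refine mul_le_mul_of_nonneg_right ?_ (by positivity)
        rw [← sum_image (f := fun s : ℕ => 1 / (s : ℝ)) (g := fun r => r / d)]
        · refine sum_le_sum_of_subset_of_nonneg (fun s hs => ?_) fun r _ _ => by positivity
          obtain ⟨r, hr, rfl⟩ := mem_image.1 hs
          obtain ⟨hr1, hr2, hr3⟩ := mem_filter.1 hr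
          exact mem_filter.2 ⟨mem_range.2 ((Nat.div_le_self r d).trans_lt (mem_range.1 hr1)),
            hr2.coprime_dvd_right (Nat.div_dvd_of_dvd hr3)⟩
        · intro r hr s hs h
          have hr' := (mem_filter.1 (mem_coe.1 hr)).2.2
          have hs' := (mem_filter.1 (mem_coe.1 hs)).2.2
          rw [← Nat.div_mul_cancel hr', ← Nat.div_mul_cancel hs']
          exact congrArg (· * d) h

/-- Most integers coprime to `W` are squarefree and prime to `ℓ` when `W` contains the small
primes. -/
theorem half_copSum_le {W D ℓ : ℕ} (hW : 1 < W) (hD : 7 ≤ D) (hWD : ∀ p, p.Prime → p ≤ D → p ∣ W)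
    (hℓ : ℓ.Prime) (hℓW : ¬ ℓ ∣ W) (N : ℕ) :
    1 / 2 * copSum W N ≤
      ∑ r ∈ (range N).filter (fun r => W.Coprime r ∧ Squarefree r ∧ ¬ ℓ ∣ r), 1 / (r : ℝ) := by
  have h0 : 0 ≤ copSum W N := sum_nonneg fun r _ => by positivity
  have hℓD : D < ℓ := by
    by_contra! h
    exact hℓW (hWD ℓ hℓ h)
  have h1 : copSum W N ≤
      ∑ r ∈ (range N).filter (fun r => W.Coprime r ∧ Squarefree r ∧ ¬ ℓ ∣ r), 1 / (r : ℝ)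
      + (∑ r ∈ (range N).filter (fun r => W.Coprime r ∧ ℓ ∣ r), 1 / (r : ℝ)
        + ∑ d ∈ Ioo D N, ∑ r ∈ (range N).filter (fun r => W.Coprime r ∧ d ^ 2 ∣ r), 1 /
            (r : ℝ)) := by
    simp only [sum_filter]
    rw [Finset.sum_comm, ← sum_add_distrib, ← sum_add_distrib, copSum, sum_filter]
    refine sum_le_sum fun r hr => ?_
    have hn : ∀ d ∈ Ioo D N, 0 ≤ if W.Coprime r ∧ d ^ 2 ∣ r then 1 / (r : ℝ) else 0 := fun d _ => by
      positivity
    have hn' : (0 : ℝ) ≤ if W.Coprime r ∧ ℓ ∣ r then 1 / (r : ℝ) else 0 := by positivity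
    have hn'' : (0 : ℝ) ≤ if W.Coprime r ∧ Squarefree r ∧ ¬ ℓ ∣ r then 1 / (r : ℝ) else 0 := by
      positivity
    by_cases hc : W.Coprime r
    · rw [if_pos hc]
      by_cases hl : ℓ ∣ r
      · have e : (if W.Coprime r ∧ ℓ ∣ r then 1 / (r : ℝ) else 0) = 1 / r := if_pos ⟨hc, hl⟩
        rw [e]
        linarith [sum_nonneg hn]
      by_cases hs : Squarefree r
      · rw [if_pos ⟨hc, hs, hl⟩]
        linarith [sum_nonneg hn]
      · have hr0 : r ≠ 0 := by
          rintro rfl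
          simp at hc
          omega
        rw [Nat.squarefree_iff_prime_squarefree] at hs
        push Not at hs
        obtain ⟨p, hp, hpr⟩ := hs
        have hpD : D < p := by
          by_contra! h
          have h2 := Nat.dvd_gcd (hWD p hp h) ((Dvd.intro _ rfl).trans hpr)
          rw [hc.gcd_eq_one] at h2
          exact hp.one_lt.ne' (Nat.dvd_one.1 h2)
        have hpN : p < N := lt_of_le_of_lt (Nat.le_of_dvd (Nat.pos_of_ne_zero hr0)
          ((Dvd.intro _ rfl).trans hpr)) (mem_range.1 hr)
        have := single_le_sum hn (mem_Ioo.2 ⟨hpD, hpN⟩)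
        rw [if_pos ⟨hc, by rwa [sq]⟩] at this
        linarith
    · rw [if_neg hc]
      linarith [sum_nonneg hn]
  have h2 := sum_filter_dvd_le W N hℓ.pos
  have h3 : ∑ d ∈ Ioo D N, ∑ r ∈ (range N).filter (fun r => W.Coprime r ∧ d ^ 2 ∣ r), 1 / (r : ℝ)
      ≤ copSum W N * (2 / (D + 1)) := by
    calc _ ≤ ∑ d ∈ Ioo D N, copSum W N * ((d : ℝ) ^ 2)⁻¹ := by
          refine sum_le_sum fun d hd => ?_
          have hd0 : 0 < d := by have := (mem_Ioo.1 hd).1; omega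
          have := sum_filter_dvd_le W N (d := d ^ 2) (by positivity)
          push_cast at this
          rwa [one_div] at this
      _ ≤ _ := by
          rw [← mul_sum]
          exact mul_le_mul_of_nonneg_left (sum_Ioo_inv_sq_le D N) h0
  have hD' : (7 : ℝ) ≤ D := by exact_mod_cast hD
  have hℓ' : (D : ℝ) + 1 ≤ ℓ := by exact_mod_cast hℓD
  have h4 : (2 : ℝ) / (D + 1) ≤ 1 / 4 := by
    rw [div_le_div_iff₀ (by linarith) (by norm_num)]
    linarith
  have h5 : (1 : ℝ) / ℓ ≤ 1 / 4 := one_div_le_one_div_of_le (by norm_num) (by linarith)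
  nlinarith

section setSum
variable {S : Finset ℕ}

theorem vol_natCast (T : Finset S) :
    vol (fun p : S => ((p : ℕ) : ℝ)) T = ((∏ p ∈ T, (p : ℕ) : ℕ) : ℝ) := by
  rw [vol]
  push_cast
  rfl

theorem primeFactors_prod_coe (hS : ∀ p ∈ S, p.Prime) (T : Finset S) :
    (∏ p ∈ T, (p : ℕ)).primeFactors = T.map (Function.Embedding.subtype _) := by
  have : ∏ p ∈ T, (p : ℕ) = ∏ p ∈ T.map (Function.Embedding.subtype _), p := by simp
  rw [this]
  refine Nat.primeFactors_prod fun p hp => ?_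
  obtain ⟨q, -, rfl⟩ := mem_map.1 hp
  exact hS q q.2

theorem prod_coe_injective (hS : ∀ p ∈ S, p.Prime) :
    Function.Injective fun T : Finset S => ∏ p ∈ T, (p : ℕ) := by
  intro T U h
  have h1 := primeFactors_prod_coe hS T
  rw [show ∏ p ∈ T, (p : ℕ) = ∏ p ∈ U, (p : ℕ) from h, primeFactors_prod_coe hS U] at h1
  exact (map_injective _ h1).symm

/-- The sum of the reciprocals of the products of volume at most `y`. -/
noncomputable def countSum {P : Type*} [Fintype P] (u : P → ℝ) (y : ℝ) : ℝ :=
  ∑ T : Finset P, if vol u T ≤ y then 1 / vol u T else 0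

theorem countSum_le (hS : ∀ p ∈ S, p.Prime) {W : ℕ} (hSW : ∀ p ∈ S, ¬ p ∣ W) (y : ℝ) :
    countSum (fun p : S => ((p : ℕ) : ℝ)) y ≤ copSum W (⌊y⌋₊ + 1) := by
  rw [countSum, ← sum_filter]
  simp only [vol_natCast]
  rw [← sum_image (f := fun r : ℕ => 1 / (r : ℝ)) (g := fun T : Finset S => ∏ p ∈ T, (p : ℕ))
    (prod_coe_injective hS).injOn]
  refine sum_le_sum_of_subset_of_nonneg (fun s hs => ?_) fun r _ _ => by positivity
  obtain ⟨T, hT, rfl⟩ := mem_image.1 hs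
  refine mem_filter.2 ⟨mem_range.2 (Nat.lt_succ_of_le (Nat.le_floor (mem_filter.1 hT).2)), ?_⟩
  exact Nat.Coprime.prod_right fun p _ => (((hS p p.2).coprime_iff_not_dvd).2 (hSW p p.2)).symm

/-- The primes up to `N` available to the sieve. -/
def sievePrimes (W ℓ N : ℕ) : Finset ℕ :=
  (range (N + 1)).filter fun p => p.Prime ∧ ¬ p ∣ W ∧ p ≠ ℓ

theorem le_countSum {W D ℓ N : ℕ} (hW : 1 < W) (hD : 7 ≤ D) (hWD : ∀ p, p.Prime → p ≤ D → p ∣ W)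
    (hℓ : ℓ.Prime) (hℓW : ¬ ℓ ∣ W) {y : ℝ} (hy0 : 0 ≤ y) (hy : ⌊y⌋₊ ≤ N) :
    1 / 2 * copSum W (⌊y⌋₊ + 1) ≤ countSum (fun p : sievePrimes W ℓ N => ((p : ℕ) : ℝ)) y := by
  refine (half_copSum_le hW hD hWD hℓ hℓW _).trans ?_
  have hS : ∀ p ∈ sievePrimes W ℓ N, p.Prime := fun p hp => (mem_filter.1 hp).2.1
  rw [countSum, ← sum_filter]
  simp only [vol_natCast]
  rw [← sum_image (f := fun r : ℕ => 1 / (r : ℝ))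
    (g := fun T : Finset (sievePrimes W ℓ N) => ∏ p ∈ T, (p : ℕ)) (prod_coe_injective hS).injOn]
  refine sum_le_sum_of_subset_of_nonneg (fun r hr => ?_) fun r _ _ => by positivity
  obtain ⟨hr1, hr2, hr3, hr4⟩ := mem_filter.1 hr
  have hry : r ≤ ⌊y⌋₊ := Nat.lt_succ_iff.1 (mem_range.1 hr1)
  have hsub : ∀ p ∈ r.primeFactors, p ∈ sievePrimes W ℓ N := by
    intro p hp
    have hp' := Nat.prime_of_mem_primeFactors hp
    have hpr := Nat.dvd_of_mem_primeFactors hp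
    refine mem_filter.2 ⟨mem_range.2 (Nat.lt_succ_of_le
      (((Nat.le_of_mem_primeFactors hp).trans hry).trans hy)), hp', fun h => ?_, fun h => ?_⟩
    · have h2 := Nat.dvd_gcd h hpr
      rw [hr2.gcd_eq_one] at h2
      exact hp'.one_lt.ne' (Nat.dvd_one.1 h2)
    · exact hr4 (h ▸ hpr)
  have hprod : ∏ p ∈ r.primeFactors.subtype (· ∈ sievePrimes W ℓ N), (p : ℕ) = r := by
    rw [prod_subtype_of_mem (fun p => p) hsub]
    exact Nat.prod_primeFactors_of_squarefree hr3
  refine mem_image.2 ⟨r.primeFactors.subtype (· ∈ sievePrimes W ℓ N), mem_filter.2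
      ⟨mem_univ _, ?_⟩, ?_⟩
  · rw [hprod]
    exact (Nat.le_floor_iff hy0).1 hry
  · exact hprod

end setSum

/-- A decreasing step function whose steps balance the dyadic ranges of `log x`. -/
noncomputable def stepFun (x : ℝ) (n : ℕ) (t : ℝ) : ℝ :=
  ∑ i ∈ range n, (1 / 2) ^ i * if t ≤ Real.exp (2 ^ i * x) then 1 else 0

theorem stepFun_antitone (x : ℝ) (n : ℕ) : Antitone (stepFun x n) := by
  intro s t h
  refine sum_le_sum fun i _ => mul_le_mul_of_nonneg_left ?_ (by positivity)
  split_ifs with h1 h2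
  · exact le_rfl
  · exact absurd (h.trans h1) h2
  · norm_num
  · exact le_rfl

theorem stepFun_nonneg (x : ℝ) (n : ℕ) (t : ℝ) : 0 ≤ stepFun x n t :=
  sum_nonneg fun i _ => by positivity

theorem sum_half_pow_le (n : ℕ) : ∑ i ∈ range n, (1 / 2 : ℝ) ^ i ≤ 2 := by
  have := sum_geometric_two_le n
  exact this

theorem stepFun_le_two (x : ℝ) (n : ℕ) (t : ℝ) : stepFun x n t ≤ 2 := by
  refine (sum_le_sum fun i _ => ?_).trans (sum_half_pow_le n)
  refine mul_le_of_le_one_right (by positivity) ?_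
  split_ifs <;> norm_num

theorem one_le_stepFun {x : ℝ} {n : ℕ} (hn : 0 < n) {t : ℝ} (ht : t ≤ Real.exp x) :
    1 ≤ stepFun x n t := by
  have := single_le_sum (f := fun i => (1 / 2 : ℝ) ^ i * if t ≤ Real.exp (2 ^ i * x) then 1 else 0)
    (fun i _ => by positivity) (mem_range.2 hn)
  simpa [stepFun, ht] using this

theorem le_exp_of_stepFun_ne_zero {x : ℝ} (hx : 0 ≤ x) {n : ℕ} {t : ℝ}
    (h : stepFun x (n + 1) t ≠ 0) : t ≤ Real.exp (2 ^ n * x) := by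
  obtain ⟨i, hi, h1⟩ := exists_ne_zero_of_sum_ne_zero h
  have h2 : t ≤ Real.exp (2 ^ i * x) := by
    by_contra h2
    simp [h2] at h1
  refine h2.trans (Real.exp_le_exp.2 (mul_le_mul_of_nonneg_right ?_ hx))
  exact pow_le_pow_right₀ (by norm_num) (Nat.lt_succ_iff.1 (mem_range.1 hi))

theorem sq_sum_half_pow_le (n : ℕ) (b : ℕ → Prop) [DecidablePred b] :
    (∑ i ∈ range n, (1 / 2 : ℝ) ^ i * if b i then 1 else 0) ^ 2
      ≤ 4 * ∑ i ∈ range n, (1 / 4 : ℝ) ^ i * if b i then 1 else 0 := by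
  induction n generalizing b with
  | zero => simp
  | succ n ih =>
    by_cases h : b 0
    · have h1 : ∑ i ∈ range (n + 1), (1 / 2 : ℝ) ^ i * (if b i then 1 else 0) ≤ 2 := by
        refine (sum_le_sum fun i _ => ?_).trans (sum_half_pow_le (n + 1))
        refine mul_le_of_le_one_right (by positivity) ?_
        split_ifs <;> norm_num
      have h0 : 0 ≤ ∑ i ∈ range (n + 1), (1 / 2 : ℝ) ^ i * (if b i then 1 else 0) :=
        sum_nonneg fun i _ => by positivity
      have h2 := single_le_sum (f := fun i => (1 / 4 : ℝ) ^ i * if b i then 1 else 0)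
        (fun i _ => by positivity) (mem_range.2 n.succ_pos)
      simp only [pow_zero, h, if_true, mul_one] at h2
      nlinarith
    · rw [sum_range_succ', sum_range_succ' (fun i => (1 / 4 : ℝ) ^ i * if b i then 1 else 0)]
      have := ih fun i => b (i + 1)
      simp only [h, if_false, mul_zero, add_zero, pow_succ]
      have e1 : ∑ i ∈ range n, (1 / 2 : ℝ) ^ i * (1 / 2) * (if b (i + 1) then 1 else 0)
          = 1 / 2 * ∑ i ∈ range n, (1 / 2 : ℝ) ^ i * (if b (i + 1) then 1 else 0) := by
        rw [mul_sum]
        exact sum_congr rfl fun i _ => by ring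
      have e2 : ∑ i ∈ range n, (1 / 4 : ℝ) ^ i * (1 / 4) * (if b (i + 1) then 1 else 0)
          = 1 / 4 * ∑ i ∈ range n, (1 / 4 : ℝ) ^ i * (if b (i + 1) then 1 else 0) := by
        rw [mul_sum]
        exact sum_congr rfl fun i _ => by ring
      rw [e1, e2]
      nlinarith

section
variable {P : Type*} [Fintype P] {u : P → ℝ}

theorem linSum_stepFun (x : ℝ) (n : ℕ) :
    linSum u (stepFun x n) = ∑ i ∈ range n, (1 / 2 : ℝ) ^ i * countSum u (Real.exp (2 ^ i
        * x)) := by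
  simp only [linSum, stepFun, countSum, mul_sum, sum_div]
  rw [Finset.sum_comm]
  refine sum_congr rfl fun i _ => sum_congr rfl fun T _ => ?_
  split_ifs <;> simp [div_eq_mul_inv]

theorem sum_sq_stepFun_mul_le (hu : ∀ a, 0 < u a) (x : ℝ) (n : ℕ) {g : Finset P → ℝ}
    (hg : ∀ T, 0 ≤ g T) :
    ∑ T, stepFun x n (vol u T) ^ 2 / vol u T * g T ≤ 4 * ∑ i ∈ range n, (1 / 4 : ℝ) ^ i *
      ∑ T, (if vol u T ≤ Real.exp (2 ^ i * x) then 1 / vol u T else 0) * g T := by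
  simp only [mul_sum]
  rw [Finset.sum_comm]
  refine sum_le_sum fun T _ => ?_
  have h1 := sq_sum_half_pow_le n fun i => vol u T ≤ Real.exp (2 ^ i * x)
  have hv := vol_pos hu T
  calc _ ≤ (4 * ∑ i ∈ range n, (1 / 4 : ℝ) ^ i * if vol u T ≤ Real.exp (2 ^ i * x) then 1 else 0)
        / vol u T * g T := by
        refine mul_le_mul_of_nonneg_right (div_le_div_of_nonneg_right h1 hv.le) (hg T)
    _ = _ := by
        rw [mul_sum, sum_div, sum_mul]
        refine sum_congr rfl fun i _ => ?_
        split_ifs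
        · ring
        · ring

theorem sqSum_stepFun_le (hu : ∀ a, 0 < u a) {x C l : ℝ} (hC : 0 ≤ C) (hl : 0 ≤ l) {n : ℕ}
    (hN : ∀ i < n, countSum u (Real.exp (2 ^ i * x)) ≤ C + 2 ^ i * l) :
    sqSum u (stepFun x n) ≤ 8 * (C + l) := by
  have h := sum_sq_stepFun_mul_le hu x n (g := fun _ => 1) fun _ => zero_le_one
  simp only [mul_one] at h
  refine h.trans ?_
  calc _ ≤ 4 * ∑ i ∈ range n, (1 / 2 : ℝ) ^ i * (C + l) := by
        refine mul_le_mul_of_nonneg_left (sum_le_sum fun i hi => ?_) (by norm_num)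
        calc _ ≤ (1 / 4 : ℝ) ^ i * (C + 2 ^ i * l) := by
              refine mul_le_mul_of_nonneg_left ?_ (by positivity)
              exact hN i (mem_range.1 hi)
          _ ≤ (1 / 4 : ℝ) ^ i * (2 ^ i * C + 2 ^ i * l) := by
              gcongr
              exact le_mul_of_one_le_left hC (one_le_pow₀ (by norm_num))
          _ = ((1 / 4 : ℝ) ^ i * 2 ^ i) * (C + l) := by ring
          _ = _ := by
              rw [← mul_pow]
              norm_num
    _ ≤ 4 * (2 * (C + l)) := by
        rw [← sum_mul]
        gcongr
        exact sum_half_pow_le n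
    _ = _ := by ring

theorem sum_sq_stepFun_log_le (hu : ∀ a, 1 ≤ u a) {x C l : ℝ} (hx : 0 ≤ x) (hC : 0 ≤ C)
    {n : ℕ} (hN : ∀ i < n, countSum u (Real.exp (2 ^ i * x)) ≤ C + 2 ^ i * l) :
    ∑ T, stepFun x n (vol u T) ^ 2 / vol u T * Real.log (vol u T) ≤ 4 * x * (2 * C + n * l) := by
  have hu0 : ∀ a, 0 < u a := fun a => by linarith [hu a]
  refine (sum_sq_stepFun_mul_le hu0 x n (g := fun T => Real.log (vol u T)) fun T =>
    Real.log_nonneg (one_le_prod fun a _ => hu a)).trans ?_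
  have h1 : ∀ i ∈ range n, (1 / 4 : ℝ) ^ i * ∑ T,
      (if vol u T ≤ Real.exp (2 ^ i * x) then 1 / vol u T else 0) * Real.log (vol u T)
      ≤ x * ((1 / 2) ^ i * C + l) := by
    intro i hi
    calc _ ≤ (1 / 4 : ℝ) ^ i * ∑ T,
          (if vol u T ≤ Real.exp (2 ^ i * x) then 1 / vol u T else 0) * (2 ^ i * x) := by
          refine mul_le_mul_of_nonneg_left (sum_le_sum fun T _ => ?_) (by positivity)
          split_ifs with h
          · refine mul_le_mul_of_nonneg_left ?_ (one_div_pos.2 (vol_pos hu0 T)).le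
            exact (Real.log_le_iff_le_exp (vol_pos hu0 T)).2 h
          · simp
      _ = (1 / 4 : ℝ) ^ i * (2 ^ i * x) * countSum u (Real.exp (2 ^ i * x)) := by
          rw [← sum_mul, countSum]
          ring
      _ ≤ (1 / 4 : ℝ) ^ i * (2 ^ i * x) * (C + 2 ^ i * l) := by
          gcongr
          exact hN i (mem_range.1 hi)
      _ = ((1 / 4 : ℝ) ^ i * 2 ^ i) * x * C + ((1 / 4 : ℝ) ^ i * 2 ^ i * 2 ^ i) * (x * l) := by ring
      _ = _ := by
          simp only [← mul_pow]
          norm_num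
          ring
  calc _ ≤ 4 * ∑ i ∈ range n, x * ((1 / 2) ^ i * C + l) := by
        exact mul_le_mul_of_nonneg_left (sum_le_sum h1) (by norm_num)
    _ = 4 * x * ((∑ i ∈ range n, (1 / 2) ^ i) * C + n * l) := by
        rw [← mul_sum, sum_add_distrib, sum_mul]
        simp
        ring
    _ ≤ _ := by
        gcongr
        exact sum_half_pow_le n

theorem le_linSum_stepFun {x C l : ℝ} (hC : 0 ≤ C) {n : ℕ}
    (hN : ∀ i < n, 1 / 2 * (2 ^ i * l - C) ≤ countSum u (Real.exp (2 ^ i * x))) :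
    1 / 2 * (n * l - 2 * C) ≤ linSum u (stepFun x n) := by
  rw [linSum_stepFun]
  calc _ ≤ 1 / 2 * (n * l - (∑ i ∈ range n, (1 / 2) ^ i) * C) := by
        gcongr
        exact sum_half_pow_le n
    _ = ∑ i ∈ range n, (1 / 2 : ℝ) ^ i * (1 / 2 * (2 ^ i * l - C)) := by
        have e : (n : ℝ) * l = ∑ _i ∈ range n, l := by simp
        rw [sum_mul, e, ← sum_sub_distrib, mul_sum]
        refine sum_congr rfl fun i _ => ?_
        have : (1 / 2 : ℝ) ^ i * 2 ^ i = 1 := by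
          rw [← mul_pow]
          norm_num
        linear_combination (-1 / 2 * l) * this
    _ ≤ _ := by
        gcongr with i hi
        exact hN i (mem_range.1 hi)

theorem countSum_le_sqSum_stepFun (hu : ∀ a, 0 < u a) (x : ℝ) {n : ℕ} (hn : 0 < n) :
    countSum u (Real.exp x) ≤ sqSum u (stepFun x n) := by
  refine sum_le_sum fun T _ => ?_
  have hv := vol_pos hu T
  split_ifs with h
  · gcongr
    nlinarith [one_le_stepFun hn h]
  · positivity

theorem one_le_countSum (hu : ∀ a, 0 < u a) {y : ℝ} (hy : 1 ≤ y) : 1 ≤ countSum u y := by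
  have := single_le_sum (f := fun T : Finset P => if vol u T ≤ y then 1 / vol u T else 0)
    (fun T _ => by
      have := vol_pos hu T
      positivity) (mem_univ ∅)
  simpa [countSum, vol, hy] using this

end

theorem stepFun_bounds {P : Type*} [Fintype P] {u : P → ℝ} (hu : ∀ a, 1 ≤ u a) (I : ℕ)
    {x C l : ℝ} (hx0 : 0 ≤ x) (hC0 : 0 ≤ C) (hR : 8 * C ≤ l)
    (hup : ∀ i < I + 1, countSum u (Real.exp (2 ^ i * x)) ≤ C + 2 ^ i * l)
    (hlo : ∀ i < I + 1, 1 / 2 * (2 ^ i * l - C) ≤ countSum u (Real.exp (2 ^ i * x))) :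
    ∑ T, stepFun x (I + 1) (vol u T) ^ 2 / vol u T * Real.log (vol u T)
        ≤ sqSum u (stepFun x (I + 1)) * (25 * (I + 1) * x) ∧
      sqSum u (stepFun x (I + 1)) * ((I + 1) * (200 * (I + 1) * 2 ^ I * l))
        ≤ 51200 * 2 ^ I * linSum u (stepFun x (I + 1)) ^ 2 := by
  have hu0 : ∀ a, 0 < u a := fun a => by linarith [hu a]
  have hl0 : 0 ≤ l := by linarith
  have h0 := hlo 0 (by omega)
  rw [pow_zero, one_mul, one_mul] at h0
  have hα1 := h0.trans (countSum_le_sqSum_stepFun hu0 x (by omega : 0 < I + 1))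
  have hα2 := sqSum_stepFun_le hu0 hC0 hl0 hup
  have hlog := sum_sq_stepFun_log_le hu hx0 hC0 hup
  have hβ := le_linSum_stepFun hC0 hlo
  have hI0 : (0 : ℝ) ≤ I := Nat.cast_nonneg I
  push_cast at hlog hβ
  have hIl : l ≤ (I + 1) * l := le_mul_of_one_le_left hl0 (by linarith)
  constructor
  · refine hlog.trans ?_
    calc 4 * x * (2 * C + (I + 1) * l) ≤ 1 / 2 * (l - C) * (25 * (I + 1) * x) := by
          have : 0 ≤ x * (12.5 * (I + 1) * (l - C) - 4 * (2 * C + (I + 1) * l)) := by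
            refine mul_nonneg hx0 ?_
            nlinarith
          nlinarith
      _ ≤ _ := by gcongr
  · have h1 : 1 / 4 * ((I + 1) * l) ≤ linSum u (stepFun x (I + 1)) := by linarith
    have h2 : sqSum u (stepFun x (I + 1)) ≤ 16 * l := by linarith
    calc _ ≤ 16 * l * ((I + 1) * (200 * (I + 1) * 2 ^ I * l)) := by gcongr
      _ = 51200 * 2 ^ I * (1 / 4 * ((I + 1) * l)) ^ 2 := by ring
      _ ≤ _ := by gcongr

/-- A sieve function for which the linear sum is large compared to the sum of squares. -/
theorem eventually_exists_sieveFun (I : ℕ) {W D : ℕ} (hW : 1 < W) (hD : 7 ≤ D)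
    (hWD : ∀ p, p.Prime → p ≤ D → p ∣ W) : ∀ᶠ R : ℝ in atTop, ∀ ℓ : ℕ, ℓ.Prime → ¬ ℓ ∣ W →
    ∃ f : ℝ → ℝ, Antitone f ∧ (∀ x, 0 ≤ f x) ∧ (∀ x, f x ≤ 2) ∧ (∀ x, f x ≠ 0 → x ≤ √R) ∧
      ∑ T, f (vol (fun p : sievePrimes W ℓ ⌊R⌋₊ => ((p : ℕ) : ℝ)) T) ^ 2 /
          vol (fun p : sievePrimes W ℓ ⌊R⌋₊ => ((p : ℕ) : ℝ)) T *
          Real.log (vol (fun p : sievePrimes W ℓ ⌊R⌋₊ => ((p : ℕ) : ℝ)) T)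
        ≤ sqSum (fun p : sievePrimes W ℓ ⌊R⌋₊ => ((p : ℕ) : ℝ)) f *
          (1 / (8 * 2 ^ I) * Real.log R) ∧
      1 ≤ sqSum (fun p : sievePrimes W ℓ ⌊R⌋₊ => ((p : ℕ) : ℝ)) f ∧
      sqSum (fun p : sievePrimes W ℓ ⌊R⌋₊ => ((p : ℕ) : ℝ)) f *
          ((I + 1) * (Nat.totient W / W : ℝ) * Real.log R)
        ≤ 51200 * 2 ^ I * linSum (fun p : sievePrimes W ℓ ⌊R⌋₊ => ((p : ℕ) : ℝ)) f ^ 2 := by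
  have hW' : (1 : ℝ) < W := by exact_mod_cast hW
  have hφ : 0 < Nat.totient W := Nat.totient_pos.2 (by omega)
  set c : ℝ := Nat.totient W / W with hc
  have hc0 : 0 < c := by positivity
  have hc1 : c ≤ 1 := div_le_one_of_le₀ (by exact_mod_cast Nat.totient_le W) (by linarith)
  set B : ℝ := 200 * (I + 1) * 2 ^ I with hB
  have hB0 : 0 < B := by positivity
  have hB2 : 2 ^ I ≤ B := by
    rw [hB]
    refine le_mul_of_one_le_left (by positivity) ?_
    have : (0 : ℝ) ≤ I := Nat.cast_nonneg I
    linarith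
  set C : ℝ := W + 1 with hC
  have hlW : Real.log W ≤ C := by linarith [Real.log_le_self (by linarith : (0 : ℝ) ≤ W)]
  have hlW0 : 0 ≤ Real.log W := Real.log_nonneg hW'.le
  have ht : Tendsto (fun R : ℝ => c * (Real.log R / B)) atTop atTop :=
    (Real.tendsto_log_atTop.atTop_div_const hB0).const_mul_atTop hc0
  filter_upwards [ht.eventually_ge_atTop (8 * C), eventually_ge_atTop 1] with R hR hR1 ℓ hℓ hℓW
  set u := fun p : sievePrimes W ℓ ⌊R⌋₊ => ((p : ℕ) : ℝ) with hu_def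
  have hS : ∀ p ∈ sievePrimes W ℓ ⌊R⌋₊, p.Prime := fun p hp => (mem_filter.1 hp).2.1
  have hSW : ∀ p ∈ sievePrimes W ℓ ⌊R⌋₊, ¬ p ∣ W := fun p hp => (mem_filter.1 hp).2.2.1
  have hu : ∀ a, 1 ≤ u a := fun a => by
    show (1 : ℝ) ≤ ((a : ℕ) : ℝ)
    exact_mod_cast (hS a a.2).one_lt.le
  have hu0 : ∀ a, 0 < u a := fun a => by linarith [hu a]
  have hlR : 0 ≤ Real.log R := Real.log_nonneg hR1
  set x := Real.log R / B with hx
  have hx0 : 0 ≤ x := div_nonneg hlR hB0.le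
  have hBx : B * x = Real.log R := mul_div_cancel₀ _ hB0.ne'
  set l := c * x with hl
  have hC0 : 0 ≤ C := by linarith
  have hl0 : 0 ≤ l := by positivity
  have hy1 : ∀ i : ℕ, 1 ≤ Real.exp (2 ^ i * x) := fun i => Real.one_le_exp (by positivity)
  have hyR : ∀ i < I + 1, Real.exp (2 ^ i * x) ≤ R := by
    intro i hi
    rw [← Real.le_log_iff_exp_le (by linarith)]
    calc 2 ^ i * x ≤ 2 ^ I * x := by
          gcongr
          · norm_num
          · omega
      _ ≤ B * x := by gcongr
      _ = Real.log R := hBx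
  have hup : ∀ i < I + 1, countSum u (Real.exp (2 ^ i * x)) ≤ C + 2 ^ i * l := by
    intro i _
    refine (countSum_le hS hSW _).trans ((copSum_le (by omega) (hy1 i)).trans (le_of_eq ?_))
    rw [Real.log_exp]
    ring
  have hlo : ∀ i < I + 1, 1 / 2 * (2 ^ i * l - C) ≤ countSum u (Real.exp (2 ^ i * x)) := by
    intro i hi
    have h1 := le_countSum hW hD hWD hℓ hℓW (Real.exp_pos (2 ^ i * x)).le
      (Nat.floor_le_floor (hyR i hi))
    have h2 := le_copSum hW (hy1 i)
    rw [Real.log_exp] at h2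
    refine le_trans ?_ h1
    have h3 : c * Real.log W ≤ C := by nlinarith
    nlinarith
  obtain ⟨hb1, hb2⟩ := stepFun_bounds hu I hx0 hC0 hR hup hlo
  have hI0 : (0 : ℝ) ≤ I := Nat.cast_nonneg I
  refine ⟨stepFun x (I + 1), stepFun_antitone _ _, stepFun_nonneg _ _, stepFun_le_two _ _,
    fun t ht => ?_, ?_, ?_, ?_⟩
  · refine (le_exp_of_stepFun_ne_zero hx0 ht).trans ?_
    rw [← Real.le_log_iff_exp_le (Real.sqrt_pos.2 (by linarith)), Real.log_sqrt (by linarith), hx,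
      hB]
    rw [mul_div_assoc', div_le_div_iff₀ (by positivity) (by norm_num)]
    have : (0 : ℝ) ≤ 2 ^ I * Real.log R := by positivity
    nlinarith
  · have e1 : 1 / (8 * 2 ^ I) * Real.log R = 25 * (I + 1) * x := by
      rw [← hBx, hB]
      field_simp
      ring
    rwa [e1]
  · refine le_trans (one_le_countSum hu0 ?_) (countSum_le_sqSum_stepFun hu0 x
      (by omega : 0 < I + 1))
    simpa using hy1 0
  · have e1 : (I + 1) * c * Real.log R = (I + 1) * (200 * (I + 1) * 2 ^ I * l) := by
      rw [hl, ← hBx, hB]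
      ring
    rwa [e1]

section sieveExpand
variable {P ι : Type*} [Fintype P] [DecidableEq P] [Fintype ι] [DecidableEq ι]

/-- The sieve weight attached to the divisibility pattern `w`. -/
def sieveWeight (u : P → ℝ) (x : (P → Option ι) → ℝ) (w : P → Option ι) : ℝ :=
  ∑ σ, x σ * ∏ a, localFactor (u a) (σ a) (w a)

/-- The indicator that the pattern `w` extends the pattern `ρ`. -/
def patternIndicator (ρ w : P → Option ι) : ℝ := ∏ a, if ρ a = none ∨ ρ a = w a then 1 else 0

/-- The multilinear coefficients of the square of the sieve weight. -/
def patternCoeff (u : P → ℝ) (σ τ ρ : P → Option ι) : ℝ := ∏ a, localCoeff (u a) (σ a) (τ a) (ρ a)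

theorem sq_sieveWeight (u : P → ℝ) (x : (P → Option ι) → ℝ) (w : P → Option ι) :
    sieveWeight u x w ^ 2 = ∑ σ, ∑ τ, x σ * x τ *
      ∑ ρ, patternCoeff u σ τ ρ * patternIndicator ρ w := by
  rw [sq, sieveWeight, sum_mul_sum]
  refine sum_congr rfl fun σ _ => sum_congr rfl fun τ _ => ?_
  simp only [patternCoeff, patternIndicator, ← prod_mul_distrib]
  rw [mul_mul_mul_comm, ← prod_mul_distrib]
  simp only [← sum_localCoeff_mul_ite]
  rw [prod_univ_sum, Fintype.piFinset_univ]

theorem sum_mul_prod_localForm (u : P → ℝ) (x : (P → Option ι) → ℝ) (g : P → ι → ℝ) :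
    ∑ σ, ∑ τ, x σ * x τ * ∏ a, localForm (u a) (g a) (σ a) (τ a) = ∑ σ, ∑ τ, x σ * x τ *
      ∑ ρ : P → Option ι, patternCoeff u σ τ ρ * ∏ a, (ρ a).elim 1 (g a) := by
  refine sum_congr rfl fun σ _ => sum_congr rfl fun τ _ => ?_
  simp only [patternCoeff, ← prod_mul_distrib, localForm, Matrix.of_apply]
  rw [prod_univ_sum, Fintype.piFinset_univ]

/-- A weighted sum of the absolute values of the coefficients in the expansion of the square of
the sieve weight. -/
def coeffNorm (u : P → ℝ) (x : (P → Option ι) → ℝ) (E : (P → Option ι) → ℝ) : ℝ :=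
  ∑ σ, ∑ τ, |x σ| * |x τ| * ∑ ρ, |patternCoeff u σ τ ρ| * E ρ

omit [Fintype ι] in
theorem localCoeff_none_none (x : ℝ) (i : ι) : localCoeff x none none (some i) = 0 := by
  simp [localCoeff, localFactor]

omit [DecidableEq P] [Fintype ι] in
theorem prod_elim_le_of_patternCoeff_ne_zero {u : P → ℝ} (hu : ∀ a, 1 ≤ u a) {σ τ ρ : P → Option ι}
    (h : patternCoeff u σ τ ρ ≠ 0) : ∏ a, (ρ a).elim 1 (fun _ => u a)
      ≤ (∏ a, (σ a).elim 1 fun _ => u a) * ∏ a, (τ a).elim 1 fun _ => u a := by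
  rw [← prod_mul_distrib]
  have h1 := prod_ne_zero_iff.1 h
  have hn : ∀ (s : Option ι) a, 1 ≤ s.elim 1 fun _ => u a := fun s a => by
    cases s <;> simp [hu a]
  refine prod_le_prod (fun a _ => by linarith [hn (ρ a) a]) fun a _ => ?_
  have h2 := h1 a (mem_univ a)
  have hσ := hn (σ a) a
  have hτ := hn (τ a) a
  cases hρ : ρ a with
  | none =>
    simp only [Option.elim_none]
    nlinarith
  | some i =>
    rw [hρ] at h2
    simp only [Option.elim_some]
    have hua := hu a
    cases hs : σ a with
    | some j =>
      simp only [Option.elim_some]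
      nlinarith
    | none =>
      cases ht : τ a with
      | some j => simp
      | none => exact absurd (by rw [hs, ht]; exact localCoeff_none_none _ _) h2

/-- The weighted sum of the square of the sieve weight is close to the quadratic form given by the
densities of the patterns. -/
theorem abs_sum_sq_sieveWeight_sub_le {u : P → ℝ} (hu : ∀ a, 1 ≤ u a) {x : (P → Option ι) → ℝ}
    {R : ℝ} (hx : ∀ σ, x σ ≠ 0 → ∏ a, (σ a).elim 1 (fun _ => u a) ≤ R) (B : Finset ℕ) (v : ℕ → ℝ)
    (w : ℕ → P → Option ι) (X : ℝ) (g : P → ι → ℝ) {E : (P → Option ι) → ℝ}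
    (hE : ∀ ρ : P → Option ι, ∏ a, (ρ a).elim 1 (fun _ => u a) ≤ R ^ 2 →
      |∑ n ∈ B, v n * patternIndicator ρ (w n) - X * ∏ a, (ρ a).elim 1 (g a)| ≤ E ρ) :
    |∑ n ∈ B, v n * sieveWeight u x (w n) ^ 2
        - X * ∑ σ, ∑ τ, x σ * x τ * ∏ a, localForm (u a) (g a) (σ a) (τ a)|
      ≤ coeffNorm u x E := by
  have h1 : ∑ n ∈ B, v n * sieveWeight u x (w n) ^ 2
        - X * ∑ σ, ∑ τ, x σ * x τ * ∏ a, localForm (u a) (g a) (σ a) (τ a)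
      = ∑ σ, ∑ τ, x σ * x τ * ∑ ρ, patternCoeff u σ τ ρ *
        (∑ n ∈ B, v n * patternIndicator ρ (w n) - X * ∏ a, (ρ a).elim 1 (g a)) := by
    rw [sum_mul_prod_localForm]
    simp only [sq_sieveWeight, mul_sub, sum_sub_distrib, mul_sum]
    congr 1
    · rw [Finset.sum_comm]
      refine sum_congr rfl fun σ _ => ?_
      rw [Finset.sum_comm]
      refine sum_congr rfl fun τ _ => ?_
      rw [Finset.sum_comm]
      refine sum_congr rfl fun ρ _ => sum_congr rfl fun n _ => ?_
      ring
    · refine sum_congr rfl fun σ _ => sum_congr rfl fun τ _ => sum_congr rfl fun ρ _ => ?_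
      ring
  rw [h1, coeffNorm]
  refine (abs_sum_le_sum_abs _ _).trans (sum_le_sum fun σ _ => ?_)
  refine (abs_sum_le_sum_abs _ _).trans (sum_le_sum fun τ _ => ?_)
  rw [abs_mul, abs_mul]
  by_cases h0 : x σ = 0 ∨ x τ = 0
  · rcases h0 with h0 | h0 <;> simp [h0]
  push Not at h0
  refine mul_le_mul_of_nonneg_left ?_ (by positivity)
  refine (abs_sum_le_sum_abs _ _).trans (sum_le_sum fun ρ _ => ?_)
  rw [abs_mul]
  by_cases hc : patternCoeff u σ τ ρ = 0
  · simp [hc]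
  refine mul_le_mul_of_nonneg_left (hE ρ ?_) (abs_nonneg _)
  refine (prod_elim_le_of_patternCoeff_ne_zero hu hc).trans ?_
  rw [sq]
  have hn : ∀ σ : P → Option ι, 0 ≤ ∏ a, (σ a).elim 1 fun _ => u a := fun σ =>
    prod_nonneg fun a _ => by
      have := hu a
      cases σ a
      · simp
      · simpa using by linarith
  exact mul_le_mul (hx σ h0.1) (hx τ h0.2) (hn τ) ((hn σ).trans (hx σ h0.1))

theorem sq_sieveWeight_le {u : P → ℝ} (hu : ∀ a, 1 ≤ u a) {x : (P → Option ι) → ℝ}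
    {R : ℝ} (hx : ∀ σ, x σ ≠ 0 → ∏ a, (σ a).elim 1 (fun _ => u a) ≤ R) (w : P → Option ι)
    {E : (P → Option ι) → ℝ}
    (hE : ∀ ρ : P → Option ι, ∏ a, (ρ a).elim 1 (fun _ => u a) ≤ R ^ 2 → 1 ≤ E ρ) :
    sieveWeight u x w ^ 2 ≤ coeffNorm u x E := by
  have h := abs_sum_sq_sieveWeight_sub_le (E := E) hu hx {0} (fun _ => 1) (fun _ => w) 0
    (fun _ _ => 0)
    fun ρ hρ => by
      rw [sum_singleton, one_mul, zero_mul, sub_zero]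
      refine le_trans ?_ (hE ρ hρ)
      rw [patternIndicator, abs_prod]
      refine prod_le_one (fun a _ => abs_nonneg _) fun a _ => ?_
      split_ifs <;> simp
  rw [sum_singleton, one_mul, zero_mul, sub_zero] at h
  exact (le_abs_self _).trans h

/-- The local factor of the norm of the coefficients. -/
noncomputable def localNorm (x : ℝ) (h : Option ι → ℝ) : ℝ :=
  ∑ s : Option ι, ∑ t : Option ι, s.elim 1 (fun _ => 1 / x) * t.elim 1 (fun _ => 1 / x) *
    ∑ r, |localCoeff x s t r| * h r

theorem coeffNorm_le (u : P → ℝ) {x : (P → Option ι) → ℝ} {c : ℝ}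
    (hx : ∀ σ, |x σ| ≤ c * ∏ a, (σ a).elim 1 fun _ => 1 / u a) {h : P → Option ι → ℝ}
    (hh : ∀ a r, 0 ≤ h a r) :
    coeffNorm u x (fun ρ => ∏ a, h a (ρ a)) ≤ c ^ 2 * ∏ a, localNorm (u a) (h a) := by
  have e1 : ∀ σ τ : P → Option ι, ∑ ρ, |patternCoeff u σ τ ρ| * ∏ a, h a (ρ a)
      = ∏ a, ∑ r, |localCoeff (u a) (σ a) (τ a) r| * h a r := by
    intro σ τ
    rw [prod_univ_sum, Fintype.piFinset_univ]
    refine sum_congr rfl fun ρ _ => ?_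
    rw [patternCoeff, abs_prod, prod_mul_distrib]
  have e2 : ∏ a, localNorm (u a) (h a) = ∑ σ : P → Option ι, ∑ τ : P → Option ι,
      (∏ a, (σ a).elim 1 fun _ => 1 / u a) * (∏ a, (τ a).elim 1 fun _ => 1 / u a) *
        ∏ a, ∑ r, |localCoeff (u a) (σ a) (τ a) r| * h a r := by
    simp only [localNorm]
    rw [prod_univ_sum, Fintype.piFinset_univ]
    refine sum_congr rfl fun σ _ => ?_
    rw [prod_univ_sum, Fintype.piFinset_univ]
    refine sum_congr rfl fun τ _ => ?_
    rw [prod_mul_distrib, prod_mul_distrib]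
  rw [e2, coeffNorm, mul_sum]
  refine sum_le_sum fun σ _ => ?_
  rw [mul_sum]
  refine sum_le_sum fun τ _ => ?_
  rw [e1]
  have h0 : 0 ≤ ∏ a, ∑ r, |localCoeff (u a) (σ a) (τ a) r| * h a r :=
    prod_nonneg fun a _ => sum_nonneg fun r _ => mul_nonneg (abs_nonneg _) (hh a r)
  rw [← mul_assoc]
  refine mul_le_mul_of_nonneg_right ?_ h0
  calc |x σ| * |x τ| ≤ (c * ∏ a, (σ a).elim 1 fun _ => 1 / u a) *
        (c * ∏ a, (τ a).elim 1 fun _ => 1 / u a) :=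
        mul_le_mul (hx σ) (hx τ) (abs_nonneg _) ((abs_nonneg _).trans (hx σ))
    _ = _ := by ring

omit [Fintype ι] in
theorem abs_localCoeff_some_le {x : ℝ} (hx : 1 ≤ x) (s t : Option ι) (i : ι) :
    |localCoeff x s t (some i)| ≤ (if s = some i then x else 0) + (if t = some i then x else 0)
      + (if s = some i then x else 0) * (if t = some i then x else 0) := by
  have h1 : ∀ s : Option ι, |localFactor x s none| = 1 := fun s => by
    cases s <;> simp [localFactor]
  have h2 : ∀ s : Option ι, localFactor x s (some i)
      = localFactor x s none + if s = some i then x else 0 := fun s => by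
    cases s with
    | none => simp [localFactor]
    | some j =>
      by_cases hj : i = j
      · simp [localFactor, hj]
        ring
      · have : ¬ j = i := fun h => hj h.symm
        simp [localFactor, hj, this]
  have h3 : ∀ s : Option ι, (0 : ℝ) ≤ if s = some i then x else 0 := fun s => by
    split_ifs <;> linarith
  simp only [localCoeff, Option.elim_some, h2]
  rw [show (localFactor x s none + if s = some i then x else 0)
      * (localFactor x t none + if t = some i then x else 0)
      - localFactor x s none * localFactor x t none
    = (if s = some i then x else 0) * localFactor x t none
      + localFactor x s none * (if t = some i then x else 0)
      + (if s = some i then x else 0) * (if t = some i then x else 0) by ring]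
  refine (abs_add_three _ _ _).trans_eq ?_
  rw [abs_mul, abs_mul, abs_mul, h1, h1, abs_of_nonneg (h3 s), abs_of_nonneg (h3 t)]
  ring

omit [Fintype ι] in
theorem abs_localCoeff_none (x : ℝ) (s t : Option ι) :
    |localCoeff x s t none| = 1 := by
  cases s <;> cases t <;> simp [localCoeff, localFactor]

theorem localNorm_elim_le {x c₀ c : ℝ} (hx : 1 ≤ x) (hc : 0 ≤ c) :
    localNorm x (fun r : Option ι => r.elim c₀ fun _ => c)
      ≤ c₀ * (1 + Fintype.card ι / x) ^ 2
        + Fintype.card ι * c * (3 + 2 * (Fintype.card ι / x)) := by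
  have hx0 : x ≠ 0 := by positivity
  let e : Option ι → ℝ := fun s => s.elim 1 fun _ => 1 / x
  have he0 : ∀ s, 0 ≤ e s := fun s => by cases s <;> simp only [e, Option.elim] <;> positivity
  have he : ∑ s, e s = 1 + Fintype.card ι / x := by
    simp [e, Fintype.sum_option, div_eq_mul_inv]
  have hei : ∀ i : ι, ∑ s, e s * (if s = some i then x else 0) = 1 := fun i => by
    simp [e, hx0]
  have key : ∀ i : ι, ∑ s, ∑ t, e s * e t * |localCoeff x s t (some i)|
      ≤ 3 + 2 * (Fintype.card ι / x) := by
    intro i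
    calc ∑ s, ∑ t, e s * e t * |localCoeff x s t (some i)|
        ≤ ∑ s, ∑ t, (e s * (if s = some i then x else 0) * e t
            + e s * (e t * (if t = some i then x else 0))
            + e s * (if s = some i then x else 0) * (e t * (if t = some i then x else 0))) := by
          refine sum_le_sum fun s _ => sum_le_sum fun t _ => ?_
          refine (mul_le_mul_of_nonneg_left (abs_localCoeff_some_le hx s t i)
            (mul_nonneg (he0 s) (he0 t))).trans_eq ?_
          ring
      _ = 3 + 2 * (Fintype.card ι / x) := by
          simp only [sum_add_distrib, ← mul_sum, ← sum_mul, hei, he]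
          ring
  calc localNorm x (fun r : Option ι => r.elim c₀ fun _ => c)
      = c₀ * ∑ s, ∑ t, e s * e t + c * ∑ i, ∑ s, ∑ t, e s * e t * |localCoeff x s t (some i)| := by
        have : ∀ s t : Option ι, e s * e t * ∑ r : Option ι,
            |localCoeff x s t r| * (r.elim c₀ fun _ => c) = c₀ * (e s * e t)
              + c * ∑ i, e s * e t * |localCoeff x s t (some i)| := fun s t => by
          rw [Fintype.sum_option, abs_localCoeff_none]
          simp only [Option.elim_none, Option.elim_some, mul_add, mul_sum]
          congr 1
          · ring
          · exact sum_congr rfl fun i _ => by ring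
        simp only [localNorm]
        simp only [e] at this ⊢
        simp only [this, sum_add_distrib, ← mul_sum]
        congr 2
        symm
        rw [Finset.sum_comm]
        refine sum_congr rfl fun s _ => ?_
        rw [Finset.sum_comm]
        simp only [mul_sum]
    _ ≤ c₀ * (1 + Fintype.card ι / x) ^ 2
        + c * ∑ _i : ι, (3 + 2 * (Fintype.card ι / x)) := by
        refine add_le_add (le_of_eq ?_)
          (mul_le_mul_of_nonneg_left (sum_le_sum fun i _ => key i) hc)
        simp only [← mul_sum, ← sum_mul, he]
        ring
    _ = _ := by
        rw [sum_const, card_univ, nsmul_eq_mul]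
        ring

theorem localNorm_le {x : ℝ} (hx : 4 * (Fintype.card ι + 1 : ℝ) ≤ x) :
    localNorm x (fun r : Option ι => r.elim 1 fun _ => 1 / (x - 1))
      ≤ 1 + 9 * Fintype.card ι / x := by
  have hk : (0 : ℝ) ≤ Fintype.card ι := Nat.cast_nonneg _
  refine (localNorm_elim_le (by linarith) (by rw [one_div, inv_nonneg]; linarith)).trans ?_
  set k : ℝ := (Fintype.card ι : ℝ)
  have hx0 : 0 < x := by linarith
  have h1 : k / x ≤ 1 / 4 := by rw [div_le_div_iff₀ hx0 (by norm_num)]; linarith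
  have h2 : 0 ≤ k / x := by positivity
  have h3 : k * (1 / (x - 1)) ≤ 4 / 3 * (k / x) := by
    rw [show 4 / 3 * (k / x) = k * (4 / 3 / x) by ring]
    refine mul_le_mul_of_nonneg_left ?_ hk
    rw [div_le_div_iff₀ (by linarith) hx0]
    linarith
  rw [mul_div_assoc]
  nlinarith [mul_le_mul_of_nonneg_right h3 (by linarith : 0 ≤ 3 + 2 * (k / x))]

theorem localNorm_zero_le {x : ℝ} (hx : 4 * (Fintype.card ι + 1 : ℝ) ≤ x) :
    localNorm x (fun r : Option ι => r.elim 0 fun _ => 1 / (x - 1))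
      ≤ 6 * Fintype.card ι / x := by
  have hk : (0 : ℝ) ≤ Fintype.card ι := Nat.cast_nonneg _
  refine (localNorm_elim_le (by linarith) (by rw [one_div, inv_nonneg]; linarith)).trans ?_
  set k : ℝ := (Fintype.card ι : ℝ)
  have hx0 : 0 < x := by linarith
  have h1 : k / x ≤ 1 / 4 := by rw [div_le_div_iff₀ hx0 (by norm_num)]; linarith
  have h2 : 0 ≤ k / x := by positivity
  have h3 : k * (1 / (x - 1)) ≤ 4 / 3 * (k / x) := by
    rw [show 4 / 3 * (k / x) = k * (4 / 3 / x) by ring]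
    refine mul_le_mul_of_nonneg_left ?_ hk
    rw [div_le_div_iff₀ (by linarith) hx0]
    linarith
  rw [mul_div_assoc]
  nlinarith [mul_le_mul_of_nonneg_right h3 (by linarith : 0 ≤ 3 + 2 * (k / x))]

end sieveExpand

theorem abs_sub_le_sum_range (G : ℕ → ℝ) {q i j : ℕ} (hi : i < q) (hj : j < q) :
    |G i - G j| ≤ ∑ n ∈ range q, |G (n + 1) - G n| := by
  wlog h : i ≤ j generalizing i j
  · rw [abs_sub_comm]
    exact this hj hi (by omega)
  rw [abs_sub_comm, ← Finset.sum_Ico_sub G h]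
  refine (abs_sum_le_sum_abs _ _).trans (sum_le_sum_of_subset_of_nonneg (fun n hn => ?_)
    fun n _ _ => abs_nonneg _)
  rw [mem_Ico] at hn
  rw [mem_range]
  omega

theorem abs_mul_sum_modEq_sub_le (G : ℕ → ℝ) {q : ℕ} (hq : 0 < q) (b J : ℕ) :
    |q * (∑ n ∈ range (q * J), if n ≡ b [MOD q] then G n else 0) - ∑ n ∈ range (q * J), G n|
      ≤ q * ∑ n ∈ range (q * J), |G (n + 1) - G n| := by
  induction J with
  | zero => simp
  | succ J ih =>
    rw [mul_add_one, sum_range_add, sum_range_add, sum_range_add]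
    have h1 : ∑ x ∈ range q, (if q * J + x ≡ b [MOD q] then G (q * J + x) else 0)
        = G (q * J + b % q) := by
      rw [sum_eq_single (b % q)]
      · rw [if_pos]
        rw [Nat.ModEq]
        simp
      · intro x hx hxb
        rw [if_neg]
        rw [Nat.ModEq, Nat.mul_add_mod, Nat.mod_eq_of_lt (mem_range.1 hx)]
        exact hxb
      · intro h
        exact absurd (mem_range.2 (Nat.mod_lt b hq)) h
    have h2 : |q * G (q * J + b % q) - ∑ x ∈ range q, G (q * J + x)|
        ≤ q * ∑ x ∈ range q, |G (q * J + x + 1) - G (q * J + x)| := by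
      have e1 : q * G (q * J + b % q) - ∑ x ∈ range q, G (q * J + x)
          = ∑ x ∈ range q, (G (q * J + b % q) - G (q * J + x)) := by
        rw [sum_sub_distrib, sum_const, card_range, nsmul_eq_mul]
      rw [e1]
      refine (abs_sum_le_sum_abs _ _).trans ?_
      refine (sum_le_card_nsmul _ _ _ fun x hx => abs_sub_le_sum_range (fun x => G (q * J + x))
        (Nat.mod_lt b hq) (mem_range.1 hx)).trans_eq ?_
      rw [card_range, nsmul_eq_mul]
      rfl
    rw [h1, mul_add, mul_add, add_sub_add_comm]
    exact (abs_add_le _ _).trans (add_le_add ih h2)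

theorem sum_range_eq_of_le {F : ℕ → ℝ} {N M : ℕ} (h : N ≤ M) (hF : ∀ n, N ≤ n → F n = 0) :
    ∑ n ∈ range M, F n = ∑ n ∈ range N, F n := by
  symm
  refine sum_subset (range_subset_range.2 h) fun n _ hn => hF n ?_
  simpa using hn

/-- A function of small variation is well distributed in residue classes. -/
theorem abs_sum_modEq_sub_le {G : ℕ → ℝ} {N : ℕ} (hG : ∀ n, N ≤ n → G n = 0) {V : ℝ}
    (hV : ∀ N, ∑ n ∈ range N, |G (n + 1) - G n| ≤ V) {q : ℕ} (hq : 0 < q) (b : ℕ) :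
    |(∑ n ∈ range N, if n ≡ b [MOD q] then G n else 0) - (∑ n ∈ range N, G n) / q| ≤ V := by
  have hNq : N ≤ q * N := Nat.le_mul_of_pos_left N hq
  have h := (abs_mul_sum_modEq_sub_le G hq b N).trans
    (mul_le_mul_of_nonneg_left (hV (q * N)) (Nat.cast_nonneg q))
  rw [sum_range_eq_of_le hNq hG, sum_range_eq_of_le hNq fun n hn => by simp [hG n hn]] at h
  have hq' : (0 : ℝ) < q := by exact_mod_cast hq
  rw [← mul_le_mul_iff_right₀ hq', ← abs_of_pos hq', ← abs_mul, abs_of_pos hq', mul_sub,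
    mul_div_cancel₀ _ hq'.ne']
  exact h

theorem sum_range_add_eq {F : ℕ → ℝ} {N h : ℕ} (h0 : ∀ n, n < h → F n = 0)
    (hF : ∀ n, N ≤ n → F n = 0) : ∑ n ∈ range N, F (n + h) = ∑ n ∈ range N, F n := by
  rw [← sum_range_eq_of_le (Nat.le_add_left N h) hF, sum_range_add,
    sum_eq_zero fun n hn => h0 n (mem_range.1 hn), zero_add]
  exact sum_congr rfl fun n _ => by rw [add_comm]

section pattern
variable {S : Finset ℕ} {W k : ℕ}

open Classical in
/-- For each prime of `S`, the form `n + i * W` divisible by it, if there is one. -/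
noncomputable def pattern (S : Finset ℕ) (W k n : ℕ) (a : S) : Option (Fin k) :=
  if h : ∃ i : Fin k, (a : ℕ) ∣ n + i * W then some h.choose else none

theorem pattern_eq_some_iff (hS : ∀ p ∈ S, p.Prime) (hSW : ∀ p ∈ S, ¬ p ∣ W)
    (hSk : ∀ p ∈ S, k ≤ p) (n : ℕ) (a : S) (i : Fin k) :
    pattern S W k n a = some i ↔ (a : ℕ) ∣ n + i * W := by
  have huniq : ∀ i j : Fin k, (a : ℕ) ∣ n + i * W → (a : ℕ) ∣ n + j * W → i ≤ j → i = j := by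
    intro i j hi hj hij
    have hij' : (i : ℕ) ≤ j := hij
    have h1 : (a : ℕ) ∣ ((j : ℕ) - i) * W := by
      have := (Nat.dvd_sub hj hi)
      rwa [Nat.add_sub_add_left, ← Nat.sub_mul] at this
    rcases (hS a a.2).dvd_mul.1 h1 with h | h
    · have h3 := hSk a a.2
      have h4 : (j : ℕ) - i = 0 := Nat.eq_zero_of_dvd_of_lt h (by omega)
      exact Fin.ext (by omega)
    · exact absurd h (hSW a a.2)
  have huniq' : ∀ i j : Fin k, (a : ℕ) ∣ n + i * W → (a : ℕ) ∣ n + j * W → i = j := by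
    intro i j hi hj
    rcases le_total i j with h | h
    · exact huniq i j hi hj h
    · exact (huniq j i hj hi h).symm
  unfold pattern
  split_ifs with h
  · rw [Option.some_inj]
    exact ⟨fun e => e ▸ h.choose_spec, fun hi => huniq' _ _ h.choose_spec hi⟩
  · simp only [false_iff]
    exact fun hi => h ⟨i, hi⟩

/-- The modulus of a pattern. -/
def patternMod (ρ : S → Option (Fin k)) : ℕ := ∏ a, (ρ a).elim 1 fun _ => (a : ℕ)

theorem cast_patternMod (ρ : S → Option (Fin k)) :
    (patternMod ρ : ℝ) = ∏ a, (ρ a).elim 1 fun _ => ((a : ℕ) : ℝ) := by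
  rw [patternMod, Nat.cast_prod]
  refine prod_congr rfl fun a _ => ?_
  cases ρ a <;> simp

theorem patternMod_pos (hS : ∀ p ∈ S, p.Prime) (ρ : S → Option (Fin k)) : 0 < patternMod ρ :=
  prod_pos fun a _ => by
    cases ρ a
    · simp
    · exact (hS a a.2).pos

theorem coprime_patternMod (hS : ∀ p ∈ S, p.Prime) (hSW : ∀ p ∈ S, ¬ p ∣ W)
    (ρ : S → Option (Fin k)) : W.Coprime (patternMod ρ) :=
  Nat.Coprime.prod_right fun a _ => by
    cases ρ a
    · simp
    · exact ((Nat.Prime.coprime_iff_not_dvd (hS a a.2)).2 (hSW a a.2)).symm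

/-- The integers congruent to `1` modulo `W` with a given pattern form a residue class. -/
theorem exists_modEq_iff (hS : ∀ p ∈ S, p.Prime) (hSW : ∀ p ∈ S, ¬ p ∣ W)
    (hSk : ∀ p ∈ S, k ≤ p) (ρ : S → Option (Fin k)) : ∃ b, ∀ n,
    (n ≡ 1 [MOD W] ∧ ∀ a, ρ a = none ∨ ρ a = pattern S W k n a)
      ↔ n ≡ b [MOD W * patternMod ρ] := by
  let s : S → ℕ := fun a => (ρ a).elim 1 fun _ => (a : ℕ)
  let c : S → ℕ := fun a => (ρ a).elim 0 fun i => (a - 1) * (i * W)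
  have hpp : Set.Pairwise ((univ : Finset S) : Set S) (Function.onFun Nat.Coprime s) := by
    intro a _ a' _ h
    simp only [s, Function.onFun]
    cases ρ a
    · simp
    · cases ρ a'
      · simp
      · exact (Nat.coprime_primes (hS a a.2) (hS a' a'.2)).2 fun e => h (Subtype.ext e)
  have hs : ∀ a ∈ (univ : Finset S), s a ≠ 0 := fun a _ => by
    simp only [s]
    cases ρ a
    · simp
    · exact (hS a a.2).ne_zero
  obtain ⟨b₁, hb₁⟩ := Nat.chineseRemainderOfFinset c s univ hs hpp
  obtain ⟨b, hb⟩ := Nat.chineseRemainder (coprime_patternMod hS hSW ρ) 1 b₁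
  have hloc : ∀ n a, (ρ a = none ∨ ρ a = pattern S W k n a) ↔ n ≡ c a [MOD s a] := by
    intro n a
    simp only [s, c]
    cases hρ : ρ a with
    | none => simp [Nat.modEq_one]
    | some i =>
      simp only [reduceCtorEq, false_or, Option.elim_some]
      rw [eq_comm, pattern_eq_some_iff hS hSW hSk]
      have hp := (hS a a.2).pos
      have h0 : (a - 1) * (i * W) + i * W ≡ 0 [MOD (a : ℕ)] := by
        rw [← Nat.succ_mul, Nat.succ_eq_add_one, Nat.sub_add_cancel hp]
        exact (Nat.modEq_zero_iff_dvd).2 (dvd_mul_right _ _)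
      rw [← Nat.modEq_zero_iff_dvd]
      constructor
      · intro h
        exact Nat.ModEq.add_right_cancel' (i * W) (h.trans h0.symm)
      · intro h
        exact (h.add_right _).trans h0
  refine ⟨b, fun n => ?_⟩
  rw [← Nat.modEq_and_modEq_iff_modEq_mul (coprime_patternMod hS hSW ρ)]
  have e1 : n ≡ b [MOD W] ↔ n ≡ 1 [MOD W] := ⟨fun h => h.trans hb.1, fun h => h.trans hb.1.symm⟩
  rw [e1]
  refine and_congr_right fun _ => ?_
  have e2 : n ≡ b [MOD patternMod ρ] ↔ n ≡ b₁ [MOD patternMod ρ] :=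
    ⟨fun h => h.trans hb.2, fun h => h.trans hb.2.symm⟩
  rw [e2]
  constructor
  · intro h
    rw [Nat.modEq_iff_dvd]
    have e3 : ((patternMod ρ : ℕ) : ℤ) = ∏ a, ((s a : ℕ) : ℤ) := Nat.cast_prod _ _
    rw [e3]
    refine prod_dvd_of_coprime (fun a ha a' ha' hne =>
      Nat.isCoprime_iff_coprime.2 (hpp ha ha' hne)) fun a _ => ?_
    exact Nat.modEq_iff_dvd.1 (((hloc n a).1 (h a)).trans (hb₁ a (mem_univ a)).symm)
  · intro h a
    rw [hloc]
    refine Nat.ModEq.trans (h.of_dvd ?_) (hb₁ a (mem_univ a))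
    exact dvd_prod_of_mem (fun a => (ρ a).elim 1 fun _ => (a : ℕ)) (mem_univ a)

theorem patternIndicator_eq_ite (ρ w : S → Option (Fin k)) :
    patternIndicator ρ w = if ∀ a, ρ a = none ∨ ρ a = w a then 1 else 0 := by
  rw [patternIndicator, prod_ite_zero]
  simp

theorem sum_mul_patternIndicator {N b : ℕ} (v : ℕ → ℝ) {ρ : S → Option (Fin k)}
    (hb : ∀ n, (n ≡ 1 [MOD W] ∧ ∀ a, ρ a = none ∨ ρ a = pattern S W k n a)
      ↔ n ≡ b [MOD W * patternMod ρ]) :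
    ∑ n ∈ range N, (if n ≡ 1 [MOD W] then v n else 0) * patternIndicator ρ (pattern S W k n)
      = ∑ n ∈ range N, if n ≡ b [MOD W * patternMod ρ] then v n else 0 := by
  refine sum_congr rfl fun n _ => ?_
  rw [patternIndicator_eq_ite, ite_zero_mul_ite_zero, mul_one]
  exact if_congr (hb n) rfl rfl

theorem abs_sum_mul_patternIndicator_sub_le (hW : 0 < W) (hS : ∀ p ∈ S, p.Prime)
    (hSW : ∀ p ∈ S, ¬ p ∣ W) (hSk : ∀ p ∈ S, k ≤ p) {G : ℕ → ℝ} {N : ℕ}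
    (hG : ∀ n, N ≤ n → G n = 0) {V : ℝ} (hV : ∀ N, ∑ n ∈ range N, |G (n + 1) - G n| ≤ V)
    (ρ : S → Option (Fin k)) :
    |∑ n ∈ range N, (if n ≡ 1 [MOD W] then G n else 0) * patternIndicator ρ (pattern S W k n)
      - (∑ n ∈ range N, G n) / W * ∏ a, (ρ a).elim 1 fun _ => 1 / ((a : ℕ) : ℝ)| ≤ V := by
  obtain ⟨b, hb⟩ := exists_modEq_iff hS hSW hSk ρ
  have h := abs_sum_modEq_sub_le hG hV (Nat.mul_pos hW (patternMod_pos hS ρ)) b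
  rw [sum_mul_patternIndicator G hb]
  convert h using 3
  rw [Nat.cast_mul, cast_patternMod, ← div_div, div_eq_mul_inv _ (∏ a, _), ← prod_inv_distrib]
  congr 1
  refine prod_congr rfl fun a _ => ?_
  cases ρ a <;> simp

end pattern

/-- Equidistribution of a weight on integers prime to `q` in the class of `c`, in terms of
primitive characters. -/
theorem abs_sum_modEq_sub_div_totient_le {q c : ℕ} [NeZero q] (hc : c.Coprime q) (T : Finset ℕ)
    (F : ℕ → ℝ) (hF : ∀ p ∈ T, F p ≠ 0 → p.Coprime q)
    {s : Finset (Σ f : ℕ, DirichletCharacter ℂ f)}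
    (hs : ∀ χ : DirichletCharacter ℂ q, χ ≠ 1 → ⟨χ.conductor, χ.primitiveCharacter⟩ ∈ s) :
    |(∑ p ∈ T, if p ≡ c [MOD q] then F p else 0) - (∑ p ∈ T, F p) / q.totient|
      ≤ 1 / q.totient * ∑ x ∈ s, (if x.1 ∣ q then 1 else 0) * ‖∑ p ∈ T, (F p : ℂ) * x.2 p‖ := by
  classical
  have hφ : (0 : ℝ) < q.totient := by exact_mod_cast Nat.totient_pos.2 (NeZero.pos q)
  have hφ' : (q.totient : ℂ) ≠ 0 := by exact_mod_cast hφ.ne'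
  have hcu : IsUnit (c : ZMod q) := (ZMod.isUnit_iff_coprime c q).2 hc
  have e1 : ((∑ p ∈ T, if p ≡ c [MOD q] then F p else 0 : ℝ) : ℂ)
      = 1 / q.totient * ∑ χ : DirichletCharacter ℂ q,
        χ (c : ZMod q)⁻¹ * ∑ p ∈ T, (F p : ℂ) * χ (p : ZMod q) := by
    simp only [mul_sum]
    rw [Finset.sum_comm, Complex.ofReal_sum]
    refine sum_congr rfl fun p _ => ?_
    have h := DirichletCharacter.sum_char_inv_mul_char_eq ℂ hcu (p : ZMod q)
    have h2 : ∀ χ : DirichletCharacter ℂ q, 1 / (q.totient : ℂ) * (χ (c : ZMod q)⁻¹ *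
        ((F p : ℂ) * χ (p : ZMod q))) = 1 / (q.totient : ℂ) * F p *
          (χ (c : ZMod q)⁻¹ * χ (p : ZMod q)) := fun χ => by ring
    simp only [h2]
    rw [← mul_sum, h]
    have h3 : ((c : ZMod q) = (p : ZMod q)) ↔ p ≡ c [MOD q] := by
      rw [ZMod.natCast_eq_natCast_iff]
      exact Nat.ModEq.comm
    by_cases h4 : p ≡ c [MOD q]
    · rw [if_pos h4, if_pos (h3.2 h4)]
      field_simp
    · rw [if_neg h4, if_neg fun h => h4 (h3.1 h)]
      simp
  have e2 : (1 : DirichletCharacter ℂ q) (c : ZMod q)⁻¹ *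
      ∑ p ∈ T, (F p : ℂ) * (1 : DirichletCharacter ℂ q) (p : ZMod q) = ∑ p ∈ T, (F p : ℂ) := by
    have hcu' : IsUnit (c : ZMod q)⁻¹ := by
      obtain ⟨a, ha⟩ := hcu
      rw [← ha, ZMod.inv_coe_unit]
      exact Units.isUnit _
    rw [MulChar.one_apply hcu', one_mul]
    refine sum_congr rfl fun p hp => ?_
    by_cases h0 : F p = 0
    · simp [h0]
    · rw [MulChar.one_apply ((ZMod.isUnit_iff_coprime p q).2 (hF p hp h0)), mul_one]
  have e3 : (((∑ p ∈ T, if p ≡ c [MOD q] then F p else 0)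
      - (∑ p ∈ T, F p) / q.totient : ℝ) : ℂ) = 1 / q.totient *
        ∑ χ ∈ (univ : Finset (DirichletCharacter ℂ q)).erase 1,
          χ (c : ZMod q)⁻¹ * ∑ p ∈ T, (F p : ℂ) * χ (p : ZMod q) := by
    rw [Complex.ofReal_sub, e1, ← add_sum_erase _ _ (mem_univ (1 : DirichletCharacter ℂ q)), e2]
    push_cast
    ring
  rw [← Real.norm_eq_abs, ← Complex.norm_real, e3, norm_mul]
  have e4 : ‖(1 / q.totient : ℂ)‖ = 1 / q.totient := by simp
  rw [e4]
  refine mul_le_mul_of_nonneg_left ?_ (by positivity)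
  let g : DirichletCharacter ℂ q → Σ f : ℕ, DirichletCharacter ℂ f :=
    fun χ => ⟨χ.conductor, χ.primitiveCharacter⟩
  have hg : Function.LeftInverse (fun x : Σ f : ℕ, DirichletCharacter ℂ f =>
      if h : x.1 ∣ q then DirichletCharacter.changeLevel h x.2 else 1) g := fun χ => by
    simp only [g]
    rw [dif_pos χ.conductor_dvd_level, DirichletCharacter.changeLevel_primitiveCharacter]
  calc ‖∑ χ ∈ (univ : Finset (DirichletCharacter ℂ q)).erase 1,
          χ (c : ZMod q)⁻¹ * ∑ p ∈ T, (F p : ℂ) * χ (p : ZMod q)‖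
      ≤ ∑ χ ∈ (univ : Finset (DirichletCharacter ℂ q)).erase 1,
        (if (g χ).1 ∣ q then 1 else 0) * ‖∑ p ∈ T, (F p : ℂ) * (g χ).2 p‖ := by
        refine (norm_sum_le _ _).trans (sum_le_sum fun χ _ => ?_)
        rw [norm_mul, if_pos χ.conductor_dvd_level]
        have h5 : ∑ p ∈ T, (F p : ℂ) * χ (p : ZMod q) = ∑ p ∈ T, (F p : ℂ) * (g χ).2 p := by
          refine sum_congr rfl fun p hp => ?_
          by_cases h0 : F p = 0
          · simp [h0]
          · rw [← changeLevel_natCast_apply χ.primitiveCharacter χ.conductor_dvd_level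
              (hF p hp h0), DirichletCharacter.changeLevel_primitiveCharacter]
        rw [h5]
        exact mul_le_mul_of_nonneg_right (DirichletCharacter.norm_le_one _ _) (norm_nonneg _)
    _ = ∑ x ∈ ((univ : Finset (DirichletCharacter ℂ q)).erase 1).image g,
        (if x.1 ∣ q then 1 else 0) * ‖∑ p ∈ T, (F p : ℂ) * x.2 p‖ := by
        rw [sum_image fun _ _ _ _ h => hg.injective h]
    _ ≤ _ := by
        refine sum_le_sum_of_subset_of_nonneg (fun x hx => ?_) fun x _ _ => ?_
        · obtain ⟨χ, hχ, rfl⟩ := mem_image.1 hx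
          exact hs χ (ne_of_mem_erase hχ)
        · split_ifs <;> positivity

section sieveError
variable {S : Finset ℕ} {W k : ℕ}

theorem not_dvd_mul_patternMod (hS : ∀ p ∈ S, p.Prime) (hSW : ∀ p ∈ S, ¬ p ∣ W)
    {ρ : S → Option (Fin k)} {a : S} (ha : ρ a = none) : ¬ (a : ℕ) ∣ W * patternMod ρ := by
  intro h
  rcases (hS a a.2).dvd_mul.1 h with h | h
  · exact hSW a a.2 h
  · rw [patternMod, (hS a a.2).prime.dvd_finsetProd_iff] at h
    obtain ⟨a', _, h⟩ := h
    cases hρ : ρ a' with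
    | none =>
      rw [hρ] at h
      exact (hS a a.2).one_lt.ne' (Nat.dvd_one.1 h)
    | some i =>
      rw [hρ] at h
      have := (Nat.prime_dvd_prime_iff_eq (hS a a.2) (hS a' a'.2)).1 h
      rw [← Subtype.ext this, ha] at hρ
      simp at hρ

theorem totient_patternMod (hS : ∀ p ∈ S, p.Prime) (ρ : S → Option (Fin k)) :
    ((patternMod ρ).totient : ℝ) = ∏ a, (ρ a).elim 1 fun _ => ((a : ℕ) : ℝ) - 1 := by
  classical
  have h : ∀ T : Finset S, ((∏ a ∈ T, (ρ a).elim 1 fun _ => (a : ℕ)).totient : ℝ)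
      = ∏ a ∈ T, (ρ a).elim 1 fun _ => ((a : ℕ) : ℝ) - 1 := by
    intro T
    induction T using Finset.induction_on with
    | empty => simp
    | insert a T ha ih =>
      rw [prod_insert ha, prod_insert ha, ← ih, Nat.totient_mul]
      · push_cast
        congr 1
        cases ρ a
        · simp
        · simp only [Option.elim_some]
          rw [Nat.totient_prime (hS a a.2), Nat.cast_sub (hS a a.2).pos, Nat.cast_one]
      · refine Nat.Coprime.prod_right fun a' ha' => ?_
        cases ρ a
        · simp
        · cases ρ a'
          · simp
          · refine (Nat.coprime_primes (hS a a.2) (hS a' a'.2)).2 fun e => ha ?_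
            rwa [Subtype.ext e]
  exact h univ

/-- The density of a pattern in the progressions to a modulus divisible by `f`. -/
noncomputable def patternDensity (f : ℕ) (a : S) (r : Option (Fin k)) : ℝ :=
  r.elim (if (a : ℕ) ∣ f then 0 else 1) fun _ => 1 / (((a : ℕ) : ℝ) - 1)

theorem patternDensity_nonneg (hS : ∀ p ∈ S, p.Prime) (f : ℕ) (a : S) (r : Option (Fin k)) :
    0 ≤ patternDensity f a r := by
  have : (1 : ℝ) ≤ (a : ℕ) := by exact_mod_cast (hS a a.2).pos
  cases r
  · simp only [patternDensity, Option.elim_none]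
    split_ifs <;> norm_num
  · simp only [patternDensity, Option.elim_some, one_div, inv_nonneg]
    linarith

theorem ite_dvd_div_totient_le (hS : ∀ p ∈ S, p.Prime) (hSW : ∀ p ∈ S, ¬ p ∣ W) (f : ℕ)
    (ρ : S → Option (Fin k)) : 1 / ((W * patternMod ρ).totient : ℝ) *
      (if f ∣ W * patternMod ρ then 1 else 0)
      ≤ 1 / W.totient * ∏ a, patternDensity f a (ρ a) := by
  have h0 : 0 ≤ ∏ a, patternDensity f a (ρ a) :=
    prod_nonneg fun a _ => patternDensity_nonneg hS f a (ρ a)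
  split_ifs with h
  · rw [mul_one, Nat.totient_mul (coprime_patternMod hS hSW ρ), Nat.cast_mul,
      totient_patternMod hS ρ, one_div, mul_inv, ← one_div, ← prod_inv_distrib]
    refine le_of_eq ?_
    congr 1
    refine prod_congr rfl fun a _ => ?_
    cases hρ : ρ a with
    | none =>
      have : ¬ (a : ℕ) ∣ f := fun h' => not_dvd_mul_patternMod hS hSW hρ (h'.trans h)
      simp [patternDensity, this]
    | some i => simp [patternDensity]
  · rw [mul_zero]
    positivity

theorem abs_sum_prime_mul_patternIndicator_sub_le (hW : 0 < W) (hS : ∀ p ∈ S, p.Prime)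
    (hSW : ∀ p ∈ S, ¬ p ∣ W) (hSk : ∀ p ∈ S, k ≤ p) {F : ℕ → ℝ} {N : ℕ}
    (hFp : ∀ n, F n ≠ 0 → n.Prime) (hFN : ∀ n, F n ≠ 0 → n < N) (hFW : ∀ n, F n ≠ 0 → k * W < n)
    (hFS : ∀ n, F n ≠ 0 → ∀ p ∈ S, p < n) (ρ : S → Option (Fin k)) (m : Fin k)
    {s : Finset (Σ f : ℕ, DirichletCharacter ℂ f)}
    (hs : ∀ χ : DirichletCharacter ℂ (W * patternMod ρ), χ ≠ 1 →
      ⟨χ.conductor, χ.primitiveCharacter⟩ ∈ s) :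
    |∑ n ∈ range N, (if n ≡ 1 [MOD W] then F (n + m * W) else 0)
          * patternIndicator ρ (pattern S W k n)
        - (∑ n ∈ range N, F n) / W.totient *
          ∏ a, (ρ a).elim 1 fun i => if i = m then 0 else 1 / (((a : ℕ) : ℝ) - 1)|
      ≤ ∑ x ∈ s, 1 / W.totient * ‖∑ p ∈ range N, (F p : ℂ) * x.2 p‖ *
        ∏ a, patternDensity x.1 a (ρ a) := by
  have hq0 : 0 < W * patternMod ρ := Nat.mul_pos hW (patternMod_pos hS ρ)
  have : NeZero (W * patternMod ρ) := ⟨hq0.ne'⟩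
  have hk : m * W ≤ k * W := Nat.mul_le_mul_right W m.2.le
  by_cases hm : ∃ a, ρ a = some m
  · obtain ⟨a, ha⟩ := hm
    rw [prod_eq_zero (mem_univ a) (by rw [ha]; simp), mul_zero, sub_zero, sum_eq_zero, abs_zero]
    · exact sum_nonneg fun x _ => mul_nonneg (by positivity)
        (prod_nonneg fun a _ => patternDensity_nonneg hS _ a (ρ a))
    · intro n _
      rw [patternIndicator_eq_ite]
      by_cases h : ∀ a, ρ a = none ∨ ρ a = pattern S W k n a
      · have h1 := h a
        rw [ha] at h1
        simp only [reduceCtorEq, false_or] at h1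
        have h2 := (pattern_eq_some_iff hS hSW hSk n a m).1 h1.symm
        have h3 : F (n + m * W) = 0 := by
          by_contra h0
          have h4 := (Nat.prime_dvd_prime_iff_eq (hS a a.2) (hFp _ h0)).1 h2
          exact (hFS _ h0 a a.2).ne h4
        simp [h3]
      · rw [if_neg h, mul_zero]
  push Not at hm
  obtain ⟨b, hb⟩ := exists_modEq_iff hS hSW hSk ρ
  rw [sum_mul_patternIndicator (fun n => F (n + m * W)) hb]
  have e1 : ∑ n ∈ range N, (if n ≡ b [MOD W * patternMod ρ] then F (n + m * W) else 0)
      = ∑ n ∈ range N, if n ≡ b + m * W [MOD W * patternMod ρ] then F n else 0 := by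
    rw [← sum_range_add_eq (h := m * W)
      (F := fun n => if n ≡ b + m * W [MOD W * patternMod ρ] then F n else 0)]
    · refine sum_congr rfl fun n _ => if_congr ?_ rfl rfl
      exact ⟨fun h => h.add_right _, fun h => Nat.ModEq.add_right_cancel' _ h⟩
    · intro n hn
      have : F n = 0 := by
        by_contra h0
        have := hFW n h0
        omega
      simp [this]
    · intro n hn
      have : F n = 0 := by
        by_contra h0
        have := hFN n h0
        omega
      simp [this]
  obtain ⟨hb1, hb2⟩ := (hb b).2 rfl
  have hc : (b + m * W).Coprime (W * patternMod ρ) := by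
    refine Nat.Coprime.mul_right ?_ (Nat.Coprime.prod_right fun a _ => ?_)
    · rw [Nat.coprime_add_mul_right_left]
      have := hb1.gcd_eq
      rw [Nat.gcd_one_left] at this
      exact this
    · cases hρ : ρ a with
      | none => simp
      | some i =>
        refine ((Nat.Prime.coprime_iff_not_dvd (hS a a.2)).2 fun h => ?_).symm
        have h1 := (pattern_eq_some_iff hS hSW hSk b a m).2 h
        rcases hb2 a with h2 | h2
        · rw [hρ] at h2
          simp at h2
        · exact hm a (h2.trans h1)
  have hcop : ∀ p ∈ range N, F p ≠ 0 → p.Coprime (W * patternMod ρ) := by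
    intro p _ h0
    have hp := hFp p h0
    refine Nat.Coprime.mul_right ?_ (Nat.Coprime.prod_right fun a _ => ?_)
    · refine (Nat.Prime.coprime_iff_not_dvd hp).2 fun h => ?_
      have h1 := Nat.le_of_dvd hW h
      have h2 := hFW p h0
      have h3 : 1 ≤ k := Nat.one_le_of_lt m.2
      nlinarith
    · cases ρ a
      · simp
      · exact (Nat.coprime_primes hp (hS a a.2)).2 (hFS p h0 a a.2).ne'
  have h := abs_sum_modEq_sub_div_totient_le hc (range N) F hcop hs
  rw [e1]
  have e2 : ∏ a, (ρ a).elim 1 (fun i => if i = m then 0 else 1 / (((a : ℕ) : ℝ) - 1))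
      = 1 / ((patternMod ρ).totient : ℝ) := by
    rw [totient_patternMod hS ρ, one_div, ← prod_inv_distrib]
    refine prod_congr rfl fun a _ => ?_
    cases hρ : ρ a with
    | none => simp
    | some i =>
      have : ¬ i = m := fun e => hm a (by rw [hρ, e])
      simp [this]
  rw [e2, div_mul_div_comm, mul_one, ← Nat.cast_mul,
    ← Nat.totient_mul (coprime_patternMod hS hSW ρ)]
  refine h.trans ?_
  rw [mul_sum]
  refine sum_le_sum fun x _ => ?_
  calc 1 / ((W * patternMod ρ).totient : ℝ) * ((if x.1 ∣ W * patternMod ρ then 1 else 0) *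
        ‖∑ p ∈ range N, (F p : ℂ) * x.2 p‖)
      = 1 / ((W * patternMod ρ).totient : ℝ) * (if x.1 ∣ W * patternMod ρ then 1 else 0) *
        ‖∑ p ∈ range N, (F p : ℂ) * x.2 p‖ := by ring
    _ ≤ 1 / W.totient * (∏ a, patternDensity x.1 a (ρ a)) *
        ‖∑ p ∈ range N, (F p : ℂ) * x.2 p‖ :=
        mul_le_mul_of_nonneg_right (ite_dvd_div_totient_le hS hSW x.1 ρ) (norm_nonneg _)
    _ = _ := by ring

theorem le_mul_prod_dvd (hS : ∀ p ∈ S, p.Prime) (hW : 0 < W) {f : ℕ}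
    (hf : f ∣ W * ∏ a : S, (a : ℕ)) : f ≤ W * ∏ a : S, if (a : ℕ) ∣ f then (a : ℕ) else 1 := by
  have h1 : ∏ a : S, (a : ℕ) = (∏ a : S, if (a : ℕ) ∣ f then (a : ℕ) else 1) *
      ∏ a : S, if (a : ℕ) ∣ f then 1 else (a : ℕ) := by
    rw [← prod_mul_distrib]
    exact prod_congr rfl fun a _ => by split_ifs <;> simp
  have h2 : f.Coprime (∏ a : S, if (a : ℕ) ∣ f then 1 else (a : ℕ)) := by
    refine Nat.Coprime.prod_right fun a _ => ?_
    split_ifs with h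
    · simp
    · exact ((Nat.Prime.coprime_iff_not_dvd (hS a a.2)).2 h).symm
  rw [h1, ← mul_assoc] at hf
  refine Nat.le_of_dvd (Nat.mul_pos hW (prod_pos fun a _ => ?_)) (h2.dvd_of_dvd_mul_right hf)
  split_ifs
  · exact (hS a a.2).pos
  · exact one_pos

theorem coeffNorm_patternDensity_le (hS : ∀ p ∈ S, p.Prime) (hW : 0 < W)
    (hSk : ∀ p ∈ S, 4 * (k + 1 : ℝ) ≤ p) (hSk' : ∀ p ∈ S, 36 * (k : ℝ) ^ 2 ≤ p)
    {x : (S → Option (Fin k)) → ℝ} {c : ℝ}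
    (hx : ∀ σ, |x σ| ≤ c * ∏ a, (σ a).elim 1 fun _ => 1 / ((a : ℕ) : ℝ)) {f : ℕ} (hf0 : 0 < f)
    (hf : f ∣ W * ∏ a : S, (a : ℕ)) :
    coeffNorm (fun a : S => ((a : ℕ) : ℝ)) x (fun ρ => ∏ a, patternDensity f a (ρ a))
      ≤ c ^ 2 * (√W / √f * ∏ a : S, (1 + 9 * k / ((a : ℕ) : ℝ))) := by
  refine (coeffNorm_le _ hx (fun a r => patternDensity_nonneg hS f a r)).trans ?_
  refine mul_le_mul_of_nonneg_left ?_ (sq_nonneg c)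
  have hpos : ∀ a : S, (0 : ℝ) < (a : ℕ) := fun a => by exact_mod_cast (hS a a.2).pos
  have h1 : ∀ a : S, localNorm ((a : ℕ) : ℝ) (patternDensity (k := k) f a)
      ≤ (if (a : ℕ) ∣ f then 1 / √((a : ℕ) : ℝ) else 1) * (1 + 9 * k / ((a : ℕ) : ℝ)) := by
    intro a
    have hk : (0 : ℝ) ≤ k := Nat.cast_nonneg k
    have ha := hpos a
    have h4 := hSk a a.2
    split_ifs with h
    · have e : patternDensity (k := k) f a = fun r => r.elim 0 fun _ => 1 /
        (((a : ℕ) : ℝ) - 1) := by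
        funext r
        simp [patternDensity, h]
      rw [e]
      refine (localNorm_zero_le (by simpa using h4)).trans ?_
      rw [Fintype.card_fin]
      have h5 : 6 * (k : ℝ) ≤ √((a : ℕ) : ℝ) :=
        Real.le_sqrt_of_sq_le (by linarith [hSk' a a.2])
      have h6 : 6 * k / ((a : ℕ) : ℝ) ≤ 1 / √((a : ℕ) : ℝ) := by
        rw [div_le_div_iff₀ ha (Real.sqrt_pos.2 ha), one_mul]
        calc 6 * k * √((a : ℕ) : ℝ) ≤ √((a : ℕ) : ℝ) * √((a : ℕ) : ℝ) := by gcongr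
          _ = _ := Real.mul_self_sqrt ha.le
      refine h6.trans (le_mul_of_one_le_right (by positivity) ?_)
      linarith [show 0 ≤ 9 * k / ((a : ℕ) : ℝ) by positivity]
    · have e : patternDensity (k := k) f a = fun r => r.elim 1 fun _ => 1 /
        (((a : ℕ) : ℝ) - 1) := by
        funext r
        simp [patternDensity, h]
      rw [e, one_mul]
      exact (localNorm_le (by simpa using h4)).trans_eq (by rw [Fintype.card_fin])
  have h0 : ∀ a : S, 0 ≤ localNorm ((a : ℕ) : ℝ) (patternDensity (k := k) f a) := fun a => by
    refine sum_nonneg fun s _ => sum_nonneg fun t _ => mul_nonneg (mul_nonneg ?_ ?_)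
      (sum_nonneg fun r _ => mul_nonneg (abs_nonneg _) (patternDensity_nonneg hS f a r))
    · cases s <;> simp
    · cases t <;> simp
  refine (prod_le_prod (fun a _ => h0 a) fun a _ => h1 a).trans ?_
  rw [prod_mul_distrib]
  refine mul_le_mul_of_nonneg_right ?_ (prod_nonneg fun a _ => by
    have := hpos a
    positivity)
  have h2 : ∏ a : S, (if (a : ℕ) ∣ f then 1 / √((a : ℕ) : ℝ) else 1)
      = 1 / √(∏ a : S, if (a : ℕ) ∣ f then ((a : ℕ) : ℝ) else 1) := by
    rw [Real.sqrt_prod _ fun a _ => by split_ifs <;> positivity, one_div, ← prod_inv_distrib]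
    exact prod_congr rfl fun a _ => by split_ifs <;> simp
  have hf0' : (0 : ℝ) < f := by exact_mod_cast hf0
  have hP : (0 : ℝ) < ∏ a : S, if (a : ℕ) ∣ f then ((a : ℕ) : ℝ) else 1 :=
    prod_pos fun a _ => by
      split_ifs
      · exact hpos a
      · exact one_pos
  rw [h2, div_le_div_iff₀ (Real.sqrt_pos.2 hP) (Real.sqrt_pos.2 hf0'), one_mul,
    ← Real.sqrt_mul (Nat.cast_nonneg W)]
  refine Real.sqrt_le_sqrt ?_
  have := le_mul_prod_dvd hS hW hf
  calc (f : ℝ) ≤ ((W * ∏ a : S, if (a : ℕ) ∣ f then (a : ℕ) else 1 : ℕ) : ℝ) := by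
        exact_mod_cast this
    _ = _ := by
      push_cast
      rfl

end sieveError

section sieveCoeff
variable {P ι : Type*} [Fintype P] [DecidableEq P] [Fintype ι] [DecidableEq ι]

omit [DecidableEq P] in
theorem abs_sieveCoeff_le {u : P → ℝ} (hu : ∀ a, 0 < u a) {f : ℝ → ℝ} (hf0 : ∀ x, 0 ≤ f x)
    (hf2 : ∀ x, f x ≤ 2) (R : ℝ) (σ : P → Option ι) :
    |sieveCoeff u f R σ| ≤ 2 ^ Fintype.card ι * ∏ a, (σ a).elim 1 fun _ => 1 / u a := by
  have h1 : |∏ a, (σ a).elim 1 fun _ => -1 / u a| = ∏ a, (σ a).elim 1 fun _ => 1 / u a := by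
    rw [abs_prod]
    refine prod_congr rfl fun a _ => ?_
    cases σ a
    · simp
    · simp [abs_div, abs_of_pos (hu a)]
  have h2 : |(∏ i, f (vol u (fiber σ i))) *
      if ∏ a, (σ a).elim 1 (fun _ => u a) ≤ R then 1 else 0| ≤ 2 ^ Fintype.card ι := by
    have h3 : ∏ i, f (vol u (fiber σ i)) ≤ 2 ^ Fintype.card ι := by
      refine (prod_le_prod (fun i _ => hf0 _) fun i _ => hf2 _).trans_eq ?_
      simp
    have h4 : 0 ≤ ∏ i, f (vol u (fiber σ i)) := prod_nonneg fun i _ => hf0 _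
    split_ifs
    · rwa [mul_one, abs_of_nonneg h4]
    · rw [mul_zero, abs_zero]
      positivity
  rw [sieveCoeff, abs_mul, h1, mul_comm]
  refine mul_le_mul_of_nonneg_right h2 (prod_nonneg fun a _ => ?_)
  cases σ a
  · simp
  · simpa using (hu a).le

omit [DecidableEq P] in
theorem prod_le_of_sieveCoeff_ne_zero {u : P → ℝ} {f : ℝ → ℝ} {R : ℝ} {σ : P → Option ι}
    (h : sieveCoeff u f R σ ≠ 0) : ∏ a, (σ a).elim 1 (fun _ => u a) ≤ R := by
  by_contra h'
  exact h (by simp [sieveCoeff, h'])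

end sieveCoeff

theorem sum_prime_inv_dyadic_le (J : ℕ) :
    ∑ p ∈ (Ioc (2 ^ J) (2 ^ (J + 1))).filter Nat.Prime, 1 / (p : ℝ) ≤ 8 / (J + 1) := by
  have hθ : ∑ p ∈ (Ioc (2 ^ J) (2 ^ (J + 1))).filter Nat.Prime, Real.log p
      ≤ Real.log 4 * 2 ^ (J + 1) := by
    refine le_trans ?_ (Chebyshev.theta_le_log4_mul_x (x := 2 ^ (J + 1)) (by positivity))
    rw [Chebyshev.theta]
    have h1 : ⌊(2 : ℝ) ^ (J + 1)⌋₊ = 2 ^ (J + 1) := by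
      rw [show (2 : ℝ) ^ (J + 1) = ((2 ^ (J + 1) : ℕ) : ℝ) by push_cast; rfl, Nat.floor_natCast]
    rw [h1]
    refine sum_le_sum_of_subset_of_nonneg (filter_subset_filter _ (Ioc_subset_Ioc_left
      (Nat.zero_le _))) fun p _ _ => Real.log_natCast_nonneg p
  have hlog2 : 0 < Real.log 2 := Real.log_pos (by norm_num)
  have hlog4 : Real.log 4 = 2 * Real.log 2 := by
    rw [show (4 : ℝ) = 2 ^ 2 by norm_num, Real.log_pow]
    norm_num
  have h2J : (0 : ℝ) < 2 ^ J := by positivity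
  rcases Nat.eq_zero_or_pos J with rfl | hJ
  · have : (Ioc (2 ^ 0) (2 ^ (0 + 1))).filter Nat.Prime = {2} := by decide
    rw [this]
    norm_num
  have hJ' : (1 : ℝ) ≤ J := by exact_mod_cast hJ
  calc ∑ p ∈ (Ioc (2 ^ J) (2 ^ (J + 1))).filter Nat.Prime, 1 / (p : ℝ)
      ≤ ∑ p ∈ (Ioc (2 ^ J) (2 ^ (J + 1))).filter Nat.Prime,
        Real.log p * (1 / (2 ^ J * (J * Real.log 2))) := by
        refine sum_le_sum fun p hp => ?_
        have h1 : 2 ^ J < p := (mem_Ioc.1 (mem_filter.1 hp).1).1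
        have h2 : (2 : ℝ) ^ J ≤ p := by exact_mod_cast h1.le
        have h3 : J * Real.log 2 ≤ Real.log p := by
          rw [← Real.log_pow]
          exact Real.log_le_log h2J h2
        rw [mul_one_div, div_le_div_iff₀ (by linarith) (by positivity), one_mul]
        calc 2 ^ J * (J * Real.log 2) ≤ p * Real.log p := by gcongr
          _ = _ := mul_comm _ _
    _ ≤ Real.log 4 * 2 ^ (J + 1) * (1 / (2 ^ J * (J * Real.log 2))) := by
        rw [← sum_mul]
        gcongr
    _ = 4 / J := by
        rw [hlog4, pow_succ]
        field_simp
        norm_num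
    _ ≤ _ := by
        rw [div_le_div_iff₀ (by linarith) (by linarith)]
        linarith

theorem sum_prime_inv_le (J : ℕ) :
    ∑ p ∈ (range (2 ^ J + 1)).filter Nat.Prime, 1 / (p : ℝ) ≤ 8 * harmonic J := by
  induction J with
  | zero =>
    have : (range (2 ^ 0 + 1)).filter Nat.Prime = ∅ := by decide
    rw [this]
    simp
  | succ J ih =>
    have h1 : (range (2 ^ (J + 1) + 1)).filter Nat.Prime
        = (range (2 ^ J + 1)).filter Nat.Prime ∪ (Ioc (2 ^ J) (2 ^ (J + 1))).filter Nat.Prime := by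
      rw [← filter_union]
      congr 1
      ext n
      have : 2 ^ J ≤ 2 ^ (J + 1) := Nat.pow_le_pow_right (by norm_num) (Nat.le_succ J)
      simp only [mem_range, mem_union, mem_Ioc]
      omega
    have h2 := (sum_union_inter (s₁ := (range (2 ^ J + 1)).filter Nat.Prime)
      (s₂ := (Ioc (2 ^ J) (2 ^ (J + 1))).filter Nat.Prime) (f := fun p : ℕ => 1 / (p : ℝ)))
    have h3 : 0 ≤ ∑ p ∈ (range (2 ^ J + 1)).filter Nat.Prime ∩
      (Ioc (2 ^ J) (2 ^ (J + 1))).filter Nat.Prime, 1 / (p : ℝ) :=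
      sum_nonneg fun p _ => by positivity
    have h4 := sum_prime_inv_dyadic_le J
    rw [h1, harmonic_succ]
    push_cast
    rw [div_eq_mul_inv] at h4
    linarith

theorem sum_sievePrimes_inv_le (W ℓ : ℕ) {L : ℝ} (hL : 2 ≤ L) {N : ℕ}
    (hN : (N : ℝ) ≤ Real.exp (L / 1000)) :
    ∑ p ∈ sievePrimes W ℓ N, 1 / (p : ℝ) ≤ 8 + 8 * Real.log L := by
  set J := ⌊L⌋₊
  have hJ1 : L < J + 1 := Nat.lt_floor_add_one L
  have hJ0 : (1 : ℝ) ≤ J := by exact_mod_cast Nat.le_floor (by push_cast; linarith)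
  have hNJ : N ≤ 2 ^ J := by
    have h1 : Real.exp (L / 1000) ≤ 2 ^ J := by
      rw [← Real.exp_log (show (0 : ℝ) < 2 ^ J by positivity), Real.log_pow]
      refine Real.exp_le_exp.2 ?_
      nlinarith [Real.log_two_gt_d9]
    exact_mod_cast hN.trans h1
  calc ∑ p ∈ sievePrimes W ℓ N, 1 / (p : ℝ)
      ≤ ∑ p ∈ (range (2 ^ J + 1)).filter Nat.Prime, 1 / (p : ℝ) := by
        refine sum_le_sum_of_subset_of_nonneg (fun p hp => ?_) fun p _ _ => by positivity
        rw [sievePrimes, mem_filter, mem_range] at hp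
        rw [mem_filter, mem_range]
        exact ⟨by omega, hp.2.1⟩
    _ ≤ 8 * harmonic J := sum_prime_inv_le J
    _ ≤ 8 * (1 + Real.log J) := by
        gcongr
        exact harmonic_le_one_add_log J
    _ ≤ 8 * (1 + Real.log L) := by
        have : Real.log J ≤ Real.log L :=
          Real.log_le_log (by linarith) (Nat.floor_le (by linarith))
        linarith
    _ = _ := by ring

theorem prod_one_add_div_le (W ℓ k : ℕ) {L : ℝ} (hL : 2 ≤ L) {N : ℕ}
    (hN : (N : ℝ) ≤ Real.exp (L / 1000)) :
    ∏ a : sievePrimes W ℓ N, (1 + 9 * k / ((a : ℕ) : ℝ)) ≤ (Real.exp 1 * L) ^ (72 * k) := by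
  have hL0 : 0 < L := by linarith
  calc ∏ a : sievePrimes W ℓ N, (1 + 9 * k / ((a : ℕ) : ℝ))
      ≤ ∏ a : sievePrimes W ℓ N, Real.exp (9 * k * (1 / ((a : ℕ) : ℝ))) := by
        refine prod_le_prod (fun a _ => by positivity) fun a _ => ?_
        rw [mul_one_div, add_comm]
        exact Real.add_one_le_exp _
    _ = Real.exp (9 * k * ∑ p ∈ sievePrimes W ℓ N, 1 / (p : ℝ)) := by
        rw [← Real.exp_sum, ← mul_sum, sum_coe_sort (sievePrimes W ℓ N) fun p => 1 / (p : ℝ)]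
    _ ≤ Real.exp (9 * k * (8 + 8 * Real.log L)) :=
        Real.exp_le_exp.2 (mul_le_mul_of_nonneg_left (sum_sievePrimes_inv_le W ℓ hL hN)
          (by positivity))
    _ = _ := by
        rw [mul_pow, ← Real.exp_nat_mul, ← Real.exp_log hL0, ← Real.exp_nat_mul, Real.log_exp,
          ← Real.exp_add]
        push_cast
        ring_nf

theorem coeffNorm_sum {P ι α : Type*} [Fintype P] [DecidableEq P] [Fintype ι] [DecidableEq ι]
    (u : P → ℝ) (x : (P → Option ι) → ℝ) (s : Finset α) (c : α → ℝ)
    (E : α → (P → Option ι) → ℝ) :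
    coeffNorm u x (fun ρ => ∑ y ∈ s, c y * E y ρ) = ∑ y ∈ s, c y * coeffNorm u x (E y) := by
  simp only [coeffNorm, mul_sum]
  symm
  rw [Finset.sum_comm]
  refine sum_congr rfl fun σ _ => ?_
  rw [Finset.sum_comm]
  refine sum_congr rfl fun τ _ => ?_
  rw [Finset.sum_comm]
  exact sum_congr rfl fun ρ _ => sum_congr rfl fun y _ => by ring

theorem coeffNorm_const_mul {P ι : Type*} [Fintype P] [DecidableEq P] [Fintype ι] [DecidableEq ι]
    (u : P → ℝ) (x : (P → Option ι) → ℝ) (c : ℝ) (E : (P → Option ι) → ℝ) :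
    coeffNorm u x (fun ρ => c * E ρ) = c * coeffNorm u x E := by
  simpa using coeffNorm_sum u x {()} (fun _ => c) (fun _ => E)

theorem coeffNorm_nonneg {P ι : Type*} [Fintype P] [DecidableEq P] [Fintype ι] [DecidableEq ι]
    (u : P → ℝ) (x : (P → Option ι) → ℝ) {E : (P → Option ι) → ℝ} (hE : ∀ ρ, 0 ≤ E ρ) :
    0 ≤ coeffNorm u x E :=
  sum_nonneg fun _ _ => sum_nonneg fun _ _ => mul_nonneg (by positivity)
    (sum_nonneg fun ρ _ => mul_nonneg (abs_nonneg _) (hE ρ))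

/-- A set of primes not dividing `W` which are large in terms of the number `k` of forms. -/
structure IsSieveSet (S : Finset ℕ) (W k : ℕ) : Prop where
  prime : ∀ p ∈ S, p.Prime
  not_dvd : ∀ p ∈ S, ¬ p ∣ W
  large : ∀ p ∈ S, 40 * (k + 1) ^ 2 ≤ p

section sieveSums
variable {S : Finset ℕ} {W k : ℕ}

theorem IsSieveSet.le (h : IsSieveSet S W k) : ∀ p ∈ S, k ≤ p := fun p hp => by
  have := h.large p hp
  nlinarith

theorem IsSieveSet.four_mul_le (h : IsSieveSet S W k) : ∀ p ∈ S, 4 * (k + 1 : ℝ) ≤ p :=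
  fun p hp => by
    have : 4 * (k + 1) ≤ p := by
      have := h.large p hp
      nlinarith
    exact_mod_cast this

theorem IsSieveSet.mul_sq_le (h : IsSieveSet S W k) : ∀ p ∈ S, 36 * (k : ℝ) ^ 2 ≤ p :=
  fun p hp => by
    have : 36 * k ^ 2 ≤ p := by
      have h1 := h.large p hp
      have h2 : k ^ 2 ≤ (k + 1) ^ 2 := Nat.pow_le_pow_left k.le_succ 2
      omega
    exact_mod_cast this

theorem one_le_mul_patternDensity (hS : ∀ p ∈ S, p.Prime) {ρ : S → Option (Fin k)} {B : ℝ}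
    (hρ : ∏ a, (ρ a).elim 1 (fun _ => ((a : ℕ) : ℝ)) ≤ B) :
    1 ≤ B * ∏ a, patternDensity 1 a (ρ a) := by
  have h0 : 0 ≤ ∏ a, patternDensity 1 a (ρ a) :=
    prod_nonneg fun a _ => patternDensity_nonneg hS 1 a (ρ a)
  refine le_trans ?_ (mul_le_mul_of_nonneg_right hρ h0)
  rw [← prod_mul_distrib]
  refine Finset.one_le_prod fun a _ => ?_
  have ha : (2 : ℝ) ≤ (a : ℕ) := by exact_mod_cast (hS a a.2).two_le
  cases ρ a with
  | none =>
    have : ¬ (a : ℕ) ∣ 1 := fun h => (hS a a.2).one_lt.ne' (Nat.dvd_one.1 h)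
    simp only [patternDensity, Option.elim_none, if_neg this, mul_one, le_refl]
  | some i =>
    simp only [patternDensity, Option.elim_some, mul_one_div]
    rw [le_div_iff₀ (by linarith)]
    linarith

theorem sq_sieveWeight_pattern_le (h : IsSieveSet S W k) {x : (S → Option (Fin k)) → ℝ} {R : ℝ}
    (hx : ∀ σ, x σ ≠ 0 → ∏ a, (σ a).elim 1 (fun _ => ((a : ℕ) : ℝ)) ≤ R) (w : S → Option (Fin k)) :
    sieveWeight (fun a : S => ((a : ℕ) : ℝ)) x w ^ 2 ≤
      R ^ 2 * coeffNorm (fun a : S => ((a : ℕ) : ℝ)) x fun ρ => ∏ a, patternDensity 1 a (ρ a) := by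
  rw [← coeffNorm_const_mul]
  exact sq_sieveWeight_le (fun a => by exact_mod_cast (h.prime a a.2).pos) hx w
    fun ρ hρ => one_le_mul_patternDensity h.prime hρ

theorem sum_mul_sq_sieveWeight_le (h : IsSieveSet S W k) (hW : 0 < W)
    {x : (S → Option (Fin k)) → ℝ} {R : ℝ}
    (hx : ∀ σ, x σ ≠ 0 → ∏ a, (σ a).elim 1 (fun _ => ((a : ℕ) : ℝ)) ≤ R) {G : ℕ → ℝ} {N : ℕ}
    (hG : ∀ n, N ≤ n → G n = 0) {V : ℝ} (hV : ∀ N, ∑ n ∈ range N, |G (n + 1) - G n| ≤ V) :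
    ∑ n ∈ range N, (if n ≡ 1 [MOD W] then G n else 0) *
        sieveWeight (fun a : S => ((a : ℕ) : ℝ)) x (pattern S W k n) ^ 2
      ≤ (∑ n ∈ range N, G n) / W * (∑ σ, ∑ τ, x σ * x τ *
          ∏ a : S, localForm ((a : ℕ) : ℝ) (fun _ => 1 / ((a : ℕ) : ℝ)) (σ a) (τ a))
        + V * (R ^ 2 *
          coeffNorm (fun a : S => ((a : ℕ) : ℝ)) x fun ρ => ∏ a, patternDensity 1 a (ρ a)) := by
  have hV0 : 0 ≤ V := by simpa using hV 0
  have h1 := abs_sum_sq_sieveWeight_sub_le (u := fun a : S => ((a : ℕ) : ℝ))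
    (fun a => by exact_mod_cast (h.prime a a.2).pos) hx (range N)
    (fun n => if n ≡ 1 [MOD W] then G n else 0) (pattern S W k) ((∑ n ∈ range N, G n) / W)
    (fun a _ => 1 / ((a : ℕ) : ℝ)) (E := fun ρ => V * (R ^ 2 * ∏ a, patternDensity 1 a (ρ a)))
    fun ρ hρ => (abs_sum_mul_patternIndicator_sub_le hW h.prime h.not_dvd h.le hG hV ρ).trans
      (le_mul_of_one_le_right hV0 (one_le_mul_patternDensity h.prime hρ))
  rw [coeffNorm_const_mul, coeffNorm_const_mul] at h1
  linarith [(abs_le.1 h1).2]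

theorem le_sum_prime_mul_sq_sieveWeight (h : IsSieveSet S W k) (hW : 0 < W)
    {x : (S → Option (Fin k)) → ℝ} {R : ℝ}
    (hx : ∀ σ, x σ ≠ 0 → ∏ a, (σ a).elim 1 (fun _ => ((a : ℕ) : ℝ)) ≤ R) {F : ℕ → ℝ} {N : ℕ}
    (hFp : ∀ n, F n ≠ 0 → n.Prime) (hFN : ∀ n, F n ≠ 0 → n < N) (hFW : ∀ n, F n ≠ 0 → k * W < n)
    (hFS : ∀ n, F n ≠ 0 → ∀ p ∈ S, p < n) (m : Fin k)
    {s : Finset (Σ f : ℕ, DirichletCharacter ℂ f)}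
    (hs : ∀ q : ℕ, (q : ℝ) ≤ W * R ^ 2 → q ∣ W * ∏ a : S, (a : ℕ) → 0 < q →
      ∀ χ : DirichletCharacter ℂ q, χ ≠ 1 → ⟨χ.conductor, χ.primitiveCharacter⟩ ∈ s) :
    (∑ n ∈ range N, F n) / W.totient * (∑ σ, ∑ τ, x σ * x τ * ∏ a : S, localForm ((a : ℕ) : ℝ)
        (fun i => if i = m then 0 else 1 / (((a : ℕ) : ℝ) - 1)) (σ a) (τ a))
      - ∑ y ∈ s, 1 / W.totient * ‖∑ p ∈ range N, (F p : ℂ) * y.2 p‖ *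
        coeffNorm (fun a : S => ((a : ℕ) : ℝ)) x (fun ρ => ∏ a, patternDensity y.1 a (ρ a))
      ≤ ∑ n ∈ range N, (if n ≡ 1 [MOD W] then F (n + m * W) else 0) *
        sieveWeight (fun a : S => ((a : ℕ) : ℝ)) x (pattern S W k n) ^ 2 := by
  have h1 := abs_sum_sq_sieveWeight_sub_le (u := fun a : S => ((a : ℕ) : ℝ))
    (fun a => by exact_mod_cast (h.prime a a.2).pos) hx (range N)
    (fun n => if n ≡ 1 [MOD W] then F (n + m * W) else 0) (pattern S W k)
    ((∑ n ∈ range N, F n) / W.totient)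
    (fun a i => if i = m then 0 else 1 / (((a : ℕ) : ℝ) - 1))
    (E := fun ρ => ∑ y ∈ s, 1 / W.totient * ‖∑ p ∈ range N, (F p : ℂ) * y.2 p‖ *
        ∏ a, patternDensity y.1 a (ρ a))
    fun ρ hρ => abs_sum_prime_mul_patternIndicator_sub_le hW h.prime h.not_dvd h.le hFp hFN hFW
      hFS ρ m (hs _ (by
        rw [Nat.cast_mul, cast_patternMod]
        gcongr) (mul_dvd_mul_left W (prod_dvd_prod_of_dvd _ _ fun a _ => by
          cases ρ a <;> simp)) (Nat.mul_pos hW (patternMod_pos h.prime ρ)))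
  rw [coeffNorm_sum] at h1
  linarith [(abs_le.1 h1).1]

/-- If at most one of the shifts is prime, then the primes are seen at most once by the weight. -/
theorem sum_prime_mul_sq_sieveWeight_le {w : ℕ → ℝ} (hw : ∀ n, 0 ≤ w n) {B : ℝ}
    (hwB : ∀ n, w n ≤ B) {G F : ℕ → ℝ} (hG : ∀ n, 0 ≤ G n) {K V : ℝ} (hK : 0 ≤ K)
    (hF : ∀ n, F n ≤ K * G n)
    (hV : ∀ N, ∑ n ∈ range N, |G (n + 1) - G n| ≤ V)
    (hone : ∀ n, ∀ i j : Fin k, F (n + i * W) ≠ 0 → F (n + j * W) ≠ 0 → i = j) (N : ℕ) :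
    ∑ m : Fin k, ∑ n ∈ range N, (if n ≡ 1 [MOD W] then F (n + m * W) else 0) * w n
      ≤ K * (∑ n ∈ range N, (if n ≡ 1 [MOD W] then G n else 0) * w n + k * (k * W) * V * B) := by
  have hB : 0 ≤ B := (hw 0).trans (hwB 0)
  have hV0 : 0 ≤ V := by simpa using hV 0
  have hshift : ∀ h : ℕ, ∑ n ∈ range N, |G (n + h) - G n| ≤ h * V := by
    intro h
    induction h with
    | zero => simp
    | succ h ih =>
      calc ∑ n ∈ range N, |G (n + (h + 1)) - G n|
          ≤ ∑ n ∈ range N, (|G (h + n + 1) - G (h + n)| + |G (n + h) - G n|) := by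
            refine sum_le_sum fun n _ => ?_
            rw [add_comm h n, add_assoc]
            exact abs_sub_le _ _ _
        _ ≤ V + h * V := by
            rw [sum_add_distrib]
            refine add_le_add ?_ ih
            refine le_trans ?_ (hV (h + N))
            rw [sum_range_add]
            exact le_add_of_nonneg_left (sum_nonneg fun _ _ => abs_nonneg _)
        _ = _ := by
            push_cast
            ring
  have hpt : ∀ n, ∑ m : Fin k, F (n + m * W)
      ≤ K * (G n + ∑ m : Fin k, |G (n + m * W) - G n|) := by
    intro n
    have h0 : 0 ≤ ∑ m : Fin k, |G (n + m * W) - G n| := sum_nonneg fun _ _ => abs_nonneg _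
    by_cases hex : ∃ m : Fin k, F (n + m * W) ≠ 0
    · obtain ⟨m, hm⟩ := hex
      rw [sum_eq_single m (fun j _ hj => by
        by_contra hne
        exact hj (hone n j m hne hm)) (by simp)]
      refine (hF _).trans (mul_le_mul_of_nonneg_left ?_ hK)
      have h1 := single_le_sum (f := fun m : Fin k => |G (n + m * W) - G n|)
        (fun _ _ => abs_nonneg _) (mem_univ m)
      linarith [le_abs_self (G (n + m * W) - G n)]
    · push Not at hex
      rw [sum_eq_zero fun m _ => hex m]
      exact mul_nonneg hK (add_nonneg (hG n) h0)
  rw [Finset.sum_comm]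
  calc ∑ n ∈ range N, ∑ m : Fin k, (if n ≡ 1 [MOD W] then F (n + m * W) else 0) * w n
      ≤ ∑ n ∈ range N, K * ((if n ≡ 1 [MOD W] then G n else 0) * w n
          + (∑ m : Fin k, |G (n + m * W) - G n|) * B) := by
        refine sum_le_sum fun n _ => ?_
        have h0 : 0 ≤ ∑ m : Fin k, |G (n + m * W) - G n| := sum_nonneg fun _ _ => abs_nonneg _
        by_cases hn : n ≡ 1 [MOD W]
        · simp only [if_pos hn]
          rw [← sum_mul]
          refine (mul_le_mul_of_nonneg_right (hpt n) (hw n)).trans ?_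
          rw [mul_assoc, add_mul]
          exact mul_le_mul_of_nonneg_left (add_le_add le_rfl
            (mul_le_mul_of_nonneg_left (hwB n) h0)) hK
        · simp only [if_neg hn, zero_mul, sum_const_zero, zero_add]
          positivity
    _ = K * (∑ n ∈ range N, (if n ≡ 1 [MOD W] then G n else 0) * w n
          + (∑ m : Fin k, ∑ n ∈ range N, |G (n + m * W) - G n|) * B) := by
        rw [← mul_sum, sum_add_distrib, ← sum_mul, Finset.sum_comm (s := range N) (t := univ)]
    _ ≤ _ := by
        refine mul_le_mul_of_nonneg_left (add_le_add le_rfl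
          (mul_le_mul_of_nonneg_right ?_ hB)) hK
        refine (sum_le_card_nsmul univ _ (k * W * V) fun m _ => ?_).trans_eq ?_
        · refine (hshift (m * W)).trans (mul_le_mul_of_nonneg_right ?_ hV0)
          have : (m : ℕ) * W ≤ k * W := Nat.mul_le_mul_right W m.2.le
          exact_mod_cast this
        · rw [card_univ, Fintype.card_fin, nsmul_eq_mul]
          ring

end sieveSums

/-- The restriction of `G` to the primes, with logarithmic weights. -/
noncomputable def primeWeight (G : ℕ → ℝ) (n : ℕ) : ℝ :=
  if n.Prime then Real.log n * G n else 0

theorem prime_of_primeWeight_ne_zero {G : ℕ → ℝ} {n : ℕ} (h : primeWeight G n ≠ 0) : n.Prime := by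
  by_contra hn
  exact h (if_neg hn)

theorem ne_zero_of_primeWeight_ne_zero {G : ℕ → ℝ} {n : ℕ} (h : primeWeight G n ≠ 0) :
    G n ≠ 0 := by
  intro hn
  refine h ?_
  simp [primeWeight, hn]

theorem sum_primeWeight (G : ℕ → ℝ) (N : ℕ) :
    ∑ n ∈ range N, primeWeight G n = ∑ p ∈ N.primesBelow, Real.log p * G p := by
  rw [Nat.primesBelow, sum_filter]
  rfl

theorem sum_primeWeight_mul (G : ℕ → ℝ) (N : ℕ) (g : ℕ → ℂ) :
    ∑ n ∈ range N, (primeWeight G n : ℂ) * g n =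
      ∑ p ∈ N.primesBelow, (Real.log p : ℂ) * (g p * (G p : ℂ)) := by
  rw [Nat.primesBelow, sum_filter]
  refine sum_congr rfl fun n _ => ?_
  rw [primeWeight]
  split_ifs
  · push_cast
    ring
  · simp

theorem IsAdmissibleWeight.primeWeight_le {W A ℓ : ℕ} {L : ℝ} {G : ℕ → ℝ}
    (hG : IsAdmissibleWeight W A ℓ L G) (hL : 0 ≤ L) (n : ℕ) :
    primeWeight G n ≤ 11 * L * G n := by
  rw [primeWeight]
  split_ifs with hn
  · by_cases h0 : G n = 0
    · simp [h0]
    · refine mul_le_mul_of_nonneg_right ?_ (hG.nonneg n)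
      rw [Real.log_le_iff_le_exp (by exact_mod_cast hn.pos)]
      exact (hG.support n h0).2
  · have := hG.nonneg n
    positivity

theorem squarefree_prod_coe {S : Finset ℕ} (hS : ∀ p ∈ S, p.Prime) :
    Squarefree (∏ a : S, (a : ℕ)) := by
  refine Finset.squarefree_prod_of_pairwise_isCoprime (fun a _ b _ hab => ?_)
    fun a _ => (hS a a.2).squarefree
  exact Nat.coprime_iff_isRelPrime.1
    ((Nat.coprime_primes (hS a a.2) (hS b b.2)).2 fun h => hab (Subtype.ext h))

theorem coprime_prod_coe {S : Finset ℕ} {W : ℕ} (hS : ∀ p ∈ S, p.Prime) (hSW : ∀ p ∈ S, ¬ p ∣ W) :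
    W.Coprime (∏ a : S, (a : ℕ)) :=
  Nat.Coprime.prod_right fun a _ =>
    ((Nat.Prime.coprime_iff_not_dvd (hS a a.2)).2 (hSW a a.2)).symm

theorem not_dvd_mul_prod_sievePrimes {W ℓ N : ℕ} (hℓ : ℓ.Prime) (hℓW : ¬ ℓ ∣ W) :
    ¬ ℓ ∣ W * ∏ a : sievePrimes W ℓ N, (a : ℕ) := by
  intro h
  rcases hℓ.dvd_mul.1 h with h | h
  · exact hℓW h
  · obtain ⟨a, -, ha⟩ := (Prime.dvd_finsetProd_iff hℓ.prime _).1 h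
    have h1 := (mem_filter.1 a.2).2
    exact h1.2.2 ((Nat.prime_dvd_prime_iff_eq hℓ h1.1).1 ha).symm

theorem isSieveSet_sievePrimes {W D k : ℕ} (hD : 40 * (k + 1) ^ 2 ≤ D)
    (hWD : ∀ p, p.Prime → p ≤ D → p ∣ W) (ℓ N : ℕ) : IsSieveSet (sievePrimes W ℓ N) W k where
  prime p hp := (mem_filter.1 hp).2.1
  not_dvd p hp := (mem_filter.1 hp).2.2.1
  large p hp := by
    by_contra h
    exact (mem_filter.1 hp).2.2.1 (hWD p (mem_filter.1 hp).2.1 (by omega))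

theorem sum_inv_sq_sievePrimes_le {W D k : ℕ} (hD : 40 * (k + 1) ^ 2 ≤ D)
    (hWD : ∀ p, p.Prime → p ≤ D → p ∣ W) (ℓ N : ℕ) :
    20 * (k + 1 : ℝ) ^ 2 * ∑ a : sievePrimes W ℓ N, 1 / ((a : ℕ) : ℝ) ^ 2 ≤ 1 := by
  have h1 : ∑ a : sievePrimes W ℓ N, 1 / ((a : ℕ) : ℝ) ^ 2 ≤ 2 / (D + 1 : ℝ) := by
    rw [univ_eq_attach, sum_attach (sievePrimes W ℓ N) fun a : ℕ => 1 / (a : ℝ) ^ 2]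
    refine le_trans ?_ (sum_Ioo_inv_sq_le D (N + 1))
    simp only [one_div]
    refine sum_le_sum_of_subset_of_nonneg (fun p hp => ?_) fun _ _ _ => by positivity
    have h := mem_filter.1 hp
    refine mem_Ioo.2 ⟨?_, mem_range.1 h.1⟩
    by_contra hc
    exact h.2.2.1 (hWD p h.2.1 (by omega))
  have hD' : 40 * (k + 1 : ℝ) ^ 2 ≤ D := by exact_mod_cast hD
  calc 20 * (k + 1 : ℝ) ^ 2 * ∑ a : sievePrimes W ℓ N, 1 / ((a : ℕ) : ℝ) ^ 2
      ≤ 20 * (k + 1 : ℝ) ^ 2 * (2 / (D + 1 : ℝ)) := by gcongr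
    _ ≤ 1 := by
      rw [mul_div_assoc', div_le_one (by positivity)]
      linarith

theorem IsAdmissibleWeight.sum_norm_mul_coeffNorm_le {W k ℓ N : ℕ} {L c : ℝ} {G : ℕ → ℝ}
    (hG : IsAdmissibleWeight W (72 * k) ℓ L G) (hL : 2 ≤ L) (hW : Squarefree W) (hℓ : ℓ.Prime)
    (hℓW : ¬ ℓ ∣ W) (hN : Real.exp (11 * L) ≤ N)
    (h : IsSieveSet (sievePrimes W ℓ ⌊Real.exp (L / 1000)⌋₊) W k)
    {x : (sievePrimes W ℓ ⌊Real.exp (L / 1000)⌋₊ → Option (Fin k)) → ℝ}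
    (hx : ∀ σ, |x σ| ≤ c * ∏ a, (σ a).elim 1 fun _ => 1 / ((a : ℕ) : ℝ))
    (s : Finset (Σ f : ℕ, DirichletCharacter ℂ f))
    (hs : ↑s ⊆ primitiveSet ⌊W * Real.exp (L / 500)⌋₊)
    (hsd : ∀ y ∈ s, y.1 ∣ W * ∏ a : sievePrimes W ℓ ⌊Real.exp (L / 1000)⌋₊, (a : ℕ)) :
    ∑ y ∈ s, 1 / W.totient * ‖∑ p ∈ range N, (primeWeight G p : ℂ) * y.2 p‖ *
        coeffNorm (fun a : sievePrimes W ℓ ⌊Real.exp (L / 1000)⌋₊ => ((a : ℕ) : ℝ)) x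
          (fun ρ => ∏ a, patternDensity y.1 a (ρ a))
      ≤ c ^ 2 * √W * Real.exp 1 ^ (72 * k) := by
  have hW0 : 0 < W := Nat.pos_of_ne_zero hW.ne_zero
  have hsq : Squarefree (W * ∏ a : sievePrimes W ℓ ⌊Real.exp (L / 1000)⌋₊, (a : ℕ)) :=
    (Nat.squarefree_mul (coprime_prod_coe h.prime h.not_dvd)).2
      ⟨hW, squarefree_prod_coe h.prime⟩
  have hφ : (1 : ℝ) / W.totient ≤ 1 := by
    rw [div_le_one (by exact_mod_cast Nat.totient_pos.2 hW0)]
    exact_mod_cast Nat.totient_pos.2 hW0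
  have hsum := hG.sum_characters N hN s hs fun y hy =>
    ⟨hsq.squarefree_of_dvd (hsd y hy), fun hd =>
      not_dvd_mul_prod_sievePrimes hℓ hℓW (hd.trans (hsd y hy))⟩
  have hprod := prod_one_add_div_le W ℓ k hL (Nat.floor_le (Real.exp_pos (L / 1000)).le)
  calc _ ≤ ∑ y ∈ s, (‖∑ p ∈ N.primesBelow, (Real.log p : ℂ) * (y.2 p * (G p : ℂ))‖ / √y.1) *
        (c ^ 2 * √W * (Real.exp 1 * L) ^ (72 * k)) := by
        refine sum_le_sum fun y hy => ?_
        rw [sum_primeWeight_mul G N fun p => y.2 p]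
        set B := ‖∑ p ∈ N.primesBelow, (Real.log p : ℂ) * (y.2 p * (G p : ℂ))‖
        have hy0 : 0 < y.1 := zero_lt_one.trans (hs hy).1
        have hc := coeffNorm_patternDensity_le h.prime hW0 h.four_mul_le h.mul_sq_le hx hy0
          (hsd y hy)
        calc 1 / (W.totient : ℝ) * B * _ ≤ 1 * B * (c ^ 2 * (√W / √y.1 *
              (Real.exp 1 * L) ^ (72 * k))) := by
              refine mul_le_mul (mul_le_mul_of_nonneg_right hφ (norm_nonneg _))
                (hc.trans (mul_le_mul_of_nonneg_left
                  (mul_le_mul_of_nonneg_left hprod (by positivity)) (sq_nonneg c)))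
                (coeffNorm_nonneg _ _ fun ρ => prod_nonneg fun a _ =>
                  patternDensity_nonneg h.prime _ a (ρ a)) (by positivity)
          _ = _ := by ring
    _ ≤ 1 / L ^ (72 * k) * (c ^ 2 * √W * (Real.exp 1 * L) ^ (72 * k)) := by
        rw [← sum_mul]
        exact mul_le_mul_of_nonneg_right hsum (by positivity)
    _ = _ := by
        have : L ^ (72 * k) ≠ 0 := pow_ne_zero _ (by linarith)
        rw [mul_pow]
        field_simp

theorem IsAdmissibleWeight.le_sum_primeWeight_mul_sq_sieveWeight {W k ℓ N : ℕ} {L c Q : ℝ}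
    {G : ℕ → ℝ} (hG : IsAdmissibleWeight W (72 * k) ℓ L G) (hL : 2 ≤ L) (hW : Squarefree W)
    (hℓ : ℓ.Prime) (hℓW : ¬ ℓ ∣ W) (hN : Real.exp (11 * L) < N) (hkW : k * W < Real.exp (L / 20))
    {S : Finset ℕ} (hS : S = sievePrimes W ℓ ⌊Real.exp (L / 1000)⌋₊) (h : IsSieveSet S W k)
    {x : (S → Option (Fin k)) → ℝ}
    (hx : ∀ σ, |x σ| ≤ c * ∏ a, (σ a).elim 1 fun _ => 1 / ((a : ℕ) : ℝ))
    (hxR : ∀ σ, x σ ≠ 0 →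
      ∏ a, (σ a).elim 1 (fun _ => ((a : ℕ) : ℝ)) ≤ Real.exp (L / 1000)) (m : Fin k) (hQ : 0 ≤ Q)
    (hform : Q ≤ ∑ σ, ∑ τ, x σ * x τ * ∏ a : S,
      localForm ((a : ℕ) : ℝ) (fun i => if i = m then 0 else 1 / (((a : ℕ) : ℝ) - 1))
        (σ a) (τ a)) :
    1 / 20 / W.totient * Q - c ^ 2 * √W * Real.exp 1 ^ (72 * k)
      ≤ ∑ n ∈ range N, (if n ≡ 1 [MOD W] then primeWeight G (n + m * W) else 0) *
        sieveWeight (fun a : S => ((a : ℕ) : ℝ)) x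
          (pattern S W k n) ^ 2 := by
  classical
  have hW0 : 0 < W := Nat.pos_of_ne_zero hW.ne_zero
  set s := (finite_primitiveSet ⌊W * Real.exp (L / 500)⌋₊).toFinset.filter
    fun y => y.1 ∣ W * ∏ a : S, (a : ℕ) with hs
  have hexp : Real.exp (L / 1000) ^ 2 = Real.exp (L / 500) := by
    rw [← Real.exp_nat_mul]
    congr 1
    push_cast
    ring
  have hsupp : ∀ n, primeWeight G n ≠ 0 → Real.exp (L / 20) ≤ n ∧ n ≤ Real.exp (11 * L) :=
    fun n hn => hG.support n (ne_zero_of_primeWeight_ne_zero hn)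
  have h1 := le_sum_prime_mul_sq_sieveWeight h hW0 hxR (F := primeWeight G) (N := N)
    (fun n hn => prime_of_primeWeight_ne_zero hn)
    (fun n hn => by exact_mod_cast (hsupp n hn).2.trans_lt hN)
    (fun n hn => by exact_mod_cast hkW.trans_le (hsupp n hn).1)
    (fun n hn p hp => by
      have hp' : p < ⌊Real.exp (L / 1000)⌋₊ + 1 := by
        rw [hS] at hp
        exact mem_range.1 (mem_filter.1 hp).1
      have h2 : (p : ℝ) ≤ Real.exp (L / 1000) :=
        (Nat.le_floor_iff (Real.exp_pos _).le).1 (Nat.lt_succ_iff.1 hp')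
      have h3 : Real.exp (L / 1000) < Real.exp (L / 20) := Real.exp_lt_exp.2 (by linarith)
      exact_mod_cast (h2.trans_lt h3).trans_le (hsupp n hn).1) m (s := s)
    (fun q hq hqd hq0 χ hχ => by
      have : NeZero q := ⟨hq0.ne'⟩
      refine mem_filter.2 ⟨(Set.Finite.mem_toFinset _).2 ⟨?_, ?_, ?_⟩,
        χ.conductor_dvd_level.trans hqd⟩
      · have h2 := χ.conductor_ne_zero
        have h3 : χ.conductor ≠ 1 := fun hc => hχ (χ.eq_one_iff_conductor_eq_one.2 hc)
        change 1 < χ.conductor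
        omega
      · refine Nat.le_floor ?_
        rw [hexp] at hq
        exact (Nat.cast_le.2 (Nat.le_of_dvd hq0 χ.conductor_dvd_level)).trans hq
      · exact χ.primitiveCharacter_isPrimitive)
  subst hS
  have h2 := hG.sum_norm_mul_coeffNorm_le hL hW hℓ hℓW hN.le h hx s
    (fun y hy => (Set.Finite.mem_toFinset _).1 (mem_filter.1 hy).1)
    (fun y hy => (mem_filter.1 hy).2)
  have h3 := hG.le_sum_primes N hN.le
  rw [← sum_primeWeight] at h3
  have h4 : 1 / 20 / (W.totient : ℝ) * Q ≤ _ :=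
    mul_le_mul (div_le_div_of_nonneg_right h3 (by positivity)) hform hQ
      (div_nonneg ((by norm_num : (0 : ℝ) ≤ 1 / 20).trans h3) (by positivity))
  linarith

theorem IsAdmissibleWeight.sieve_inequality {W D k ℓ : ℕ} {L : ℝ}
    {G : ℕ → ℝ} (hG : IsAdmissibleWeight W (72 * k) ℓ L G) (hL : 2 ≤ L) (hW : Squarefree W)
    (hD : 40 * (k + 1) ^ 2 ≤ D) (hWD : ∀ p, p.Prime → p ≤ D → p ∣ W)
    (hℓ : ℓ.Prime) (hℓW : ¬ ℓ ∣ W) (hkW : k * W < Real.exp (L / 20))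
    {f : ℝ → ℝ} (hf : Antitone f) (hf0 : ∀ x, 0 ≤ f x) (hf2 : ∀ x, f x ≤ 2)
    (hfR : ∀ x, f x ≠ 0 → x ≤ √(Real.exp (L / 1000)))
    {S : Finset ℕ} (hS : S = sievePrimes W ℓ ⌊Real.exp (L / 1000)⌋₊) {u : S → ℝ}
    (hu : u = fun p : S => ((p : ℕ) : ℝ))
    (hb : ∑ T, f (vol u T) ^ 2 / vol u T * Real.log (vol u T) ≤
      sqSum u f * (1 / (8 * k) * Real.log (Real.exp (L / 1000))))
    (hone : ∀ n : ℕ, ∀ i j : Fin k, Real.exp (L / 20) ≤ n + k * W → (n + i * W).Prime →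
      (n + j * W).Prime → i = j) :
    k * (1 / 20 / W.totient * (1 / 4 * linSum u f ^ 2 * sqSum u f ^ (k - 1))
        - (2 ^ k) ^ 2 * √W * Real.exp 1 ^ (72 * k))
      ≤ 11 * L * (8 / W * sqSum u f ^ k + (1 + k * (k * W)) * (Real.exp (-(L / 20)) *
        (Real.exp (L / 1000) ^ 2 * ((2 ^ k) ^ 2 * (√W * (Real.exp 1 * L) ^ (72 * k)))))) := by
  have hW0 : 0 < W := Nat.pos_of_ne_zero hW.ne_zero
  have h := isSieveSet_sievePrimes hD hWD ℓ ⌊Real.exp (L / 1000)⌋₊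
  have hδ := sum_inv_sq_sievePrimes_le hD hWD ℓ ⌊Real.exp (L / 1000)⌋₊
  have hprod := prod_one_add_div_le W ℓ k hL (Nat.floor_le (Real.exp_pos (L / 1000)).le)
  rw [← hS] at h hδ hprod
  subst hu
  set u : S → ℝ := fun p : S => ((p : ℕ) : ℝ) with hu
  have hu0 : ∀ a, 0 < u a := fun a => by
    have := (h.prime a a.2).pos
    simpa [hu] using this
  set R := Real.exp (L / 1000) with hR
  set x : (S → Option (Fin k)) → ℝ := sieveCoeff u f R with hxdef
  have hx : ∀ σ, |x σ| ≤ 2 ^ k * ∏ a : S, (σ a).elim 1 fun _ => 1 / ((a : ℕ) : ℝ) := fun σ => by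
    have h1 := abs_sieveCoeff_le hu0 hf0 hf2 R σ
    rwa [Fintype.card_fin] at h1
  have hxR : ∀ σ, x σ ≠ 0 → ∏ a, (σ a).elim 1 (fun _ => ((a : ℕ) : ℝ)) ≤ R :=
    fun σ hσ => prod_le_of_sieveCoeff_ne_zero hσ
  set N := ⌈Real.exp (11 * L)⌉₊ + 1 with hNdef
  have hN : Real.exp (11 * L) < N := by
    rw [hNdef]
    push_cast
    linarith [Nat.le_ceil (Real.exp (11 * L))]
  set Z := coeffNorm u x fun ρ => ∏ a, patternDensity 1 a (ρ a) with hZ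
  have hZle : Z ≤ (2 ^ k) ^ 2 * (√W * (Real.exp 1 * L) ^ (72 * k)) := by
    have h1 := coeffNorm_patternDensity_le h.prime hW0 h.four_mul_le h.mul_sq_le hx one_pos
      (one_dvd _)
    refine h1.trans (mul_le_mul_of_nonneg_left ?_ (by positivity))
    simp only [Nat.cast_one, Real.sqrt_one, div_one]
    exact mul_le_mul_of_nonneg_left hprod (Real.sqrt_nonneg _)
  have hsq0 : 0 ≤ sqSum u f := sum_nonneg fun T _ => div_nonneg (sq_nonneg _)
    (prod_nonneg fun a _ => (hu0 a).le)
  have hV0 : 0 ≤ Real.exp (-(L / 20)) := (Real.exp_pos _).le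
  have hGN : ∀ n, N ≤ n → G n = 0 := fun n hn => by
    by_contra h0
    have h1 := (hG.support n h0).2
    have h2 : (N : ℝ) ≤ n := by exact_mod_cast hn
    linarith
  have hlow : ∀ m : Fin k, 1 / 20 / W.totient * (1 / 4 * linSum u f ^ 2 * sqSum u f ^ (k - 1))
      - (2 ^ k) ^ 2 * √W * Real.exp 1 ^ (72 * k) ≤
      ∑ n ∈ range N, (if n ≡ 1 [MOD W] then primeWeight G (n + m * W) else 0) *
        sieveWeight u x (pattern S W k n) ^ 2 := fun m => by
    refine hG.le_sum_primeWeight_mul_sq_sieveWeight hL hW hℓ hℓW hN hkW hS h hx hxR m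
      (by positivity) ?_
    have h1 := form_sieveCoeff_ge (ι := Fin k) (u := u)
      (by simpa using fun a : S => h.four_mul_le a a.2) hf hf0 (R := R) hfR
      (by rw [hR]; exact Real.one_lt_exp_iff.2 (by linarith)) (by simpa using hδ)
      (by simpa using hb) m
    simpa using h1
  have hdiag : ∑ σ, ∑ τ, x σ * x τ *
      ∏ a : S, localForm ((a : ℕ) : ℝ) (fun _ => 1 / ((a : ℕ) : ℝ)) (σ a) (τ a) ≤
      sqSum u f ^ k := by
    have h1 := diagonal_form_sieveCoeff_le (ι := Fin k) hu0
      (by simpa [hu] using fun a ha => h.le a ha) f R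
    simpa using h1
  have hup := sum_mul_sq_sieveWeight_le h hW0 hxR hGN hG.variation
  have hcmp := sum_prime_mul_sq_sieveWeight_le (k := k) (W := W)
    (w := fun n => sieveWeight u x (pattern S W k n) ^ 2) (fun n => sq_nonneg _)
    (B := R ^ 2 * Z) (fun n => sq_sieveWeight_pattern_le h hxR _) hG.nonneg
    (K := 11 * L) (by positivity) (hG.primeWeight_le (by linarith)) hG.variation
    (fun n i j hi hj => by
      refine hone n i j ?_ (prime_of_primeWeight_ne_zero hi) (prime_of_primeWeight_ne_zero hj)
      have h1 := (hG.support _ (ne_zero_of_primeWeight_ne_zero hi)).1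
      have h2 : ((n + i * W : ℕ) : ℝ) ≤ n + k * W := by
        have := Nat.mul_le_mul_right W i.2.le
        exact_mod_cast Nat.add_le_add_left this n
      exact h1.trans h2) N
  have hsum := sum_le_sum fun (m : Fin k) (_ : m ∈ univ) => hlow m
  rw [sum_const, card_univ, Fintype.card_fin, nsmul_eq_mul] at hsum
  refine (hsum.trans hcmp).trans (mul_le_mul_of_nonneg_left ?_ (by positivity))
  have h5 : (∑ n ∈ range N, G n) / W * (∑ σ, ∑ τ, x σ * x τ *
      ∏ a : S, localForm ((a : ℕ) : ℝ) (fun _ => 1 / ((a : ℕ) : ℝ)) (σ a) (τ a)) ≤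
      8 / W * sqSum u f ^ k := by
    refine (mul_le_mul_of_nonneg_left hdiag (div_nonneg (sum_nonneg fun n _ => hG.nonneg n)
      (by positivity))).trans (mul_le_mul_of_nonneg_right ?_ (by positivity))
    exact div_le_div_of_nonneg_right (hG.sum_le N) (by positivity)
  have h6 : Real.exp (-(L / 20)) * (R ^ 2 * Z) ≤ Real.exp (-(L / 20)) *
      (R ^ 2 * ((2 ^ k) ^ 2 * (√W * (Real.exp 1 * L) ^ (72 * k)))) :=
    mul_le_mul_of_nonneg_left (mul_le_mul_of_nonneg_left hZle (sq_nonneg R)) hV0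
  have h7 : 0 ≤ 1 + (k : ℝ) * (k * W) := by positivity
  have h8 := mul_le_mul_of_nonneg_left h6 h7
  linarith

theorem le_of_sieve_inequality {k : ℕ} (hk : 0 < k) {J φ W L α β E T : ℝ} (hφ : 0 < φ)
    (hW : 0 < W) (hL : 0 < L) (hα : 1 ≤ α) (hJ : (10 : ℝ) ^ 12 ≤ J)
    (h : k * (1 / 20 / φ * (1 / 4 * β ^ 2 * α ^ (k - 1)) - E) ≤ 11 * L * (8 / W * α ^ k + T))
    (hT : 11 * L * T ≤ 1) (hαβ : α * (J * (φ / W) * (L / 1000)) ≤ 51200 * k * β ^ 2) :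
    L ≤ W * (1 + k * E) := by
  obtain ⟨j, rfl⟩ : ∃ j, k = j + 1 := ⟨k - 1, by omega⟩
  rw [Nat.add_sub_cancel] at h
  have hαj : 1 ≤ α ^ j := one_le_pow₀ hα
  have hαk : 1 ≤ α ^ (j + 1) := one_le_pow₀ hα
  set k : ℝ := ((j + 1 : ℕ) : ℝ) with hkdef
  have h1 : (10 : ℝ) ^ 12 * (α ^ (j + 1) * L / W) / (80 * 51200000) ≤
      k * (1 / 20 / φ * (1 / 4 * β ^ 2 * α ^ j)) := by
    have h2 : α ^ (j + 1) * (J * (φ / W) * (L / 1000)) ≤ 51200 * k * β ^ 2 * α ^ j := by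
      calc α ^ (j + 1) * (J * (φ / W) * (L / 1000))
          = α * (J * (φ / W) * (L / 1000)) * α ^ j := by ring
        _ ≤ _ := mul_le_mul_of_nonneg_right hαβ (by positivity)
    calc (10 : ℝ) ^ 12 * (α ^ (j + 1) * L / W) / (80 * 51200000)
        ≤ J * (α ^ (j + 1) * L / W) / (80 * 51200000) := by gcongr
      _ = α ^ (j + 1) * (J * (φ / W) * (L / 1000)) / (51200 * 80 * φ) := by
        field_simp
        norm_num
      _ ≤ 51200 * k * β ^ 2 * α ^ j / (51200 * 80 * φ) := by gcongr
      _ = _ := by ring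
  have h3 : L / W ≤ α ^ (j + 1) * L / W := by
    rw [div_le_div_iff_of_pos_right hW]
    exact le_mul_of_one_le_left hL.le hαk
  have h4 : 11 * L * (8 / W * α ^ (j + 1)) = 88 * (α ^ (j + 1) * L / W) := by ring
  have h5 : 0 < α ^ (j + 1) * L / W := by positivity
  rw [← div_le_iff₀' hW]
  nlinarith

/-- Among `k` suitable shifts, two are infinitely often simultaneously prime. -/
theorem eventually_exists_prime_prime {I : ℕ} (hI : (10 : ℝ) ^ 12 ≤ I + 1) :
    ∃ k W : ℕ, 0 < W ∧ ∀ᶠ L : ℝ in atTop, ∃ n : ℕ, ∃ i j : Fin k, i ≠ j ∧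
      Real.exp (L / 20) ≤ n + k * W ∧ (n + i * W).Prime ∧ (n + j * W).Prime := by
  obtain ⟨k, hk⟩ : ∃ k : ℕ, k = 2 ^ I := ⟨_, rfl⟩
  have hk0 : 0 < k := by rw [hk]; positivity
  have hkR : (k : ℝ) = 2 ^ I := by rw [hk]; push_cast; rfl
  obtain ⟨D, hD, hD7⟩ : ∃ D, 40 * (k + 1) ^ 2 ≤ D ∧ 7 ≤ D :=
    ⟨40 * (k + 1) ^ 2 + 7, by omega, by omega⟩
  obtain ⟨W, hWsq, hWD⟩ : ∃ W, Squarefree W ∧ ∀ p, p.Prime → p ≤ D → p ∣ W :=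
    ⟨_, squarefree_primorial D, fun p hp hpD => hp.dvd_primorial_iff.2 hpD⟩
  have hW0 : 0 < W := Nat.pos_of_ne_zero hWsq.ne_zero
  have hW1 : 1 < W := Nat.lt_of_lt_of_le one_lt_two
    (Nat.le_of_dvd hW0 (hWD 2 Nat.prime_two (by omega)))
  have hexp : Tendsto (fun L : ℝ => Real.exp (L / 1000)) atTop atTop :=
    Real.tendsto_exp_atTop.comp (tendsto_id.atTop_div_const (by norm_num))
  have hexp' : Tendsto (fun L : ℝ => Real.exp (L / 20)) atTop atTop :=
    Real.tendsto_exp_atTop.comp (tendsto_id.atTop_div_const (by norm_num))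
  refine ⟨k, W, hW0, ?_⟩
  filter_upwards [eventually_exists_isAdmissibleWeight hW0 (72 * k),
    hexp.eventually (eventually_exists_sieveFun I hW1 hD7 hWD),
    hexp'.eventually_gt_atTop ((k : ℝ) * W), eventually_ge_atTop (2 : ℝ),
    eventually_gt_atTop (W * (1 + k * ((2 ^ k) ^ 2 * √W * Real.exp 1 ^ (72 * k)))),
    eventually_mul_pow_mul_exp_le (11 * (1 + k * (k * W)) * ((2 ^ k) ^ 2 *
      (√W * Real.exp 1 ^ (72 * k)))) (72 * k + 1) (c := 6 / 125) (ε := 1) (by norm_num)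
      one_pos] with L hL1 hL2 hL3 hL4 hL5 hL6
  obtain ⟨ℓ, hℓ, hℓW, G, hG⟩ := hL1
  obtain ⟨f, hf, hf0, hf2, hfR, hb, hα, hαβ⟩ := hL2 ℓ hℓ hℓW
  by_contra hcon
  push Not at hcon
  have hone : ∀ n : ℕ, ∀ i j : Fin k, Real.exp (L / 20) ≤ n + k * W → (n + i * W).Prime →
      (n + j * W).Prime → i = j := fun n i j hn hi hj => by
    by_contra hij
    exact hcon n i j hij hn hi hj
  have h := hG.sieve_inequality hL4 hWsq hD hWD hℓ hℓW hL3 hf hf0 hf2 hfR rfl rfl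
    (by rwa [hkR]) hone
  rw [← hkR, Real.log_exp] at hαβ
  refine absurd (le_of_sieve_inequality hk0 (by exact_mod_cast Nat.totient_pos.2 hW0)
    (by exact_mod_cast hW0) (by linarith) hα hI h ?_ hαβ) (not_le.2 hL5)
  refine le_trans (le_of_eq ?_) hL6
  have hE : Real.exp (-(6 / 125 * L)) = Real.exp (-(L / 20)) * Real.exp (L / 1000) ^ 2 := by
    rw [← Real.exp_nat_mul, ← Real.exp_add]
    congr 1
    push_cast
    ring
  rw [hE, mul_pow]
  ring

theorem exists_forall_exists_prime_prime :
    ∃ H : ℕ, ∀ M : ℕ, ∃ p q : ℕ, p.Prime ∧ q.Prime ∧ M < p ∧ p < q ∧ q ≤ p + H := by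
  obtain ⟨I, hI⟩ := exists_nat_ge ((10 : ℝ) ^ 12)
  obtain ⟨k, W, hW, h⟩ := eventually_exists_prime_prime (I := I) (hI.trans (by linarith))
  refine ⟨k * W, fun M => ?_⟩
  have hexp : Tendsto (fun L : ℝ => Real.exp (L / 20)) atTop atTop :=
    Real.tendsto_exp_atTop.comp (tendsto_id.atTop_div_const (by norm_num))
  obtain ⟨L, ⟨n, i, j, hij, hn, hi, hj⟩, hL⟩ :=
    (h.and (hexp.eventually_gt_atTop ((M + k * W : ℕ) : ℝ))).exists
  have hMn : M < n := by
    have h1 := hL.trans_le hn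
    have h2 : M + k * W < n + k * W := by exact_mod_cast h1
    omega
  have key : ∀ i j : Fin k, i < j → (n + i * W).Prime → (n + j * W).Prime →
      ∃ p q : ℕ, p.Prime ∧ q.Prime ∧ M < p ∧ p < q ∧ q ≤ p + k * W := by
    intro i j hij hi hj
    have h1 : (i : ℕ) * W ≤ j * W := Nat.mul_le_mul_right W hij.le
    have h2 : (j : ℕ) * W ≤ k * W := Nat.mul_le_mul_right W j.2.le
    refine ⟨_, _, hi, hj, by omega, ?_, by omega⟩
    have h3 : (i : ℕ) * W < j * W := Nat.mul_lt_mul_of_pos_right hij hW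
    omega
  rcases lt_or_gt_of_ne hij with h1 | h1
  · exact key i j h1 hi hj
  · exact key j i h1 hj hi

theorem nth_prime_succ_le {p q : ℕ} (hp : p.Prime) (hq : q.Prime) (h : p < q) :
    Nat.nth Nat.Prime (Nat.count Nat.Prime p) = p ∧
      Nat.nth Nat.Prime (Nat.count Nat.Prime p + 1) ≤ q := by
  refine ⟨Nat.nth_count hp, ?_⟩
  rw [← Nat.nth_count hq]
  refine (Nat.nth_le_nth Nat.infinite_setOfPred_prime).2 ?_
  exact Nat.count_strict_mono hp h

end PrimeGaps

/-- Goldston–Pintz–Yıldırım: the normalized prime gaps satisfy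
`liminf (p_{n+1} - p_n) / log p_n = 0`. -/
theorem liminf_primeGap_div_log_eq_zero :
    Filter.liminf
      (fun n : ℕ =>
        ((Nat.nth Nat.Prime (n + 1) : ℝ) - (Nat.nth Nat.Prime n : ℝ)) /
          Real.log (Nat.nth Nat.Prime n))
      atTop = 0 := by

  set g : ℕ → ℝ := fun n : ℕ => ((Nat.nth Nat.Prime (n + 1) : ℝ) - (Nat.nth Nat.Prime n : ℝ)) /
        Real.log (Nat.nth Nat.Prime n : ℝ) with hg
  have hg0 : ∀ n, 0 ≤ g n := fun n => by
    refine div_nonneg (sub_nonneg.2 ?_) (Real.log_natCast_nonneg _)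
    exact_mod_cast Nat.nth_monotone Nat.infinite_setOfPred_prime n.le_succ
  have hfreq : ∀ ε : ℝ, 0 < ε → ∃ᶠ n in atTop, g n ≤ ε := by
    intro ε hε
    obtain ⟨H, hH⟩ := PrimeGaps.exists_forall_exists_prime_prime
    refine frequently_atTop.2 fun a => ?_
    obtain ⟨M, hM⟩ := exists_nat_ge (Real.exp (H / ε))
    obtain ⟨p, q, hp, hq, hMp, hpq, hqH⟩ := hH (max M (Nat.nth Nat.Prime a))
    obtain ⟨h1, h2⟩ := PrimeGaps.nth_prime_succ_le hp hq hpq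
    refine ⟨Nat.count Nat.Prime p, ?_, ?_⟩
    · rw [← Nat.nth_le_nth Nat.infinite_setOfPred_prime, h1]
      exact (le_max_right _ _).trans hMp.le
    · simp only [hg, h1]
      have hpM : Real.exp (H / ε) ≤ p :=
        hM.trans (by exact_mod_cast (le_max_left _ _).trans hMp.le)
      have hlog : H / ε ≤ Real.log p :=
        (Real.le_log_iff_exp_le (by exact_mod_cast hp.pos)).2 hpM
      rw [div_le_iff₀ (Real.log_pos (by exact_mod_cast hp.one_lt))]
      rw [div_le_iff₀' hε] at hlog
      have h3 : ((Nat.nth Nat.Prime (Nat.count Nat.Prime p + 1) : ℕ) : ℝ) ≤ p + H := by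
        exact_mod_cast h2.trans hqH
      linarith
  have hbdd : IsBoundedUnder (· ≥ ·) atTop g := isBoundedUnder_of ⟨0, hg0⟩
  have hcobdd : IsCoboundedUnder (· ≥ ·) atTop g :=
    .of_frequently_le (hfreq 1 one_pos)
  refine le_antisymm (le_of_forall_pos_le_add fun ε hε => ?_) ?_
  · rw [zero_add]
    exact liminf_le_of_frequently_le (hfreq ε hε) hbdd
  · exact le_liminf_of_le hcobdd (Eventually.of_forall hg0)
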